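/- Let λ > 0 be a real number, let s ≥ 2 be a natural number, and let A be a finite non-empty subset of 𝒮_{3,λ}. Then for every ε > 0 there is a constant C(s, ε) > 0, independent of λ and A, such that E_{s,2}(A) ≤ C(s, ε) · |A|^{2s − 2 + 2·3^{−s} + ε}. -/

import Mathlib

open Finset

noncomputable section

/-- The sphere `𝒮_{d,λ}` of points `x ∈ ℝ^d` with `x₁² + ⋯ + x_d² = λ`. -/
def realSphere (d : ℕ) (lam : ℝ) : Set (Fin d → ℝ) := {x | ∑ i, x i ^ 2 = lam}

/-- The additive energy `E_{s,2}(A)`: the number of `2s`-tuples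
`(x₁, …, x_{2s}) ∈ A^{2s}` with `x₁ + ⋯ + x_s = x_{s+1} + ⋯ + x_{2s}`. -/
def addEnergy {V : Type*} [AddCommMonoid V] (s : ℕ) (A : Set V) : ℕ :=
  Nat.card {p : (Fin s → V) × (Fin s → V) //
    (∀ i, p.1 i ∈ A) ∧ (∀ i, p.2 i ∈ A) ∧ ∑ i, p.1 i = ∑ i, p.2 i}


section Comp1Sec
/-- Lagrange-type separation: an indicator polynomial on a finite set. -/
lemma exists_indicator_poly {d : ℕ} (Z : Finset (Fin d → ℝ)) (z : Fin d → ℝ) :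
    ∃ p : MvPolynomial (Fin d) ℝ, MvPolynomial.eval z p ≠ 0 ∧
      ∀ y ∈ Z, y ≠ z → MvPolynomial.eval y p = 0 := by
  classical
  have H : ∀ y : Fin d → ℝ, ∃ q : MvPolynomial (Fin d) ℝ, MvPolynomial.eval y q = 0 ∧
      (y ≠ z → MvPolynomial.eval z q ≠ 0) := by
    intro y
    by_cases h : y = z
    · exact ⟨0, by simp, fun h' => absurd h h'⟩
    · obtain ⟨i, hi⟩ := Function.ne_iff.mp h
      refine ⟨MvPolynomial.X i - MvPolynomial.C (y i), by simp, fun _ => ?_⟩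
      simp only [map_sub, MvPolynomial.eval_X, MvPolynomial.eval_C]
      exact sub_ne_zero.mpr (Ne.symm hi)
  choose q hq1 hq2 using H
  refine ⟨∏ y ∈ Z.erase z, q y, ?_, ?_⟩
  · rw [map_prod, Finset.prod_ne_zero_iff]
    intro y hy
    exact hq2 y (Finset.ne_of_mem_erase hy)
  · intro y hy hyz
    rw [map_prod]
    exact Finset.prod_eq_zero (Finset.mem_erase.mpr ⟨hyz, hy⟩) (hq1 y)

lemma zeros_card {d n : ℕ} (c : ℝ) (hc : c ≠ 0) (r : Fin d → MvPolynomial (Fin d) ℝ)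
    (hr : ∀ i, (r i).totalDegree < n) (Z : Finset (Fin d → ℝ))
    (hZ : ∀ z ∈ Z, ∀ i, c * z i ^ n + MvPolynomial.eval z (r i) = 0) : Z.card ≤ n ^ d := by
  classical
  let ev : MvPolynomial (Fin d) ℝ →ₗ[ℝ] (Z → ℝ) :=
    { toFun := fun p z => MvPolynomial.eval z.1 p
      map_add' := by intro p q; ext z; simp
      map_smul' := by intro a p; ext z; simp [MvPolynomial.smul_eval] }
  have hev : ∀ p z, ev p z = MvPolynomial.eval z.1 p := fun p z => rfl
  let b : (Fin d → Fin n) → (Z → ℝ) := fun α =>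
    ev (MvPolynomial.monomial (Finsupp.equivFunOnFinite.symm fun i => (α i : ℕ)) 1)
  let S := Submodule.span ℝ (Set.range b)
  have key : ∀ N : ℕ, ∀ p : MvPolynomial (Fin d) ℝ, p.totalDegree < N → ev p ∈ S := by
    intro N
    induction N with
    | zero => intro p hp; omega
    | succ N ih =>
      intro p hp
      rw [p.as_sum, map_sum]
      refine Submodule.sum_mem _ fun α hα => ?_
      have hdeg : (α.sum fun _ e => e) ≤ N := by
        have := MvPolynomial.le_totalDegree hα
        omega
      have e1 : MvPolynomial.monomial α (MvPolynomial.coeff α p)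
          = (MvPolynomial.coeff α p) • MvPolynomial.monomial α (1 : ℝ) := by
        rw [MvPolynomial.smul_monomial]; simp
      rw [e1, map_smul]
      refine Submodule.smul_mem _ _ ?_
      by_cases hall : ∀ i, α i < n
      · refine Submodule.subset_span ⟨fun i => ⟨α i, hall i⟩, ?_⟩
        simp only [b]
        congr 2
        ext i; simp
      · push Not at hall
        obtain ⟨i, hi⟩ := hall
        have e2 : α = (α - Finsupp.single i n) + Finsupp.single i n := by
          ext j
          by_cases hj : j = i
          · subst hj; simp; omega
          · simp [Finsupp.single_apply, Ne.symm hj]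
        set β := α - Finsupp.single i n with hβ
        have e3 : ev (MvPolynomial.monomial α (1 : ℝ)) =
            (-(1 / c)) • ev (MvPolynomial.monomial β 1 * r i) := by
          ext z
          have h1 := hZ z.1 z.2 i
          have h2 : MvPolynomial.monomial α (1 : ℝ) =
              MvPolynomial.monomial β 1 * MvPolynomial.X i ^ n := by
            rw [e2, MvPolynomial.X_pow_eq_monomial, MvPolynomial.monomial_mul]; simp
          rw [h2]
          simp only [hev, Pi.smul_apply, map_mul, map_pow, MvPolynomial.eval_X, smul_eq_mul]
          have h3 : MvPolynomial.eval z.1 (r i) = - (c * z.1 i ^ n) := by linarith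
          rw [h3]; field_simp
        rw [e3]
        refine Submodule.smul_mem _ _ (ih _ ?_)
        have h4 := MvPolynomial.totalDegree_mul (MvPolynomial.monomial β (1 : ℝ)) (r i)
        have h5 : (MvPolynomial.monomial β (1 : ℝ)).totalDegree = β.sum fun _ e => e :=
          MvPolynomial.totalDegree_monomial _ one_ne_zero
        have h6 : (α.sum fun _ e => e) = (β.sum fun _ e => e) + n := by
          conv_lhs => rw [e2]
          rw [Finsupp.sum_add_index' (by simp) (by simp)]
          simp
        have := hr i
        omega
  have htop : S = ⊤ := by
    rw [eq_top_iff]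
    intro g _
    have : g = ∑ z : Z, g z • (Pi.single z (1 : ℝ) : Z → ℝ) := by
      ext w; simp [Finset.sum_apply, Pi.single_apply]
    rw [this]
    refine Submodule.sum_mem _ fun z _ => Submodule.smul_mem _ _ ?_
    obtain ⟨p, hp1, hp2⟩ := exists_indicator_poly Z z.1
    have : (Pi.single z (1 : ℝ) : Z → ℝ) = (MvPolynomial.eval z.1 p)⁻¹ • ev p := by
      ext w
      by_cases hw : w = z
      · subst hw; simp [hev, hp1]
      · have := hp2 w.1 w.2 (fun h => hw (Subtype.ext h))
        simp [hev, this, hw]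
    rw [this]
    exact Submodule.smul_mem _ _ (key _ p (Nat.lt_succ_self _))
  have h1 : (Set.range b).finrank ℝ ≤ Fintype.card (Fin d → Fin n) := finrank_range_le_card b
  have h2 : (Set.range b).finrank ℝ = Z.card := by
    unfold Set.finrank
    change Module.finrank ℝ S = _
    rw [htop, finrank_top]; simp
  rw [h2] at h1
  simpa using h1
end Comp1Sec

section Comp2Sec
lemma totalDegree_pderiv_le' {d : ℕ} (i : Fin d) (p : MvPolynomial (Fin d) ℝ) :
    (MvPolynomial.pderiv i p).totalDegree ≤ p.totalDegree := by
  classical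
  conv_lhs => rw [p.as_sum, map_sum]
  refine MvPolynomial.totalDegree_finsetSum_le fun α hα => ?_
  rw [MvPolynomial.pderiv_monomial]
  refine (MvPolynomial.totalDegree_monomial_le _ _).trans ?_
  refine le_trans ?_ (MvPolynomial.le_totalDegree hα)
  rw [Finsupp.sum_fintype _ _ (by simp), Finsupp.sum_fintype _ _ (by simp)]
  exact Finset.sum_le_sum fun j _ => by simp

lemma hasDerivAt_eval_update {d : ℕ} (p : MvPolynomial (Fin d) ℝ) (z : Fin d → ℝ) (i : Fin d)
    (t : ℝ) : HasDerivAt (fun t => MvPolynomial.eval (Function.update z i t) p)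
      (MvPolynomial.eval (Function.update z i t) (MvPolynomial.pderiv i p)) t := by
  classical
  induction p using MvPolynomial.induction_on with
  | C a => simpa using hasDerivAt_const t a
  | add p q hp hq =>
    simp only [map_add]
    exact hp.add hq
  | mul_X p j hp =>
    have hX : HasDerivAt (fun t => (Function.update z i t) j) (if j = i then 1 else 0) t := by
      by_cases h : j = i
      · subst h
        simp only [Function.update_self, if_true]
        exact hasDerivAt_id t
      · simp only [Function.update_of_ne h, if_neg h]
        exact hasDerivAt_const t (z j)
    have := hp.mul hX
    simp only [MvPolynomial.pderiv_mul, MvPolynomial.pderiv_X, map_add, map_mul, MvPolynomial.eval_X]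
    have e : MvPolynomial.eval (Function.update z i t) 
        ((Pi.single i (1 : MvPolynomial (Fin d) ℝ) : Fin d → MvPolynomial (Fin d) ℝ) j)
        = if j = i then (1 : ℝ) else 0 := by
      by_cases h : j = i
      · subst h; simp
      · simp [h]
    rw [e]
    exact this

lemma comp_card {d D : ℕ} (P : MvPolynomial (Fin d) ℝ) (hP : P.totalDegree ≤ D)
    (X : Finset (Fin d → ℝ)) (hX : ∀ x ∈ X, MvPolynomial.eval x P ≠ 0)
    (hsep : ∀ x ∈ X, ∀ y ∈ X,
      y ∈ connectedComponentIn {z | MvPolynomial.eval z P ≠ 0} x → x = y) :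
    X.card ≤ (D + 4) ^ d := by
  classical
  obtain ⟨Rb, hRb0, hRb⟩ : ∃ Rb : ℝ, 0 < Rb ∧ ∀ x ∈ X, ∑ i, x i ^ 2 < Rb := by
    refine ⟨∑ x ∈ X, ∑ i, x i ^ 2 + 1, ?_, ?_⟩
    · have : 0 ≤ ∑ x ∈ X, ∑ i, x i ^ 2 :=
        Finset.sum_nonneg fun x _ => Finset.sum_nonneg fun i _ => sq_nonneg _
      linarith
    · intro x hx
      have := Finset.single_le_sum (f := fun x : Fin d → ℝ => ∑ i, x i ^ 2)
        (fun x _ => Finset.sum_nonneg fun i _ => sq_nonneg _) hx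
      linarith
  set g : MvPolynomial (Fin d) ℝ := P * (MvPolynomial.C Rb - ∑ i, MvPolynomial.X i ^ 2) with hg
  have hgev : ∀ z, MvPolynomial.eval z g = MvPolynomial.eval z P * (Rb - ∑ i, z i ^ 2) := by
    intro z; simp [hg]
  set k := (D + 5) / 2 with hk
  set B : ℝ := d * Rb ^ k with hB
  have hB0 : 0 ≤ B := by positivity
  obtain ⟨γ, hγ0, hγ⟩ : ∃ γ : ℝ, 0 < γ ∧ ∀ x ∈ X, γ ≤ |MvPolynomial.eval x g| := by
    by_cases hne : X.Nonempty
    · obtain ⟨x0, hx0, hmin⟩ := X.exists_min_image (fun x => |MvPolynomial.eval x g|) hne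
      refine ⟨_, ?_, hmin⟩
      rw [abs_pos, hgev]
      exact mul_ne_zero (hX x0 hx0) (by have := hRb x0 hx0; linarith)
    · exact ⟨1, one_pos, fun x hx => absurd ⟨x, hx⟩ hne⟩
  set ε := γ / (2 * B + 1) with hε
  have hε0 : 0 < ε := by positivity
  have hεB : 2 * (ε * B) < γ := by
    rw [hε, div_mul_eq_mul_div, ← mul_div_assoc, div_lt_iff₀ (by positivity)]; nlinarith
  set F : MvPolynomial (Fin d) ℝ := g + MvPolynomial.C ε * ∑ i, MvPolynomial.X i ^ (2 * k) with hF
  have hFev : ∀ z, MvPolynomial.eval z F = MvPolynomial.eval z g + ε * ∑ i, z i ^ (2 * k) := by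
    intro z; simp [hF]
  have hs0 : ∀ z : Fin d → ℝ, 0 ≤ ∑ i, z i ^ (2 * k) := fun z =>
    Finset.sum_nonneg fun i _ => by rw [pow_mul]; positivity
  have hsB : ∀ z : Fin d → ℝ, ∑ i, z i ^ 2 ≤ Rb → ∑ i, z i ^ (2 * k) ≤ B := by
    intro z hz
    have : ∀ i ∈ (Finset.univ : Finset (Fin d)), z i ^ (2 * k) ≤ Rb ^ k := by
      intro i hi
      rw [pow_mul]
      refine pow_le_pow_left₀ (sq_nonneg _) (le_trans ?_ hz) _
      exact Finset.single_le_sum (f := fun i => z i ^ 2) (fun i _ => sq_nonneg _) hi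
    have := Finset.sum_le_sum this
    simpa [hB] using this
  set Vb : Set (Fin d → ℝ) := {z | MvPolynomial.eval z P ≠ 0 ∧ ∑ i, z i ^ 2 < Rb} with hVb
  have hVbo : IsOpen Vb := by
    refine IsOpen.inter ?_ ?_
    · exact isOpen_ne_fun (MvPolynomial.continuous_eval P) continuous_const
    · exact isOpen_lt (f := fun z : Fin d → ℝ => ∑ i, z i ^ 2) (by fun_prop) continuous_const
  set Kc : Set (Fin d → ℝ) := {z | ∑ i, z i ^ 2 ≤ Rb} with hKc
  have hKcl : IsClosed Kc := isClosed_le (by fun_prop) continuous_const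
  have hKco : IsCompact Kc := by
    refine Metric.isCompact_of_isClosed_isBounded hKcl ?_
    refine (Metric.isBounded_closedBall (x := (0 : Fin d → ℝ)) (r := Rb + 1)).subset ?_
    intro z hz
    rw [mem_closedBall_zero_iff, pi_norm_le_iff_of_nonneg (by linarith)]
    intro i
    have h1 : z i ^ 2 ≤ Rb := le_trans
      (Finset.single_le_sum (f := fun i => z i ^ 2) (fun i _ => sq_nonneg _) (Finset.mem_univ i)) hz
    rw [Real.norm_eq_abs]
    exact abs_le_of_sq_le_sq (by nlinarith) (by linarith)
  have main : ∀ x ∈ X, ∃ z ∈ connectedComponentIn Vb x,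
      ∀ i, MvPolynomial.eval z (MvPolynomial.pderiv i F) = 0 := by
    intro x hx
    have hxV : x ∈ Vb := ⟨hX x hx, hRb x hx⟩
    set Ω := connectedComponentIn Vb x with hΩ
    have hΩo : IsOpen Ω := hVbo.connectedComponentIn
    have hxΩ : x ∈ Ω := mem_connectedComponentIn hxV
    have hcl : closure Ω ⊆ Kc := by
      refine closure_minimal ?_ hKcl
      intro z hz
      exact (connectedComponentIn_subset Vb x hz).2.le
    have hcomp : IsCompact (closure Ω) := hKco.of_isClosed_subset isClosed_closure hcl
    obtain ⟨σ, hσ1, hσ⟩ : ∃ σ : ℝ, |σ| = 1 ∧ σ * MvPolynomial.eval x g = |MvPolynomial.eval x g| := by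
      rcases le_total 0 (MvPolynomial.eval x g) with h | h
      · exact ⟨1, by simp, by rw [abs_of_nonneg h]; ring⟩
      · exact ⟨-1, by simp, by rw [abs_of_nonpos h]; ring⟩
    have hσe : σ = 1 ∨ σ = -1 := by
      exact eq_or_eq_neg_of_abs_eq hσ1
    have hFc : Continuous fun z => σ * MvPolynomial.eval z F :=
      continuous_const.mul (MvPolynomial.continuous_eval F)
    obtain ⟨z, hz, hmax⟩ := hcomp.exists_isMaxOn ⟨x, subset_closure hxΩ⟩ hFc.continuousOn
    have hzΩ : z ∈ Ω := by
      by_contra hzn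
      have hg0 : MvPolynomial.eval z g = 0 := by
        by_contra hne
        rw [hgev] at hne
        have hzV : z ∈ Vb := by
          refine ⟨left_ne_zero_of_mul hne, ?_⟩
          have h1 : ∑ i, z i ^ 2 ≤ Rb := hcl hz
          have h2 := right_ne_zero_of_mul hne
          exact lt_of_le_of_ne h1 (fun h => h2 (by rw [h]; ring))
        obtain ⟨w, hw1, hw2⟩ := mem_closure_iff.mp hz (connectedComponentIn Vb z)
          hVbo.connectedComponentIn (mem_connectedComponentIn hzV)
        have e1 := connectedComponentIn_eq hw1
        have e2 := connectedComponentIn_eq hw2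
        apply hzn
        rw [hΩ, e2, ← e1]
        exact mem_connectedComponentIn hzV
      have h1 := hmax (subset_closure hxΩ)
      simp only [Set.mem_ofPred_eq] at h1
      rw [hFev, hFev, hg0] at h1
      have h2 := hsB z (hcl hz)
      have h3 := hs0 z
      have h4 := hsB x (hRb x hx).le
      have h5 := hs0 x
      have h6 := hγ x hx
      have h7 := mul_le_mul_of_nonneg_left h2 hε0.le
      have h8 := mul_le_mul_of_nonneg_left h4 hε0.le
      have h9 := mul_nonneg hε0.le h3
      have h10 := mul_nonneg hε0.le h5
      rw [← hσ] at h6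
      rcases hσe with h | h <;> subst h <;> linarith
    refine ⟨z, hzΩ, fun i => ?_⟩
    have hloc : IsLocalMax (fun z => σ * MvPolynomial.eval z F) z :=
      hmax.isLocalMax (Filter.mem_of_superset (hΩo.mem_nhds hzΩ) subset_closure)
    have hup : Function.update z i (z i) = z := Function.update_eq_self i z
    have hloc2 : IsLocalMax ((fun z => σ * MvPolynomial.eval z F) ∘
        (fun t => Function.update z i t)) (z i) := by
      refine IsLocalMax.comp_continuous (b := z i) ?_ ?_
      · rw [hup]; exact hloc
      · exact (continuous_const.update i continuous_id).continuousAt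
    have hd := (hasDerivAt_eval_update F z i (z i)).const_mul σ
    have h0 := hloc2.hasDerivAt_eq_zero hd
    rw [hup] at h0
    rcases hσe with h | h <;> subst h <;> simpa using h0
  choose! zf hz1 hz2 using main
  have hinj : Set.InjOn zf (X : Set (Fin d → ℝ)) := by
    intro x hx y hy hxy
    have e1 := connectedComponentIn_eq (hz1 x hx)
    have e2 := connectedComponentIn_eq (hz1 y hy)
    apply hsep x hx y hy
    have hyV : y ∈ Vb := ⟨hX y hy, hRb y hy⟩
    have : y ∈ connectedComponentIn Vb x := by
      rw [e1, hxy, ← e2]; exact mem_connectedComponentIn hyV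
    exact connectedComponentIn_mono x (fun z hz => hz.1) this
  rw [← Finset.card_image_of_injOn hinj]
  have hk1 : D + 4 ≤ 2 * k := by omega
  have hk2 : 2 * k ≤ D + 5 := by omega
  refine (zeros_card (n := 2 * k - 1) (ε * (2 * k)) ?_ (fun i => MvPolynomial.pderiv i g) ?_ _ ?_).trans ?_
  · have : (k : ℝ) ≠ 0 := by
      have : k ≠ 0 := by omega
      exact_mod_cast this
    positivity
  · intro i
    have h1 := totalDegree_pderiv_le' i g
    have h2 : g.totalDegree ≤ D + 2 := by
      refine (MvPolynomial.totalDegree_mul _ _).trans (Nat.add_le_add hP ?_)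
      refine (MvPolynomial.totalDegree_sub _ _).trans (max_le (by simp) ?_)
      refine MvPolynomial.totalDegree_finsetSum_le fun j _ => ?_
      exact (MvPolynomial.totalDegree_pow _ _).trans (by simp)
    omega
  · intro z hz i
    obtain ⟨x, hx, rfl⟩ := Finset.mem_image.mp hz
    have h := hz2 x hx i
    have h3 : MvPolynomial.pderiv i F = MvPolynomial.pderiv i g
        + MvPolynomial.C ε * (MvPolynomial.C ((2 * k : ℕ) : ℝ) * MvPolynomial.X i ^ (2 * k - 1)) := by
      rw [hF, map_add, MvPolynomial.pderiv_C_mul, map_sum]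
      congr 2
      rw [Finset.sum_eq_single i]
      · rw [MvPolynomial.pderiv_pow, MvPolynomial.pderiv_X_self, mul_one, map_natCast]
      · intro j _ hj
        rw [MvPolynomial.pderiv_pow]; simp [MvPolynomial.pderiv_X, hj]
      · simp
    rw [h3] at h
    simp only [map_add, map_mul, MvPolynomial.eval_C, map_pow, MvPolynomial.eval_X] at h
    push_cast at h
    linarith
  · exact Nat.pow_le_pow_left (by omega) d
end Comp2Sec

section Comp3Sec
/-- Substituting rational functions `num i / den` in a polynomial and clearing denominators. -/
lemma exists_rational_subst {d e D δ : ℕ} (P : MvPolynomial (Fin e) ℝ) (hP : P.totalDegree ≤ D)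
    (num : Fin e → MvPolynomial (Fin d) ℝ) (den : MvPolynomial (Fin d) ℝ)
    (hnum : ∀ i, (num i).totalDegree ≤ δ) (hden : den.totalDegree ≤ δ) :
    ∃ Q : MvPolynomial (Fin d) ℝ, Q.totalDegree ≤ δ * D ∧
      ∀ w, MvPolynomial.eval w den ≠ 0 → MvPolynomial.eval w Q = MvPolynomial.eval w den ^ D *
        MvPolynomial.eval (fun i => MvPolynomial.eval w (num i) / MvPolynomial.eval w den) P := by
  classical
  refine ⟨∑ α ∈ P.support, MvPolynomial.C (MvPolynomial.coeff α P) *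
    ((∏ i, num i ^ α i) * den ^ (D - ∑ i, α i)), ?_, ?_⟩
  · refine MvPolynomial.totalDegree_finsetSum_le fun α hα => ?_
    have h0 : ∑ i, α i ≤ D := by
      have := MvPolynomial.le_totalDegree hα
      rw [Finsupp.sum_fintype _ _ (by simp)] at this
      omega
    refine (MvPolynomial.totalDegree_mul _ _).trans ?_
    rw [MvPolynomial.totalDegree_C, zero_add]
    refine (MvPolynomial.totalDegree_mul _ _).trans ?_
    have h1 : (∏ i, num i ^ α i).totalDegree ≤ δ * ∑ i, α i := by
      refine (MvPolynomial.totalDegree_finsetProd _ _).trans ?_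
      rw [Finset.mul_sum]
      refine Finset.sum_le_sum fun i _ => ?_
      refine (MvPolynomial.totalDegree_pow _ _).trans ?_
      rw [mul_comm]; exact Nat.mul_le_mul_right _ (hnum i)
    have h2 : (den ^ (D - ∑ i, α i)).totalDegree ≤ δ * (D - ∑ i, α i) := by
      refine (MvPolynomial.totalDegree_pow _ _).trans ?_
      rw [mul_comm]; exact Nat.mul_le_mul_right _ hden
    calc _ ≤ δ * (∑ i, α i) + δ * (D - ∑ i, α i) := Nat.add_le_add h1 h2
      _ = δ * D := by rw [← Nat.mul_add]; congr 1; omega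
  · intro w hw
    rw [MvPolynomial.eval_eq' _ P, map_sum, Finset.mul_sum]
    refine Finset.sum_congr rfl fun α hα => ?_
    have h0 : ∑ i, α i ≤ D := by
      have := MvPolynomial.le_totalDegree hα
      rw [Finsupp.sum_fintype _ _ (by simp)] at this
      omega
    simp only [map_mul, MvPolynomial.eval_C, map_prod, map_pow, div_pow]
    rw [Finset.prod_div_distrib, Finset.prod_pow_eq_pow_sum]
    have h3 : MvPolynomial.eval w den ^ D =
      MvPolynomial.eval w den ^ (D - ∑ i, α i) * MvPolynomial.eval w den ^ (∑ i, α i) := by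
      rw [← pow_add]; congr 1; omega
    rw [h3]
    have h4 : MvPolynomial.eval w den ^ (∑ i, α i) ≠ 0 := pow_ne_zero _ hw
    field_simp

/-- A sphere in `ℝ³` meets `O(D²)` components of the complement of a degree `D` surface. -/
lemma sphere_comp_card {D : ℕ} (P : MvPolynomial (Fin 3) ℝ) (hP : P.totalDegree ≤ D)
    (u : Fin 3 → ℝ) (ρ : ℝ) (hρ : 0 < ρ) (X : Finset (Fin 3 → ℝ))
    (hX : ∀ x ∈ X, MvPolynomial.eval x P ≠ 0) (hs : ∀ x ∈ X, ∑ i, (x i - u i) ^ 2 = ρ)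
    (hsep : ∀ x ∈ X, ∀ y ∈ X,
      y ∈ connectedComponentIn {z | MvPolynomial.eval z P ≠ 0} x → x = y) :
    X.card ≤ (2 * D + 4) ^ 2 + 1 := by
  classical
  set q := Real.sqrt ρ with hq
  have hq0 : 0 < q := Real.sqrt_pos.mpr hρ
  have hqq : q ^ 2 = ρ := Real.sq_sqrt hρ.le
  set den : MvPolynomial (Fin 2) ℝ := 1 + MvPolynomial.X 0 ^ 2 + MvPolynomial.X 1 ^ 2 with hden
  set num : Fin 3 → MvPolynomial (Fin 2) ℝ := ![
    MvPolynomial.C (u 0) * den + MvPolynomial.C (2 * q) * MvPolynomial.X 0,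
    MvPolynomial.C (u 1) * den + MvPolynomial.C (2 * q) * MvPolynomial.X 1,
    MvPolynomial.C (u 2 - q) * den +
      MvPolynomial.C (2 * q) * (MvPolynomial.X 0 ^ 2 + MvPolynomial.X 1 ^ 2)] with hnum
  have hXd : ∀ i : Fin 2, ((MvPolynomial.X i : MvPolynomial (Fin 2) ℝ) ^ 2).totalDegree ≤ 2 :=
    fun i => (MvPolynomial.totalDegree_pow _ _).trans (by simp)
  have hdd : den.totalDegree ≤ 2 := by
    refine (MvPolynomial.totalDegree_add _ _).trans (max_le ?_ (hXd 1))
    exact (MvPolynomial.totalDegree_add _ _).trans (max_le (by simp) (hXd 0))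
  have hcm : ∀ (c : ℝ) (p : MvPolynomial (Fin 2) ℝ), p.totalDegree ≤ 2 →
      (MvPolynomial.C c * p).totalDegree ≤ 2 := by
    intro c p hp
    refine (MvPolynomial.totalDegree_mul _ _).trans ?_
    rw [MvPolynomial.totalDegree_C]; omega
  have hnd : ∀ i, (num i).totalDegree ≤ 2 := by
    intro i
    fin_cases i
    · exact (MvPolynomial.totalDegree_add _ _).trans (max_le (hcm _ _ hdd) (hcm _ _ (by simp)))
    · exact (MvPolynomial.totalDegree_add _ _).trans (max_le (hcm _ _ hdd) (hcm _ _ (by simp)))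
    · exact (MvPolynomial.totalDegree_add _ _).trans (max_le (hcm _ _ hdd) (hcm _ _
        ((MvPolynomial.totalDegree_add _ _).trans (max_le (hXd 0) (hXd 1)))))
  obtain ⟨Q, hQd, hQ⟩ := exists_rational_subst P hP num den hnd hdd
  have hdev : ∀ w, MvPolynomial.eval w den = 1 + w 0 ^ 2 + w 1 ^ 2 := by intro w; simp [hden]
  have hdpos : ∀ w, 0 < MvPolynomial.eval w den := by intro w; rw [hdev]; positivity
  set φ : (Fin 2 → ℝ) → (Fin 3 → ℝ) :=
    fun w i => MvPolynomial.eval w (num i) / MvPolynomial.eval w den with hφ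
  have hφc : Continuous φ := by
    refine continuous_pi fun i => ?_
    exact (MvPolynomial.continuous_eval _).div (MvPolynomial.continuous_eval _)
      (fun w => (hdpos w).ne')
  -- inverse
  set ψ : (Fin 3 → ℝ) → (Fin 2 → ℝ) :=
    fun x => ![(x 0 - u 0) / (q - (x 2 - u 2)), (x 1 - u 1) / (q - (x 2 - u 2))] with hψ
  have hinv : ∀ x : Fin 3 → ℝ, ∑ i, (x i - u i) ^ 2 = ρ → x 2 - u 2 ≠ q → φ (ψ x) = x := by
    intro x hx hne
    have ht : q - (x 2 - u 2) ≠ 0 := sub_ne_zero.mpr (Ne.symm hne)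
    rw [Fin.sum_univ_three, ← hqq] at hx
    have hden1 : MvPolynomial.eval (ψ x) den = 2 * q / (q - (x 2 - u 2)) := by
      rw [hdev]; simp only [hψ, Matrix.cons_val_zero, Matrix.cons_val_one]
      field_simp
      linear_combination hx
    funext i
    change MvPolynomial.eval (ψ x) (num i) / MvPolynomial.eval (ψ x) den = x i
    rw [div_eq_iff (hdpos _).ne']
    fin_cases i
    · simp only [hnum, Fin.zero_eta, Matrix.cons_val_zero, map_add, map_mul, MvPolynomial.eval_C,
        MvPolynomial.eval_X]
      rw [hden1]; simp only [hψ, Matrix.cons_val_zero]; field_simp; ring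
    · have h6 : MvPolynomial.eval (ψ x) (num 1) =
          u 1 * MvPolynomial.eval (ψ x) den + 2 * q * ψ x 1 := by simp [hnum]
      change MvPolynomial.eval (ψ x) (num 1) = x 1 * MvPolynomial.eval (ψ x) den
      have h7 : ψ x 1 = (x 1 - u 1) / (q - (x 2 - u 2)) := by simp [hψ]
      rw [h6, hden1, h7]; field_simp; ring
    · have h5 : (ψ x 0) ^ 2 + (ψ x 1) ^ 2 = MvPolynomial.eval (ψ x) den - 1 := by rw [hdev]; ring
      simp only [hnum, Fin.reduceFinMk, Matrix.cons_val, map_add, map_mul, MvPolynomial.eval_C,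
        MvPolynomial.eval_X, map_pow]
      rw [h5, hden1]; field_simp; ring
  set Y := X.filter (fun x => x 2 - u 2 ≠ q) with hY
  have hinjY : Set.InjOn ψ (Y : Set (Fin 3 → ℝ)) := by
    intro x hx y hy hxy
    rw [Finset.mem_coe, hY, Finset.mem_filter] at hx hy
    rw [← hinv x (hs x hx.1) hx.2, ← hinv y (hs y hy.1) hy.2, hxy]
  have h1 : Y.card ≤ (2 * D + 4) ^ 2 := by
    rw [← Finset.card_image_of_injOn hinjY]
    refine comp_card Q hQd _ ?_ ?_
    · intro w hw
      obtain ⟨x, hx, rfl⟩ := Finset.mem_image.mp hw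
      rw [hY, Finset.mem_filter] at hx
      rw [hQ _ (hdpos _).ne']
      refine mul_ne_zero (pow_ne_zero _ (hdpos _).ne') ?_
      have : MvPolynomial.eval (φ (ψ x)) P ≠ 0 := by rw [hinv x (hs x hx.1) hx.2]; exact hX x hx.1
      exact this
    · intro w hw w' hw' hmem
      obtain ⟨x, hx, rfl⟩ := Finset.mem_image.mp hw
      obtain ⟨y, hy, rfl⟩ := Finset.mem_image.mp hw'
      rw [hY, Finset.mem_filter] at hx hy
      congr 1
      apply hsep x hx.1 y hy.1
      have hsub : φ '' connectedComponentIn {z | MvPolynomial.eval z Q ≠ 0} (ψ x) ⊆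
          connectedComponentIn {z | MvPolynomial.eval z P ≠ 0} x := by
        refine IsPreconnected.subset_connectedComponentIn
          (isPreconnected_connectedComponentIn.image φ hφc.continuousOn) ?_ ?_
        · refine ⟨ψ x, ?_, hinv x (hs x hx.1) hx.2⟩
          refine mem_connectedComponentIn ?_
          by_contra hne
          have := connectedComponentIn_eq_empty hne
          rw [this] at hmem; exact hmem
        · rintro _ ⟨w, hw, rfl⟩
          have h3 := connectedComponentIn_subset _ _ hw
          change MvPolynomial.eval w Q ≠ 0 at h3
          rw [hQ _ (hdpos _).ne'] at h3
          exact right_ne_zero_of_mul h3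
      have : φ (ψ y) ∈ connectedComponentIn {z | MvPolynomial.eval z P ≠ 0} x := hsub ⟨_, hmem, rfl⟩
      rwa [hinv y (hs y hy.1) hy.2] at this
  have h2 : (X.filter (fun x => ¬ (x 2 - u 2 ≠ q))).card ≤ 1 := by
    rw [Finset.card_le_one]
    have : ∀ a ∈ X.filter (fun x => ¬ (x 2 - u 2 ≠ q)), a 0 = u 0 ∧ a 1 = u 1 ∧ a 2 = u 2 + q := by
      intro a ha
      rw [Finset.mem_filter, not_not] at ha
      have h := hs a ha.1
      rw [Fin.sum_univ_three, ha.2, hqq] at h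
      refine ⟨?_, ?_, by linarith [ha.2]⟩
      · nlinarith [sq_nonneg (a 0 - u 0), sq_nonneg (a 1 - u 1)]
      · nlinarith [sq_nonneg (a 0 - u 0), sq_nonneg (a 1 - u 1)]
    intro a ha b hb
    obtain ⟨a0, a1, a2⟩ := this a ha
    obtain ⟨b0, b1, b2⟩ := this b hb
    funext i
    fin_cases i
    · simp [a0, b0]
    · simp [a1, b1]
    · simp [a2, b2]
  have h3 := Finset.card_filter_add_card_filter_not (s := X) (fun x => x 2 - u 2 ≠ q)
  rw [← hY] at h3
  omega
end Comp3Sec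

section ForsterSec
lemma det_rank1 {κ : Type*} [Fintype κ] [DecidableEq κ] (A : Matrix κ κ ℝ) (hA : IsUnit A.det)
    (t : ℝ) (u : κ → ℝ) :
    (A + t • Matrix.vecMulVec u u).det = A.det * (1 + t * (u ⬝ᵥ (A⁻¹.mulVec u))) := by
  have h := Matrix.det_add_replicateCol_mul_replicateRow (ι := Unit) hA (t • u) u
  have e1 : A + t • Matrix.vecMulVec u u
      = A + Matrix.replicateCol Unit (t • u) * Matrix.replicateRow Unit u := by
    ext i j
    simp [Matrix.vecMulVec, Matrix.mul_apply, Matrix.replicateCol, Matrix.replicateRow]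
    ring
  rw [e1, h]
  congr 1
  rw [Matrix.mul_assoc, Matrix.det_unique, Matrix.add_apply, Matrix.one_apply_eq, Matrix.mul_apply]
  congr 1
  simp only [Matrix.replicateRow_apply, Matrix.mul_apply, Matrix.replicateCol_apply,
    dotProduct, Matrix.mulVec, Pi.smul_apply, smul_eq_mul, Finset.mul_sum]
  refine Finset.sum_congr rfl fun i _ => ?_
  refine Finset.sum_congr rfl fun j _ => ?_
  ring

/-- Gram matrix. -/
def gramM {ι κ : Type*} (s : Finset ι) (v : ι → κ → ℝ) (w : ι → ℝ) :
    Matrix κ κ ℝ := ∑ x ∈ s, w x • Matrix.vecMulVec (v x) (v x)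

lemma gramM_quad {ι κ : Type*} [Fintype κ] (s : Finset ι) (v : ι → κ → ℝ) (w : ι → ℝ) (a : κ → ℝ) :
    a ⬝ᵥ ((gramM s v w).mulVec a) = ∑ x ∈ s, w x * (a ⬝ᵥ v x)^2 := by
  classical
  unfold gramM
  rw [Matrix.sum_mulVec, dotProduct_sum]
  refine Finset.sum_congr rfl fun x _ => ?_
  rw [Matrix.smul_mulVec, Matrix.vecMulVec_mulVec, dotProduct_smul, dotProduct_smul]
  rw [dotProduct_comm a (v x)]
  simp [sq]

lemma gramM_herm {ι κ : Type*} (s : Finset ι) (v : ι → κ → ℝ) (w : ι → ℝ) :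
    (gramM s v w).IsHermitian := by
  ext i j
  simp [gramM, Matrix.sum_apply, Matrix.vecMulVec, mul_comm]

lemma gramM_image {ι κ : Type*} [Fintype κ] [DecidableEq κ] [DecidableEq ι] (v : ι → κ → ℝ)
    (w : ι → ℝ) (e : κ → ι) (he : Function.Injective e) :
    (gramM (univ.image e) v w).det = (∏ k, w (e k)) * (Matrix.of (fun k => v (e k))).det ^ 2 := by
  have : gramM (univ.image e) v w = (Matrix.of (fun k => v (e k))).transpose *
      (Matrix.diagonal (fun k => w (e k)) * Matrix.of (fun k => v (e k))) := by
    ext i j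
    rw [gramM, Finset.sum_image (fun a _ b _ h => he h)]
    simp [Matrix.sum_apply, Matrix.vecMulVec, Matrix.mul_apply, Matrix.diagonal_apply]
    refine Finset.sum_congr rfl fun x _ => by ring
  rw [this, Matrix.det_mul, Matrix.det_mul, Matrix.det_diagonal, Matrix.det_transpose]
  ring

lemma gramM_posDef {ι κ : Type*} [Fintype κ] [DecidableEq κ] [DecidableEq ι] (v : ι → κ → ℝ)
    (w : ι → ℝ) (hw : ∀ x, 0 < w x) (e : κ → ι) 
    (hdet : (Matrix.of (fun k => v (e k))).det ≠ 0) (s : Finset ι) (hs : univ.image e ⊆ s) :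
    (gramM s v w).PosDef := by
  refine Matrix.PosDef.of_dotProduct_mulVec_pos (gramM_herm s v w) fun a ha => ?_
  have : (star a) = a := by ext; simp
  rw [this, gramM_quad]
  have hnn : ∀ x ∈ s, 0 ≤ w x * (a ⬝ᵥ v x)^2 := fun x _ => mul_nonneg (hw x).le (sq_nonneg _)
  rcases (Finset.sum_nonneg hnn).lt_or_eq with h | h
  · exact h
  · exfalso
    rw [eq_comm, Finset.sum_eq_zero_iff_of_nonneg hnn] at h
    apply ha
    have : (Matrix.of (fun k => v (e k))).mulVec a = 0 := by
      ext k
      have := h (e k) (hs (by simp))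
      have h2 : a ⬝ᵥ v (e k) = 0 := by
        have := (mul_eq_zero.mp this).resolve_left (hw _).ne'
        simpa using this
      simp [Matrix.mulVec, dotProduct_comm, h2]
    exact Matrix.eq_zero_of_mulVec_eq_zero hdet this

lemma gramM_det_mono {ι κ : Type*} [Fintype κ] [DecidableEq κ] [DecidableEq ι] (v : ι → κ → ℝ)
    (w : ι → ℝ) (hw : ∀ x, 0 < w x) (e : κ → ι)
    (hdet : (Matrix.of (fun k => v (e k))).det ≠ 0) (t : Finset ι) :
    (gramM (univ.image e) v w).det ≤ (gramM (univ.image e ∪ t) v w).det := by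
  induction t using Finset.induction_on with
  | empty => simp
  | insert x t hx ih =>
    by_cases hxm : x ∈ univ.image e ∪ t
    · have : univ.image e ∪ insert x t = univ.image e ∪ t := by
        rw [Finset.union_insert, Finset.insert_eq_of_mem hxm]
      rwa [this]
    · rw [Finset.union_insert]
      have hp := gramM_posDef v w hw e hdet (univ.image e ∪ t) subset_union_left
      have : gramM (insert x (univ.image e ∪ t)) v w = gramM (univ.image e ∪ t) v w
          + w x • Matrix.vecMulVec (v x) (v x) := by
        unfold gramM
        rw [Finset.sum_insert hxm, add_comm]
      rw [this, det_rank1 _ hp.det_pos.ne'.isUnit]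
      have hq : 0 ≤ v x ⬝ᵥ ((gramM (univ.image e ∪ t) v w)⁻¹.mulVec (v x)) := by
        have := hp.inv.posSemidef.dotProduct_mulVec_nonneg (v x)
        simpa using this
      have := mul_nonneg (hw x).le hq
      nlinarith [hp.det_pos]

/-- A weighted sum with weights in `[0,1]` of total mass `K` is at most the sum over some `K` indices. -/
lemma exists_top_subset {ι : Type*} [Fintype ι] [DecidableEq ι] (K : ℕ) (c l : ι → ℝ)
    (hc0 : ∀ x, 0 < c x) (hc1 : ∀ x, c x ≤ 1) (hcs : ∑ x, c x = K) :
    ∃ B : Finset ι, B.card = K ∧ ∑ x, c x * l x ≤ ∑ x ∈ B, l x := by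
  have hK : K ≤ (univ : Finset ι).card := by
    have : (∑ x : ι, c x) ≤ ∑ x : ι, (1:ℝ) := Finset.sum_le_sum fun x _ => hc1 x
    rw [hcs] at this
    simp at this
    exact_mod_cast this
  obtain ⟨B, hB, hmax⟩ := Finset.exists_max_image (powersetCard K (univ : Finset ι))
    (fun B => ∑ x ∈ B, l x) (powersetCard_nonempty.mpr hK)
  rw [mem_powersetCard] at hB
  refine ⟨B, hB.2, ?_⟩
  have hex : ∀ x ∈ B, ∀ y, y ∉ B → l y ≤ l x := by
    intro x hx y hy
    have h1 : insert y (B.erase x) ∈ powersetCard K (univ : Finset ι) := by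
      rw [mem_powersetCard]
      refine ⟨subset_univ _, ?_⟩
      rw [card_insert_of_notMem (by simp [hy]), card_erase_of_mem hx, hB.2]
      have : 0 < B.card := card_pos.mpr ⟨x, hx⟩
      omega
    have h2 := hmax _ h1
    rw [sum_insert (by simp [hy])] at h2
    have h3 := Finset.add_sum_erase B l hx
    linarith
  rcases B.eq_empty_or_nonempty with h0 | hne
  · have hK0 : K = 0 := by rw [← hB.2, h0]; rfl
    rw [hK0] at hcs
    have hemp : IsEmpty ι := by
      by_contra hne
      rw [not_isEmpty_iff] at hne
      have : 0 < ∑ x, c x := Finset.sum_pos (fun x _ => hc0 x) univ_nonempty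
      simp [hcs] at this
    simp [h0]
  · obtain ⟨z, hz, hzmin⟩ := Finset.exists_min_image B l hne
    have e1 : ∑ x, c x * (l x - l z) ≤ ∑ x ∈ B, (l x - l z) := by
      rw [← Finset.sum_add_sum_compl B]
      have a1 : ∑ x ∈ B, c x * (l x - l z) ≤ ∑ x ∈ B, (l x - l z) := by
        refine Finset.sum_le_sum fun x hx => ?_
        have := hzmin x hx
        have := hc1 x
        nlinarith
      have a2 : ∑ x ∈ Bᶜ, c x * (l x - l z) ≤ 0 := by
        refine Finset.sum_nonpos fun x hx => ?_
        have := hex z hz x (by simpa using hx)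
        have := hc0 x
        nlinarith
      linarith
    simp only [mul_sub, Finset.sum_sub_distrib, ← Finset.sum_mul, hcs] at e1
    simp only [Finset.sum_const, hB.2, nsmul_eq_mul] at e1
    linarith

theorem forster {ι κ : Type*} [Fintype ι] [DecidableEq ι] [Fintype κ] [DecidableEq κ]
    (v : ι → κ → ℝ) (hgen : ∀ e : κ → ι, Function.Injective e → (Matrix.of (fun k => v (e k))).det ≠ 0)
    (c : ι → ℝ) (hc0 : ∀ x, 0 < c x) (hc1 : ∀ x, c x ≤ 1) (hcs : ∑ x, c x = Fintype.card κ) :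
    ∃ w : ι → ℝ, (∀ x, 0 < w x) ∧ ∀ (a : κ → ℝ) (x : ι),
      w x * (a ⬝ᵥ v x)^2 ≤ 2 * c x * ∑ y, w y * (a ⬝ᵥ v y)^2 := by
  rcases isEmpty_or_nonempty ι with hι | hι
  · exact ⟨fun _ => 1, fun _ => one_pos, fun a x => (hι.false x).elim⟩
  set F : (ι → ℝ) → ℝ := fun w => ∑ x, c x * Real.log (w x) - Real.log (gramM univ v w).det with hF
  -- a basis
  have hbas : ∀ B : Finset ι, B.card = Fintype.card κ → ∃ e : κ → ι, Function.Injective e ∧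
      univ.image e = B := by
    intro B hB
    have : Fintype.card κ = Fintype.card B := by simp [hB]
    let f := Fintype.equivOfCardEq this
    refine ⟨fun k => (f k : ι), fun a b h => f.injective (Subtype.ext h), ?_⟩
    ext x
    simp only [mem_image, mem_univ, true_and]
    constructor
    · rintro ⟨k, rfl⟩; exact (f k).2
    · intro hx; exact ⟨f.symm ⟨x, hx⟩, by simp⟩
  obtain ⟨e0, he0, -⟩ : ∃ e : κ → ι, Function.Injective e ∧ True := by
    obtain ⟨B, hB, -⟩ := exists_top_subset (Fintype.card κ) c 0 hc0 hc1 hcs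
    obtain ⟨e, he, -⟩ := hbas B hB
    exact ⟨e, he, trivial⟩
  have hpd : ∀ w : ι → ℝ, (∀ x, 0 < w x) → (gramM univ v w).PosDef := fun w hw =>
    gramM_posDef v w hw e0 (hgen e0 he0) univ (subset_univ _)
  obtain ⟨G, hG⟩ : ∃ G : ℝ, ∀ e : κ → ι, - Real.log ((Matrix.of (fun k => v (e k))).det ^ 2) ≤ G := by
    obtain ⟨G, hG⟩ := (Set.finite_range (fun e : κ → ι =>
      - Real.log ((Matrix.of (fun k => v (e k))).det ^ 2))).bddAbove
    exact ⟨G, fun e => hG ⟨e, rfl⟩⟩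
  have hbdd : ∀ w : ι → ℝ, (∀ x, 0 < w x) → F w ≤ G := by
    intro w hw
    obtain ⟨B, hB, hle⟩ := exists_top_subset (Fintype.card κ) c (fun x => Real.log (w x)) hc0 hc1 hcs
    obtain ⟨e, he, heB⟩ := hbas B hB
    have h1 := gramM_det_mono v w hw e (hgen e he) univ
    rw [Finset.union_eq_right.mpr (subset_univ _)] at h1
    rw [gramM_image v w e he] at h1
    have hdp : 0 < (Matrix.of (fun k => v (e k))).det ^ 2 := by
      have := hgen e he
      positivity
    have hpp : 0 < ∏ k, w (e k) := Finset.prod_pos fun k _ => hw _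
    have h2 := Real.log_le_log (by positivity) h1
    rw [Real.log_mul hpp.ne' hdp.ne', Real.log_prod (fun k _ => (hw _).ne')] at h2
    have h3 := hG e
    have h4 : ∑ x ∈ B, Real.log (w x) = ∑ k, Real.log (w (e k)) := by
      rw [← heB, Finset.sum_image (fun a _ b _ h => he h)]
    simp only [hF]
    linarith
  -- near maximiser
  obtain ⟨z, -, hz⟩ := Finset.exists_min_image (univ : Finset ι) c univ_nonempty
  have hlog2 : Real.log 2 < 1 := by
    have := Real.log_two_lt_d9; linarith
  set S : Set ℝ := F '' {w | ∀ x, 0 < w x} with hS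
  have hSb : BddAbove S := ⟨G, by rintro _ ⟨w, hw, rfl⟩; exact hbdd w hw⟩
  have hSn : S.Nonempty := ⟨F (fun _ => 1), ⟨fun _ => 1, fun _ => one_pos, rfl⟩⟩
  have hη : sSup S - c z * (1 - Real.log 2) < sSup S := by
    have := mul_pos (hc0 z) (sub_pos.mpr hlog2)
    linarith
  obtain ⟨_, ⟨w, hw, rfl⟩, hwS⟩ := exists_lt_of_lt_csSup hSn hη
  have hw : ∀ x, 0 < w x := hw
  refine ⟨w, hw, fun a x => ?_⟩
  have hp := hpd w hw
  set M := gramM univ v w with hM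
  set τ : ℝ := w x * (v x ⬝ᵥ (M⁻¹.mulVec (v x))) with hτ
  have hτle : τ ≤ 2 * c x := by
    by_contra hcon
    push Not at hcon
    let w' := Function.update w x (w x / 2)
    have hw' : ∀ y, 0 < w' y := by
      intro y
      by_cases h : y = x
      · subst h; simp [w', hw]
      · simp [w', h, hw]
    have hM' : gramM univ v w' = M + (-(w x / 2)) • Matrix.vecMulVec (v x) (v x) := by
      rw [hM]; unfold gramM
      rw [← Finset.add_sum_erase univ _ (mem_univ x), ← Finset.add_sum_erase univ (fun y => w y • _) (mem_univ x)]
      have : ∑ y ∈ univ.erase x, w' y • Matrix.vecMulVec (v y) (v y)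
          = ∑ y ∈ univ.erase x, w y • Matrix.vecMulVec (v y) (v y) := by
        refine Finset.sum_congr rfl fun y hy => ?_
        simp [w', (Finset.mem_erase.mp hy).1]
      rw [this]
      simp only [w', Function.update_self]
      module
    have hd : (gramM univ v w').det = M.det * (1 - τ/2) := by
      rw [hM', det_rank1 _ hp.det_pos.ne'.isUnit, hτ]; ring
    have hd0 := (hpd w' hw').det_pos
    rw [hd] at hd0
    have h1 : 0 < 1 - τ/2 := by
      by_contra h; push Not at h; nlinarith [hp.det_pos]
    have hF' : F w' = F w - c x * Real.log 2 - Real.log (1 - τ/2) := by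
      simp only [hF]
      rw [hd, Real.log_mul hp.det_pos.ne' h1.ne']
      rw [← Finset.add_sum_erase univ _ (mem_univ x), ← Finset.add_sum_erase univ (fun y => c y * Real.log (w y)) (mem_univ x)]
      have : ∑ y ∈ univ.erase x, c y * Real.log (w' y)
          = ∑ y ∈ univ.erase x, c y * Real.log (w y) := by
        refine Finset.sum_congr rfl fun y hy => ?_
        simp [w', (Finset.mem_erase.mp hy).1]
      rw [this]
      simp only [w', Function.update_self]
      rw [Real.log_div (hw x).ne' two_ne_zero]
      ring
    have h2 : F w' ≤ sSup S := le_csSup hSb ⟨w', hw', rfl⟩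
    have h3 := Real.log_le_sub_one_of_pos h1
    have h4 := hz x (mem_univ x)
    have h5 : c z * (1 - Real.log 2) ≤ c x * (1 - Real.log 2) :=
      mul_le_mul_of_nonneg_right h4 (by linarith)
    nlinarith
  -- Cauchy-Schwarz
  have hq : 0 ≤ v x ⬝ᵥ (M⁻¹.mulVec (v x)) := by
    have := hp.inv.posSemidef.dotProduct_mulVec_nonneg (v x)
    simpa using this
  set b := M⁻¹.mulVec (v x) with hb
  have hMb : M.mulVec b = v x := by
    rw [hb, Matrix.mulVec_mulVec, Matrix.mul_nonsing_inv _ hp.det_pos.ne'.isUnit, Matrix.one_mulVec]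
  have hbb : v x ⬝ᵥ b = ∑ y, w y * (b ⬝ᵥ v y)^2 := by
    rw [← gramM_quad, ← hM, hMb, dotProduct_comm]
  have hab : a ⬝ᵥ v x = ∑ y, w y * ((a ⬝ᵥ v y) * (b ⬝ᵥ v y)) := by
    rw [← hMb, hM]
    unfold gramM
    rw [Matrix.sum_mulVec, dotProduct_sum]
    refine Finset.sum_congr rfl fun y _ => ?_
    rw [Matrix.smul_mulVec, Matrix.vecMulVec_mulVec, dotProduct_smul, dotProduct_smul]
    rw [dotProduct_comm b (v y)]
    simp
    try ring
  have hcs : (a ⬝ᵥ v x)^2 ≤ (∑ y, w y * (a ⬝ᵥ v y)^2) * (v x ⬝ᵥ b) := by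
    rw [hab, hbb]
    have := Finset.sum_mul_sq_le_sq_mul_sq univ (fun y => √(w y) * (a ⬝ᵥ v y)) (fun y => √(w y) * (b ⬝ᵥ v y))
    simp only [mul_pow, Real.sq_sqrt (hw _).le] at this
    refine le_of_eq_of_le ?_ this
    congr 1
    refine Finset.sum_congr rfl fun y _ => ?_
    rw [mul_mul_mul_comm, Real.mul_self_sqrt (hw _).le]
  have hsum : 0 ≤ ∑ y, w y * (a ⬝ᵥ v y)^2 := Finset.sum_nonneg fun y _ => mul_nonneg (hw y).le (sq_nonneg _)
  calc w x * (a ⬝ᵥ v x)^2 ≤ w x * ((∑ y, w y * (a ⬝ᵥ v y)^2) * (v x ⬝ᵥ b)) :=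
        mul_le_mul_of_nonneg_left hcs (hw x).le
    _ = τ * ∑ y, w y * (a ⬝ᵥ v y)^2 := by rw [hτ]; ring
    _ ≤ _ := mul_le_mul_of_nonneg_right hτle hsum
end ForsterSec

section SplitSec
/-- sign -/
def sgnB (b : Bool) : ℝ := if b then 1 else -1

lemma rademacher (r : ℕ) (f : Fin r → ℝ) :
    (∑ e : Fin r → Bool, (∑ j, sgnB (e j) * f j)^2 = 2^r * ∑ j, f j ^ 2) ∧
    (∑ e : Fin r → Bool, (∑ j, sgnB (e j) * f j)^4 ≤ 3 * 2^r * (∑ j, f j ^ 2)^2) := by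
  induction r with
  | zero => simp
  | succ r ih =>
    have key : ∀ n : ℕ, ∑ e : Fin (r+1) → Bool, (∑ j, sgnB (e j) * f j)^n
        = ∑ e : Fin r → Bool, ((∑ j, sgnB (e j) * f j.succ + f 0)^n
          + (∑ j, sgnB (e j) * f j.succ - f 0)^n) := by
      intro n
      rw [← (Fin.consEquiv (fun _ : Fin (r+1) => Bool)).sum_comp, Fintype.sum_prod_type]
      rw [Finset.sum_comm]
      refine Finset.sum_congr rfl fun e _ => ?_
      rw [Fintype.sum_bool]
      simp only [Fin.consEquiv, Equiv.coe_fn_mk, Fin.sum_univ_succ, Fin.cons_zero, Fin.cons_succ]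
      simp [sgnB]
      congr 1
      · ring
      · ring
    obtain ⟨h2, h4⟩ := ih (fun j => f j.succ)
    set S := ∑ j : Fin r, f j.succ ^ 2 with hS
    have hSn : 0 ≤ S := Finset.sum_nonneg fun _ _ => sq_nonneg _
    rw [key, key, Fin.sum_univ_succ, ← hS]
    constructor
    · have : ∀ e : Fin r → Bool, ((∑ j, sgnB (e j) * f j.succ + f 0)^2
          + (∑ j, sgnB (e j) * f j.succ - f 0)^2) = 2 * (∑ j, sgnB (e j) * f j.succ)^2 + 2 * f 0 ^2 := by
        intro e; ring
      simp only [this, Finset.sum_add_distrib, ← Finset.mul_sum, h2]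
      simp
      ring
    · have : ∀ e : Fin r → Bool, ((∑ j, sgnB (e j) * f j.succ + f 0)^4
          + (∑ j, sgnB (e j) * f j.succ - f 0)^4) = 2 * (∑ j, sgnB (e j) * f j.succ)^4 +
            12 * f 0 ^2 * (∑ j, sgnB (e j) * f j.succ)^2 + 2 * f 0 ^4 := by
        intro e; ring
      simp only [this, Finset.sum_add_distrib, ← Finset.mul_sum, h2]
      simp
      have : (0:ℝ) < 2^r := by positivity
      have h5 : 0 ≤ 2^r * f 0 ^ 4 := by positivity
      rw [pow_succ (2:ℝ) r]
      nlinarith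

lemma quart_nonpos (t : ℝ) (ht : t ≤ 0) : 3/10 * t + t^2/2 - t^4/4 ≤ 0 := by
  nlinarith [mul_nonneg (neg_nonneg.mpr ht) (sq_nonneg (t + 8/10)), mul_nonneg (mul_nonneg (neg_nonneg.mpr ht) (neg_nonneg.mpr ht)) (sq_nonneg (t+8/10)),
    mul_nonneg (neg_nonneg.mpr ht) (mul_nonneg (neg_nonneg.mpr ht) (neg_nonneg.mpr ht))]

lemma quart_le_one (t : ℝ) : 3/10 * t + t^2/2 - t^4/4 ≤ 1 := by
  nlinarith [sq_nonneg (t^2 - 1), sq_nonneg (t-1), sq_nonneg (t^2-1.3)]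

/-- number of positive values of a sequence with zero sum, via moments. -/
lemma pos_count {ι : Type*} (s : Finset ι) (g : ι → ℝ) (hg : ∑ x ∈ s, g x = 0) (l : ℝ) (hl : 0 ≤ l) :
    l * (∑ x ∈ s, g x ^ 2) / 2 - l^2 * (∑ x ∈ s, g x ^ 4) / 4 ≤ ((s.filter (fun x => 0 < g x)).card : ℝ) := by
  have h : ∀ x ∈ s, 3/10 * (√l * g x) + (√l * g x)^2/2 - (√l * g x)^4/4 ≤ if 0 < g x then 1 else 0 := by
    intro x _
    split_ifs with hx
    · exact quart_le_one _
    · exact quart_nonpos _ (mul_nonpos_of_nonneg_of_nonpos (Real.sqrt_nonneg _) (not_lt.mp hx))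
  have h2 := Finset.sum_le_sum h
  rw [Finset.card_filter]
  push_cast
  refine le_trans (le_of_eq ?_) h2
  have e2 : ∀ x, (√l * g x)^2 = l * g x ^2 := fun x => by rw [mul_pow, Real.sq_sqrt hl]
  have e4 : ∀ x, (√l * g x)^4 = l^2 * g x ^4 := fun x => by
    rw [mul_pow]; congr 1
    rw [show (4:ℕ) = 2*2 by norm_num, pow_mul, Real.sq_sqrt hl]
  simp only [e2, e4, Finset.sum_add_distrib, Finset.sum_sub_distrib, ← Finset.mul_sum,
    ← Finset.sum_div, hg]
  ring

/-- A subspace of `ℝ^ι` on which coordinates are controlled admits a good sign combination basis. -/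
lemma onb_bounds {ι : Type*} [Fintype ι] (W : Submodule ℝ (EuclideanSpace ℝ ι)) (c : ι → ℝ)
    (hc0 : ∀ x, 0 ≤ c x) (hc : ∀ f ∈ W, ∀ x, (f x)^2 ≤ 2 * c x * ∑ y, (f y)^2) :
    ∃ F : Fin (Module.finrank ℝ W) → (ι → ℝ), (∀ j, WithLp.toLp 2 (F j) ∈ W) ∧
      (∀ x, ∑ j, F j x ^ 2 ≤ 2 * c x) ∧ ∑ x, ∑ j, F j x ^ 2 = Module.finrank ℝ W := by
  classical
  let b := stdOrthonormalBasis ℝ W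
  let F : Fin (Module.finrank ℝ W) → (ι → ℝ) := fun j x => (b j : EuclideanSpace ℝ ι) x
  have hin : ∀ i j, ∑ y, F i y * F j y = if i = j then 1 else 0 := by
    intro i j
    have := (orthonormal_iff_ite.mp b.orthonormal) i j
    rw [← this, Submodule.coe_inner, PiLp.inner_apply]
    refine Finset.sum_congr rfl fun y _ => ?_
    simp [F, mul_comm]
  refine ⟨F, fun j => (b j).2, fun x => ?_, ?_⟩
  · have hmem : (∑ j, F j x • (b j : EuclideanSpace ℝ ι)) ∈ W :=
      Submodule.sum_mem _ fun j _ => W.smul_mem _ (b j).2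
    have h := hc _ hmem x
    have hval : ∀ y, (∑ j, F j x • (b j : EuclideanSpace ℝ ι)) y = ∑ j, F j x * F j y := by
      intro y
      simp [F]
    simp only [hval] at h
    have hn : ∑ y, (∑ j, F j x * F j y)^2 = ∑ j, F j x ^ 2 := by
      calc ∑ y, (∑ j, F j x * F j y)^2 = ∑ y, ∑ i, ∑ j, F i x * F j x * (F i y * F j y) := by
            refine Finset.sum_congr rfl fun y _ => ?_
            rw [sq, Finset.sum_mul_sum]
            refine Finset.sum_congr rfl fun i _ => Finset.sum_congr rfl fun j _ => by ring
        _ = ∑ i, ∑ j, F i x * F j x * ∑ y, F i y * F j y := by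
            rw [Finset.sum_comm]
            refine Finset.sum_congr rfl fun i _ => ?_
            rw [Finset.sum_comm]
            refine Finset.sum_congr rfl fun j _ => ?_
            rw [Finset.mul_sum]
        _ = _ := by
            simp only [hin]
            simp [sq]
    rw [hn] at h
    have e : ∑ j, F j x * F j x = ∑ j, F j x ^ 2 := Finset.sum_congr rfl fun j _ => by ring
    rw [e] at h
    have h0 : 0 ≤ ∑ j, F j x ^ 2 := Finset.sum_nonneg fun _ _ => sq_nonneg _
    rcases h0.lt_or_eq with h1 | h1
    · by_contra hcon
      push Not at hcon
      nlinarith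
    · rw [← h1]
      have := hc0 x
      linarith
  · rw [Finset.sum_comm]
    have : ∀ j, ∑ x, F j x ^ 2 = 1 := by
      intro j
      have := hin j j
      simp only [if_true] at this
      rw [← this]
      exact Finset.sum_congr rfl fun y _ => by ring
    simp [this]

lemma finrank_map_inj {V V' : Type*} [AddCommGroup V] [Module ℝ V] [AddCommGroup V'] [Module ℝ V']
    (f : V →ₗ[ℝ] V') (hf : Function.Injective f) (p : Submodule ℝ V) :
    Module.finrank ℝ (p.map f) = Module.finrank ℝ p :=
  (LinearEquiv.finrank_eq (Submodule.equivMapOfInjective f hf p)).symm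

lemma split_arith (s l c Ω K T R Q : ℝ) (hs : 0 < s) (hΩ : 0 < Ω) (hK : 0 < K)
    (hl : l = Ω / (6 * K * s)) (hc : c = K * s / Ω) (h1 : T ≤ 2 * c) (hT : 0 ≤ T) (hR : 0 ≤ R)
    (hQ : Q ≤ 3 * R * T ^ 2) :
    R * (Ω / (24 * K) * T) ≤ s * (l * (R * T) / 2 - l ^ 2 * Q / 4) := by
  have hlc : l * (2 * c) = 1 / 3 := by
    rw [hl, hc]; field_simp; norm_num
  have hlx : 0 ≤ l := by rw [hl]; positivity
  have h5 : l * T ≤ 1/3 := by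
    rw [← hlc]; exact mul_le_mul_of_nonneg_left h1 hlx
  have h6 : l^2 * Q ≤ R * (l * T) := by
    calc _ ≤ l^2 * (3 * R * T^2) := mul_le_mul_of_nonneg_left hQ (sq_nonneg _)
      _ = 3 * R * (l * T) * (l * T) := by ring
      _ ≤ 3 * R * (l * T) * (1/3) := mul_le_mul_of_nonneg_left h5 (by positivity)
      _ = _ := by ring
  have h7 : Ω / (24 * K) = s * (l / 4) := by
    rw [hl]; field_simp; norm_num
  rw [h7]
  calc R * (s * (l / 4) * T) = s * (l * (R * T) / 2 - R * (l * T) / 4) := by ring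
    _ ≤ _ := mul_le_mul_of_nonneg_left (by linarith) hs.le

set_option maxHeartbeats 1000000 in
/-- The splitting step: some linear functional splits the cells on average. -/
theorem split_step {ι κ γ : Type*} [Fintype ι] [DecidableEq ι] [Nonempty ι] [Fintype κ] [DecidableEq κ]
    [Fintype γ] [DecidableEq γ]
    (v : ι → κ → ℝ) (hgen : ∀ e : κ → ι, Function.Injective e → (Matrix.of (fun k => v (e k))).det ≠ 0)
    (cl : ι → γ) (hK : 4 * Fintype.card γ ≤ Fintype.card κ)
    (hbig : ∀ x, Fintype.card κ ≤ (univ.filter (fun y => cl y = cl x)).card) :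
    ∃ a : κ → ℝ, a ≠ 0 ∧
      32 * ∑ i, (((univ.filter (fun x => cl x = i ∧ 0 < a ⬝ᵥ v x)).card : ℝ)^2
        + ((univ.filter (fun x => cl x = i ∧ a ⬝ᵥ v x < 0)).card : ℝ)^2)
      ≤ 31 * ∑ i, ((univ.filter (fun x => cl x = i)).card : ℝ)^2 := by
  set s : γ → ℝ := fun i => ((univ.filter (fun x => cl x = i)).card : ℝ) with hs
  set Ω : ℝ := ∑ i, s i ^ 2 with hΩ
  set K : ℕ := Fintype.card κ with hKdef
  obtain ⟨x0⟩ := ‹Nonempty ι›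
  have hγ : 0 < Fintype.card γ := Fintype.card_pos_iff.mpr ⟨cl x0⟩
  have hKpos : 0 < K := by omega
  have hsK : ∀ x, (K:ℝ) ≤ s (cl x) := fun x => by simp only [hs]; exact_mod_cast hbig x
  have hspos : ∀ x, 0 < s (cl x) := fun x => lt_of_lt_of_le (by exact_mod_cast hKpos) (hsK x)
  have hΩge : ∀ i, s i ^ 2 ≤ Ω := fun i =>
    Finset.single_le_sum (f := fun i => s i ^ 2) (fun _ _ => sq_nonneg _) (mem_univ i)
  have hΩpos : 0 < Ω := lt_of_lt_of_le (by have := hspos x0; positivity) (hΩge (cl x0))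
  have hKr : (0:ℝ) < K := by exact_mod_cast hKpos
  set c : ι → ℝ := fun x => K * s (cl x) / Ω with hc
  have hc0 : ∀ x, 0 < c x := fun x => div_pos (mul_pos hKr (hspos x)) hΩpos
  have hc1 : ∀ x, c x ≤ 1 := by
    intro x
    rw [hc, div_le_one hΩpos]
    refine le_trans ?_ (hΩge (cl x))
    rw [sq]
    exact mul_le_mul_of_nonneg_right (hsK x) (hspos x).le
  have hsums : ∀ h : γ → ℝ, ∑ x, h (cl x) = ∑ i, s i * h i := by
    intro h
    rw [← Finset.sum_fiberwise_of_maps_to (s := univ) (t := univ) (g := cl) (fun _ _ => mem_univ _)]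
    refine Finset.sum_congr rfl fun i _ => ?_
    rw [Finset.sum_congr rfl (g := fun _ => h i) (fun x hx => by rw [(mem_filter.mp hx).2])]
    simp [hs]
  have hcs : ∑ x, c x = K := by
    simp only [hc]
    rw [hsums (fun i => K * s i / Ω)]
    have : ∀ i, s i * (K * s i / Ω) = K / Ω * s i ^ 2 := fun i => by ring
    simp only [this, ← Finset.mul_sum, ← hΩ]
    field_simp
  obtain ⟨w, hw, hforster⟩ := forster v hgen c hc0 hc1 hcs
  -- the linear map
  let Φ : (κ → ℝ) →ₗ[ℝ] EuclideanSpace ℝ ι :=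
    { toFun := fun a => WithLp.toLp 2 (fun x => √(w x) * (a ⬝ᵥ v x))
      map_add' := fun a b => by ext x; simp [add_dotProduct, mul_add]
      map_smul' := fun t a => by ext x; simp [smul_dotProduct]; ring }
  have hΦ : ∀ a x, Φ a x = √(w x) * (a ⬝ᵥ v x) := fun a x => rfl
  have hΦsq : ∀ a x, (Φ a x)^2 = w x * (a ⬝ᵥ v x)^2 := fun a x => by
    rw [hΦ, mul_pow, Real.sq_sqrt (hw x).le]
  have hinj : Function.Injective Φ := by
    rw [← LinearMap.ker_eq_bot, LinearMap.ker_eq_bot']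
    intro a ha
    have hcard : Fintype.card κ ≤ Fintype.card ι := le_trans (hbig x0) (card_filter_le _ _)
    obtain ⟨e⟩ := Function.Embedding.nonempty_of_card_le hcard
    refine Matrix.eq_zero_of_mulVec_eq_zero (hgen e e.injective) ?_
    ext k
    have : Φ a (e k) = 0 := by rw [ha]; rfl
    rw [hΦ] at this
    have h2 := (mul_eq_zero.mp this).resolve_left (Real.sqrt_pos.mpr (hw _)).ne'
    simp only [Matrix.mulVec, Matrix.of_apply, Pi.zero_apply]
    rw [dotProduct_comm]; exact h2
  let S : (κ → ℝ) →ₗ[ℝ] (γ → ℝ) :=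
    { toFun := fun a i => ∑ x ∈ univ.filter (fun x => cl x = i), Φ a x
      map_add' := fun a b => by ext i; simp [Finset.sum_add_distrib]
      map_smul' := fun t a => by ext i; simp [Finset.mul_sum] }
  set W := (LinearMap.ker S).map Φ with hW
  have hr : 3 * (K:ℝ) ≤ 4 * Module.finrank ℝ W := by
    rw [hW, finrank_map_inj Φ hinj]
    have h1 := LinearMap.finrank_range_add_finrank_ker S
    have h2 : Module.finrank ℝ (LinearMap.range S) ≤ Fintype.card γ := by
      have := Submodule.finrank_le (LinearMap.range S)
      simpa using this
    simp only [Module.finrank_fintype_fun_eq_card] at h1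
    have : 3 * K ≤ 4 * Module.finrank ℝ (LinearMap.ker S) := by omega
    exact_mod_cast this
  obtain ⟨r, hr, F, A, hAker, hA, hσ, hσsum⟩ : ∃ r : ℕ, 3 * (K:ℝ) ≤ 4 * r ∧
      ∃ (F : Fin r → ι → ℝ) (A : Fin r → κ → ℝ), (∀ j, A j ∈ LinearMap.ker S) ∧
        (∀ j, Φ (A j) = WithLp.toLp 2 (F j)) ∧ (∀ x, ∑ j, F j x ^ 2 ≤ 2 * c x) ∧
        ∑ x, ∑ j, F j x ^ 2 = r := by
    obtain ⟨F, hFW, hσ, hσsum⟩ := onb_bounds W c (fun x => (hc0 x).le) (by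
      rintro f ⟨a, -, rfl⟩ x
      simp only [hΦsq]
      exact hforster a x)
    choose A hAker hA using fun j => hFW j
    exact ⟨_, hr, F, A, hAker, hA, hσ, hσsum⟩
  clear_value Φ
  let a : (Fin r → Bool) → (κ → ℝ) := fun e => ∑ j, sgnB (e j) • A j
  have hΦa : ∀ e x, Φ (a e) x = ∑ j, sgnB (e j) * F j x := by
    intro e x
    simp only [a, map_sum, map_smul, hA]
    simp
  have haker : ∀ e i, ∑ x ∈ univ.filter (fun x => cl x = i), Φ (a e) x = 0 := by
    intro e i
    have : a e ∈ LinearMap.ker S := Submodule.sum_mem _ fun j _ => Submodule.smul_mem _ _ (hAker j)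
    exact congrFun (LinearMap.mem_ker.mp this) i
  -- positivity counts
  set l : γ → ℝ := fun i => Ω / (6 * K * s i) with hl
  have hl0 : ∀ i, 0 ≤ l i := fun i => by
    have : 0 ≤ s i := Nat.cast_nonneg _
    exact div_nonneg hΩpos.le (by positivity)
  set L : (Fin r → Bool) → γ → ℝ := fun e i => 
    l i * (∑ x ∈ univ.filter (fun x => cl x = i), Φ (a e) x ^ 2) / 2
      - l i^2 * (∑ x ∈ univ.filter (fun x => cl x = i), Φ (a e) x ^ 4) / 4 with hL
  have hpos : ∀ e i, L e i ≤ ((univ.filter (fun x => cl x = i ∧ 0 < a e ⬝ᵥ v x)).card : ℝ) := by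
    intro e i
    have := pos_count _ _ (haker e i) (l i) (hl0 i)
    rw [Finset.filter_filter] at this
    convert this using 5 with x
    rw [hΦ, mul_pos_iff_of_pos_left (Real.sqrt_pos.mpr (hw x))]
  have hneg : ∀ e i, L e i ≤ ((univ.filter (fun x => cl x = i ∧ a e ⬝ᵥ v x < 0)).card : ℝ) := by
    intro e i
    have h0 : ∑ x ∈ univ.filter (fun x => cl x = i), -(Φ (a e) x) = 0 := by
      rw [Finset.sum_neg_distrib, haker, neg_zero]
    have := pos_count _ _ h0 (l i) (hl0 i)
    rw [Finset.filter_filter] at this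
    simp only [neg_sq, Even.neg_pow (by decide : Even 4)] at this
    convert this using 5 with x
    rw [hΦ, neg_pos, mul_neg_iff]
    have := Real.sqrt_pos.mpr (hw x)
    exact ⟨fun h => Or.inl ⟨this, h⟩, fun h => h.elim (fun h => h.2) (fun h => absurd h.1 (not_lt.mpr this.le))⟩
  -- average
  have havg : (2:ℝ)^r * (Ω / 32) ≤ ∑ e, ∑ i, s i * L e i := by
    have hLx : ∀ e, ∑ i, s i * L e i = ∑ x, s (cl x) * (l (cl x) * Φ (a e) x ^ 2 / 2
        - l (cl x) ^ 2 * Φ (a e) x ^ 4 / 4) := by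
      intro e
      rw [← Finset.sum_fiberwise_of_maps_to (s := univ) (t := univ) (g := cl) (fun _ _ => mem_univ _)]
      refine Finset.sum_congr rfl fun i _ => ?_
      rw [Finset.sum_congr rfl (g := fun x => s i * (l i * Φ (a e) x ^ 2 / 2
        - l i ^ 2 * Φ (a e) x ^ 4 / 4)) (fun x hx => by rw [(mem_filter.mp hx).2])]
      simp only [hL, ← Finset.mul_sum, Finset.sum_sub_distrib, ← Finset.sum_div]
    simp only [hLx]
    rw [Finset.sum_comm]
    have hx : ∀ x, (2:ℝ)^r * (Ω / (24 * K) * ∑ j, F j x ^ 2) ≤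
        ∑ e, s (cl x) * (l (cl x) * Φ (a e) x ^ 2 / 2 - l (cl x) ^ 2 * Φ (a e) x ^ 4 / 4) := by
      intro x
      obtain ⟨h2, h4⟩ := rademacher r (fun j => F j x)
      have h1 := hσ x
      set T := ∑ j, F j x ^ 2 with hT
      have hT0 : 0 ≤ T := Finset.sum_nonneg fun _ _ => sq_nonneg _
      rw [← Finset.mul_sum, Finset.sum_sub_distrib, ← Finset.sum_div, ← Finset.sum_div,
        ← Finset.mul_sum, ← Finset.mul_sum]
      simp only [hΦa]
      rw [h2]
      have hsx := hspos x
      exact split_arith (s (cl x)) (l (cl x)) (c x) Ω K T ((2:ℝ)^r) _ hsx hΩpos hKr rfl rfl h1 hT0 (by positivity) h4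
    refine le_trans ?_ (Finset.sum_le_sum fun x _ => hx x)
    rw [← Finset.mul_sum, ← Finset.mul_sum, hσsum]
    refine mul_le_mul_of_nonneg_left ?_ (by positivity)
    rw [div_mul_eq_mul_div, div_le_div_iff₀ (by norm_num) (by positivity)]
    nlinarith
  obtain ⟨e, he⟩ : ∃ e, Ω / 32 ≤ ∑ i, s i * L e i := by
    by_contra hcon
    push Not at hcon
    have := Finset.sum_lt_sum_of_nonempty (univ_nonempty (α := Fin r → Bool)) (fun e _ => hcon e)
    simp at this
    linarith
  refine ⟨a e, ?_, ?_⟩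
  · intro h0
    have : ∑ i, s i * L e i = 0 := by
      refine Finset.sum_eq_zero fun i _ => ?_
      simp [hL, h0]
    rw [this] at he
    linarith
  · have hi : ∀ i, (((univ.filter (fun x => cl x = i ∧ 0 < a e ⬝ᵥ v x)).card : ℝ)^2
        + ((univ.filter (fun x => cl x = i ∧ a e ⬝ᵥ v x < 0)).card : ℝ)^2) ≤ s i ^ 2 - s i * L e i := by
      intro i
      have hp := hpos e i
      have hn := hneg e i
      have hsum : ((univ.filter (fun x => cl x = i ∧ 0 < a e ⬝ᵥ v x)).card : ℝ)
          + ((univ.filter (fun x => cl x = i ∧ a e ⬝ᵥ v x < 0)).card : ℝ) ≤ s i := by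
        simp only [hs]
        norm_cast
        rw [← Finset.card_union_of_disjoint]
        · refine card_le_card ?_
          intro x hx
          simp at hx ⊢
          tauto
        · rw [Finset.disjoint_filter]
          rintro x - ⟨-, h1⟩ ⟨-, h2⟩
          linarith
      have h1 : (0:ℝ) ≤ ((univ.filter (fun x => cl x = i ∧ 0 < a e ⬝ᵥ v x)).card : ℝ) := by positivity
      have h2 : (0:ℝ) ≤ ((univ.filter (fun x => cl x = i ∧ a e ⬝ᵥ v x < 0)).card : ℝ) := by positivity
      generalize ((univ.filter (fun x => cl x = i ∧ 0 < a e ⬝ᵥ v x)).card : ℝ) = p at *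
      generalize ((univ.filter (fun x => cl x = i ∧ a e ⬝ᵥ v x < 0)).card : ℝ) = q at *
      rcases le_total p q with h | h
      · nlinarith
      · nlinarith
    have := Finset.sum_le_sum (s := univ) fun i _ => hi i
    rw [Finset.sum_sub_distrib, ← hΩ] at this
    linarith
end SplitSec

section Part1Sec
/-- vector of monomials with all exponents `< q`. -/
def ver {d q : ℕ} (x : Fin d → ℝ) : (Fin d → Fin q) → ℝ := fun α => ∏ i, x i ^ (α i : ℕ)

/-- the polynomial with the given coefficient vector. -/
def polyOf {d q : ℕ} (a : (Fin d → Fin q) → ℝ) : MvPolynomial (Fin d) ℝ :=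
  ∑ α, MvPolynomial.C (a α) * ∏ i, MvPolynomial.X i ^ (α i : ℕ)

lemma eval_polyOf {d q : ℕ} (a : (Fin d → Fin q) → ℝ) (x : Fin d → ℝ) :
    MvPolynomial.eval x (polyOf a) = a ⬝ᵥ ver x := by
  simp [polyOf, ver, dotProduct, map_sum, map_prod]

lemma degreeOf_polyOf {d q : ℕ} (hq : 0 < q) (a : (Fin d → Fin q) → ℝ) (j : Fin d) :
    (polyOf a).degreeOf j < q := by
  classical
  have : (polyOf a).degreeOf j ≤ q - 1 := by
    unfold polyOf
    refine (MvPolynomial.degreeOf_sum_le _ _ _).trans ?_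
    refine Finset.sup_le fun α _ => ?_
    refine (MvPolynomial.degreeOf_C_mul_le _ _ _).trans ?_
    refine (MvPolynomial.degreeOf_prod_le _ _ _).trans ?_
    calc ∑ i, MvPolynomial.degreeOf j (MvPolynomial.X i ^ (α i : ℕ) : MvPolynomial (Fin d) ℝ)
        ≤ ∑ i, if i = j then (α i : ℕ) else 0 := by
          refine Finset.sum_le_sum fun i _ => ?_
          refine (MvPolynomial.degreeOf_pow_le _ _ _).trans ?_
          rw [MvPolynomial.degreeOf_X]
          by_cases h : i = j
          · subst h; simp
          · rw [if_neg (fun h' => h h'.symm), if_neg h]; simp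
      _ = α j := by simp
      _ ≤ q - 1 := by omega
  omega

lemma totalDegree_polyOf {d q : ℕ} (a : (Fin d → Fin q) → ℝ) : (polyOf a).totalDegree ≤ d * q := by
  unfold polyOf
  refine MvPolynomial.totalDegree_finsetSum_le fun α _ => ?_
  refine (MvPolynomial.totalDegree_mul _ _).trans ?_
  rw [MvPolynomial.totalDegree_C, zero_add]
  refine (MvPolynomial.totalDegree_finsetProd _ _).trans ?_
  calc ∑ i, (MvPolynomial.X i ^ (α i : ℕ) : MvPolynomial (Fin d) ℝ).totalDegree ≤ ∑ i : Fin d, q := by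
        refine Finset.sum_le_sum fun i _ => ?_
        rw [MvPolynomial.totalDegree_X_pow]
        omega
    _ = d * q := by simp

lemma coeff_polyOf {d q : ℕ} (a : (Fin d → Fin q) → ℝ) (h : polyOf a = 0) : a = 0 := by
  classical
  ext β
  have hm : ∀ α : Fin d → Fin q, (∏ i, MvPolynomial.X i ^ (α i : ℕ) : MvPolynomial (Fin d) ℝ)
      = MvPolynomial.monomial (Finsupp.equivFunOnFinite.symm (fun i => (α i : ℕ))) 1 := by
    intro α
    rw [MvPolynomial.monomial_eq]
    simp [Finsupp.prod_fintype]
  have := congrArg (MvPolynomial.coeff (Finsupp.equivFunOnFinite.symm (fun i => (β i : ℕ)))) h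
  simp only [polyOf, MvPolynomial.coeff_sum, hm, MvPolynomial.coeff_C_mul, MvPolynomial.coeff_monomial,
    MvPolynomial.coeff_zero] at this
  rw [Finset.sum_eq_single β] at this
  · simpa using this
  · intro α _ hne
    rw [if_neg, mul_zero]
    intro h
    apply hne
    ext i
    have := congrArg (fun f => f i) h
    simpa using this
  · simp

lemma grid_det {d q : ℕ} (hq : 0 < q) :
    (Matrix.of (fun k : Fin d → Fin q => (ver (fun i => ((k i : ℕ) : ℝ)) : (Fin d → Fin q) → ℝ))).det ≠ 0 := by
  intro h0
  obtain ⟨a, ha, h⟩ := Matrix.exists_mulVec_eq_zero_iff.mpr h0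
  apply ha
  apply coeff_polyOf
  refine MvPolynomial.eq_zero_of_eval_zero_at_prod_finset (polyOf a)
    (fun _ => (Finset.range q).image (fun n : ℕ => (n : ℝ))) ?_ ?_
  · intro i
    rw [Finset.card_image_of_injective _ Nat.cast_injective, Finset.card_range]
    exact degreeOf_polyOf hq a i
  · intro x hx
    simp only [mem_image, mem_range] at hx
    choose n hn hnx using hx
    have := congrFun h (fun i => ⟨n i, hn i⟩)
    simp only [Matrix.mulVec, Matrix.of_apply, hnx, Pi.zero_apply] at this
    rw [eval_polyOf, dotProduct_comm]
    exact this

/-- general position with respect to monomials with exponents `< q`. -/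
def GenPos {d : ℕ} (q : ℕ) {ι : Type*} (pts : ι → Fin d → ℝ) : Prop :=
  ∀ e : (Fin d → Fin q) → ι, Function.Injective e →
    (Matrix.of (fun k => (ver (pts (e k)) : (Fin d → Fin q) → ℝ))).det ≠ 0

lemma GenPos.comp {d q : ℕ} {ι ι' : Type*} {pts : ι → Fin d → ℝ} (h : GenPos q pts) (f : ι' → ι)
    (hf : Function.Injective f) : GenPos q (pts ∘ f) := fun e he => h (f ∘ e) (hf.comp he)

theorem exists_genPos {d q : ℕ} (hq : 0 < q) {ι : Type*} [Fintype ι] (p : ι → Fin d → ℝ) (η : ℝ)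
    (hη : 0 < η) : ∃ pts : ι → Fin d → ℝ, GenPos q pts ∧ ∀ x i, |pts x i - p x i| < η := by
  classical
  let M : ((Fin d → Fin q) → ι) → Matrix (Fin d → Fin q) (Fin d → Fin q) (MvPolynomial (ι × Fin d) ℝ) :=
    fun e => Matrix.of fun k α => ∏ i, MvPolynomial.X (e k, i) ^ (α i : ℕ)
  have hM : ∀ e (y : ι × Fin d → ℝ), MvPolynomial.eval y (M e).det
      = (Matrix.of (fun k => (ver (fun i => y (e k, i)) : (Fin d → Fin q) → ℝ))).det := by
    intro e y
    rw [RingHom.map_det]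
    congr 1
    ext k α
    simp [M, ver, map_prod]
  let P : MvPolynomial (ι × Fin d) ℝ := ∏ e ∈ univ.filter (fun e : (Fin d → Fin q) → ι => Function.Injective e), (M e).det
  have hP : P ≠ 0 := by
    rw [Finset.prod_ne_zero_iff]
    intro e he h0
    have he : Function.Injective e := (mem_filter.mp he).2
    have hqq : Nonempty (Fin d → Fin q) := ⟨fun _ => ⟨0, hq⟩⟩
    have := hM e (fun z => ((Function.invFun e z.1 z.2 : ℕ) : ℝ))
    rw [h0, map_zero] at this
    simp only [Function.leftInverse_invFun he _] at this
    exact grid_det hq this.symm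
  by_contra hcon
  push Not at hcon
  apply hP
  refine MvPolynomial.funext_set (s := fun z : ι × Fin d => Set.Ioo (p z.1 z.2 - η) (p z.1 z.2 + η))
    (fun z => Set.Ioo_infinite (by linarith)) fun y hy => ?_
  rw [map_zero]
  by_contra hne
  obtain ⟨x, i, hxi⟩ := hcon (fun x i => y (x, i)) (by
    intro e he h0
    apply hne
    simp only [P, map_prod]
    refine Finset.prod_eq_zero (i := e) (by simp [he]) ?_
    rw [hM, h0])
  have := hy (x, i) (Set.mem_univ _)
  simp only [Set.mem_Ioo] at this
  rw [le_abs] at hxi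
  rcases hxi with h | h <;> linarith [this.1, this.2]

/-- in general position a nonzero polynomial vanishes at few points. -/
lemma GenPos.zeros {d q : ℕ} {ι : Type*} [Fintype ι] {pts : ι → Fin d → ℝ}
    (h : GenPos q pts) (a : (Fin d → Fin q) → ℝ) (ha : a ≠ 0) [DecidablePred fun x => MvPolynomial.eval (pts x) (polyOf a) = 0] :
    (univ.filter (fun x => MvPolynomial.eval (pts x) (polyOf a) = 0)).card < q ^ d := by
  classical
  by_contra hcon
  push Not at hcon
  have hc : Fintype.card (Fin d → Fin q) ≤ Fintype.card (univ.filter (fun x => MvPolynomial.eval (pts x) (polyOf a) = 0)) := by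
    simp only [Fintype.card_pi, Fintype.card_fin, Finset.prod_const, Finset.card_univ, Fintype.card_coe]
    exact hcon
  obtain ⟨e⟩ := Function.Embedding.nonempty_of_card_le hc
  apply ha
  refine Matrix.eq_zero_of_mulVec_eq_zero (h (fun k => (e k : ι)) (fun x y hxy => e.injective (Subtype.ext hxy))) ?_
  ext k
  have := (mem_filter.mp (e k).2).2
  rw [eval_polyOf, dotProduct_comm] at this
  exact this
end Part1Sec

section Part2Sec
/-- sign vector of a list of polynomials at a point -/
def sgv {d : ℕ} (l : List (MvPolynomial (Fin d) ℝ)) (x : Fin d → ℝ) : List SignType :=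
  l.map (fun f => SignType.sign (MvPolynomial.eval x f))

lemma part_step {d D : ℕ} (hd : 0 < d) (hD : 0 < D) {ι : Type*} [Fintype ι] [DecidableEq ι]
    (pts : ι → Fin d → ℝ) (hg : GenPos (4 * D) pts) (hm : (4*D)^d * D^d ≤ Fintype.card ι)
    (l : List (MvPolynomial (Fin d) ℝ)) :
    ∃ a : (Fin d → Fin (4 * D)) → ℝ, a ≠ 0 ∧ ∀ B : Finset (List SignType), ∃ B' : Finset (List SignType),
      (∀ σ ∈ B, 0 ∉ σ ∧ Fintype.card ι < (univ.filter (fun x => sgv (polyOf a :: l) (pts x) = σ)).card * D^d) →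
      (∀ σ ∈ B', 0 ∉ σ ∧ Fintype.card ι < (univ.filter (fun x => sgv l (pts x) = σ)).card * D^d) ∧
      32 * ∑ σ ∈ B, ((univ.filter (fun x => sgv (polyOf a :: l) (pts x) = σ)).card : ℝ)^2
      ≤ 31 * ∑ σ ∈ B', ((univ.filter (fun x => sgv l (pts x) = σ)).card : ℝ)^2 := by
  classical
  set q := 4 * D with hq
  have hDd : 0 < D^d := pow_pos hD d
  have hqd : 0 < (4*D)^d := by positivity
  have hmpos : 0 < Fintype.card ι := lt_of_lt_of_le (by positivity) hm
  set G : Finset (List SignType) := (univ.image (fun x => sgv l (pts x))).filter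
    (fun σ => 0 ∉ σ ∧ Fintype.card ι < (univ.filter (fun x => sgv l (pts x) = σ)).card * D^d) with hG
  have hsucc : ∀ (a : (Fin d → Fin q) → ℝ) (B : Finset (List SignType)),
      (∀ σ ∈ B, 0 ∉ σ ∧ Fintype.card ι < (univ.filter (fun x => sgv (polyOf a :: l) (pts x) = σ)).card * D^d) →
      ∑ σ ∈ B, ((univ.filter (fun x => sgv (polyOf a :: l) (pts x) = σ)).card : ℝ)^2 ≤
      ∑ σ ∈ G, (((univ.filter (fun x => sgv l (pts x) = σ ∧ 0 < a ⬝ᵥ ver (pts x))).card : ℝ)^2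
        + ((univ.filter (fun x => sgv l (pts x) = σ ∧ a ⬝ᵥ ver (pts x) < 0)).card : ℝ)^2) := by
    intro a B hB
    have hsub : B ⊆ G.image (fun σ => 1 :: σ) ∪ G.image (fun σ => (-1) :: σ) := by
      intro σ hσ
      obtain ⟨h0, hlt⟩ := hB σ hσ
      have hne : (univ.filter (fun x => sgv (polyOf a :: l) (pts x) = σ)).Nonempty := by
        rw [← card_pos]
        by_contra h
        rw [Nat.eq_zero_of_not_pos h] at hlt
        omega
      obtain ⟨x, hx⟩ := hne
      have hx := (mem_filter.mp hx).2
      have hx' : σ = SignType.sign (MvPolynomial.eval (pts x) (polyOf a)) :: sgv l (pts x) := by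
        rw [← hx]; rfl
      have hGm : sgv l (pts x) ∈ G := by
        rw [hG, mem_filter]
        refine ⟨mem_image_of_mem _ (mem_univ _), ?_, ?_⟩
        · intro h; apply h0; rw [hx']; exact List.mem_cons_of_mem _ h
        · refine lt_of_lt_of_le hlt (Nat.mul_le_mul_right _ (card_le_card ?_))
          intro y hy
          have hy := (mem_filter.mp hy).2
          rw [mem_filter]
          refine ⟨mem_univ _, ?_⟩
          rw [hx'] at hy
          exact (List.cons.inj hy).2
      rw [mem_union, mem_image, mem_image]
      rcases SignType.trichotomy (SignType.sign (MvPolynomial.eval (pts x) (polyOf a))) with h | h | h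
      · right; exact ⟨_, hGm, by rw [hx', h]⟩
      · exfalso; apply h0; rw [hx', h]; exact List.mem_cons_self
      · left; exact ⟨_, hGm, by rw [hx', h]⟩
    refine (Finset.sum_le_sum_of_subset_of_nonneg hsub (fun _ _ _ => sq_nonneg _)).trans ?_
    rw [Finset.sum_union (by
      rw [Finset.disjoint_left]
      intro σ h1 h2
      obtain ⟨τ, -, rfl⟩ := mem_image.mp h1
      obtain ⟨τ', -, h⟩ := mem_image.mp h2
      exact absurd (List.cons.inj h).1 (by decide))]
    rw [Finset.sum_image (fun x _ y _ h => (List.cons.inj h).2),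
      Finset.sum_image (fun x _ y _ h => (List.cons.inj h).2), ← Finset.sum_add_distrib]
    refine le_of_eq (Finset.sum_congr rfl fun σ _ => ?_)
    congr 4
    · ext x
      rw [mem_filter, mem_filter]
      simp only [mem_univ, true_and, sgv, List.map_cons, List.cons.injEq, sign_eq_one_iff, eval_polyOf]
      tauto
    · ext x
      rw [mem_filter, mem_filter]
      simp only [mem_univ, true_and, sgv, List.map_cons, List.cons.injEq, sign_eq_neg_one_iff, eval_polyOf]
      tauto
  have hGprop : ∀ σ ∈ G, 0 ∉ σ ∧ Fintype.card ι < (univ.filter (fun x => sgv l (pts x) = σ)).card * D^d :=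
    fun σ hσ => (mem_filter.mp hσ).2
  suffices ∃ a : (Fin d → Fin q) → ℝ, a ≠ 0 ∧ 
      32 * ∑ σ ∈ G, (((univ.filter (fun x => sgv l (pts x) = σ ∧ 0 < a ⬝ᵥ ver (pts x))).card : ℝ)^2
        + ((univ.filter (fun x => sgv l (pts x) = σ ∧ a ⬝ᵥ ver (pts x) < 0)).card : ℝ)^2) ≤
      31 * ∑ σ ∈ G, ((univ.filter (fun x => sgv l (pts x) = σ)).card : ℝ)^2 by
    obtain ⟨a, ha, h⟩ := this
    refine ⟨a, ha, fun B => ⟨G, fun hB => ⟨hGprop, ?_⟩⟩⟩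
    have := hsucc a B hB
    linarith
  rcases G.eq_empty_or_nonempty with hGe | ⟨σ0, hσ0⟩
  · refine ⟨fun _ => 1, ?_, by simp [hGe]⟩
    intro h
    have := congrFun h (fun _ => ⟨0, by omega⟩)
    simp at this
  -- apply the splitting step
  let ι' := {x : ι // sgv l (pts x) ∈ G}
  let cl : ι' → G := fun x => ⟨sgv l (pts x.1), x.2⟩
  have hcardfib : ∀ (σ : G) (Pr : ι → Prop) [DecidablePred Pr], (univ.filter (fun x : ι' => cl x = σ ∧ Pr x.1)).card
      = (univ.filter (fun x : ι => sgv l (pts x) = σ ∧ Pr x)).card := by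
    intro σ Pr _
    refine Finset.card_bij (fun x _ => x.1) ?_ ?_ ?_
    · intro x hx
      simp only [mem_filter, mem_univ, true_and, cl, Subtype.ext_iff] at hx ⊢
      exact hx
    · intro x _ y _ h; exact Subtype.ext h
    · intro x hx
      simp only [mem_filter, mem_univ, true_and] at hx
      refine ⟨⟨x, by rw [hx.1]; exact σ.2⟩, ?_, rfl⟩
      simp only [mem_filter, mem_univ, true_and, cl, Subtype.ext_iff]
      exact hx
  have hcardfib' : ∀ (σ : G), (univ.filter (fun x : ι' => cl x = σ)).card
      = (univ.filter (fun x : ι => sgv l (pts x) = σ)).card := by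
    intro σ
    have := hcardfib σ (fun _ => True)
    simpa using this
  have hbigσ : ∀ σ ∈ G, (4*D)^d < (univ.filter (fun x => sgv l (pts x) = σ)).card := by
    intro σ hσ
    have := (hGprop σ hσ).2
    exact lt_of_mul_lt_mul_right (lt_of_le_of_lt hm this) (Nat.zero_le _)
  have hcardG : G.card ≤ D^d := by
    have h1 : ∑ σ ∈ G, (univ.filter (fun x => sgv l (pts x) = σ)).card ≤ Fintype.card ι := by
      rw [← Finset.card_biUnion]
      · exact card_le_univ _
      · intro σ _ τ _ hne
        rw [Function.onFun, Finset.disjoint_left]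
        intro x h1 h2
        exact hne ((mem_filter.mp h1).2.symm.trans (mem_filter.mp h2).2)
    have h2 : ∑ σ ∈ G, Fintype.card ι ≤ ∑ σ ∈ G, (univ.filter (fun x => sgv l (pts x) = σ)).card * D^d :=
      Finset.sum_le_sum fun σ hσ => (hGprop σ hσ).2.le
    rw [← Finset.sum_mul, Finset.sum_const, smul_eq_mul] at h2
    have h3 : G.card * Fintype.card ι ≤ D^d * Fintype.card ι := by nlinarith
    exact le_of_mul_le_mul_right h3 hmpos
  have hι' : Nonempty ι' := by
    have : 0 < (univ.filter (fun x => sgv l (pts x) = σ0)).card := lt_of_le_of_lt (Nat.zero_le _) (hbigσ σ0 hσ0)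
    obtain ⟨x, hx⟩ := card_pos.mp this
    exact ⟨⟨x, by rw [(mem_filter.mp hx).2]; exact hσ0⟩⟩
  have hcK : Fintype.card (Fin d → Fin q) = (4*D)^d := by simp [hq]
  obtain ⟨a, ha, h⟩ := split_step (fun x : ι' => (ver (pts x.1) : (Fin d → Fin q) → ℝ))
    (hg.comp (fun x : ι' => x.1) Subtype.val_injective) cl (by
      rw [hcK, Fintype.card_coe, mul_pow]
      have : 4 ≤ 4^d := by
        calc 4 = 4^1 := by norm_num
          _ ≤ 4^d := Nat.pow_le_pow_right (by norm_num) hd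
      exact Nat.mul_le_mul this hcardG)
    (by
      intro x
      rw [hcK, hcardfib']
      exact (hbigσ _ (cl x).2).le)
  refine ⟨a, ha, ?_⟩
  simp only [hcardfib', hcardfib _ (fun x => 0 < a ⬝ᵥ ver (pts x)), hcardfib _ (fun x => a ⬝ᵥ ver (pts x) < 0)] at h
  rw [Finset.sum_coe_sort G (fun σ => (((univ.filter (fun x => sgv l (pts x) = σ ∧ 0 < a ⬝ᵥ ver (pts x))).card : ℝ)^2
        + ((univ.filter (fun x => sgv l (pts x) = σ ∧ a ⬝ᵥ ver (pts x) < 0)).card : ℝ)^2)),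
     Finset.sum_coe_sort G (fun σ => ((univ.filter (fun x => sgv l (pts x) = σ)).card : ℝ)^2)] at h
  exact h

/-- polynomial partitioning for points in general position. -/
theorem partition_generic {d D T : ℕ} (hd : 0 < d) (hD : 0 < D) {ι : Type*} [Fintype ι] [DecidableEq ι]
    (pts : ι → Fin d → ℝ) (hg : GenPos (4 * D) pts) (hm : (4*D)^d * D^d ≤ Fintype.card ι)
    (hT : 31^T * (D^d)^2 ≤ 32^T) :
    ∃ A : List ((Fin d → Fin (4 * D)) → ℝ), A.length = T ∧ (∀ a ∈ A, a ≠ 0) ∧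
      ∀ σ : List SignType, 0 ∉ σ →
        (univ.filter (fun x => sgv (A.map polyOf) (pts x) = σ)).card * D^d ≤ Fintype.card ι := by
  classical
  have key : ∀ n : ℕ, ∃ A : List ((Fin d → Fin (4 * D)) → ℝ), A.length = n ∧ (∀ a ∈ A, a ≠ 0) ∧
      ∀ B : Finset (List SignType), (∀ σ ∈ B, 0 ∉ σ ∧ Fintype.card ι <
        (univ.filter (fun x => sgv (A.map polyOf) (pts x) = σ)).card * D^d) →
      32^n * ∑ σ ∈ B, ((univ.filter (fun x => sgv (A.map polyOf) (pts x) = σ)).card : ℝ)^2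
       ≤ 31^n * (Fintype.card ι : ℝ)^2 := by
    intro n
    induction n with
    | zero =>
      refine ⟨[], rfl, by simp, fun B hB => ?_⟩
      simp only [pow_zero, one_mul, List.map_nil]
      have h1 : ∑ σ ∈ B, (univ.filter (fun x => sgv [] (pts x) = σ)).card ≤ Fintype.card ι := by
        rw [← Finset.card_biUnion]
        · exact card_le_univ _
        · intro σ _ τ _ hne
          rw [Function.onFun, Finset.disjoint_left]
          intro x h1 h2
          exact hne ((mem_filter.mp h1).2.symm.trans (mem_filter.mp h2).2)
      have h2 := Finset.sum_sq_le_sq_sum_of_nonneg (s := B) (f := fun σ => ((univ.filter (fun x => sgv [] (pts x) = σ)).card : ℝ)) (fun _ _ => by positivity)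
      refine h2.trans ?_
      have h3 : (∑ σ ∈ B, ((univ.filter (fun x => sgv [] (pts x) = σ)).card : ℝ)) ≤ Fintype.card ι := by
        exact_mod_cast h1
      exact pow_le_pow_left₀ (Finset.sum_nonneg fun _ _ => by positivity) h3 2
    | succ n ih =>
      obtain ⟨A, hA, hA0, hAB⟩ := ih
      obtain ⟨a, ha, h⟩ := part_step hd hD pts hg hm (A.map polyOf)
      refine ⟨a :: A, by simp [hA], by simpa using ⟨ha, hA0⟩, fun B hB => ?_⟩
      obtain ⟨B', hB'⟩ := h B
      obtain ⟨h1, h2⟩ := hB' hB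
      have h3 := hAB B' h1
      simp only [List.map_cons]
      rw [pow_succ, pow_succ]
      have : (0:ℝ) < 32^n := by positivity
      calc _ = 32^n * (32 * ∑ σ ∈ B, ((univ.filter (fun x => sgv (polyOf a :: A.map polyOf) (pts x) = σ)).card : ℝ)^2) := by ring
        _ ≤ 32^n * (31 * ∑ σ ∈ B', ((univ.filter (fun x => sgv (A.map polyOf) (pts x) = σ)).card : ℝ)^2) :=
          mul_le_mul_of_nonneg_left h2 this.le
        _ = 31 * (32^n * ∑ σ ∈ B', ((univ.filter (fun x => sgv (A.map polyOf) (pts x) = σ)).card : ℝ)^2) := by ring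
        _ ≤ 31 * (31^n * (Fintype.card ι : ℝ)^2) := mul_le_mul_of_nonneg_left h3 (by norm_num)
        _ = _ := by ring
  obtain ⟨A, hA, hA0, hAB⟩ := key T
  refine ⟨A, hA, hA0, fun σ h0 => ?_⟩
  by_contra hcon
  push Not at hcon
  have h := hAB {σ} (by intro τ hτ; rw [mem_singleton] at hτ; subst hτ; exact ⟨h0, hcon⟩)
  rw [Finset.sum_singleton] at h
  have h' : 32^T * (univ.filter (fun x => sgv (A.map polyOf) (pts x) = σ)).card^2 ≤ 31^T * (Fintype.card ι)^2 := by
    exact_mod_cast h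
  set s := (univ.filter (fun x => sgv (A.map polyOf) (pts x) = σ)).card
  have h1 : (Fintype.card ι)^2 < (s * D^d)^2 := Nat.pow_lt_pow_left hcon (by norm_num)
  have h2 : 31^T * (Fintype.card ι)^2 < 31^T * (s * D^d)^2 := Nat.mul_lt_mul_of_pos_left h1 (by positivity)
  have h3 : 31^T * (s * D^d)^2 ≤ 32^T * s^2 := by
    calc _ = 31^T * (D^d)^2 * s^2 := by ring
      _ ≤ _ := Nat.mul_le_mul_right _ hT
  omega
end Part2Sec

section Part3Sec
open Filter Topology
/-- function form of `partition_generic` -/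
theorem partition_fn {d D T : ℕ} (hd : 0 < d) (hD : 0 < D) {ι : Type*} [Fintype ι] [DecidableEq ι]
    (pts : ι → Fin d → ℝ) (hg : GenPos (4 * D) pts) (hm : (4*D)^d * D^d ≤ Fintype.card ι)
    (hT : 31^T * (D^d)^2 ≤ 32^T) :
    ∃ a : Fin T → ((Fin d → Fin (4 * D)) → ℝ), (∀ t, a t ≠ 0) ∧
      ∀ σ : Fin T → SignType, (∀ t, σ t ≠ 0) →
        (univ.filter (fun x => ∀ t, SignType.sign (MvPolynomial.eval (pts x) (polyOf (a t))) = σ t)).card * D^d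
          ≤ Fintype.card ι := by
  classical
  obtain ⟨A, hA, hA0, h⟩ := partition_generic hd hD pts hg hm hT
  subst hA
  refine ⟨fun t => A[t], fun t => hA0 _ (List.getElem_mem _), fun σ hσ => ?_⟩
  have := h (List.ofFn σ) (by
    rw [List.mem_ofFn]
    rintro ⟨t, ht⟩
    exact hσ t ht)
  refine le_of_eq_of_le ?_ this
  congr 2
  ext x
  rw [mem_filter, mem_filter]
  have e : sgv (A.map polyOf) (pts x) = List.ofFn (fun t : Fin A.length =>
      SignType.sign (MvPolynomial.eval (pts x) (polyOf A[t]))) := by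
    unfold sgv
    refine List.ext_getElem (by simp) fun i h1 h2 => ?_
    simp
  rw [e, List.ofFn_inj, funext_iff]

lemma tendsto_eval_polyOf {d q : ℕ} {a : ℕ → (Fin d → Fin q) → ℝ} {b : (Fin d → Fin q) → ℝ}
    {x : ℕ → Fin d → ℝ} {y : Fin d → ℝ} (ha : Tendsto a atTop (𝓝 b)) (hx : Tendsto x atTop (𝓝 y)) :
    Tendsto (fun n => MvPolynomial.eval (x n) (polyOf (a n))) atTop (𝓝 (MvPolynomial.eval y (polyOf b))) := by
  simp only [eval_polyOf, ver, dotProduct]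
  refine tendsto_finsetSum _ fun α _ => ?_
  refine Tendsto.mul ((tendsto_pi_nhds.mp ha) α) ?_
  refine tendsto_finsetProd _ fun i _ => ?_
  exact ((tendsto_pi_nhds.mp hx) i).pow _

lemma polyOf_smul {d q : ℕ} (t : ℝ) (a : (Fin d → Fin q) → ℝ) (x : Fin d → ℝ) :
    MvPolynomial.eval x (polyOf (t • a)) = t * MvPolynomial.eval x (polyOf a) := by
  simp [eval_polyOf, smul_dotProduct]

set_option maxHeartbeats 1000000 in
/-- polynomial partitioning for arbitrary points; points on the zero sets are not controlled. -/
theorem partition_limit {d D T : ℕ} (hd : 0 < d) (hD : 0 < D) {ι : Type*} [Fintype ι] [DecidableEq ι]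
    (p : ι → Fin d → ℝ) (hT : 31^T * (D^d)^2 ≤ 32^T) :
    ∃ a : Fin T → ((Fin d → Fin (4 * D)) → ℝ), (∀ t, a t ≠ 0) ∧
      ∀ σ : Fin T → SignType, (∀ t, σ t ≠ 0) →
        (univ.filter (fun x => ∀ t, SignType.sign (MvPolynomial.eval (p x) (polyOf (a t))) = σ t)).card * D^d
          ≤ Fintype.card ι := by
  classical
  rcases isEmpty_or_nonempty ι with hι | hι
  · refine ⟨fun _ _ => 1, fun t h => ?_, fun σ _ => by simp⟩
    have := congrFun h (fun _ => ⟨0, by omega⟩)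
    simp at this
  obtain ⟨M0, hM0⟩ : ∃ M0, M0 = (4*D)^d * D^d := ⟨_, rfl⟩
  have hM0pos : 0 < M0 := by rw [hM0]; positivity
  have step : ∀ n : ℕ, ∃ (pts : ι × Fin M0 → Fin d → ℝ) (a : Fin T → ((Fin d → Fin (4 * D)) → ℝ)),
      (∀ x i, |pts x i - p x.1 i| < 1 / ((n:ℝ) + 1)) ∧ (∀ t, ‖a t‖ = 1) ∧
      ∀ σ : Fin T → SignType, (∀ t, σ t ≠ 0) →
        (univ.filter (fun x => ∀ t, SignType.sign (MvPolynomial.eval (pts x) (polyOf (a t))) = σ t)).card * D^d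
          ≤ Fintype.card ι * M0 := by
    intro n
    obtain ⟨pts, hg, hclose⟩ := exists_genPos (d := d) (q := 4*D) (by omega) (fun x : ι × Fin M0 => p x.1) (1 / ((n:ℝ)+1)) (by positivity)
    obtain ⟨a, ha, h⟩ := partition_fn hd hD pts hg (by
      rw [Fintype.card_prod, Fintype.card_fin, ← hM0]
      exact Nat.le_mul_of_pos_left _ Fintype.card_pos) hT
    refine ⟨pts, fun t => (‖a t‖)⁻¹ • a t, hclose, fun t => ?_, fun σ hσ => ?_⟩
    · rw [norm_smul, norm_inv, norm_norm, inv_mul_cancel₀ (norm_ne_zero_iff.mpr (ha t))]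
    · have := h σ hσ
      rw [Fintype.card_prod, Fintype.card_fin] at this
      have hs : ∀ x t, SignType.sign (MvPolynomial.eval (pts x) (polyOf ((‖a t‖)⁻¹ • a t)))
          = SignType.sign (MvPolynomial.eval (pts x) (polyOf (a t))) := by
        intro x t
        have hp : 0 < (‖a t‖)⁻¹ := inv_pos.mpr (norm_pos_iff.mpr (ha t))
        rw [polyOf_smul, sign_mul, sign_pos hp, one_mul]
      simp only [hs]
      exact this
  choose pts a hclose hnorm hcell using step
  have hcomp : IsCompact (Set.univ.pi (fun _ : Fin T => Metric.sphere (0 : (Fin d → Fin (4 * D)) → ℝ) 1)) :=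
    isCompact_univ_pi fun _ => isCompact_sphere _ _
  obtain ⟨b, hb, φ, hφ, hlim⟩ := hcomp.tendsto_subseq (x := a) (fun n t _ => by simp [hnorm n t])
  have hptlim : ∀ x, Tendsto (fun n => pts (φ n) x) atTop (𝓝 (p x.1)) := by
    intro x
    rw [tendsto_pi_nhds]
    intro i
    rw [tendsto_iff_dist_tendsto_zero]
    refine squeeze_zero (fun _ => dist_nonneg) (fun n => ?_) 
      (tendsto_one_div_add_atTop_nhds_zero_nat.comp hφ.tendsto_atTop)
    rw [Real.dist_eq]
    exact (hclose (φ n) x i).le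
  refine ⟨b, fun t h0 => ?_, fun σ hσ => ?_⟩
  · have := hb t (Set.mem_univ _)
    rw [h0] at this
    simp at this
  have hev : ∀ᶠ n in atTop, ∀ (x : ι × Fin M0) (t : Fin T),
      SignType.sign (MvPolynomial.eval (p x.1) (polyOf (b t))) = σ t →
      SignType.sign (MvPolynomial.eval (pts (φ n) x) (polyOf (a (φ n) t))) = σ t := by
    rw [eventually_all]; intro x
    rw [eventually_all]; intro t
    have hl : Tendsto (fun n => MvPolynomial.eval (pts (φ n) x) (polyOf (a (φ n) t))) atTop
        (𝓝 (MvPolynomial.eval (p x.1) (polyOf (b t)))) := by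
      have h1 : Tendsto (fun n => a (φ n) t) atTop (𝓝 (b t)) := (tendsto_pi_nhds.mp hlim) t
      exact tendsto_eval_polyOf h1 (hptlim x)
    rcases lt_trichotomy (MvPolynomial.eval (p x.1) (polyOf (b t))) 0 with h | h | h
    · filter_upwards [hl.eventually_lt_const h] with n hn hs
      rw [← hs, sign_neg h, sign_neg hn]
    · refine Eventually.of_forall fun n hs => ?_
      rw [h, sign_zero] at hs
      exact absurd hs.symm (hσ t)
    · filter_upwards [hl.eventually_const_lt h] with n hn hs
      rw [← hs, sign_pos h, sign_pos hn]
  obtain ⟨n, hn⟩ := hev.exists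
  have h := hcell (φ n) σ hσ
  have hsub : (univ.filter (fun x => ∀ t, SignType.sign (MvPolynomial.eval (p x) (polyOf (b t))) = σ t)) ×ˢ
      (univ : Finset (Fin M0)) ⊆ univ.filter (fun x => ∀ t, SignType.sign (MvPolynomial.eval (pts (φ n) x) (polyOf (a (φ n) t))) = σ t) := by
    intro x hx
    rw [mem_product, mem_filter] at hx
    rw [mem_filter]
    exact ⟨mem_univ _, fun t => hn x t (hx.1.2 t)⟩
  have hc := card_le_card hsub
  rw [card_product, card_univ, Fintype.card_fin] at hc
  refine Nat.le_of_mul_le_mul_right (c := M0) ?_ hM0pos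
  calc _ = (univ.filter (fun x => ∀ t, SignType.sign (MvPolynomial.eval (p x) (polyOf (b t))) = σ t)).card * M0 * D^d := by ring
    _ ≤ _ := Nat.mul_le_mul_right _ hc
    _ ≤ _ := h
end Part3Sec

section Iter1Sec
/-- `P` polynomial; the zero-free region -/
def nz {d : ℕ} (P : MvPolynomial (Fin d) ℝ) : Set (Fin d → ℝ) := {z | MvPolynomial.eval z P ≠ 0}

lemma cont_ev {d : ℕ} (P : MvPolynomial (Fin d) ℝ) : Continuous (fun z : Fin d → ℝ => MvPolynomial.eval z P) :=
  MvPolynomial.continuous_eval P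

/-- number of components meeting a finite family, one representative each -/
lemma comp_labels_card {d D : ℕ} (P : MvPolynomial (Fin d) ℝ) (hP : P.totalDegree ≤ D)
    (L : Finset (Set (Fin d → ℝ))) (hL : ∀ l ∈ L, ∃ z ∈ nz P, connectedComponentIn (nz P) z = l) :
    L.card ≤ (D + 4)^d := by
  classical
  choose! r hr hrl using hL
  have hinj : Set.InjOn r L := by
    intro l hl l' hl' h
    rw [← hrl l hl, ← hrl l' hl', h]
  rw [← card_image_of_injOn hinj]
  refine comp_card P hP _ ?_ ?_
  · intro x hx
    obtain ⟨l, hl, rfl⟩ := mem_image.mp hx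
    exact hr l hl
  · intro x hx y hy hxy
    obtain ⟨l, hl, rfl⟩ := mem_image.mp hx
    obtain ⟨l', hl', rfl⟩ := mem_image.mp hy
    have := connectedComponentIn_eq hxy
    have h2 : l = l' := by rw [← hrl l hl, ← hrl l' hl']; exact this
    rw [h2]

lemma sphere_labels_card {D : ℕ} (P : MvPolynomial (Fin 3) ℝ) (hP : P.totalDegree ≤ D)
    (u : Fin 3 → ℝ) (ρ : ℝ) (hρ : 0 < ρ)
    (L : Finset (Set (Fin 3 → ℝ))) (hL : ∀ l ∈ L, ∃ z ∈ nz P, connectedComponentIn (nz P) z = l ∧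
      ∃ y ∈ l, ∑ i, (y i - u i)^2 = ρ) :
    L.card ≤ (2 * D + 4)^2 + 1 := by
  classical
  have hL' : ∀ l ∈ L, ∃ y, MvPolynomial.eval y P ≠ 0 ∧ connectedComponentIn (nz P) y = l ∧ ∑ i, (y i - u i)^2 = ρ := by
    intro l hl
    obtain ⟨z, hz, hzl, y, hy, hyr⟩ := hL l hl
    subst hzl
    exact ⟨y, connectedComponentIn_subset _ _ hy, (connectedComponentIn_eq hy).symm, hyr⟩
  choose! r hr hrl hrs using hL'
  have hinj : Set.InjOn r L := by
    intro l hl l' hl' h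
    rw [← hrl l hl, ← hrl l' hl', h]
  rw [← card_image_of_injOn hinj]
  refine sphere_comp_card P hP u ρ hρ _ ?_ ?_ ?_
  · intro x hx
    obtain ⟨l, hl, rfl⟩ := mem_image.mp hx
    exact hr l hl
  · intro x hx
    obtain ⟨l, hl, rfl⟩ := mem_image.mp hx
    exact hrs l hl
  · intro x hx y hy hxy
    obtain ⟨l, hl, rfl⟩ := mem_image.mp hx
    obtain ⟨l', hl', rfl⟩ := mem_image.mp hy
    have := connectedComponentIn_eq hxy
    have h2 : l = l' := by rw [← hrl l hl, ← hrl l' hl']; exact this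
    rw [h2]

/-- a factor has constant sign on components. -/
lemma sign_const {d : ℕ} (P f : MvPolynomial (Fin d) ℝ) (hf : f ∣ P) (x y : Fin d → ℝ)
    (hy : y ∈ connectedComponentIn (nz P) x) :
    SignType.sign (MvPolynomial.eval y f) = SignType.sign (MvPolynomial.eval x f) := by
  have hx : x ∈ nz P := connectedComponentIn_nonempty_iff.mp ⟨y, hy⟩
  have hpre : IsPreconnected (connectedComponentIn (nz P) x) := isPreconnected_connectedComponentIn
  have hne : ∀ z ∈ connectedComponentIn (nz P) x, MvPolynomial.eval z f ≠ 0 := by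
    intro z hz h0
    have := connectedComponentIn_subset _ _ hz
    obtain ⟨g, rfl⟩ := hf
    apply this
    simp [h0]
  have hxx := mem_connectedComponentIn hx
  have hc := (cont_ev f).continuousOn (s := connectedComponentIn (nz P) x)
  rcases lt_or_gt_of_ne (hne x hxx) with h1 | h1 <;> rcases lt_or_gt_of_ne (hne y hy) with h2 | h2
  · rw [sign_neg h1, sign_neg h2]
  · obtain ⟨z, hz, h0⟩ := hpre.intermediate_value hxx hy hc (show (0:ℝ) ∈ Set.Icc _ _ from ⟨h1.le, h2.le⟩)
    exact absurd h0 (hne z hz)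
  · obtain ⟨z, hz, h0⟩ := hpre.intermediate_value hy hxx hc (show (0:ℝ) ∈ Set.Icc _ _ from ⟨h2.le, h1.le⟩)
    exact absurd h0 (hne z hz)
  · rw [sign_pos h1, sign_pos h2]

/-- shell incidences -/
def shInc {ι υ : Type*} (pts : ι → Fin 3 → ℝ) (c : υ → Fin 3 → ℝ) (δ : ℝ) (x : ι) (u : υ) : Prop :=
  |∑ i, (pts x i - c u i)^2 - 1| < δ

open Classical in
/-- incidences -/
def Inc {ι υ : Type*} (R : ι → υ → Prop) (X : Finset ι) (V : Finset υ) : ℕ :=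
  ∑ u ∈ V, (X.filter (fun x => R x u)).card

open Classical in
theorem inc_step {ι υ : Type*} {D T : ℕ} (hD : 0 < D)
    (hT : 31^T * (D^3)^2 ≤ 32^T) (pts : ι → Fin 3 → ℝ) (hg : GenPos (4 * D) pts) (c : υ → Fin 3 → ℝ)
    (δ : ℝ) (hδ : 0 < δ) (hδ1 : δ < 1) (X : Finset ι) (V : Finset υ)
    (h3 : ∀ x y z, x ≠ y → y ≠ z → x ≠ z →
      (V.filter (fun u => shInc pts c δ x u ∧ shInc pts c δ y u ∧ shInc pts c δ z u)).card ≤ 2)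
    (hX : (4*D)^3 * D^3 ≤ X.card) :
    ∃ (L : Finset (Set (Fin 3 → ℝ))) (XX : Set (Fin 3 → ℝ) → Finset ι) (VV : Set (Fin 3 → ℝ) → Finset υ),
      L.card ≤ (T * (3 * (4*D)) + 4)^3 ∧ (∀ l ∈ L, (XX l).card * D^3 ≤ X.card) ∧
      (∀ l ∈ L, XX l ⊆ X) ∧ (∀ l ∈ L, VV l ⊆ V) ∧
      ∑ l ∈ L, (XX l).card ≤ X.card ∧
      ∑ l ∈ L, (VV l).card ≤ 2 * ((2 * (T * (3 * (4*D))) + 4)^2 + 1) * V.card ∧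
      Inc (shInc pts c δ) X V ≤ ∑ l ∈ L, Inc (shInc pts c δ) (XX l) (VV l) + 2 * X.card
        + (T * (4*D)^3 + 2 * (T * (3 * (4*D)) + 4)^3) * V.card := by
  obtain ⟨a, ha, hcell⟩ := partition_fn (T := T) (by norm_num : 0 < 3) hD (fun x : X => pts x.1)
    (hg.comp (fun x : X => x.1) Subtype.val_injective) (by simpa using hX) hT
  set Q : MvPolynomial (Fin 3) ℝ := ∏ t, polyOf (a t) with hQ
  set D' := T * (3 * (4*D)) with hD'
  have hQd : Q.totalDegree ≤ D' := by
    refine (MvPolynomial.totalDegree_finsetProd _ _).trans ?_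
    refine (Finset.sum_le_sum fun t _ => totalDegree_polyOf (a t)).trans ?_
    simp [hD']
  set lab : ι → Set (Fin 3 → ℝ) := fun x => connectedComponentIn (nz Q) (pts x) with hlab
  set Xs := X.filter (fun x => pts x ∈ nz Q) with hXs
  set L := Xs.image lab with hL
  set XX : Set (Fin 3 → ℝ) → Finset ι := fun l => Xs.filter (fun x => lab x = l) with hXX
  set VV : Set (Fin 3 → ℝ) → Finset υ := fun l => V.filter (fun u =>
    (∃ x ∈ XX l, shInc pts c δ x u) ∧ (∃ x ∈ XX l, ¬ shInc pts c δ x u)) with hVV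
  have hLprop : ∀ l ∈ L, ∃ z ∈ nz Q, connectedComponentIn (nz Q) z = l := by
    intro l hl
    obtain ⟨x, hx, rfl⟩ := mem_image.mp hl
    exact ⟨pts x, (mem_filter.mp hx).2, rfl⟩
  have hLc : L.card ≤ (D' + 4)^3 := comp_labels_card Q hQd L hLprop
  have hXsum : ∑ l ∈ L, (XX l).card = Xs.card := by
    rw [card_eq_sum_card_fiberwise (f := lab) (t := L) (fun x hx => mem_image_of_mem _ hx)]
  have hmemcc : ∀ x ∈ Xs, pts x ∈ lab x := fun x hx => mem_connectedComponentIn (mem_filter.mp hx).2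
  refine ⟨L, XX, VV, hLc, ?_, ?_, ?_, ?_, ?_, ?_⟩
  · -- cell sizes
    intro l hl
    obtain ⟨x0, hx0, rfl⟩ := mem_image.mp hl
    have hne : ∀ t, SignType.sign (MvPolynomial.eval (pts x0) (polyOf (a t))) ≠ 0 := by
      intro t h
      rw [sign_eq_zero_iff] at h
      have := (mem_filter.mp hx0).2
      apply this
      rw [hQ, map_prod]
      exact Finset.prod_eq_zero (mem_univ t) h
    have := hcell _ hne
    rw [Fintype.card_coe] at this
    refine le_trans (Nat.mul_le_mul_right _ ?_) this
    refine Finset.card_le_card_of_injOn (fun x => if h : x ∈ X then ⟨x, h⟩ else ⟨x0, (mem_filter.mp hx0).1⟩) ?_ ?_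
    · intro x hx
      have hx := mem_filter.mp hx
      have hxX : x ∈ X := (mem_filter.mp hx.1).1
      simp only [hxX, dif_pos, coe_filter, mem_univ, true_and, Set.mem_ofPred_eq]
      intro t
      refine sign_const Q _ (Finset.dvd_prod_of_mem _ (mem_univ t)) _ _ ?_
      have h5 : lab x = lab x0 := hx.2
      have := hmemcc x hx.1
      rw [h5] at this
      exact this
    · intro x hx y hy h
      have hxX : x ∈ X := (mem_filter.mp (mem_filter.mp hx).1).1
      have hyX : y ∈ X := (mem_filter.mp (mem_filter.mp hy).1).1
      simpa [hxX, hyX] using h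
  · intro l _ x hx
    exact (mem_filter.mp (mem_filter.mp hx).1).1
  · intro l _; exact filter_subset _ _
  · rw [hXsum]; exact card_le_card (filter_subset _ _)
  · -- partial spheres
    have : ∀ u ∈ V, (L.filter (fun l => u ∈ VV l)).card ≤ 2 * ((2 * D' + 4)^2 + 1) := by
      intro u _
      set f : (Fin 3 → ℝ) → ℝ := fun z => ∑ i, (z i - c u i)^2 with hf
      have hfc : Continuous f := by fun_prop
      have hsub : L.filter (fun l => u ∈ VV l) ⊆ L.filter (fun l => ∃ y ∈ l, f y = 1 + δ) ∪
          L.filter (fun l => ∃ y ∈ l, f y = 1 - δ) := by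
        intro l hl
        obtain ⟨hl, hu⟩ := mem_filter.mp hl
        obtain ⟨-, ⟨x, hx, hxu⟩, ⟨y, hy, hyu⟩⟩ := mem_filter.mp hu
        have hx' := mem_filter.mp hx
        have hy' := mem_filter.mp hy
        have hxl : pts x ∈ l := by rw [← hx'.2]; exact hmemcc x hx'.1
        have hyl : pts y ∈ l := by rw [← hy'.2]; exact hmemcc y hy'.1
        have hpre : IsPreconnected l := by rw [← hx'.2]; exact isPreconnected_connectedComponentIn
        have hxu : |f (pts x) - 1| < δ := hxu
        have hyu : ¬ |f (pts y) - 1| < δ := hyu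
        rw [abs_lt] at hxu
        rw [not_lt, le_abs] at hyu
        rw [mem_union, mem_filter, mem_filter]
        rcases hyu with h | h
        · left
          obtain ⟨z, hz, hzz⟩ := hpre.intermediate_value hxl hyl hfc.continuousOn
            (show 1 + δ ∈ Set.Icc _ _ from ⟨by linarith [hxu.2], by linarith⟩)
          exact ⟨hl, z, hz, hzz⟩
        · right
          obtain ⟨z, hz, hzz⟩ := hpre.intermediate_value hyl hxl hfc.continuousOn
            (show 1 - δ ∈ Set.Icc _ _ from ⟨by linarith, by linarith [hxu.1]⟩)
          exact ⟨hl, z, hz, hzz⟩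
      refine (card_le_card hsub).trans ((card_union_le _ _).trans ?_)
      have h1 := sphere_labels_card Q hQd (c u) (1 + δ) (by linarith) (L.filter (fun l => ∃ y ∈ l, f y = 1 + δ)) (by
        intro l hl
        obtain ⟨hl, hy⟩ := mem_filter.mp hl
        obtain ⟨z, hz, hzl⟩ := hLprop l hl
        exact ⟨z, hz, hzl, hy⟩)
      have h2 := sphere_labels_card Q hQd (c u) (1 - δ) (by linarith) (L.filter (fun l => ∃ y ∈ l, f y = 1 - δ)) (by
        intro l hl
        obtain ⟨hl, hy⟩ := mem_filter.mp hl
        obtain ⟨z, hz, hzl⟩ := hLprop l hl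
        exact ⟨z, hz, hzl, hy⟩)
      omega
    have e : ∑ l ∈ L, (VV l).card = ∑ u ∈ V, (L.filter (fun l => u ∈ VV l)).card := by
      have : ∀ l ∈ L, (VV l).card = (V.filter (fun u => u ∈ VV l)).card := by
        intro l _
        congr 1
        ext u
        simp only [mem_filter]
        exact ⟨fun h => ⟨(mem_filter.mp h).1, h⟩, fun h => h.2⟩
      rw [Finset.sum_congr rfl this]
      simp only [Finset.card_filter]
      rw [Finset.sum_comm]
    rw [e]
    refine (Finset.sum_le_sum this).trans ?_
    rw [Finset.sum_const, smul_eq_mul, mul_comm]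
  · -- incidences
    set R := shInc pts c δ with hR
    set Z := X.filter (fun x => pts x ∉ nz Q) with hZ
    have hZc : Z.card ≤ T * (4*D)^3 := by
      have hsub : Z ⊆ univ.biUnion (fun t : Fin T => X.filter (fun x => MvPolynomial.eval (pts x) (polyOf (a t)) = 0)) := by
        intro x hx
        obtain ⟨hx, hq⟩ := mem_filter.mp hx
        have : MvPolynomial.eval (pts x) Q = 0 := by
          by_contra h; exact hq h
        rw [hQ, map_prod, Finset.prod_eq_zero_iff] at this
        obtain ⟨t, ht, h0⟩ := this
        exact mem_biUnion.mpr ⟨t, ht, mem_filter.mpr ⟨hx, h0⟩⟩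
      refine (card_le_card hsub).trans (card_biUnion_le.trans ?_)
      have : ∀ t : Fin T, (X.filter (fun x => MvPolynomial.eval (pts x) (polyOf (a t)) = 0)).card ≤ (4*D)^3 := by
        intro t
        have := (GenPos.zeros (hg.comp (fun x : X => x.1) Subtype.val_injective) (a t) (ha t)).le
        refine le_trans (le_of_eq ?_) this
        rw [← Finset.card_map (Function.Embedding.subtype _) ]
        congr 1
        ext x
        simp
        tauto
      refine (Finset.sum_le_sum fun t _ => this t).trans ?_
      simp
    have hsplit : ∀ u, (X.filter (fun x => R x u)).card ≤ Z.card + ∑ l ∈ L, ((XX l).filter (fun x => R x u)).card := by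
      intro u
      have h1 : (X.filter (fun x => R x u)) ⊆ Z ∪ L.biUnion (fun l => (XX l).filter (fun x => R x u)) := by
        intro x hx
        obtain ⟨hx, hr⟩ := mem_filter.mp hx
        by_cases h : pts x ∈ nz Q
        · have hxs : x ∈ Xs := mem_filter.mpr ⟨hx, h⟩
          refine mem_union_right _ (mem_biUnion.mpr ⟨lab x, mem_image_of_mem _ hxs, ?_⟩)
          exact mem_filter.mpr ⟨mem_filter.mpr ⟨hxs, rfl⟩, hr⟩
        · exact mem_union_left _ (mem_filter.mpr ⟨hx, h⟩)
      refine (card_le_card h1).trans ((card_union_le _ _).trans ?_)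
      exact Nat.add_le_add_left card_biUnion_le _
    have hl : ∀ l ∈ L, ∑ u ∈ V, ((XX l).filter (fun x => R x u)).card ≤ Inc R (XX l) (VV l) + (2 * (XX l).card + 2 * V.card) := by
      intro l hl
      have hVV' : VV l ⊆ V := filter_subset _ _
      rw [← Finset.sum_sdiff hVV', add_comm]
      refine Nat.add_le_add_left ?_ _
      -- full ones
      set Fu := V.filter (fun u => ∀ x ∈ XX l, R x u) with hFu
      have hz : ∀ u ∈ V \ VV l, ((XX l).filter (fun x => R x u)).card ≤ if u ∈ Fu then (XX l).card else 0 := by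
        intro u hu
        obtain ⟨huV, huVV⟩ := mem_sdiff.mp hu
        split_ifs with h
        · exact card_le_card (filter_subset _ _)
        · rw [Nat.le_zero, card_eq_zero, filter_eq_empty_iff]
          intro x hx hxu
          apply huVV
          refine mem_filter.mpr ⟨huV, ⟨x, hx, hxu⟩, ?_⟩
          by_contra hcon
          push Not at hcon
          exact h (mem_filter.mpr ⟨huV, hcon⟩)
      refine (Finset.sum_le_sum hz).trans ?_
      refine (Finset.sum_le_sum_of_subset (sdiff_subset : V \ VV l ⊆ V)).trans ?_
      rw [← Finset.sum_filter, Finset.sum_const, smul_eq_mul]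
      have hFF : (V.filter (fun u => u ∈ Fu)).card ≤ Fu.card := card_le_card (fun u hu => (mem_filter.mp hu).2)
      rcases Nat.lt_or_ge 2 (XX l).card with h | h
      · obtain ⟨x, hx, y, hy, z, hz, hxy, hxz, hyz⟩ := two_lt_card.mp h
        have h2 := h3 x y z hxy hyz hxz
        have : Fu ⊆ V.filter (fun u => R x u ∧ R y u ∧ R z u) := by
          intro u hu
          obtain ⟨hu, hall⟩ := mem_filter.mp hu
          exact mem_filter.mpr ⟨hu, hall x hx, hall y hy, hall z hz⟩
        have h4 := hFF.trans ((card_le_card this).trans h2)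
        exact (Nat.mul_le_mul_right _ h4).trans (Nat.le_add_right _ _)
      · have h5 : Fu.card ≤ V.card := card_le_card (filter_subset _ _)
        have h6 := Nat.mul_le_mul (hFF.trans h5) h
        linarith
    calc Inc R X V ≤ ∑ u ∈ V, (Z.card + ∑ l ∈ L, ((XX l).filter (fun x => R x u)).card) :=
          Finset.sum_le_sum fun u _ => hsplit u
      _ = V.card * Z.card + ∑ l ∈ L, ∑ u ∈ V, ((XX l).filter (fun x => R x u)).card := by
          rw [Finset.sum_add_distrib, Finset.sum_const, smul_eq_mul, Finset.sum_comm]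
      _ ≤ V.card * Z.card + ∑ l ∈ L, (Inc R (XX l) (VV l) + (2 * (XX l).card + 2 * V.card)) :=
          Nat.add_le_add_left (Finset.sum_le_sum hl) _
      _ = V.card * Z.card + (∑ l ∈ L, Inc R (XX l) (VV l) + (2 * Xs.card + L.card * (2 * V.card))) := by
          rw [Finset.sum_add_distrib, Finset.sum_add_distrib, ← Finset.mul_sum, hXsum, Finset.sum_const, smul_eq_mul]
      _ ≤ V.card * (T * (4*D)^3) + (∑ l ∈ L, Inc R (XX l) (VV l) + (2 * X.card + (D' + 4)^3 * (2 * V.card))) := by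
          have := card_le_card (filter_subset (fun x => pts x ∈ nz Q) X)
          have h1 := Nat.mul_le_mul_left V.card hZc
          have h2 := Nat.mul_le_mul_right (2 * V.card) hLc
          have h3 : 2 * Xs.card ≤ 2 * X.card := Nat.mul_le_mul_left _ this
          omega
      _ = _ := by ring
end Iter1Sec

section Iter2Sec
lemma holder_two_thirds {σ : Type*} (L : Finset σ) (v : σ → ℝ) (hv : ∀ l, 0 ≤ v l) :
    ∑ l ∈ L, (v l)^(2/3:ℝ) ≤ (L.card:ℝ)^(1/3:ℝ) * (∑ l ∈ L, v l)^(2/3:ℝ) := by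
  have hpq : (3:ℝ).HolderConjugate (3/2) := by
    rw [Real.holderConjugate_iff]; norm_num
  have := Real.inner_le_Lp_mul_Lq_of_nonneg L hpq (f := fun _ => 1) (g := fun l => (v l)^(2/3:ℝ))
    (fun _ _ => zero_le_one) (fun l _ => Real.rpow_nonneg (hv l) _)
  simp only [one_mul, Real.one_rpow, sum_const, nsmul_eq_mul, mul_one] at this
  refine this.trans (le_of_eq ?_)
  congr 1
  rw [show (1/(3/2):ℝ) = 2/3 by norm_num]
  congr 1
  refine Finset.sum_congr rfl fun l _ => ?_
  rw [← Real.rpow_mul (hv l)]; norm_num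

/-- arithmetic of one step -/
lemma iter_arith {a b c' g1 c1j c2j g c1 c2 c0 K0 L V X j SI S23 SV SX I W : ℝ}
    (ha : 0 ≤ a) (hb : 0 ≤ b) (hc' : 0 ≤ c') (hg1 : 0 ≤ g1) (hc1j : 1 ≤ c1j) (hc2j : 0 ≤ c2j)
    (hc1 : 1 ≤ c1) (hc0 : 0 ≤ c0) (hK0 : 0 ≤ K0) (hj : 0 ≤ j) (hV : 0 ≤ V)
    (hL : L ≤ c2) (hSV : SV ≤ c1 * V) (hSX : SX ≤ X) (h23 : S23 ≤ g * W)
    (hSI : SI ≤ a * g1 * S23 + b * c1j * SV + c' * c2j * L + 2 * j * SX + (c0 + K0) * j * c1j * SV)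
    (hI : I ≤ SI + 2 * X + c0 * V) :
    I ≤ a * (g1 * g) * W + b * (c1j * c1) * V + c' * (c2j * c2) + 2 * (j + 1) * X
      + (c0 + K0) * (j + 1) * (c1j * c1) * V := by
  have h1 : a * g1 * S23 ≤ a * g1 * (g * W) := mul_le_mul_of_nonneg_left h23 (by positivity)
  have h2 : b * c1j * SV ≤ b * c1j * (c1 * V) := mul_le_mul_of_nonneg_left hSV (by positivity)
  have h3 : c' * c2j * L ≤ c' * c2j * c2 := mul_le_mul_of_nonneg_left hL (by positivity)
  have h4 : 2 * j * SX ≤ 2 * j * X := mul_le_mul_of_nonneg_left hSX (by positivity)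
  have h5 : (c0 + K0) * j * c1j * SV ≤ (c0 + K0) * j * c1j * (c1 * V) :=
    mul_le_mul_of_nonneg_left hSV (by positivity)
  have h6 : (1:ℝ) ≤ c1j * c1 := one_le_mul_of_one_le_of_one_le hc1j hc1
  have h7 : c0 * V ≤ (c0 + K0) * V * (c1j * c1) := by
    have : 0 ≤ K0 * V := by positivity
    have h8 : 0 ≤ (c0 + K0) * V := by positivity
    nlinarith
  nlinarith

open Classical in
theorem iter_abs {ι υ σ : Type*} (Rl : ι → υ → Prop) (D K0 c0 c1 c2 : ℕ) (hD : 0 < D) (hc1 : 1 ≤ c1)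
    (step : ∀ (X : Finset ι) (V : Finset υ), K0 ≤ X.card →
      ∃ (L : Finset σ) (XX : σ → Finset ι) (VV : σ → Finset υ),
      L.card ≤ c2 ∧ (∀ l ∈ L, (XX l).card * D^3 ≤ X.card) ∧
      ∑ l ∈ L, (XX l).card ≤ X.card ∧ ∑ l ∈ L, (VV l).card ≤ c1 * V.card ∧
      Inc Rl X V ≤ ∑ l ∈ L, Inc Rl (XX l) (VV l) + 2 * X.card + c0 * V.card)
    (Y : ℕ) (a b c' : ℝ) (ha : 0 ≤ a) (hb : 0 ≤ b) (hc' : 0 ≤ c')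
    (leaf : ∀ (X : Finset ι) (V : Finset υ), X.card ≤ Y →
      (Inc Rl X V : ℝ) ≤ a * (V.card:ℝ)^(2/3:ℝ) + b * V.card + c')
    (j : ℕ) : ∀ (X : Finset ι) (V : Finset υ), X.card ≤ Y * D^(3*j) →
      (Inc Rl X V : ℝ) ≤ a * ((c2:ℝ)^(1/3:ℝ) * (c1:ℝ)^(2/3:ℝ))^j * (V.card:ℝ)^(2/3:ℝ) + b * (c1:ℝ)^j * V.card
        + c' * (c2:ℝ)^j + 2 * j * X.card + ((c0:ℝ) + K0) * j * (c1:ℝ)^j * V.card := by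
  induction j with
  | zero =>
    intro X V hX
    have := leaf X V (by simpa using hX)
    simpa using this
  | succ j ih =>
    intro X V hX
    have hc1' : (1:ℝ) ≤ c1 := by exact_mod_cast hc1
    have hc1j : (1:ℝ) ≤ (c1:ℝ)^j := one_le_pow₀ hc1'
    rcases lt_or_ge X.card K0 with h | h
    · have h1 : Inc Rl X V ≤ V.card * K0 := by
        unfold Inc
        rw [← smul_eq_mul, ← Finset.sum_const]
        exact Finset.sum_le_sum fun u _ => (card_le_card (filter_subset _ _)).trans h.le
      have h2 : (Inc Rl X V : ℝ) ≤ V.card * K0 := by exact_mod_cast h1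
      have h3 : (0:ℝ) ≤ a * ((c2:ℝ)^(1/3:ℝ) * (c1:ℝ)^(2/3:ℝ))^(j+1) * (V.card:ℝ)^(2/3:ℝ) := by positivity
      have h4 : (0:ℝ) ≤ b * (c1:ℝ)^(j+1) * V.card := by positivity
      have h5 : (0:ℝ) ≤ c' * (c2:ℝ)^(j+1) := by positivity
      have h6 : (1:ℝ) ≤ ((j+1:ℕ):ℝ) * (c1:ℝ)^(j+1) := by
        refine one_le_mul_of_one_le_of_one_le (by simp) (one_le_pow₀ hc1')
      have h7 : (0:ℝ) ≤ 2 * ((j+1:ℕ):ℝ) * X.card := by positivity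
      have h8 : ((c0:ℝ) + K0) * V.card ≤ ((c0:ℝ) + K0) * V.card * (((j+1:ℕ):ℝ) * (c1:ℝ)^(j+1)) :=
        le_mul_of_one_le_right (by positivity) h6
      have h9 : (0:ℝ) ≤ c0 * V.card := by positivity
      nlinarith
    · obtain ⟨L, XX, VV, hL, hXl, hSX, hSV, hI⟩ := step X V h
      have hih : ∀ l ∈ L, (Inc Rl (XX l) (VV l) : ℝ) ≤ _ := fun l hl => ih (XX l) (VV l) (by
        have h1 := (hXl l hl).trans hX
        have h2 : Y * D^(3*(j+1)) = (Y * D^(3*j)) * D^3 := by ring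
        rw [h2] at h1
        exact Nat.le_of_mul_le_mul_right h1 (by positivity))
      have hsum := Finset.sum_le_sum hih
      simp only [Finset.sum_add_distrib, ← Finset.mul_sum, Finset.sum_const, nsmul_eq_mul] at hsum
      have hH := holder_two_thirds L (fun l => ((VV l).card : ℝ)) (fun l => by positivity)
      have hSV' : (∑ l ∈ L, ((VV l).card : ℝ)) ≤ c1 * V.card := by exact_mod_cast hSV
      have hSX' : (∑ l ∈ L, ((XX l).card : ℝ)) ≤ X.card := by exact_mod_cast hSX
      have hL' : (L.card:ℝ) ≤ c2 := by exact_mod_cast hL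
      have h23 : ∑ l ∈ L, ((VV l).card:ℝ)^(2/3:ℝ) ≤ ((c2:ℝ)^(1/3:ℝ) * (c1:ℝ)^(2/3:ℝ)) * (V.card:ℝ)^(2/3:ℝ) := by
        refine hH.trans ?_
        rw [mul_assoc, ← Real.mul_rpow (by positivity) (by positivity)]
        gcongr
      have hI' : (Inc Rl X V : ℝ) ≤ (∑ l ∈ L, (Inc Rl (XX l) (VV l) : ℝ)) + 2 * X.card + c0 * V.card := by
        exact_mod_cast hI
      have := iter_arith (g1 := ((c2:ℝ)^(1/3:ℝ) * (c1:ℝ)^(2/3:ℝ))^j) (j := (j:ℝ)) (K0 := (K0:ℝ)) (c2j := (c2:ℝ)^j) ha hb hc' (by positivity) hc1j (by positivity) hc1' (by positivity) (by positivity)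
        (by positivity) (by positivity) hL' hSV' hSX' h23 (hsum.trans (le_of_eq (by ring))) hI'
      refine this.trans (le_of_eq ?_)
      push_cast
      ring

/-- choice of the constant -/
lemma exists_scale (ε : ℝ) (hε : 0 < ε) : ∃ k : ℕ, 0 < k ∧ (1588^3 * (k:ℝ)^3) ≤ ((2:ℝ)^k)^ε := by
  have h1 : (1:ℝ) < 2^ε := Real.one_lt_rpow (by norm_num) hε
  have h := tendsto_pow_const_div_const_pow_of_one_lt 3 h1
  have h2 := (h.eventually (gt_mem_nhds (show (0:ℝ) < 1/1588^3 by norm_num))).and (Filter.eventually_gt_atTop 0)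
  obtain ⟨k, hk, hk0⟩ := h2.exists
  refine ⟨k, hk0, ?_⟩
  rw [← Real.rpow_natCast 2 k, ← Real.rpow_mul (by norm_num), mul_comm (k:ℝ) ε, Real.rpow_mul (by norm_num), Real.rpow_natCast]
  rw [div_lt_iff₀ (by positivity)] at hk
  nlinarith

/-- arithmetic for the final bound -/
lemma fin_arith {q g c1 c2 D A : ℝ} (j : ℕ) {a b c' w v x I : ℝ} (hq : 2 ≤ q) (hD : 1 ≤ D) (hA : 0 ≤ A)
    (hg0 : 0 ≤ g) (hc10 : 0 ≤ c1) (hc20 : 0 ≤ c2)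
    (hg : g ≤ q * D^(7/3:ℝ)) (hc1 : c1 ≤ q * D^2) (hc2 : c2 ≤ q * D^3)
    (ha : 0 ≤ a) (hb : 0 ≤ b) (hc' : 0 ≤ c') (hw : 0 ≤ w) (hv : 0 ≤ v) (hx : 0 ≤ x)
    (hI : I ≤ a * g^j * w + b * c1^j * v + c' * c2^j + 2 * j * x + A * j * c1^j * v) :
    I ≤ (A + 2) * (q^j)^2 * (a * (D^j)^(7/3:ℝ) * w + (b + 1) * (D^j)^2 * v + c' * (D^j)^3 + x) := by
  have hqj : (j:ℝ) ≤ q^j := by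
    have h1 : (j:ℝ) ≤ 2^j := by exact_mod_cast Nat.lt_two_pow_self.le
    exact h1.trans (pow_le_pow_left₀ (by norm_num) hq j)
  have hq1 : 1 ≤ q^j := one_le_pow₀ (by linarith)
  obtain ⟨Q, hQ⟩ : ∃ Q, Q = q^j := ⟨_, rfl⟩
  have e1 : g^j ≤ Q * (D^j)^(7/3:ℝ) := by
    refine (pow_le_pow_left₀ hg0 hg j).trans (le_of_eq ?_)
    rw [mul_pow, hQ, ← Real.rpow_natCast (D^(7/3:ℝ)), ← Real.rpow_natCast D, ← Real.rpow_mul (by linarith),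
      ← Real.rpow_mul (by linarith), mul_comm (7/3:ℝ)]
  have e2 : c1^j ≤ Q * (D^j)^2 := by
    refine (pow_le_pow_left₀ hc10 hc1 j).trans (le_of_eq ?_)
    rw [mul_pow, hQ, ← pow_mul, ← pow_mul, mul_comm j]
  have e3 : c2^j ≤ Q * (D^j)^3 := by
    refine (pow_le_pow_left₀ hc20 hc2 j).trans (le_of_eq ?_)
    rw [mul_pow, hQ, ← pow_mul, ← pow_mul, mul_comm j]
  rw [← hQ] at hqj hq1 ⊢
  have hr : 0 ≤ (D^j)^(7/3:ℝ) := by positivity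
  have hR : 0 ≤ D^j := by positivity
  obtain ⟨R, hRR⟩ : ∃ R, R = D^j := ⟨_, rfl⟩
  obtain ⟨S, hS⟩ : ∃ S, S = (D^j)^(7/3:ℝ) := ⟨_, rfl⟩
  rw [← hS] at hr e1 ⊢
  rw [← hRR] at hR e2 e3 ⊢
  have f1 : a * g^j * w ≤ a * (Q * S) * w := by gcongr
  have f2 : b * c1^j * v ≤ b * (Q * R^2) * v := by gcongr
  have f3 : c' * c2^j ≤ c' * (Q * R^3) := by gcongr
  have f4 : 2 * j * x ≤ 2 * Q * x := by gcongr
  have f5 : A * j * c1^j * v ≤ A * Q * (Q * R^2) * v := by gcongr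
  have hQQ : Q ≤ Q^2 := by nlinarith
  have g1 : a * (Q * S) * w ≤ Q^2 * (a * S * w) := by
    have h0 : 0 ≤ a * S * w := by positivity
    calc a * (Q * S) * w = Q * (a * S * w) := by ring
      _ ≤ _ := mul_le_mul_of_nonneg_right hQQ h0
  have g2 : b * (Q * R^2) * v ≤ Q^2 * (b * R^2 * v) := by
    have h0 : 0 ≤ b * R^2 * v := by positivity
    calc b * (Q * R^2) * v = Q * (b * R^2 * v) := by ring
      _ ≤ _ := mul_le_mul_of_nonneg_right hQQ h0
  have g3 : c' * (Q * R^3) ≤ Q^2 * (c' * R^3) := by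
    have h0 : 0 ≤ c' * R^3 := by positivity
    calc c' * (Q * R^3) = Q * (c' * R^3) := by ring
      _ ≤ _ := mul_le_mul_of_nonneg_right hQQ h0
  have g4 : 2 * Q * x ≤ 2 * (Q^2 * x) := by
    have := mul_le_mul_of_nonneg_right hQQ hx
    linarith
  have p1 : 0 ≤ Q^2 * (a * S * w) := by positivity
  have p2 : 0 ≤ Q^2 * (b * R^2 * v) := by positivity
  have p3 : 0 ≤ Q^2 * (c' * R^3) := by positivity
  have p4 : 0 ≤ Q^2 * x := by positivity
  have p5 : 0 ≤ Q^2 * (R^2 * v) := by positivity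
  have k1 := mul_nonneg hA p1
  have k2 := mul_nonneg hA p2
  have k3 := mul_nonneg hA p3
  have k4 := mul_nonneg hA p4
  have k5 := mul_nonneg hA p5
  have e : (A + 2) * Q^2 * (a * S * w + (b + 1) * R^2 * v + c' * R^3 + x) =
      A * (Q^2 * (a * S * w)) + A * (Q^2 * (b * R^2 * v)) + A * (Q^2 * (c' * R^3)) + A * (Q^2 * x)
      + A * (Q^2 * (R^2 * v)) + 2 * (Q^2 * (a * S * w)) + 2 * (Q^2 * (b * R^2 * v)) + 2 * (Q^2 * (c' * R^3))
      + 2 * (Q^2 * x) + 2 * (Q^2 * (R^2 * v)) := by ring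
  have e5 : A * Q * (Q * R^2) * v = A * (Q^2 * (R^2 * v)) := by ring
  rw [e]
  linarith
end Iter2Sec

section Iter3Sec
/-- unit distance -/
def ud (x u : Fin 3 → ℝ) : Prop := ∑ i, (x i - u i)^2 = 1

lemma ud_comm {x u : Fin 3 → ℝ} : ud x u ↔ ud u x := by
  unfold ud
  have : ∑ i, (x i - u i)^2 = ∑ i, (u i - x i)^2 := Finset.sum_congr rfl fun i _ => by ring
  rw [this]

lemma three_spheres_aux (x0 x1 x2 y0 y1 y2 z0 z1 z2 : ℝ)
    (h1 : x0^2+x1^2+x2^2 = 1) (h2 : y0^2+y1^2+y2^2 = 1) (h3 : z0^2+z1^2+z2^2=1)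
    (hxy : (y0-x0)^2+(y1-x1)^2+(y2-x2)^2 ≠ 0) (hxz : (z0-x0)^2+(z1-x1)^2+(z2-x2)^2 ≠ 0)
    (hyz : (z0-y0)^2+(z1-y1)^2+(z2-y2)^2 ≠ 0)
    (n0 : (y1-x1)*(z2-x2)-(y2-x2)*(z1-x1) = 0)
    (n1 : (y2-x2)*(z0-x0)-(y0-x0)*(z2-x2) = 0)
    (n2 : (y0-x0)*(z1-x1)-(y1-x1)*(z0-x0) = 0) : False := by
  obtain ⟨e0, he0⟩ : ∃ e, e = y0 - x0 := ⟨_, rfl⟩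
  obtain ⟨e1, he1⟩ : ∃ e, e = y1 - x1 := ⟨_, rfl⟩
  obtain ⟨e2, he2⟩ : ∃ e, e = y2 - x2 := ⟨_, rfl⟩
  obtain ⟨f0, hf0⟩ : ∃ e, e = z0 - x0 := ⟨_, rfl⟩
  obtain ⟨f1, hf1⟩ : ∃ e, e = z1 - x1 := ⟨_, rfl⟩
  obtain ⟨f2, hf2⟩ : ∃ e, e = z2 - x2 := ⟨_, rfl⟩
  obtain rfl : y0 = x0 + e0 := by linarith
  obtain rfl : y1 = x1 + e1 := by linarith
  obtain rfl : y2 = x2 + e2 := by linarith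
  obtain rfl : z0 = x0 + f0 := by linarith
  obtain rfl : z1 = x1 + f1 := by linarith
  obtain rfl : z2 = x2 + f2 := by linarith
  simp only [add_sub_cancel_left] at *
  obtain ⟨t, ht⟩ : ∃ t, t = (e0*f0+e1*f1+e2*f2)/(e0^2+e1^2+e2^2) := ⟨_, rfl⟩
  rw [eq_div_iff hxy] at ht
  have g0 : f0 = t * e0 := by
    apply mul_left_cancel₀ hxy
    linear_combination e2 * n1 - e1 * n2 - e0 * ht
  have g1 : f1 = t * e1 := by
    apply mul_left_cancel₀ hxy
    linear_combination e0 * n2 - e2 * n0 - e1 * ht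
  have g2 : f2 = t * e2 := by
    apply mul_left_cancel₀ hxy
    linear_combination e1 * n0 - e0 * n1 - e2 * ht
  subst g0 g1 g2
  have k1 : 2*(x0*e0+x1*e1+x2*e2) + (e0^2+e1^2+e2^2) = 0 := by linear_combination h2 - h1
  have k2 : t * ((t - 1) * (e0^2+e1^2+e2^2)) = 0 := by linear_combination h3 - h1 - t * k1
  rcases mul_eq_zero.mp k2 with h | h
  · subst h; apply hxz; ring
  · rcases mul_eq_zero.mp h with h | h
    · obtain rfl : t = 1 := by linarith
      apply hyz; ring
    · exact hxy h

lemma ne_sq {x y : Fin 3 → ℝ} (h : x ≠ y) : (y 0 - x 0)^2+(y 1 - x 1)^2+(y 2 - x 2)^2 ≠ 0 := by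
  intro h0
  apply h
  funext i
  fin_cases i <;> simp <;> nlinarith [sq_nonneg (y 0 - x 0), sq_nonneg (y 1 - x 1), sq_nonneg (y 2 - x 2)]

lemma par3 (e0 e1 e2 f0 f1 f2 p0 p1 p2 q0 q1 q2 : ℝ) (o1 : e0*p0+e1*p1+e2*p2 = 0)
    (o2 : f0*p0+f1*p1+f2*p2 = 0) (o3 : e0*q0+e1*q1+e2*q2 = 0) (o4 : f0*q0+f1*q1+f2*q2 = 0)
    (hne : ¬ (e1*f2-e2*f1 = 0 ∧ e2*f0-e0*f2 = 0 ∧ e0*f1-e1*f0=0)) (r : ℝ)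
    (hr : r = p1*q2-p2*q1 ∨ r = p2*q0-p0*q2 ∨ r = p0*q1-p1*q0) : r = 0 := by
  obtain ⟨n0, hn0⟩ : ∃ n, n = e1*f2-e2*f1 := ⟨_, rfl⟩
  obtain ⟨n1, hn1⟩ : ∃ n, n = e2*f0-e0*f2 := ⟨_, rfl⟩
  obtain ⟨n2, hn2⟩ : ∃ n, n = e0*f1-e1*f0 := ⟨_, rfl⟩
  have m0 : n1*p2-n2*p1 = 0 := by rw [hn1, hn2]; linear_combination f0 * o1 - e0 * o2
  have m1 : n2*p0-n0*p2 = 0 := by rw [hn0, hn2]; linear_combination f1 * o1 - e1 * o2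
  have m2 : n0*p1-n1*p0 = 0 := by rw [hn0, hn1]; linear_combination f2 * o1 - e2 * o2
  have k0 : n1*q2-n2*q1 = 0 := by rw [hn1, hn2]; linear_combination f0 * o3 - e0 * o4
  have k1 : n2*q0-n0*q2 = 0 := by rw [hn0, hn2]; linear_combination f1 * o3 - e1 * o4
  have k2 : n0*q1-n1*q0 = 0 := by rw [hn0, hn1]; linear_combination f2 * o3 - e2 * o4
  rw [← hn0, ← hn1, ← hn2] at hne
  have hn : n0^2+n1^2+n2^2 ≠ 0 := by
    intro h
    apply hne
    refine ⟨?_, ?_, ?_⟩ <;> nlinarith [sq_nonneg n0, sq_nonneg n1, sq_nonneg n2]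
  apply (mul_eq_zero.mp (?_ : (n0^2+n1^2+n2^2) * r = 0)).resolve_left hn
  rcases hr with rfl | rfl | rfl
  · linear_combination (n0*p0+n1*p1+n2*p2)*k0 - ((n2*m0-n0*m2)*q2 - (n0*m1-n1*m0)*q1)
  · linear_combination (n0*p0+n1*p1+n2*p2)*k1 - ((n0*m1-n1*m0)*q0 - (n1*m2-n2*m1)*q2)
  · linear_combination (n0*p0+n1*p1+n2*p2)*k2 - ((n1*m2-n2*m1)*q1 - (n2*m0-n0*m2)*q0)

lemma three_spheres (x y z : Fin 3 → ℝ) (hxy : x ≠ y) (hyz : y ≠ z) (hxz : x ≠ z)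
    (u v w : Fin 3 → ℝ) (huv : u ≠ v) (hvw : v ≠ w) (huw : u ≠ w)
    (hx : ud x u ∧ ud x v ∧ ud x w) (hy : ud y u ∧ ud y v ∧ ud y w) (hz : ud z u ∧ ud z v ∧ ud z w) : False := by
  unfold ud at *
  simp only [Fin.sum_univ_three] at *
  obtain ⟨xu, xv, xw⟩ := hx
  obtain ⟨yu, yv, yw⟩ := hy
  obtain ⟨zu, zv, zw⟩ := hz
  have A := ne_sq huv
  have B := ne_sq hvw
  have Cc := ne_sq huw
  have D1 := ne_sq hxy
  have D2 := ne_sq hyz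
  have D3 := ne_sq hxz
  -- v - u and w - u are parallel to n
  refine three_spheres_aux (u 0 - x 0) (u 1 - x 1) (u 2 - x 2) (v 0 - x 0) (v 1 - x 1) (v 2 - x 2)
    (w 0 - x 0) (w 1 - x 1) (w 2 - x 2) (by linarith) (by linarith) (by linarith)
    (by simpa using A) (by simpa using Cc) (by simpa using B) ?_ ?_ ?_
  all_goals
    simp only [sub_sub_sub_cancel_right]
    have hne := three_spheres_aux (x 0 - u 0) (x 1 - u 1) (x 2 - u 2) (y 0 - u 0) (y 1 - u 1) (y 2 - u 2)
      (z 0 - u 0) (z 1 - u 1) (z 2 - u 2) xu yu zu (by simpa using D1) (by simpa using D3) (by simpa using D2)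
    simp only [sub_sub_sub_cancel_right] at hne
    obtain ⟨e0, he0⟩ : ∃ e, e = y 0 - x 0 := ⟨_, rfl⟩
    obtain ⟨e1, he1⟩ : ∃ e, e = y 1 - x 1 := ⟨_, rfl⟩
    obtain ⟨e2, he2⟩ : ∃ e, e = y 2 - x 2 := ⟨_, rfl⟩
    obtain ⟨f0, hf0⟩ : ∃ e, e = z 0 - x 0 := ⟨_, rfl⟩
    obtain ⟨f1, hf1⟩ : ∃ e, e = z 1 - x 1 := ⟨_, rfl⟩
    obtain ⟨f2, hf2⟩ : ∃ e, e = z 2 - x 2 := ⟨_, rfl⟩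
    obtain ⟨p0, hp0⟩ : ∃ e, e = v 0 - u 0 := ⟨_, rfl⟩
    obtain ⟨p1, hp1⟩ : ∃ e, e = v 1 - u 1 := ⟨_, rfl⟩
    obtain ⟨p2, hp2⟩ : ∃ e, e = v 2 - u 2 := ⟨_, rfl⟩
    obtain ⟨q0, hq0⟩ : ∃ e, e = w 0 - u 0 := ⟨_, rfl⟩
    obtain ⟨q1, hq1⟩ : ∃ e, e = w 1 - u 1 := ⟨_, rfl⟩
    obtain ⟨q2, hq2⟩ : ∃ e, e = w 2 - u 2 := ⟨_, rfl⟩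
    have o1 : e0*p0+e1*p1+e2*p2 = 0 := by subst_vars; linarith
    have o2 : f0*p0+f1*p1+f2*p2 = 0 := by subst_vars; linarith
    have o3 : e0*q0+e1*q1+e2*q2 = 0 := by subst_vars; linarith
    have o4 : f0*q0+f1*q1+f2*q2 = 0 := by subst_vars; linarith
    refine par3 e0 e1 e2 f0 f1 f2 p0 p1 p2 q0 q1 q2 o1 o2 o3 o4 ?_ _ ?_
    · rintro ⟨a1, a2, a3⟩
      subst_vars
      exact hne a1 a2 a3
    · subst_vars; simp

open Classical in
lemma Inc_map {ι υ α β : Type*} (R : α → β → Prop) (f : ι ↪ α) (g : υ ↪ β) (X : Finset ι) (V : Finset υ) :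
    Inc R (X.map f) (V.map g) = Inc (fun x u => R (f x) (g u)) X V := by
  unfold Inc
  rw [Finset.sum_map]
  refine Finset.sum_congr rfl fun u _ => ?_
  rw [Finset.filter_map, Finset.card_map]
  rfl

open Filter Topology in
lemma exists_perturb (P U : Finset (Fin 3 → ℝ)) : ∃ δ η : ℝ, 0 < δ ∧ δ < 1 ∧ 0 < η ∧
    ∀ x ∈ P, ∀ u ∈ U, ∀ y : Fin 3 → ℝ, (∀ i, |y i - x i| < η) →
      (|∑ i, (y i - u i)^2 - 1| < δ ↔ ud x u) := by
  have h1 : ∀ᶠ δ in 𝓝[>] (0:ℝ), ∀ x ∈ P, ∀ u ∈ U, ¬ ud x u → 2 * δ ≤ |∑ i, (x i - u i)^2 - 1| := by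
    rw [Filter.eventually_all_finset]
    intro x _
    rw [Filter.eventually_all_finset]
    intro u _
    by_cases h : ud x u
    · simp [h]
    · have h0 : 0 < |∑ i, (x i - u i)^2 - 1| := abs_pos.mpr (sub_ne_zero.mpr h)
      filter_upwards [Ioo_mem_nhdsGT (show (0:ℝ) < |∑ i, (x i - u i)^2 - 1|/2 by linarith)] with δ hδ _
      linarith [hδ.2]
  obtain ⟨δ, ⟨h2, hδ⟩⟩ := (h1.and (Ioo_mem_nhdsGT (show (0:ℝ) < 1 by norm_num))).exists
  have h3 : ∀ᶠ η in 𝓝[>] (0:ℝ), ∀ x ∈ P, ∀ u ∈ U, ∀ y : Fin 3 → ℝ, (∀ i, |y i - x i| < η) →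
      |∑ i, (y i - u i)^2 - ∑ i, (x i - u i)^2| < δ := by
    rw [Filter.eventually_all_finset]
    intro x _
    rw [Filter.eventually_all_finset]
    intro u _
    have hc : Continuous (fun y : Fin 3 → ℝ => ∑ i, (y i - u i)^2) := by fun_prop
    obtain ⟨η0, hη0, h⟩ := Metric.continuous_iff.mp hc x δ hδ.1
    filter_upwards [Ioo_mem_nhdsGT hη0] with η hη y hy
    refine h y ((dist_pi_lt_iff hη0).mpr fun i => ?_)
    rw [Real.dist_eq]
    exact (hy i).trans hη.2
  obtain ⟨η, h4, hη⟩ := (h3.and self_mem_nhdsWithin).exists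
  refine ⟨δ, η, hδ.1, hδ.2, hη, fun x hx u hu y hy => ?_⟩
  have h5 := h4 x hx u hu y hy
  constructor
  · intro h
    by_contra hn
    have h6 := h2 x hx u hu hn
    have h7 := abs_sub_abs_le_abs_sub (∑ i, (x i - u i)^2 - 1) (∑ i, (y i - u i)^2 - 1)
    rw [abs_sub_comm] at h5
    have h8 : ∑ i, (x i - u i)^2 - 1 - (∑ i, (y i - u i)^2 - 1) = ∑ i, (x i - u i)^2 - ∑ i, (y i - u i)^2 := by ring
    rw [h8] at h7
    linarith
  · intro h
    unfold ud at h
    rw [h] at h5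
    exact h5

open Classical in
theorem sphere_iter (ε : ℝ) (hε : 0 < ε) : ∃ D : ℕ, 2 ≤ D ∧ ∃ C : ℝ, 0 < C ∧
    ∀ (P U : Finset (Fin 3 → ℝ)) (Y j : ℕ), P.card ≤ Y * D^(3*j) → ∀ (a b c' : ℝ), 0 ≤ a → 0 ≤ b → 0 ≤ c' →
    (∀ P0 ⊆ P, ∀ U0 ⊆ U, P0.card ≤ Y →
      (Inc ud P0 U0 : ℝ) ≤ a * (U0.card:ℝ)^(2/3:ℝ) + b * U0.card + c') →
    (Inc ud P U : ℝ) ≤ C * ((D:ℝ)^j)^ε *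
      (a * ((D:ℝ)^j)^(7/3:ℝ) * (U.card:ℝ)^(2/3:ℝ) + (b+1) * ((D:ℝ)^j)^2 * U.card + c' * ((D:ℝ)^j)^3 + P.card) := by
  obtain ⟨k, hk0, hk⟩ := exists_scale (ε/2) (by positivity)
  obtain ⟨D, hD⟩ : ∃ D, D = 2^k := ⟨_, rfl⟩
  obtain ⟨T, hT⟩ : ∃ T, T = 132 * k := ⟨_, rfl⟩
  have hD2 : 2 ≤ D := by rw [hD]; exact Nat.le_self_pow hk0.ne' 2
  have hTD : 31^T * (D^3)^2 ≤ 32^T := by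
    rw [hT, hD]
    have h1 : 31^22*2 ≤ 32^22 := by norm_num
    calc 31^(132*k) * ((2^k)^3)^2 = (31^22*2)^(6*k) := by rw [mul_pow]; simp only [← pow_mul]; ring_nf
      _ ≤ (32^22)^(6*k) := Nat.pow_le_pow_left h1 _
      _ = 32^(132*k) := by rw [← pow_mul]; ring_nf
  obtain ⟨K0, hK0⟩ : ∃ K, K = (4*D)^3 * D^3 := ⟨_, rfl⟩
  obtain ⟨c0, hc0⟩ : ∃ K, K = T * (4*D)^3 + 2 * (T * (3 * (4*D)) + 4)^3 := ⟨_, rfl⟩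
  obtain ⟨c1, hc1⟩ : ∃ K, K = 2 * ((2 * (T * (3 * (4*D))) + 4)^2 + 1) := ⟨_, rfl⟩
  obtain ⟨c2, hc2⟩ : ∃ K, K = (T * (3 * (4*D)) + 4)^3 := ⟨_, rfl⟩
  refine ⟨D, hD2, (c0 + K0 : ℝ) + 2, by positivity, ?_⟩
  intro P U Y j hP a b c' ha hb hc' leaf
  obtain ⟨δ, η, hδ, hδ1, hη, hpert⟩ := exists_perturb P U
  obtain ⟨pts, hg, hpts⟩ := exists_genPos (d := 3) (q := 4*D) (by omega) (fun x : P => x.1) η hη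
  have hinc : ∀ (x : P) (u : U), shInc pts (fun u : U => u.1) δ x u ↔ ud x.1 u.1 := fun x u =>
    hpert x.1 x.2 u.1 u.2 (pts x) (hpts x)
  have hrel : shInc pts (fun u : U => u.1) δ = fun (x : P) (u : U) => ud x.1 u.1 := by
    funext x u; exact propext (hinc x u)
  have h3 : ∀ V : Finset U, ∀ x y z : P, x ≠ y → y ≠ z → x ≠ z →
      (V.filter (fun u => shInc pts (fun u : U => u.1) δ x u ∧ shInc pts (fun u : U => u.1) δ y u ∧
        shInc pts (fun u : U => u.1) δ z u)).card ≤ 2 := by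
    intro V x y z hxy hyz hxz
    by_contra! h
    obtain ⟨u, hu, v, hv, w, hw, huv, huw, hvw⟩ := two_lt_card.mp h
    simp only [mem_filter, hinc] at hu hv hw
    exact three_spheres x.1 y.1 z.1 (Subtype.coe_injective.ne hxy) (Subtype.coe_injective.ne hyz)
      (Subtype.coe_injective.ne hxz) u.1 v.1 w.1 (Subtype.coe_injective.ne huv)
      (Subtype.coe_injective.ne hvw) (Subtype.coe_injective.ne huw)
      ⟨hu.2.1, hv.2.1, hw.2.1⟩ ⟨hu.2.2.1, hv.2.2.1, hw.2.2.1⟩ ⟨hu.2.2.2, hv.2.2.2, hw.2.2.2⟩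
  have main := iter_abs (σ := Set (Fin 3 → ℝ)) (fun (x : P) (u : U) => ud x.1 u.1) D K0 c0 c1 c2 (by omega)
    (by rw [hc1]; omega) (by
      intro X V hX
      obtain ⟨L, XX, VV, g1, g2, _, _, g5, g6, g7⟩ := inc_step (by omega : 0 < D) hTD pts hg (fun u : U => u.1) δ hδ hδ1 X V
        (h3 V) (by rw [← hK0]; exact hX)
      rw [← hc2] at g1
      rw [← hc1] at g6
      rw [← hc0, hrel] at g7
      exact ⟨L, XX, VV, g1, g2, g5, g6, g7⟩) Y a b c' ha hb hc' (by
      intro X V hX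
      have := leaf (X.map (Function.Embedding.subtype _)) (by intro x hx; simp at hx; exact hx.1)
        (V.map (Function.Embedding.subtype _)) (by intro x hx; simp at hx; exact hx.1) (by simpa using hX)
      rw [Inc_map] at this
      simpa using this) j univ univ (by simpa using hP)
  have hI : Inc (fun (x : P) (u : U) => ud x.1 u.1) univ univ = Inc ud P U := by
    have := Inc_map ud (Function.Embedding.subtype (· ∈ P)) (Function.Embedding.subtype (· ∈ U)) univ univ
    simp only [Function.Embedding.coe_subtype] at this
    rw [← this]
    congr 1
    · ext x; simp
    · ext x; simp
  rw [hI] at main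
  simp only [card_univ, Fintype.card_coe] at main
  obtain ⟨q, hq⟩ : ∃ q : ℝ, q = 1588^3 * (k:ℝ)^3 := ⟨_, rfl⟩
  have hk1 : (1:ℝ) ≤ k := by exact_mod_cast hk0
  have hq2 : 2 ≤ q := by
    have : (1:ℝ) ≤ (k:ℝ)^3 := one_le_pow₀ hk1
    rw [hq]; linarith
  have hD1 : (1:ℝ) ≤ D := by exact_mod_cast (by omega : 1 ≤ D)
  have hkD : (1:ℝ) ≤ k * D := one_le_mul_of_one_le_of_one_le hk1 hD1
  have hd' : ((T * (3 * (4*D)) + 4 : ℕ):ℝ) ≤ 1588 * (k * D) := by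
    rw [hT]; push_cast; linarith
  have hc2' : (c2:ℝ) ≤ q * (D:ℝ)^3 := by
    rw [hc2, Nat.cast_pow]
    refine (pow_le_pow_left₀ (by positivity) hd' 3).trans (le_of_eq ?_)
    rw [hq]; ring
  have hc1' : (c1:ℝ) ≤ q * (D:ℝ)^2 := by
    have h1 : ((2 * (T * (3 * (4*D))) + 4 : ℕ):ℝ) ≤ 3176 * (k * D) := by
      rw [hT]; push_cast; linarith
    have h2 := pow_le_pow_left₀ (by positivity) h1 2
    have h3 : (1:ℝ) ≤ (k * D)^2 := one_le_pow₀ hkD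
    have h4 : (k:ℝ)^2 ≤ k^3 := pow_le_pow_right₀ hk1 (by norm_num)
    have h5 : (k:ℝ)^2 * D^2 ≤ k^3 * D^2 := mul_le_mul_of_nonneg_right h4 (by positivity)
    have h6 : (0:ℝ) ≤ k^3 * D^2 := by positivity
    rw [hc1, Nat.cast_mul, Nat.cast_add, Nat.cast_pow, hq]
    push_cast at h2 ⊢
    calc _ ≤ (2:ℝ) * ((3176 * (k * D))^2 + (k * D)^2) := by linarith
      _ = 2 * (3176^2 + 1) * (k^2 * D^2) := by ring
      _ ≤ 2 * (3176^2 + 1) * (k^3 * D^2) := by linarith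
      _ ≤ 1588^3 * (k^3 * D^2) := by
        apply mul_le_mul_of_nonneg_right _ h6; norm_num
      _ = _ := by ring
  have hgq : (c2:ℝ)^(1/3:ℝ) * (c1:ℝ)^(2/3:ℝ) ≤ q * (D:ℝ)^(7/3:ℝ) := by
    have h1 : (c2:ℝ)^(1/3:ℝ) ≤ (q * (D:ℝ)^3)^(1/3:ℝ) := Real.rpow_le_rpow (by positivity) hc2' (by norm_num)
    have h2 : (c1:ℝ)^(2/3:ℝ) ≤ (q * (D:ℝ)^2)^(2/3:ℝ) := Real.rpow_le_rpow (by positivity) hc1' (by norm_num)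
    refine (mul_le_mul h1 h2 (by positivity) (by positivity)).trans (le_of_eq ?_)
    rw [Real.mul_rpow (by linarith) (by positivity), Real.mul_rpow (by linarith) (by positivity),
      ← Real.rpow_natCast, ← Real.rpow_natCast, ← Real.rpow_mul (by positivity), ← Real.rpow_mul (by positivity)]
    rw [mul_mul_mul_comm, ← Real.rpow_add (by linarith), ← Real.rpow_add (by linarith)]
    norm_num
  have fin := fin_arith (D := (D:ℝ)) (A := (c0 + K0 : ℝ)) j hq2 hD1 (by positivity) (by positivity) (by positivity) (by positivity) hgq hc1' hc2'
    ha hb hc' (by positivity) (by positivity) (by positivity) main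
  refine fin.trans ?_
  have hqj : (q^j)^2 ≤ ((D:ℝ)^j)^ε := by
    have h1 : q ≤ (D:ℝ)^(ε/2) := by
      rw [hq, hD]; push_cast; exact hk
    calc (q^j)^2 ≤ (((D:ℝ)^(ε/2))^j)^2 :=
          pow_le_pow_left₀ (by positivity) (pow_le_pow_left₀ (by linarith) h1 j) 2
      _ = ((D:ℝ)^j)^ε := by
        rw [← pow_mul, ← Real.rpow_natCast, ← Real.rpow_natCast, ← Real.rpow_mul (by positivity), ← Real.rpow_mul (by positivity)]
        congr 1; push_cast; ring
  gcongr
end Iter3Sec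

section Iter4Sec
open Classical in
lemma kst3 {ι υ : Type*} (R : ι → υ → Prop) (X : Finset ι) (V : Finset υ)
    (h3 : ∀ x y z, x ≠ y → y ≠ z → x ≠ z →
      (V.filter (fun u => R x u ∧ R y u ∧ R z u)).card ≤ 2) :
    ∑ u ∈ V, ((X.filter (fun x => R x u)).card - 2)^3 ≤ 2 * X.card^3 := by
  have h1 : ∀ n : ℕ, (n - 2)^3 ≤ 6 * n.choose 3 := by
    intro n
    have := Nat.pow_sub_le_descFactorial n 3
    rw [Nat.descFactorial_eq_factorial_mul_choose] at this
    simpa [Nat.factorial] using this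
  have h2 : 6 * X.card.choose 3 ≤ X.card^3 := by
    have := Nat.descFactorial_le_pow X.card 3
    rw [Nat.descFactorial_eq_factorial_mul_choose] at this
    simpa [Nat.factorial] using this
  have h4 : ∑ u ∈ V, (X.filter (fun x => R x u)).card.choose 3 ≤ X.card.choose 3 * 2 := by
    have h5 : ∀ u ∈ V, (X.filter (fun x => R x u)).card.choose 3 =
        ((powersetCard 3 X).filter (fun t => ∀ x ∈ t, R x u)).card := by
      intro u _
      rw [← card_powersetCard]
      congr 1
      ext t
      rw [mem_filter, mem_powersetCard, mem_powersetCard]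
      constructor
      · rintro ⟨h1, h2⟩
        exact ⟨⟨fun x hx => (mem_filter.mp (h1 hx)).1, h2⟩, fun x hx => (mem_filter.mp (h1 hx)).2⟩
      · rintro ⟨⟨h1, h2⟩, h3⟩
        exact ⟨fun x hx => mem_filter.mpr ⟨h1 hx, h3 x hx⟩, h2⟩
    rw [Finset.sum_congr rfl h5]
    simp only [card_filter]
    rw [Finset.sum_comm, ← card_powersetCard, ← smul_eq_mul, ← Finset.sum_const]
    refine Finset.sum_le_sum fun t ht => ?_
    rw [← card_filter]
    obtain ⟨x, y, z, hxy, hxz, hyz, rfl⟩ := card_eq_three.mp (mem_powersetCard.mp ht).2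
    refine le_trans (card_le_card ?_) (h3 x y z hxy hyz hxz)
    intro u hu
    rw [mem_filter] at hu ⊢
    simpa using hu
  calc _ ≤ ∑ u ∈ V, 6 * (X.filter (fun x => R x u)).card.choose 3 := Finset.sum_le_sum fun u _ => h1 _
    _ = 6 * ∑ u ∈ V, (X.filter (fun x => R x u)).card.choose 3 := by rw [Finset.mul_sum]
    _ ≤ 6 * (X.card.choose 3 * 2) := Nat.mul_le_mul_left _ h4
    _ ≤ 2 * X.card^3 := by linarith

open Classical in
lemma kst3' {ι υ : Type*} (R : ι → υ → Prop) (X : Finset ι) (V : Finset υ)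
    (h3 : ∀ x y z, x ≠ y → y ≠ z → x ≠ z →
      (V.filter (fun u => R x u ∧ R y u ∧ R z u)).card ≤ 2) :
    (Inc R X V : ℝ) ≤ 2 * X.card * (V.card:ℝ)^(2/3:ℝ) + 2 * V.card := by
  have h := kst3 R X V h3
  obtain ⟨S, hS⟩ : ∃ S, S = ∑ u ∈ V, ((X.filter (fun x => R x u)).card - 2) := ⟨_, rfl⟩
  have h1 : Inc R X V ≤ S + 2 * V.card := by
    rw [hS, mul_comm, ← smul_eq_mul, ← Finset.sum_const, ← Finset.sum_add_distrib]
    exact Finset.sum_le_sum fun u _ => by omega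
  have h2 : S^3 ≤ V.card^2 * (2 * X.card^3) := by
    have h5 := pow_sum_le_card_mul_sum_pow (s := V) (f := fun u => (X.filter (fun x => R x u)).card - 2)
      (fun _ _ => Nat.zero_le _) 2
    rw [hS]
    exact h5.trans (Nat.mul_le_mul_left _ h)
  have h3 : (S:ℝ) ≤ 2 * X.card * (V.card:ℝ)^(2/3:ℝ) := by
    have h4 : (S:ℝ)^3 ≤ (2 * X.card * (V.card:ℝ)^(2/3:ℝ))^3 := by
      have h5 : ((V.card:ℝ)^(2/3:ℝ))^3 = (V.card:ℝ)^2 := by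
        rw [← Real.rpow_natCast, ← Real.rpow_mul (by positivity), ← Real.rpow_natCast]; norm_num
      rw [mul_pow, h5]
      have h6 : (S:ℝ)^3 ≤ V.card^2 * (2 * X.card^3) := by exact_mod_cast h2
      have h7 : (0:ℝ) ≤ V.card^2 * X.card^3 := by positivity
      nlinarith
    exact le_of_pow_le_pow_left₀ (by norm_num) (by positivity) h4
  have h4 : (Inc R X V : ℝ) ≤ S + 2 * V.card := by exact_mod_cast h1
  linarith


lemma ud_kst (P U : Finset (Fin 3 → ℝ)) :
    (Inc ud P U : ℝ) ≤ 2 * P.card * (U.card:ℝ)^(2/3:ℝ) + 2 * U.card := by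
  classical
  apply kst3'
  intro x y z hxy hyz hxz
  by_contra! h
  obtain ⟨u, hu, v, hv, w, hw, huv, huw, hvw⟩ := two_lt_card.mp h
  rw [mem_filter] at hu hv hw
  exact three_spheres x y z hxy hyz hxz u v w huv hvw huw
      ⟨hu.2.1, hv.2.1, hw.2.1⟩ ⟨hu.2.2.1, hv.2.2.1, hw.2.2.1⟩ ⟨hu.2.2.2, hv.2.2.2, hw.2.2.2⟩

lemma exists_pow_between (D : ℕ) (hD : 2 ≤ D) (t : ℝ) (ht : 1 ≤ t) :
    ∃ j : ℕ, (D:ℝ)^j ≤ t ∧ t ≤ D * (D:ℝ)^j := by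
  have h1 : (1:ℝ) < D := by exact_mod_cast (by omega : 1 < D)
  obtain ⟨j, h2, h3⟩ := exists_nat_pow_near ht h1
  exact ⟨j, h2, by rw [pow_succ] at h3; linarith⟩

lemma B_arith {m n R D Y : ℝ} (hm : 1 ≤ m) (hn : 1 ≤ n) (hD : 1 ≤ D) (hR : 1 ≤ R) (hY : Y ≤ m / R^3 + 1)
    (h1 : R ≤ (m^3/n)^(1/8:ℝ)) (h2 : (m^3/n)^(1/8:ℝ) ≤ D * R) :
    2 * Y * R^(7/3:ℝ) * n^(2/3:ℝ) + (2+1) * R^2 * n + 0 * R^3 + m ≤ (2 * D + 6) * ((m*n)^(3/4:ℝ) + m + n) := by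
  obtain ⟨x, rfl⟩ : ∃ x, m = Real.exp x := ⟨Real.log m, (Real.exp_log (by linarith)).symm⟩
  obtain ⟨y, rfl⟩ : ∃ x, n = Real.exp x := ⟨Real.log n, (Real.exp_log (by linarith)).symm⟩
  have hρ : (Real.exp x^3/Real.exp y)^(1/8:ℝ) = Real.exp ((3*x-y)/8) := by
    rw [← Real.exp_nat_mul, ← Real.exp_sub, ← Real.exp_mul]; congr 1; push_cast; ring
  rw [hρ] at h1 h2
  have hR0 : 0 < R := by linarith
  have e1 : R^2 ≤ Real.exp ((3*x-y)/8)^2 := pow_le_pow_left₀ hR0.le h1 2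
  have e2 : R^(7/3:ℝ) ≤ Real.exp ((3*x-y)/8)^(7/3:ℝ) := Real.rpow_le_rpow hR0.le h1 (by norm_num)
  have e3 : Real.exp ((3*x-y)/8)^(2/3:ℝ) ≤ D * R^(2/3:ℝ) := by
    refine (Real.rpow_le_rpow (Real.exp_pos _).le h2 (by norm_num)).trans ?_
    rw [Real.mul_rpow (by linarith) hR0.le]
    gcongr
    calc D^(2/3:ℝ) ≤ D^(1:ℝ) := Real.rpow_le_rpow_of_exponent_le hD (by norm_num)
      _ = D := Real.rpow_one D
  rw [← Real.exp_mul] at e2 e3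
  rw [← Real.exp_nat_mul] at e1
  rw [← Real.exp_mul, ← Real.exp_add, ← Real.exp_mul]
  have hR73 : 0 < R^(7/3:ℝ) := by positivity
  have hsplit : R^(7/3:ℝ) * R^(2/3:ℝ) = R^3 := by
    rw [← Real.rpow_add hR0, ← Real.rpow_natCast]; norm_num
  have t1 : Y * R^(7/3:ℝ) * Real.exp (y * (2/3)) ≤
      D * Real.exp ((x+y)*(3/4)) + Real.exp (x*(7/8) + y*(3/8)) := by
    have a1 : Y * R^(7/3:ℝ) ≤ Real.exp x * R^(7/3:ℝ)/R^3 + R^(7/3:ℝ) := by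
      have := mul_le_mul_of_nonneg_right hY hR73.le
      refine this.trans (le_of_eq ?_); ring
    have a2 : Real.exp x * R^(7/3:ℝ)/R^3 ≤ D * Real.exp (x - (3*x-y)/8*(2/3)) := by
      rw [← hsplit, div_le_iff₀ (by positivity)]
      rw [Real.exp_sub]
      have a3 : 1 ≤ D * R^(2/3:ℝ) / Real.exp ((3*x-y)/8*(2/3)) := by rw [le_div_iff₀ (Real.exp_pos _)]; linarith
      calc Real.exp x * R^(7/3:ℝ) = Real.exp x * R^(7/3:ℝ) * 1 := by ring
        _ ≤ Real.exp x * R^(7/3:ℝ) * (D * R^(2/3:ℝ) / Real.exp ((3*x-y)/8*(2/3))) := by gcongr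
        _ = _ := by ring
    calc Y * R^(7/3:ℝ) * Real.exp (y * (2/3)) ≤ (D * Real.exp (x - (3*x-y)/8*(2/3)) + Real.exp ((3*x-y)/8*(7/3))) * Real.exp (y*(2/3)) := by
          gcongr; linarith
      _ = D * (Real.exp (x - (3*x-y)/8*(2/3)) * Real.exp (y*(2/3))) + Real.exp ((3*x-y)/8*(7/3)) * Real.exp (y*(2/3)) := by ring
      _ = _ := by
        rw [← Real.exp_add, ← Real.exp_add]; ring_nf
  have t2 : Real.exp (x*(7/8) + y*(3/8)) ≤ Real.exp ((x+y)*(3/4)) + Real.exp x := by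
    rcases le_total x (3*y) with h | h
    · have : Real.exp (x*(7/8) + y*(3/8)) ≤ Real.exp ((x+y)*(3/4)) := Real.exp_le_exp.mpr (by linarith)
      linarith [Real.exp_pos x]
    · have : Real.exp (x*(7/8) + y*(3/8)) ≤ Real.exp x := Real.exp_le_exp.mpr (by linarith)
      linarith [Real.exp_pos ((x+y)*(3/4))]
  have t3 : R^2 * Real.exp y ≤ Real.exp ((x+y)*(3/4)) := by
    refine (mul_le_mul_of_nonneg_right e1 (Real.exp_pos _).le).trans (le_of_eq ?_)
    rw [← Real.exp_add]; congr 1; push_cast; ring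
  have p1 := Real.exp_pos x
  have p2 := Real.exp_pos y
  have p3 := Real.exp_pos ((x+y)*(3/4))
  have q1 := mul_pos (by linarith : 0 < D) p1
  have q2 := mul_pos (by linarith : 0 < D) p2
  nlinarith

theorem sphere_B (ε : ℝ) (hε : 0 < ε) : ∃ C : ℝ, 0 < C ∧
    ∀ (P U : Finset (Fin 3 → ℝ)), P.Nonempty → U.Nonempty →
    (Inc ud P U : ℝ) ≤ C * (P.card:ℝ)^ε * (((P.card:ℝ) * U.card)^(3/4:ℝ) + P.card + U.card) := by
  obtain ⟨D, hD, C, hC, h⟩ := sphere_iter ε hε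
  refine ⟨C * (2 * D + 6) + 4, by positivity, ?_⟩
  intro P U hP hU
  have hm : (1:ℝ) ≤ P.card := by exact_mod_cast hP.card_pos
  have hn : (1:ℝ) ≤ U.card := by exact_mod_cast hU.card_pos
  obtain ⟨m, hmm⟩ : ∃ m : ℝ, m = P.card := ⟨_, rfl⟩
  obtain ⟨n, hnn⟩ : ∃ m : ℝ, m = U.card := ⟨_, rfl⟩
  have hD1 : (1:ℝ) ≤ D := by exact_mod_cast (by omega : 1 ≤ D)
  have hmε : 1 ≤ m^ε := Real.one_le_rpow (by rw [hmm]; exact hm) hε.le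
  rw [← hmm] at hm ⊢
  rw [← hnn] at hn ⊢
  have hpos : 0 ≤ (m*n)^(3/4:ℝ) := by positivity
  have hS : 0 ≤ (m*n)^(3/4:ℝ) + m + n := by linarith
  rcases le_total n (m^3) with hc | hc
  · obtain ⟨j, hj1, hj2⟩ := exists_pow_between D hD ((m^3/n)^(1/8:ℝ))
      (Real.one_le_rpow ((one_le_div (by linarith)).mpr hc) (by norm_num))
    obtain ⟨R, hR⟩ : ∃ R : ℝ, R = (D:ℝ)^j := ⟨_, rfl⟩
    have hR1 : 1 ≤ R := by rw [hR]; exact one_le_pow₀ hD1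
    obtain ⟨Y, hY⟩ : ∃ Y : ℕ, Y = ⌈m / R^3⌉₊ := ⟨_, rfl⟩
    have hY1 : m / R^3 ≤ Y := by rw [hY]; exact Nat.le_ceil _
    have hY2 : (Y:ℝ) ≤ m / R^3 + 1 := by rw [hY]; exact (Nat.ceil_lt_add_one (by positivity)).le
    have hPY : P.card ≤ Y * D^(3*j) := by
      have : m ≤ Y * R^3 := by rwa [div_le_iff₀ (by positivity)] at hY1
      rw [hmm, hR, ← pow_mul, mul_comm j 3] at this
      exact_mod_cast this
    have key := h P U Y j hPY (2 * Y) 2 0 (by positivity) (by norm_num) le_rfl (by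
      intro P0 _ U0 _ hP0
      have h1 := ud_kst P0 U0
      have h2 : (P0.card:ℝ) ≤ Y := by exact_mod_cast hP0
      have h3 : 2 * (P0.card:ℝ) * (U0.card:ℝ)^(2/3:ℝ) ≤ 2 * Y * (U0.card:ℝ)^(2/3:ℝ) := by gcongr
      linarith)
    rw [← hmm, ← hnn, ← hR] at key
    rw [← hR] at hj1 hj2
    have hB := B_arith hm hn hD1 hR1 hY2 hj1 hj2
    have hRm : R^ε ≤ m^ε := by
      refine Real.rpow_le_rpow (by linarith) (hj1.trans ?_) hε.le
      have h8 : m^3/n ≤ m^3 := div_le_self (by positivity) hn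
      calc (m^3/n)^(1/8:ℝ) ≤ (m^3)^(1/8:ℝ) := Real.rpow_le_rpow (by positivity) h8 (by norm_num)
        _ = m^(3/8:ℝ) := by rw [← Real.rpow_natCast, ← Real.rpow_mul (by linarith)]; norm_num
        _ ≤ m^(1:ℝ) := Real.rpow_le_rpow_of_exponent_le hm (by norm_num)
        _ = m := Real.rpow_one m
    calc (Inc ud P U : ℝ) ≤ _ := key
      _ ≤ C * m^ε * ((2 * D + 6) * ((m*n)^(3/4:ℝ) + m + n)) := by
        refine mul_le_mul (mul_le_mul_of_nonneg_left hRm hC.le) hB ?_ (by positivity)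
        positivity
      _ = (C * (2 * D + 6)) * m^ε * ((m*n)^(3/4:ℝ) + m + n) := by ring
      _ ≤ _ := by gcongr; linarith
  · have h1 := ud_kst P U
    rw [← hmm, ← hnn] at h1
    have h2 : m * n^(2/3:ℝ) ≤ n := by
      have h3 : m ≤ n^(1/3:ℝ) := by
        calc m = (m^3)^(1/3:ℝ) := by rw [← Real.rpow_natCast, ← Real.rpow_mul (by linarith)]; norm_num
          _ ≤ _ := Real.rpow_le_rpow (by positivity) hc (by norm_num)
      calc m * n^(2/3:ℝ) ≤ n^(1/3:ℝ) * n^(2/3:ℝ) := by gcongr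
        _ = n := by rw [← Real.rpow_add (by linarith)]; norm_num
    have h4 : (Inc ud P U : ℝ) ≤ 4 * n := by linarith
    refine h4.trans ?_
    calc 4 * n ≤ 4 * ((m*n)^(3/4:ℝ) + m + n) := by linarith
      _ ≤ (C * (2 * D + 6) + 4) * m^ε * ((m*n)^(3/4:ℝ) + m + n) := by
        apply mul_le_mul_of_nonneg_right _ hS
        have : 0 ≤ C * (2 * D + 6) := by positivity
        nlinarith
end Iter4Sec

section LensSec
lemma div_two_pow_succ (n l : ℕ) : n / 2^(l+1) = n / 2^l / 2 := by
  rw [Nat.div_div_eq_div_mul, pow_succ]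

/-- nested or disjoint pairs of intervals -/
def Nst (a b c d : ℕ) : Prop := (a < c ∧ d < b) ∨ (c < a ∧ b < d)
def Dsj (a b c d : ℕ) : Prop := b < c ∨ d < a

section core
variable {ι : Type*} (lo hi : ι → ℕ)

/-- intervals in a window -/
def win (S : Finset ι) (l w : ℕ) : Finset ι := S.filter (fun x => lo x / 2^l = w ∧ hi x / 2^l = w)

lemma one_child (A : Finset ι) (l w : ℕ) (hA : ∀ x ∈ A, lo x < hi x)
    (hAA : ∀ x ∈ A, ∀ y ∈ A, x ≠ y → Nst (lo x) (hi x) (lo y) (hi y))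
    (hns : ∀ x ∈ win lo hi A (l+1) w, lo x / 2^l = hi x / 2^l) :
    ∃ c, win lo hi A (l+1) w ⊆ win lo hi A l c := by
  rcases (win lo hi A (l+1) w).eq_empty_or_nonempty with h | ⟨x, hx⟩
  · exact ⟨0, by simp [h]⟩
  refine ⟨lo x / 2^l, fun y hy => ?_⟩
  have h1 := hns x hx
  have h2 := hns y hy
  simp only [win, mem_filter, div_two_pow_succ] at hx hy ⊢
  refine ⟨hy.1, ?_⟩
  by_cases hxy : x = y
  · subst hxy; simp [h1]
  have h3 := hAA x hx.1 y hy.1 hxy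
  have m : ∀ {a b : ℕ}, a < b → a / 2^l ≤ b / 2^l := fun h => Nat.div_le_div_right h.le
  rcases h3 with ⟨h3, h4⟩ | ⟨h3, h4⟩
  · have := m h3; have := m h4; omega
  · have := m h3; have := m h4; omega

lemma one_child' (A B : Finset ι) (l w : ℕ) (hA : ∀ x ∈ A, lo x < hi x) (hB : ∀ x ∈ B, lo x < hi x)
    (hAA : ∀ x ∈ A, ∀ y ∈ A, x ≠ y → Nst (lo x) (hi x) (lo y) (hi y))
    (hBB : ∀ x ∈ B, ∀ y ∈ B, x ≠ y → Nst (lo x) (hi x) (lo y) (hi y))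
    (hAB : ∀ x ∈ A, ∀ y ∈ B, Dsj (lo x) (hi x) (lo y) (hi y)) :
    (∃ c, win lo hi A (l+1) w ⊆ win lo hi A l c) ∨ (∃ c, win lo hi B (l+1) w ⊆ win lo hi B l c) := by
  by_cases h : ∀ x ∈ win lo hi A (l+1) w, lo x / 2^l = hi x / 2^l
  · exact Or.inl (one_child lo hi A l w hA hAA h)
  right
  push Not at h
  obtain ⟨x, hx, hne⟩ := h
  apply one_child lo hi B l w hB hBB
  intro y hy
  simp only [win, mem_filter, div_two_pow_succ] at hx hy
  have h3 := hAB x hx.1 y hy.1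
  have m : ∀ {a b : ℕ}, a < b → a / 2^l ≤ b / 2^l := fun h => Nat.div_le_div_right h.le
  have := m (hA x hx.1)
  have := m (hB y hy.1)
  rcases h3 with h3 | h3
  · have := m h3; omega
  · have := m h3; omega

lemma win_min (A B : Finset ι) (δ : ℤ) (hA : ∀ x ∈ A, lo x < hi x) (hB : ∀ x ∈ B, lo x < hi x)
    (hAA : ∀ x ∈ A, ∀ y ∈ A, x ≠ y → Nst (lo x) (hi x) (lo y) (hi y))
    (hBB : ∀ x ∈ B, ∀ y ∈ B, x ≠ y → Nst (lo x) (hi x) (lo y) (hi y))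
    (hAB : ∀ x ∈ A, ∀ y ∈ B, Dsj (lo x) (hi x) (lo y) (hi y)) (l : ℕ) 
    (hδ : ∀ l' < l, ∀ w, |((win lo hi A l' w).card : ℤ) - (win lo hi B l' w).card| ≤ δ) : ∀ w,
    min ((win lo hi A l w).card : ℤ) (win lo hi B l w).card ≤ δ * l := by
  induction l with
  | zero =>
    intro w
    have : win lo hi A 0 w = ∅ := by
      rw [win, filter_eq_empty_iff]
      intro x hx h
      have := hA x hx
      simp at h
      omega
    simp [this]
  | succ l ih =>
    intro w
    have ih' := ih (fun l' hl => hδ l' (by omega))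
    push_cast
    rw [mul_add, mul_one]
    rcases one_child' lo hi A B l w hA hB hAA hBB hAB with ⟨c, hc⟩ | ⟨c, hc⟩
    · have h1 := abs_le.mp (hδ l (by omega) c)
      have h2 := ih' c
      have h3 : ((win lo hi A (l+1) w).card : ℤ) ≤ (win lo hi A l c).card := by exact_mod_cast card_le_card hc
      rw [min_le_iff] at *
      rcases h2 with h2 | h2 <;> left <;> linarith
    · have h1 := abs_le.mp (hδ l (by omega) c)
      have h2 := ih' c
      have h3 : ((win lo hi B (l+1) w).card : ℤ) ≤ (win lo hi B l c).card := by exact_mod_cast card_le_card hc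
      rw [min_le_iff] at *
      rcases h2 with h2 | h2 <;> right <;> linarith

lemma core_bound (A B : Finset ι) (k : ℕ) (hA : ∀ x ∈ A, lo x < hi x) (hB : ∀ x ∈ B, lo x < hi x)
    (hAk : ∀ x ∈ A, hi x < 2^k) (hBk : ∀ x ∈ B, hi x < 2^k)
    (hAA : ∀ x ∈ A, ∀ y ∈ A, x ≠ y → Nst (lo x) (hi x) (lo y) (hi y))
    (hBB : ∀ x ∈ B, ∀ y ∈ B, x ≠ y → Nst (lo x) (hi x) (lo y) (hi y))
    (hAB : ∀ x ∈ A, ∀ y ∈ B, Dsj (lo x) (hi x) (lo y) (hi y)) :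
    ((A.card : ℤ) + B.card)^2 ≤ (2*k+1)^2 * ∑ l ∈ range (k+1), ∑ w ∈ range (2^k),
      (((win lo hi A l w).card : ℤ) - (win lo hi B l w).card)^2 := by
  obtain ⟨S, hS⟩ : ∃ S, S = ∑ l ∈ range (k+1), ∑ w ∈ range (2^k),
      (((win lo hi A l w).card : ℤ) - (win lo hi B l w).card)^2 := ⟨_, rfl⟩
  rw [← hS]
  obtain ⟨p, hp, hmax⟩ := exists_max_image (range (k+1) ×ˢ range (2^k))
    (fun p => |((win lo hi A p.1 p.2).card : ℤ) - (win lo hi B p.1 p.2).card|) ⟨(0,0), by simp⟩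
  obtain ⟨δ, hδ⟩ : ∃ δ, δ = |((win lo hi A p.1 p.2).card : ℤ) - (win lo hi B p.1 p.2).card| := ⟨_, rfl⟩
  rw [← hδ] at hmax
  have hδ0 : 0 ≤ δ := hδ ▸ abs_nonneg _
  have hδS : δ^2 ≤ S := by
    rw [hS, hδ, sq_abs, ← Finset.sum_product']
    exact Finset.single_le_sum (f := fun p : ℕ × ℕ => (((win lo hi A p.1 p.2).card : ℤ) - (win lo hi B p.1 p.2).card)^2)
      (fun _ _ => sq_nonneg _) hp
  have hall : ∀ l ≤ k, ∀ w, |((win lo hi A l w).card : ℤ) - (win lo hi B l w).card| ≤ δ := by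
    intro l hl w
    by_cases hw : w < 2^k
    · exact hmax (l, w) (by simp; omega)
    · have e : ∀ S : Finset ι, (∀ x ∈ S, hi x < 2^k) → win lo hi S l w = ∅ := by
        intro S hS
        rw [win, filter_eq_empty_iff]
        intro x hx h
        have h1 := hS x hx
        have h2 : hi x / 2^l ≤ hi x := Nat.div_le_self _ _
        omega
      rw [e A hAk, e B hBk]
      simpa using hδ0
  have h1 := win_min lo hi A B δ hA hB hAA hBB hAB k (fun l hl => hall l hl.le) 0
  have h2 := abs_le.mp (hall k le_rfl 0)
  have e : ∀ S : Finset ι, (∀ x ∈ S, hi x < 2^k) → (∀ x ∈ S, lo x < hi x) → win lo hi S k 0 = S := by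
    intro S hS hS'
    rw [win, filter_eq_self]
    intro x hx
    have h1 := hS x hx
    have h2 := hS' x hx
    exact ⟨Nat.div_eq_of_lt (by omega), Nat.div_eq_of_lt h1⟩
  rw [e A hAk hA, e B hBk hB] at h1 h2
  have h3 : (A.card : ℤ) + B.card ≤ (2*k+1) * δ := by
    rcases min_le_iff.mp h1 with h | h <;> linarith
  calc ((A.card : ℤ) + B.card)^2 ≤ ((2*k+1) * δ)^2 := pow_le_pow_left₀ (by positivity) h3 2
    _ = (2*k+1)^2 * δ^2 := by ring
    _ ≤ _ := mul_le_mul_of_nonneg_left hδS (by positivity)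

end core

/-- allowed order patterns -/
def Good (u u' v v' : ℕ) : Prop :=
  (u' < v' ∧ v' < v ∧ v < u) ∨ (v' < u' ∧ u' < u ∧ u < v) ∨ (u < v ∧ v < v' ∧ v' < u') ∨ (v < u ∧ u < u' ∧ u' < v') ∨
  (u' < u ∧ v < v' ∧ (u < v ∨ v' < u')) ∨ (u < u' ∧ v' < v ∧ (u' < v' ∨ v < u))

lemma Good.transpose {u u' v v' : ℕ} (h : Good u u' v v') : Good u v u' v' := by
  unfold Good at *; omega

section lens
variable {I J : Type*} [Fintype I] [Fintype J] (E : I → J → Prop) (t : I → J → ℕ)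

open Classical in
/-- edge indicator in a window -/
def eW (l w : ℕ) (f : I) (x : J) : ℤ := if E f x ∧ t f x / 2^l = w then 1 else 0

/-- color -/
def colr (f f' : I) (x : J) : ℤ := if t f' x < t f x then 1 else -1
def ordr (f : I) (x y : J) : ℤ := if t f x < t f y then 1 else -1

def DW (l w : ℕ) (f f' : I) : ℤ := ∑ x, eW E t l w f x * eW E t l w f' x * colr t f f' x

lemma eW_sq (l w : ℕ) (f : I) (x : J) : eW E t l w f x * eW E t l w f x = eW E t l w f x := by
  unfold eW; split_ifs <;> simp

lemma eW_nonneg (l w : ℕ) (f : I) (x : J) : 0 ≤ eW E t l w f x := by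
  unfold eW; split_ifs <;> simp

lemma eW_edge {l w : ℕ} {f : I} {x : J} (h : eW E t l w f x ≠ 0) : E f x := by
  unfold eW at h; split_ifs at h with h1
  · exact h1.1
  · simp at h

open Classical in
lemma DW_sq (h : ∀ f f' x y, f ≠ f' → x ≠ y → E f x → E f' x → E f y → E f' y →
      Good (t f x) (t f' x) (t f y) (t f' y)) (l w : ℕ) (f f' : I) (hf : f ≠ f') :
    (DW E t l w f f')^2 = ∑ x, eW E t l w f x * eW E t l w f' x
      - ∑ x, ∑ y, if x = y then 0 else (eW E t l w f x * eW E t l w f y * ordr t f x y) *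
        (eW E t l w f' x * eW E t l w f' y * ordr t f' x y) := by
  rw [pow_two, DW, Finset.sum_mul_sum, ← Finset.sum_sub_distrib]
  refine Finset.sum_congr rfl fun x _ => ?_
  have : ∀ g : J → ℤ, eW E t l w f x * eW E t l w f' x - ∑ y, g y
      = ∑ y, ((if x = y then eW E t l w f x * eW E t l w f' x else 0) - g y) := by
    intro g; rw [Finset.sum_sub_distrib]; simp
  rw [this]
  refine Finset.sum_congr rfl fun y _ => ?_
  by_cases hxy : x = y
  · subst hxy
    simp only [if_true, sub_zero]
    have hc : colr t f f' x * colr t f f' x = 1 := by unfold colr; split_ifs <;> simp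
    linear_combination (eW E t l w f x * eW E t l w f x * eW E t l w f' x * eW E t l w f' x) * hc
      + eW E t l w f' x * eW E t l w f' x * eW_sq E t l w f x + eW E t l w f x * eW_sq E t l w f' x
  · simp only [if_neg hxy, zero_sub]
    by_cases hz : eW E t l w f x * eW E t l w f' x * eW E t l w f y * eW E t l w f' y = 0
    · linear_combination (colr t f f' x * colr t f f' y + ordr t f x y * ordr t f' x y) * hz
    · have hE : E f x ∧ E f' x ∧ E f y ∧ E f' y := by
        refine ⟨?_, ?_, ?_, ?_⟩ <;> apply eW_edge E t (l := l) (w := w) <;> intro h0 <;> apply hz <;> rw [h0] <;> simp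
      have g := h f f' x y hf hxy hE.1 hE.2.1 hE.2.2.1 hE.2.2.2
      have hc : colr t f f' x * colr t f f' y = - (ordr t f x y * ordr t f' x y) := by
        unfold colr ordr Good at *
        split_ifs <;> first | rfl | (exfalso; omega)
      linear_combination (eW E t l w f x * eW E t l w f' x * eW E t l w f y * eW E t l w f' y) * hc

open Classical in
lemma DW_sum (h : ∀ f f' x y, f ≠ f' → x ≠ y → E f x → E f' x → E f y → E f' y →
      Good (t f x) (t f' x) (t f y) (t f' y)) (l w : ℕ) :
    ∑ f, ∑ f', (if f = f' then 0 else (DW E t l w f f')^2) ≤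
      ∑ x, (∑ f, eW E t l w f x)^2 + ∑ f, (∑ x, eW E t l w f x)^2 := by
  set e := eW E t l w with he
  set G : I → I → ℤ := fun f f' => ∑ x, e f x * e f' x
      - ∑ x, ∑ y, if x = y then 0 else (e f x * e f y * ordr t f x y) *
        (e f' x * e f' y * ordr t f' x y) with hG
  have h1 : ∀ f f', (if f = f' then 0 else (DW E t l w f f')^2) ≤ G f f' + if f = f' then (∑ x, e f x)^2 else 0 := by
    intro f f'
    by_cases hf : f = f'
    · subst hf
      simp only [if_true, hG]
      have h2 : 0 ≤ ∑ x, e f x * e f x := Finset.sum_nonneg fun x _ => mul_self_nonneg _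
      have h3 : ∑ x, ∑ y, (if x = y then 0 else (e f x * e f y * ordr t f x y) *
        (e f x * e f y * ordr t f x y)) ≤ (∑ x, e f x)^2 := by
        rw [pow_two, Finset.sum_mul_sum]
        refine Finset.sum_le_sum fun x _ => Finset.sum_le_sum fun y _ => ?_
        have a1 := eW_nonneg E t l w f x
        have a2 := eW_nonneg E t l w f y
        have a3 := eW_sq E t l w f x
        have a4 := eW_sq E t l w f y
        rw [← he] at a1 a2 a3 a4
        have a5 : ordr t f x y * ordr t f x y = 1 := by unfold ordr; split_ifs <;> simp
        split_ifs
        · positivity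
        · apply le_of_eq
          linear_combination (e f x * e f x * e f y * e f y) * a5 + e f y * e f y * a3 + e f x * a4
      linarith
    · simp only [if_neg hf, add_zero]
      exact (DW_sq E t h l w f f' hf).le
  have h2 : ∑ f, ∑ f', G f f' = ∑ x, (∑ f, e f x)^2 - ∑ x, ∑ y, if x = y then 0 else
      (∑ f, e f x * e f y * ordr t f x y)^2 := by
    simp only [hG, Finset.sum_sub_distrib]
    congr 1
    · simp only [pow_two, Finset.sum_mul_sum]
      calc ∑ f, ∑ f', ∑ x, e f x * e f' x = ∑ f, ∑ x, ∑ f', e f x * e f' x :=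
            Finset.sum_congr rfl fun f _ => Finset.sum_comm
        _ = _ := Finset.sum_comm
    · simp only [pow_two, Finset.sum_mul_sum]
      calc (∑ f, ∑ f', ∑ x, ∑ y, if x = y then (0:ℤ) else (e f x * e f y * ordr t f x y) *
              (e f' x * e f' y * ordr t f' x y))
          = ∑ f, ∑ x, ∑ f', ∑ y, (if x = y then (0:ℤ) else (e f x * e f y * ordr t f x y) *
              (e f' x * e f' y * ordr t f' x y)) := Finset.sum_congr rfl fun f _ => Finset.sum_comm
        _ = ∑ x, ∑ f, ∑ f', ∑ y, (if x = y then (0:ℤ) else (e f x * e f y * ordr t f x y) *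
              (e f' x * e f' y * ordr t f' x y)) := Finset.sum_comm
        _ = ∑ x, ∑ f, ∑ y, ∑ f', (if x = y then (0:ℤ) else (e f x * e f y * ordr t f x y) *
              (e f' x * e f' y * ordr t f' x y)) :=
            Finset.sum_congr rfl fun x _ => Finset.sum_congr rfl fun f _ => Finset.sum_comm
        _ = ∑ x, ∑ y, ∑ f, ∑ f', (if x = y then (0:ℤ) else (e f x * e f y * ordr t f x y) *
              (e f' x * e f' y * ordr t f' x y)) := Finset.sum_congr rfl fun x _ => Finset.sum_comm
        _ = _ := by
            refine Finset.sum_congr rfl fun x _ => Finset.sum_congr rfl fun y _ => ?_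
            split_ifs <;> simp
  have h3 : 0 ≤ ∑ x, ∑ y, if x = y then 0 else (∑ f, e f x * e f y * ordr t f x y)^2 :=
    Finset.sum_nonneg fun x _ => Finset.sum_nonneg fun y _ => by split_ifs <;> positivity
  calc _ ≤ ∑ f, ∑ f', (G f f' + if f = f' then (∑ x, e f x)^2 else 0) :=
        Finset.sum_le_sum fun f _ => Finset.sum_le_sum fun f' _ => h1 f f'
    _ = ∑ f, ∑ f', G f f' + ∑ f, (∑ x, e f x)^2 := by
        simp only [Finset.sum_add_distrib]; simp
    _ ≤ _ := by rw [h2]; linarith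

open Classical in
/-- degrees -/
def degI (f : I) : ℕ := (univ.filter (fun x => E f x)).card
open Classical in
def degJ (x : J) : ℕ := (univ.filter (fun f => E f x)).card
open Classical in
def coI (f f' : I) : ℕ := (univ.filter (fun x => E f x ∧ E f' x)).card

open Classical in
lemma win_sum_sq (l k : ℕ) {α : Type*} [Fintype α] (p : α → Prop) (τ : α → ℕ) :
    ∑ w ∈ range (2^k), (∑ x, if p x ∧ τ x / 2^l = w then (1:ℤ) else 0)^2 ≤ ((univ.filter p).card : ℤ)^2 := by
  refine (Finset.sum_sq_le_sq_sum_of_nonneg ?_).trans ?_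
  · intro w _
    exact Finset.sum_nonneg fun x _ => by split_ifs <;> simp
  · apply pow_le_pow_left₀
    · exact Finset.sum_nonneg fun w _ => Finset.sum_nonneg fun x _ => by split_ifs <;> simp
    · rw [Finset.sum_comm, card_filter]
      push_cast
      refine Finset.sum_le_sum fun x _ => ?_
      by_cases hp : p x
      · simp only [hp, true_and, if_true]
        rw [Finset.sum_ite_eq]
        split_ifs <;> simp
      · simp [hp]

open Classical in
lemma coI_bound (k : ℕ) (htk : ∀ f x, t f x < 2^k) (hI : ∀ f f' x, f ≠ f' → E f x → E f' x → t f x ≠ t f' x)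
    (h : ∀ f f' x y, f ≠ f' → x ≠ y → E f x → E f' x → E f y → E f' y →
      Good (t f x) (t f' x) (t f y) (t f' y)) (f f' : I) (hf : f ≠ f') :
    (coI E f f' : ℤ)^2 ≤ (2*k+1)^2 * ∑ l ∈ range (k+1), ∑ w ∈ range (2^k), (DW E t l w f f')^2 := by
  set A := univ.filter (fun x => (E f x ∧ E f' x) ∧ t f' x < t f x) with hA
  set B := univ.filter (fun x => (E f x ∧ E f' x) ∧ ¬ t f' x < t f x) with hB
  have hcard : coI E f f' = A.card + B.card := by
    have e1 : A = (univ.filter (fun x => E f x ∧ E f' x)).filter (fun x => t f' x < t f x) := by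
      rw [hA, filter_filter]
    have e2 : B = (univ.filter (fun x => E f x ∧ E f' x)).filter (fun x => ¬ t f' x < t f x) := by
      rw [hB, filter_filter]
    rw [coI, e1, e2, card_filter_add_card_filter_not]
  have key := core_bound (fun x => min (t f x) (t f' x)) (fun x => max (t f x) (t f' x)) A B k ?_ ?_ ?_ ?_ ?_ ?_ ?_
  · rw [hcard]; push_cast
    refine key.trans (le_of_eq ?_)
    congr 1
    refine Finset.sum_congr rfl fun l _ => Finset.sum_congr rfl fun w _ => ?_
    congr 1
    rw [win, win, card_filter, card_filter, hA, hB, Finset.sum_filter, Finset.sum_filter]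
    push_cast
    rw [← Finset.sum_sub_distrib, DW]
    refine Finset.sum_congr rfl fun x _ => ?_
    unfold eW colr
    rcases lt_or_ge (t f' x) (t f x) with h1 | h1
    · rw [min_eq_right h1.le, max_eq_left h1.le]
      by_cases h2 : E f x <;> by_cases h3 : E f' x <;> by_cases h4 : t f x / 2^l = w <;> by_cases h5 : t f' x / 2^l = w <;>
        simp [h1, h2, h3, h4, h5]
    · rw [min_eq_left h1, max_eq_right h1]
      by_cases h2 : E f x <;> by_cases h3 : E f' x <;> by_cases h4 : t f x / 2^l = w <;> by_cases h5 : t f' x / 2^l = w <;>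
        simp [h1, not_lt.mpr h1, h2, h3, h4, h5]
  all_goals simp only [hA, hB, mem_filter, mem_univ, true_and]
  · rintro x ⟨h1, h2⟩; simp only [lt_sup_iff, inf_lt_iff]; omega
  · rintro x ⟨h1, h2⟩; have := hI f f' x hf h1.1 h1.2; simp only [lt_sup_iff, inf_lt_iff]; omega
  · rintro x -; exact max_lt (htk _ _) (htk _ _)
  · rintro x -; exact max_lt (htk _ _) (htk _ _)
  · rintro x ⟨h1, h2⟩ y ⟨h3, h4⟩ hxy
    have g := h f f' x y hf hxy h1.1 h1.2 h3.1 h3.2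
    unfold Good at g; unfold Nst
    rw [min_eq_right h2.le, max_eq_left h2.le, min_eq_right h4.le, max_eq_left h4.le]
    omega
  · rintro x ⟨h1, h2⟩ y ⟨h3, h4⟩ hxy
    have g := h f f' x y hf hxy h1.1 h1.2 h3.1 h3.2
    have := hI f f' x hf h1.1 h1.2
    unfold Good at g; unfold Nst
    rw [min_eq_left (not_lt.mp h2), max_eq_right (not_lt.mp h2), min_eq_left (not_lt.mp h4), max_eq_right (not_lt.mp h4)]
    omega
  · rintro x ⟨h1, h2⟩ y ⟨h3, h4⟩
    have hxy : x ≠ y := by rintro rfl; exact h4 h2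
    have g := h f f' x y hf hxy h1.1 h1.2 h3.1 h3.2
    have := hI f f' y hf h3.1 h3.2
    unfold Good at g; unfold Dsj
    rw [min_eq_right h2.le, max_eq_left h2.le, min_eq_left (not_lt.mp h4), max_eq_right (not_lt.mp h4)]
    omega

open Classical in
lemma degJ_eq (x : J) : (degJ E x : ℤ) = ∑ f, if E f x then 1 else 0 := by
  rw [degJ, card_filter]; push_cast; rfl

open Classical in
lemma coI_sum : ∑ f, ∑ f', (coI E f f' : ℤ) = ∑ x, (degJ E x : ℤ)^2 := by
  have : ∀ f f', (coI E f f' : ℤ) = ∑ x, (if E f x then 1 else 0) * (if E f' x then 1 else 0) := by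
    intro f f'
    rw [coI, card_filter]; push_cast
    refine Finset.sum_congr rfl fun x _ => ?_
    by_cases h1 : E f x <;> by_cases h2 : E f' x <;> simp [h1, h2]
  simp only [this, degJ_eq, pow_two, Finset.sum_mul_sum]
  calc _ = ∑ f, ∑ x, ∑ f', (if E f x then (1:ℤ) else 0) * (if E f' x then 1 else 0) :=
            Finset.sum_congr rfl fun f _ => Finset.sum_comm
    _ = _ := Finset.sum_comm

open Classical in
lemma lens_half (k : ℕ) (htk : ∀ f x, t f x < 2^k) (hI : ∀ f f' x, f ≠ f' → E f x → E f' x → t f x ≠ t f' x)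
    (h : ∀ f f' x y, f ≠ f' → x ≠ y → E f x → E f' x → E f y → E f' y →
      Good (t f x) (t f' x) (t f y) (t f' y)) :
    (∑ x, (degJ E x : ℤ)^2 - ∑ f, (degI E f : ℤ))^2 ≤ (Fintype.card I : ℤ)^2 *
      (((2*k+1)^2 * (k+1)) * (∑ f, (degI E f : ℤ)^2 + ∑ x, (degJ E x : ℤ)^2)) := by
  have h1 : ∑ x, (degJ E x : ℤ)^2 - ∑ f, (degI E f : ℤ) = ∑ f, ∑ f', if f = f' then 0 else (coI E f f' : ℤ) := by
    rw [← coI_sum, ← Finset.sum_sub_distrib]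
    refine Finset.sum_congr rfl fun f _ => ?_
    have : (degI E f : ℤ) = ∑ f', if f = f' then (coI E f f' : ℤ) else 0 := by
      rw [Finset.sum_ite_eq]; simp [degI, coI]
    rw [this, ← Finset.sum_sub_distrib]
    refine Finset.sum_congr rfl fun f' _ => ?_
    split_ifs <;> simp
  rw [h1]
  have h2 : (∑ f, ∑ f', if f = f' then 0 else (coI E f f' : ℤ))^2 ≤
      (Fintype.card I : ℤ)^2 * ∑ f, ∑ f', if f = f' then 0 else (coI E f f' : ℤ)^2 := by
    rw [← Finset.sum_product', ← Finset.sum_product']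
    refine (sq_sum_le_card_mul_sum_sq).trans (le_of_eq ?_)
    rw [card_product, card_univ]
    push_cast
    rw [pow_two]
    congr 1
    refine Finset.sum_congr rfl fun p _ => ?_
    split_ifs <;> simp
  refine h2.trans (mul_le_mul_of_nonneg_left ?_ (by positivity))
  calc ∑ f, ∑ f', (if f = f' then 0 else (coI E f f' : ℤ)^2)
      ≤ ∑ f, ∑ f', (2*k+1)^2 * ∑ l ∈ range (k+1), ∑ w ∈ range (2^k), (if f = f' then 0 else (DW E t l w f f')^2) := by
        refine Finset.sum_le_sum fun f _ => Finset.sum_le_sum fun f' _ => ?_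
        by_cases hf : f = f'
        · simp [hf]
        · simp only [if_neg hf]
          exact coI_bound E t k htk hI h f f' hf
    _ = (2*k+1)^2 * ∑ l ∈ range (k+1), ∑ w ∈ range (2^k), ∑ f, ∑ f', (if f = f' then 0 else (DW E t l w f f')^2) := by
        simp only [← Finset.mul_sum]
        congr 1
        calc _ = ∑ f, ∑ l ∈ range (k+1), ∑ f', ∑ w ∈ range (2^k), (if f = f' then 0 else (DW E t l w f f')^2) :=
              Finset.sum_congr rfl fun f _ => Finset.sum_comm
          _ = ∑ l ∈ range (k+1), ∑ f, ∑ f', ∑ w ∈ range (2^k), (if f = f' then 0 else (DW E t l w f f')^2) := Finset.sum_comm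
          _ = ∑ l ∈ range (k+1), ∑ f, ∑ w ∈ range (2^k), ∑ f', (if f = f' then 0 else (DW E t l w f f')^2) :=
              Finset.sum_congr rfl fun l _ => Finset.sum_congr rfl fun f _ => Finset.sum_comm
          _ = _ := Finset.sum_congr rfl fun l _ => Finset.sum_comm
    _ ≤ (2*k+1)^2 * ∑ l ∈ range (k+1), (∑ f, (degI E f : ℤ)^2 + ∑ x, (degJ E x : ℤ)^2) := by
        refine mul_le_mul_of_nonneg_left ?_ (by positivity)
        refine Finset.sum_le_sum fun l _ => ?_
        calc _ ≤ ∑ w ∈ range (2^k), (∑ x, (∑ f, eW E t l w f x)^2 + ∑ f, (∑ x, eW E t l w f x)^2) :=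
              Finset.sum_le_sum fun w _ => DW_sum E t h l w
          _ = ∑ f, ∑ w ∈ range (2^k), (∑ x, eW E t l w f x)^2 + ∑ x, ∑ w ∈ range (2^k), (∑ f, eW E t l w f x)^2 := by
              rw [Finset.sum_add_distrib, add_comm, Finset.sum_comm, Finset.sum_comm (s := range (2^k))]
          _ ≤ _ := by
              apply add_le_add
              · exact Finset.sum_le_sum fun f _ => win_sum_sq l k (fun x => E f x) (fun x => t f x)
              · exact Finset.sum_le_sum fun x _ => win_sum_sq l k (fun f => E f x) (fun f => t f x)
    _ = _ := by simp; ring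

lemma lens_arith (e n Λ SI SJ : ℝ) (he : 0 ≤ e) (hn : 1 ≤ n) (hΛ : 1 ≤ Λ) (hI : e ≤ SI) (hJ : e ≤ SJ)
    (h1 : e^2 ≤ n * SI) (h2 : e^2 ≤ n * SJ) (h3 : (SJ - e)^2 ≤ n^2 * (Λ * (SI+SJ)))
    (h4 : (SI - e)^2 ≤ n^2 * (Λ * (SI+SJ))) : e^2 ≤ 16 * n^3 * Λ := by
  rcases le_or_gt e (4*n) with h | h
  · calc e^2 ≤ (4*n)^2 := pow_le_pow_left₀ he h 2
      _ = 16 * n^2 * 1 * 1 := by ring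
      _ ≤ 16 * n^2 * n * Λ := by gcongr
      _ = _ := by ring
  · obtain ⟨S, hS⟩ : ∃ S, S = SI + SJ := ⟨_, rfl⟩
    rw [← hS] at h3 h4
    have h5 : (S - 2*e)^2 ≤ 4 * (n^2 * (Λ * S)) := by
      have := sq_nonneg ((SJ - e) - (SI - e))
      have e1 : (S - 2*e)^2 = 2 * (SJ-e)^2 + 2*(SI-e)^2 - ((SJ - e) - (SI - e))^2 := by rw [hS]; ring
      linarith
    have h6 : 2 * e^2 ≤ n * S := by rw [hS]; linarith
    have h7 : 8 * e ≤ S := by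
      have : n * (8*e) ≤ n * S := by
        calc n * (8*e) = 2 * ((4 * n) * e) := by ring
          _ ≤ 2 * (e * e) := by gcongr
          _ = 2 * e^2 := by ring
          _ ≤ _ := h6
      exact le_of_mul_le_mul_left this (by linarith)
    have hS0 : 0 < S := by linarith
    have h8 : (3/4*S)^2 ≤ (S - 2*e)^2 := pow_le_pow_left₀ (by positivity) (by linarith) 2
    have h9 : S * S ≤ S * (64/9 * n^2*Λ) := by
      have : (3/4*S)^2 = 9/16 * (S*S) := by ring
      have : S * (64/9 * n^2*Λ) = 16/9 * (4 * (n^2 * (Λ * S))) := by ring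
      linarith
    have h10 := le_of_mul_le_mul_left h9 hS0
    have : n * S ≤ n * (64/9 * n^2*Λ) := mul_le_mul_of_nonneg_left h10 (by linarith)
    have e2 : n * (64/9 * n^2*Λ) = 64/9 * (n^3 * Λ) := by ring
    have : 0 ≤ n^3*Λ := by positivity
    linarith

/-- the lens lemma -/
theorem lens_bound (k n : ℕ) (hn : 1 ≤ n) (hnI : Fintype.card I ≤ n) (hnJ : Fintype.card J ≤ n)
    (htk : ∀ f x, t f x < 2^k) (hI : ∀ f f' x, f ≠ f' → E f x → E f' x → t f x ≠ t f' x)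
    (hJ : ∀ f x y, x ≠ y → E f x → E f y → t f x ≠ t f y)
    (h : ∀ f f' x y, f ≠ f' → x ≠ y → E f x → E f' x → E f y → E f' y →
      Good (t f x) (t f' x) (t f y) (t f' y)) :
    (∑ f, (degI E f : ℝ))^2 ≤ 16 * (n:ℝ)^3 * ((2*k+1)^2*(k+1)) := by
  classical
  have H1 := lens_half E t k htk hI h
  have H2 := lens_half (fun x f => E f x) (fun x f => t f x) k (fun x f => htk f x)
    (fun x y f hxy hx hy => hJ f x y hxy hx hy)
    (fun x y f f' hxy hf hfx hfy hf'x hf'y => (h f f' x y hf hxy hfx hf'x hfy hf'y).transpose)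
  have a1 : ∀ f, degJ (fun x f => E f x) f = degI E f := fun f => rfl
  have a2 : ∀ x, degI (fun x f => E f x) x = degJ E x := fun f => rfl
  simp only [a1, a2] at H2
  have hsum : ∑ f, (degI E f : ℤ) = ∑ x, (degJ E x : ℤ) := by
    have e1 : ∀ f, (degI E f : ℤ) = ∑ x, if E f x then 1 else 0 := fun f => by
      rw [degI, card_filter]; push_cast; rfl
    simp only [e1, degJ_eq]
    exact Finset.sum_comm
  rw [← hsum] at H2
  have hsq : ∀ m : ℕ, (m:ℝ) ≤ (m:ℝ)^2 := fun m => by exact_mod_cast Nat.le_self_pow (by norm_num) m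
  have hsumR : ∑ f, (degI E f : ℝ) = ∑ x, (degJ E x : ℝ) := by exact_mod_cast hsum
  have H1' : (∑ x, (degJ E x : ℝ)^2 - ∑ f, (degI E f : ℝ))^2 ≤ (Fintype.card I : ℝ)^2 *
      (((2*k+1)^2 * (k+1)) * (∑ f, (degI E f : ℝ)^2 + ∑ x, (degJ E x : ℝ)^2)) := by exact_mod_cast H1
  have H2' : (∑ f, (degI E f : ℝ)^2 - ∑ f, (degI E f : ℝ))^2 ≤ (Fintype.card J : ℝ)^2 *
      (((2*k+1)^2 * (k+1)) * (∑ x, (degJ E x : ℝ)^2 + ∑ f, (degI E f : ℝ)^2)) := by exact_mod_cast H2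
  have n1 : (Fintype.card I : ℝ) ≤ n := by exact_mod_cast hnI
  have n2 : (Fintype.card J : ℝ) ≤ n := by exact_mod_cast hnJ
  have hn' : (1:ℝ) ≤ n := by exact_mod_cast hn
  apply lens_arith _ (n:ℝ) _ (∑ f, (degI E f : ℝ)^2) (∑ x, (degJ E x : ℝ)^2)
  · positivity
  · exact hn'
  · have : (1:ℝ) ≤ (2*k+1)^2 := one_le_pow₀ (by linarith [Nat.cast_nonneg (α := ℝ) k])
    have h2 : (1:ℝ) ≤ (k+1) := by linarith [Nat.cast_nonneg (α := ℝ) k]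
    nlinarith
  · exact Finset.sum_le_sum fun f _ => hsq _
  · rw [hsumR]; exact Finset.sum_le_sum fun f _ => hsq _
  · refine (sq_sum_le_card_mul_sum_sq).trans ?_
    rw [card_univ]; gcongr
  · rw [hsumR]
    refine (sq_sum_le_card_mul_sum_sq).trans ?_
    rw [card_univ]; gcongr
  · refine H1'.trans ?_
    gcongr
  · refine H2'.trans ?_
    rw [add_comm (∑ x, (degJ E x : ℝ)^2)]
    gcongr

end lens
end LensSec

section Circ1Sec
/-- planar circles -/
@[ext] structure Cir where
  a : ℝ
  b : ℝ
  r : ℝ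
  hr : 0 < r

namespace Cir
/-- power of a point -/
def q (c : Cir) (x y : ℝ) : ℝ := (x-c.a)^2+(y-c.b)^2-c.r^2
/-- upper arc -/
def up (c : Cir) (x : ℝ) : ℝ := c.b + √(c.r^2-(x-c.a)^2)
def dfd (c : Cir) (x : ℝ) : Prop := (x-c.a)^2 ≤ c.r^2

lemma b_le_up (c : Cir) (x : ℝ) : c.b ≤ c.up x := by
  unfold up; linarith [Real.sqrt_nonneg (c.r^2-(x-c.a)^2)]

lemma q_up (c : Cir) {x : ℝ} (h : c.dfd x) : c.q x (c.up x) = 0 := by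
  unfold q up dfd at *
  have : c.b + √(c.r^2-(x-c.a)^2) - c.b = √(c.r^2-(x-c.a)^2) := by ring
  rw [this, Real.sq_sqrt (by linarith)]; ring

lemma eq_up (c : Cir) {x y : ℝ} (hy : c.b ≤ y) (h : c.q x y = 0) : c.dfd x ∧ y = c.up x := by
  unfold q up dfd at *
  refine ⟨by nlinarith [sq_nonneg (y-c.b)], ?_⟩
  have : c.r^2-(x-c.a)^2 = (y-c.b)^2 := by linarith
  rw [this, Real.sqrt_sq (by linarith)]; ring

lemma q_neg (c : Cir) {x y : ℝ} (h : c.q x y < 0) : c.dfd x ∧ y < c.up x := by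
  unfold q up dfd at *
  refine ⟨by nlinarith [sq_nonneg (y-c.b)], ?_⟩
  have : y - c.b < √(c.r^2-(x-c.a)^2) := Real.lt_sqrt_of_sq_lt (by linarith)
  linarith

lemma q_pos (c : Cir) {x y : ℝ} (h : c.dfd x → c.up x < y) : 0 < c.q x y := by
  by_contra hn
  push Not at hn
  rcases hn.lt_or_eq with h1 | h1
  · obtain ⟨h2, h3⟩ := c.q_neg h1
    linarith [h h2]
  · have hd : c.dfd x := by unfold q dfd at *; nlinarith [sq_nonneg (y-c.b)]
    have h2 := h hd
    have := c.eq_up ((c.b_le_up x).trans h2.le) h1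
    linarith [this.2]

/-- chord -/
lemma chord_q (c : Cir) {x₁ y₁ x₃ y₃ : ℝ} (x₂ : ℝ) (h13 : x₁ < x₃) (h1 : c.q x₁ y₁ = 0) (h3 : c.q x₃ y₃ = 0) 
    (h12 : x₁ < x₂) (h23 : x₂ < x₃) : c.q x₂ (((x₃-x₂)*y₁+(x₂-x₁)*y₃)/(x₃-x₁)) < 0 := by
  have hp : 0 < x₃ - x₁ := by linarith
  obtain ⟨m, hm⟩ : ∃ m, m = (x₂-x₁)/(x₃-x₁) := ⟨_, rfl⟩
  have e1 : x₂ = (1-m)*x₁+m*x₃ := by rw [hm]; field_simp; ring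
  have e2 : ((x₃-x₂)*y₁+(x₂-x₁)*y₃)/(x₃-x₁) = (1-m)*y₁+m*y₃ := by rw [hm]; field_simp; ring
  have hm0 : 0 < m := by rw [hm]; exact div_pos (by linarith) hp
  have hm1 : m < 1 := by rw [hm, div_lt_one hp]; linarith
  rw [e2]
  have : c.q x₂ ((1-m)*y₁+m*y₃) = (1-m) * c.q x₁ y₁ + m * c.q x₃ y₃ - m*(1-m)*((x₃-x₁)^2+(y₃-y₁)^2) := by
    rw [e1]; unfold q; ring
  rw [this, h1, h3]
  have : 0 < m*(1-m)*((x₃-x₁)^2+(y₃-y₁)^2) := by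
    apply mul_pos (mul_pos hm0 (by linarith))
    have := pow_pos hp 2
    positivity
  linarith

lemma concave (c : Cir) {x₁ x₂ x₃ : ℝ} (h1 : c.dfd x₁) (h3 : c.dfd x₃) (h12 : x₁ < x₂) (h23 : x₂ < x₃) :
    c.dfd x₂ ∧ (x₃-x₂) * c.up x₁ + (x₂-x₁) * c.up x₃ < (x₃-x₁) * c.up x₂ := by
  have := c.q_neg (c.chord_q x₂ (h12.trans h23) (c.q_up h1) (c.q_up h3) h12 h23)
  refine ⟨this.1, ?_⟩
  have h4 := this.2
  rw [div_lt_iff₀ (by linarith)] at h4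
  linarith

/-- above relation -/
def abv (t : ℝ) (i j : Cir) : Prop := i.dfd t ∧ (j.dfd t → j.up t < i.up t)

lemma abv_asymm {t : ℝ} {i j : Cir} (h : abv t i j) (h' : abv t j i) : False := by
  have := h.2 h'.1; have := h'.2 h.1; linarith

lemma lin_sub (i j : Cir) (x y : ℝ) : i.q x y - j.q x y = (2*j.a-2*i.a)*x+(2*j.b-2*i.b)*y
    + (i.a^2-j.a^2+i.b^2-j.b^2-i.r^2+j.r^2) := by unfold q; ring

lemma no_alt {i j : Cir} {t1 t2 t3 t4 : ℝ} (h12 : t1 < t2) (h23 : t2 < t3) (h34 : t3 < t4)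
    (h1 : abv t1 i j) (h2 : abv t2 j i) (h3 : abv t3 i j) (h4 : abv t4 j i) : False := by
  have p1 := j.q_pos h1.2
  have p2 := i.q_pos h2.2
  have p3 := j.q_pos h3.2
  have p4 := i.q_pos h4.2
  obtain ⟨d2, c2⟩ := i.concave h1.1 h3.1 h12 h23
  obtain ⟨d3, c3⟩ := j.concave h2.1 h4.1 h23 h34
  have l1 := lin_sub i j t1 (i.up t1)
  have l2 := lin_sub i j t2 (j.up t2)
  have l3 := lin_sub i j t3 (i.up t3)
  have l4 := lin_sub i j t4 (j.up t4)
  rw [i.q_up h1.1] at l1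
  rw [j.q_up h2.1] at l2
  rw [i.q_up h3.1] at l3
  rw [j.q_up h4.1] at l4
  have u2 := h2.2 d2
  have u3 := h3.2 d3
  obtain ⟨α, hα⟩ : ∃ α, α = 2*j.a-2*i.a := ⟨_, rfl⟩
  obtain ⟨β, hβ⟩ : ∃ β, β = 2*j.b-2*i.b := ⟨_, rfl⟩
  obtain ⟨γ, hγ⟩ : ∃ γ, γ = i.a^2-j.a^2+i.b^2-j.b^2-i.r^2+j.r^2 := ⟨_, rfl⟩
  rw [← hα, ← hβ, ← hγ] at l1 l2 l3 l4
  have n1 : α*t1+β*i.up t1+γ < 0 := by linarith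
  have n2 : 0 < α*t2+β*j.up t2+γ := by linarith
  have n3 : α*t3+β*i.up t3+γ < 0 := by linarith
  have n4 : 0 < α*t4+β*j.up t4+γ := by linarith
  have w1 : 0 < t2-t1 := by linarith
  have w2 : 0 < t3-t2 := by linarith
  have w3 : 0 < t4-t3 := by linarith
  have w4 : 0 < t3-t1 := by linarith
  have w5 : 0 < t4-t2 := by linarith
  rcases le_or_gt β 0 with hb | hb
  · have a1 := mul_neg_of_pos_of_neg w2 n1
    have a2 := mul_neg_of_pos_of_neg w1 n3
    have a3 := mul_pos w4 n2
    have a4 : (t3-t2) * i.up t1 + (t2-t1) * i.up t3 < (t3-t1) * j.up t2 :=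
      c2.trans (mul_lt_mul_of_pos_left u2 w4)
    have a5 : β * ((t3-t1) * j.up t2) ≤ β * ((t3-t2) * i.up t1 + (t2-t1) * i.up t3) :=
      mul_le_mul_of_nonpos_left a4.le hb
    linarith
  · have a1 := mul_pos w3 n2
    have a2 := mul_pos w2 n4
    have a3 := mul_neg_of_pos_of_neg w5 n3
    have a4 : (t4-t3) * j.up t2 + (t3-t2) * j.up t4 < (t4-t2) * i.up t3 :=
      c3.trans (mul_lt_mul_of_pos_left u3 w5)
    have a5 : β * ((t4-t3) * j.up t2 + (t3-t2) * j.up t4) ≤ β * ((t4-t2) * i.up t3) :=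
      mul_le_mul_of_nonneg_left a4.le hb.le
    linarith

/-- lens fact -/
lemma lens_out {f a : Cir} {p q m t : ℝ} (hpm : p < m) (hmq : m < q) (fp : f.dfd p) (fq : f.dfd q) (ap : a.dfd p)
    (aq : a.dfd q) (ep : f.up p = a.up p) (eq : f.up q = a.up q) (hm : f.up m < a.up m)
    (ht : t < p ∨ q < t) (hat : a.dfd t) : f.dfd t ∧ a.up t < f.up t := by
  apply f.q_neg
  have l1 := lin_sub f a p (a.up p)
  have l2 := lin_sub f a q (a.up q)
  have l3 := lin_sub f a m (a.up m)
  have l4 := lin_sub f a t (a.up t)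
  obtain ⟨am, cm⟩ := a.concave ap aq hpm hmq
  have pm := f.q_pos (fun _ => hm)
  rw [a.q_up ap, ← ep, f.q_up fp] at l1
  rw [a.q_up aq, ← eq, f.q_up fq] at l2
  rw [a.q_up am] at l3
  rw [a.q_up hat] at l4
  rw [ep] at l1
  rw [eq] at l2
  obtain ⟨α, hα⟩ : ∃ α, α = 2*a.a-2*f.a := ⟨_, rfl⟩
  obtain ⟨β, hβ⟩ : ∃ β, β = 2*a.b-2*f.b := ⟨_, rfl⟩
  obtain ⟨γ, hγ⟩ : ∃ γ, γ = f.a^2-a.a^2+f.b^2-a.b^2-f.r^2+a.r^2 := ⟨_, rfl⟩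
  rw [← hα, ← hβ, ← hγ] at l1 l2 l3 l4
  have hq : 0 < q - p := by linarith
  have hb : 0 < β := by
    by_contra hb
    push Not at hb
    have a1 := mul_le_mul_of_nonpos_left cm.le hb
    have a2 := mul_pos hq pm
    have : (q-p) * f.q m (a.up m) = β * ((q - p) * a.up m) - β * ((q - m) * a.up p + (m - p) * a.up q) := by
      linear_combination (q-p)*l3 - (q-m)*l1 - (m-p)*l2
    linarith
  have hc : (q-p) * a.up t < (q-t) * a.up p + (t-p) * a.up q := by
    rcases ht with ht | ht
    · have := (a.concave hat aq ht (hpm.trans hmq)).2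
      linarith
    · have := (a.concave ap hat (hpm.trans hmq) ht).2
      linarith
  have e : (q-p) * f.q t (a.up t) = β * ((q - p) * a.up t) - β * ((q-t) * a.up p + (t-p) * a.up q) := by
      linear_combination (q-p)*l4 - (q-t)*l1 - (t-p)*l2
  have := mul_lt_mul_of_pos_left hc hb
  by_contra hn
  push Not at hn
  have := mul_nonneg hq.le hn
  linarith

/-- three common abscissae on the upper arcs: equal circles -/
lemma eq_of_three {f a : Cir} {p q m : ℝ} (hpm : p < m) (hmq : m < q) (fp : f.dfd p) (fq : f.dfd q) (ap : a.dfd p)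
    (aq : a.dfd q) (ep : f.up p = a.up p) (eq : f.up q = a.up q) (hm : f.up m = a.up m) : f = a := by
  have l1 := lin_sub f a p (a.up p)
  have l2 := lin_sub f a q (a.up q)
  have l3 := lin_sub f a m (a.up m)
  obtain ⟨am, cm⟩ := a.concave ap aq hpm hmq
  obtain ⟨fm, -⟩ := f.concave fp fq hpm hmq
  rw [a.q_up ap, ← ep, f.q_up fp] at l1
  rw [a.q_up aq, ← eq, f.q_up fq] at l2
  rw [a.q_up am, ← hm, f.q_up fm] at l3
  rw [ep] at l1
  rw [eq] at l2
  rw [hm] at l3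
  have hb : a.b = f.b := by
    have : (2*a.b-2*f.b) * ((q - p) * a.up m - ((q - m) * a.up p + (m - p) * a.up q)) = 0 := by
      linear_combination -(q-p)*l3 + (q-m)*l1 + (m-p)*l2
    rcases mul_eq_zero.mp this with h | h <;> linarith
  have ha : a.a = f.a := by
    rw [hb] at l1 l2
    have : (a.a - f.a) * (p - q) = 0 := by linear_combination (l2-l1)/2
    rcases mul_eq_zero.mp this with h | h <;> linarith
  have hr : a.r = f.r := by
    rw [hb, ha] at l1
    have : (a.r-f.r)*(a.r+f.r) = 0 := by linear_combination -l1
    have h1 := a.hr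
    have h2 := f.hr
    rcases mul_eq_zero.mp this with h | h <;> linarith
  exact (Cir.ext ha hb hr).symm

end Cir
end Circ1Sec

section Circ2Sec
/-- alternation of the pairs (u,v), (u',v') -/
def Alt {α : Type*} [LT α] (u v u' v' : α) : Prop :=
  (u < u' ∧ u' < v ∧ v < v') ∨ (u < v' ∧ v' < v ∧ v < u') ∨ (v < u' ∧ u' < u ∧ u < v') ∨ (v < v' ∧ v' < u ∧ u < u') ∨
  (u' < u ∧ u < v' ∧ v' < v) ∨ (v' < u ∧ u < u' ∧ u' < v) ∨ (u' < v ∧ v < v' ∧ v' < u) ∨ (v' < v ∧ v < u' ∧ u' < u)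

lemma good_of_not_alt {u u' v v' : ℕ} (h1 : ¬ Alt u v u' v') (h2 : ¬ Alt u u' v v') (h3 : u ≠ v') (h4 : u' ≠ v)
   (h5 : u ≠ u') (h6 : u ≠ v) (h7 : v ≠ v') (h8 : u' ≠ v') : Good u u' v v' := by
  unfold Alt at *; unfold Good
  rcases lt_or_gt_of_ne h5 with a5 | a5 <;> rcases lt_or_gt_of_ne h6 with a6 | a6 <;>
  rcases lt_or_gt_of_ne h7 with a7 | a7 <;> rcases lt_or_gt_of_ne h8 with a8 | a8 <;>
  rcases lt_or_gt_of_ne h3 with a3 | a3 <;> rcases lt_or_gt_of_ne h4 with a4 | a4 <;>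
  simp only [a3, a4, a5, a6, a7, a8, not_lt_of_gt a3, not_lt_of_gt a4, not_lt_of_gt a5, not_lt_of_gt a6, not_lt_of_gt a7,
    not_lt_of_gt a8, and_self, and_true, true_and, and_false, false_and, or_false, false_or, or_true, true_or, not_true, not_false_iff] at h1 h2 ⊢

lemma poly_log (ε : ℝ) (hε : 0 < ε) : ∃ C : ℝ, 0 < C ∧ ∀ n : ℕ, 1 ≤ n → ∃ k : ℕ, n^2 ≤ 2^k ∧
    16 * (n:ℝ)^3*((2*k+1)^2*(k+1)) ≤ (C * (n:ℝ)^(3/2+ε))^2 := by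
  obtain ⟨δ, hδ⟩ : ∃ δ, δ = 2*ε/3 := ⟨_, rfl⟩
  have hδ0 : 0 < δ := by rw [hδ]; positivity
  refine ⟨4*(9 + 8/δ)^2, by positivity, fun n hn => ?_⟩
  have hn' : (1:ℝ) ≤ n := by exact_mod_cast hn
  refine ⟨2 * Nat.clog 2 n, ?_, ?_⟩
  · rw [mul_comm, pow_mul]
    exact Nat.pow_le_pow_left (Nat.le_pow_clog (by norm_num) n) 2
  · have h1 : (Nat.clog 2 n : ℝ) ≤ 1 + 2 * Real.log n := by
      have : (Nat.clog 2 n : ℝ) ≤ 1 + Nat.log 2 n := by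
        exact_mod_cast (by
          have := Nat.clog_le_of_le_pow (Nat.lt_pow_succ_log_self (b := 2) (by norm_num) n).le; omega : Nat.clog 2 n ≤ 1 + Nat.log 2 n)
      have h2 : ((2:ℝ)^(Nat.log 2 n)) ≤ n := by exact_mod_cast Nat.pow_log_le_self 2 (by omega)
      have h3 := Real.log_le_log (by positivity) h2
      rw [Real.log_pow] at h3
      have h4 := Real.log_two_gt_d9
      have : (0:ℝ) ≤ Nat.log 2 n := by positivity
      nlinarith
    have h2 : Real.log n ≤ (n:ℝ)^δ/δ := Real.log_le_rpow_div (by positivity) hδ0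
    have h3 : (1:ℝ) ≤ (n:ℝ)^δ := Real.one_le_rpow hn' hδ0.le
    obtain ⟨z, hz⟩ : ∃ z, z = (n:ℝ)^δ := ⟨_, rfl⟩
    rw [← hz] at h2 h3
    have h4 : 2*((2 * Nat.clog 2 n : ℕ) : ℝ)+1 ≤ (9 + 8/δ) * z := by
      push_cast
      have : (9 + 8/δ) * z = 9 * z + 8 * (z/δ) := by ring
      linarith
    have h0 : (0:ℝ) ≤ ((2 * Nat.clog 2 n : ℕ) : ℝ) := by positivity
    obtain ⟨κ, hκ⟩ : ∃ κ, κ = ((2 * Nat.clog 2 n : ℕ) : ℝ) := ⟨_, rfl⟩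
    rw [← hκ] at h4 h0 ⊢
    have e : ((n:ℝ)^(3/2+ε))^2 = (n:ℝ)^3 * z^3 := by
      rw [hz, ← Real.rpow_natCast, ← Real.rpow_mul (by positivity), ← Real.rpow_natCast, ← Real.rpow_natCast,
        ← Real.rpow_mul (by positivity), ← Real.rpow_add (by positivity)]
      congr 1
      rw [hδ]; push_cast; ring
    have hw : 1 ≤ 9 + 8/δ := by have : 0 < 8/δ := by positivity
                                linarith
    obtain ⟨w, hw'⟩ : ∃ w, w = 9 + 8/δ := ⟨_, rfl⟩
    rw [← hw'] at h4 hw ⊢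
    calc 16 * (n:ℝ)^3*((2*κ+1)^2*(κ+1)) ≤ 16 * (n:ℝ)^3*((2*κ+1)^2*(2*κ+1)) := by gcongr; linarith
      _ = 16 * (n:ℝ)^3*((2*κ+1)^3) := by ring
      _ ≤ 16 * (n:ℝ)^3*((w*z)^3) := by gcongr
      _ = 16 * (n:ℝ)^3*(w^3*z^3*1) := by ring
      _ ≤ 16 * (n:ℝ)^3*(w^3*z^3*w) := by gcongr
      _ = (4*w^2)^2 * ((n:ℝ)^3 * z^3) := by ring
      _ = _ := by rw [← e]; ring

theorem lens_real (ε : ℝ) (hε : 0 < ε) : ∃ C : ℝ, 0 < C ∧ ∀ (I : Type) [Fintype I] (E : I → I → Prop) (t : I → I → ℝ),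
    (∀ f f' x, f ≠ f' → E f x → E f' x → t f x ≠ t f' x) → (∀ f x y, x ≠ y → E f x → E f y → t f x ≠ t f y) →
    (∀ f f' x y, f ≠ f' → x ≠ y → E f x → E f' x → E f y → E f' y →
      (¬ Alt (t f x) (t f y) (t f' x) (t f' y)) ∧ (¬ Alt (t f x) (t f' x) (t f y) (t f' y)) ∧ t f x ≠ t f' y ∧ t f' x ≠ t f y) →
    (∑ f, (degI E f : ℝ)) ≤ C * (Fintype.card I : ℝ)^(3/2+ε) := by
  obtain ⟨C, hC, H⟩ := poly_log ε hε
  refine ⟨C, hC, fun I _ E t hI hJ h => ?_⟩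
  classical
  rcases Nat.eq_zero_or_pos (Fintype.card I) with h0 | hn
  · have := Fintype.card_eq_zero_iff.mp h0
    simp only [univ_eq_empty, sum_empty]
    positivity
  obtain ⟨k, hk, hb⟩ := H _ hn
  set T : Finset ℝ := (univ : Finset (I × I)).image (fun p => t p.1 p.2) with hT
  have hTc : T.card ≤ 2^k := by
    refine card_image_le.trans (le_trans ?_ hk)
    rw [card_univ, Fintype.card_prod, pow_two]
  have hmem : ∀ f x, t f x ∈ T := fun f x => mem_image_of_mem (fun p : I × I => t p.1 p.2) (mem_univ (f, x))
  set rk : ℝ → ℕ := fun s => (T.filter (· < s)).card with hrk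
  have hmono : ∀ a b, a ∈ T → a < b → rk a < rk b := by
    intro a b ha hab
    apply card_lt_card
    rw [Finset.ssubset_iff_of_subset (fun z hz => by
      rw [mem_filter] at hz ⊢; exact ⟨hz.1, hz.2.trans hab⟩)]
    exact ⟨a, by simp [ha, hab], by simp⟩
  have hlt : ∀ f x f' x', rk (t f x) < rk (t f' x') → t f x < t f' x' := by
    intro f x f' x' hh
    by_contra hn
    push Not at hn
    rcases hn.lt_or_eq with h1 | h1
    · have := hmono _ _ (hmem _ _) h1; omega
    · rw [h1] at hh; omega
  have hne : ∀ f x f' x', t f x ≠ t f' x' → rk (t f x) ≠ rk (t f' x') := by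
    intro f x f' x' hh
    rcases lt_or_gt_of_ne hh with h1 | h1
    · exact (hmono _ _ (hmem _ _) h1).ne
    · exact (hmono _ _ (hmem _ _) h1).ne'
  have halt : ∀ f x f' x' g y g' y', Alt (rk (t f x)) (rk (t f' x')) (rk (t g y)) (rk (t g' y')) →
      Alt (t f x) (t f' x') (t g y) (t g' y') := by
    intro f x f' x' g y g' y' ha
    unfold Alt at ha ⊢
    rcases ha with ⟨a1, a2, a3⟩ | ⟨a1, a2, a3⟩ | ⟨a1, a2, a3⟩ | ⟨a1, a2, a3⟩ | ⟨a1, a2, a3⟩ | ⟨a1, a2, a3⟩ | ⟨a1, a2, a3⟩ | ⟨a1, a2, a3⟩ <;>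
      simp only [hlt _ _ _ _ a1, hlt _ _ _ _ a2, hlt _ _ _ _ a3, and_self, true_or, or_true]
  have key := lens_bound E (fun f x => rk (t f x)) k (Fintype.card I) hn le_rfl le_rfl ?_ ?_ ?_ ?_
  · exact abs_le_of_sq_le_sq' (key.trans hb) (by positivity) |>.2
  · intro f x
    refine lt_of_lt_of_le (card_lt_card ?_) hTc
    exact filter_ssubset.mpr ⟨t f x, hmem _ _, lt_irrefl _⟩
  · exact fun f f' x hf h1 h2 => hne _ _ _ _ (hI f f' x hf h1 h2)
  · exact fun f x y hf h1 h2 => hne _ _ _ _ (hJ f x y hf h1 h2)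
  · intro f f' x y hf hxy h1 h2 h3 h4
    obtain ⟨a1, a2, a3, a4⟩ := h f f' x y hf hxy h1 h2 h3 h4
    refine good_of_not_alt (fun h => a1 (halt _ _ _ _ _ _ _ _ h)) (fun h => a2 (halt _ _ _ _ _ _ _ _ h)) (hne _ _ _ _ a3) (hne _ _ _ _ a4)
      (hne _ _ _ _ (hI _ _ _ hf h1 h2)) (hne _ _ _ _ (hJ _ _ _ hxy h1 h3)) (hne _ _ _ _ (hI _ _ _ hf h3 h4)) (hne _ _ _ _ (hJ _ _ _ hxy h2 h4))
end Circ2Sec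

section Circ3Sec
namespace Cir

/-- p,q consecutive on the upper arc of c -/
def Nx (S : Cir → Finset (Fin 2 → ℝ)) (c : Cir) (p q : Fin 2 → ℝ) : Prop :=
  p ∈ S c ∧ q ∈ S c ∧ p 0 < q 0 ∧ ∀ z ∈ S c, z 0 ≤ p 0 ∨ q 0 ≤ z 0

def md (p q : Fin 2 → ℝ) : ℝ := (p 0 + q 0)/2

lemma md_lt {p q : Fin 2 → ℝ} (h : p 0 < q 0) : p 0 < md p q ∧ md p q < q 0 := by
  unfold md; constructor <;> linarith

variable (M : Finset Cir) (S : Cir → Finset (Fin 2 → ℝ))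

/-- on the upper arc -/
def onUp (c : Cir) (p : Fin 2 → ℝ) : Prop := c.dfd (p 0) ∧ p 1 = c.up (p 0)

/-- edge with witness -/
def EdgeW (f a : Cir) (p q : Fin 2 → ℝ) : Prop := Nx S f p q ∧ Nx S a p q ∧ f.up (md p q) < a.up (md p q) ∧
  ∀ c ∈ M, Nx S c p q → ¬ (f.up (md p q) < c.up (md p q) ∧ c.up (md p q) < a.up (md p q))

variable {M S}

lemma pt_ext {c : Cir} {p q : Fin 2 → ℝ} (hp : c.onUp p) (hq : c.onUp q) (h : p 0 = q 0) : p = q := by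
  funext i
  fin_cases i
  · exact h
  · show p 1 = q 1
    rw [hp.2, hq.2, h]

lemma Nx_cases {c : Cir} (hS : ∀ p ∈ S c, c.onUp p) {p q p' q' : Fin 2 → ℝ} (h : Nx S c p q) (h' : Nx S c p' q') :
    (p = p' ∧ q = q') ∨ (md p q < p' 0 ∨ q' 0 < md p q) := by
  obtain ⟨h1, h2, h3, h4⟩ := h
  obtain ⟨h1', h2', h3', h4'⟩ := h'
  have a1 := h4 p' h1'
  have a2 := h4 q' h2'
  have a3 := h4' p h1
  have a4 := h4' q h2
  have := md_lt h3
  by_cases hp : p 0 = p' 0 ∧ q 0 = q' 0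
  · left; exact ⟨pt_ext (hS p h1) (hS p' h1') hp.1, pt_ext (hS q h2) (hS q' h2') hp.2⟩
  · right
    by_contra hn
    push Not at hn
    apply hp
    constructor
    · rcases a1 with a1 | a1 <;> rcases a2 with a2 | a2 <;> rcases a3 with a3 | a3 <;> rcases a4 with a4 | a4 <;> linarith
    · rcases a1 with a1 | a1 <;> rcases a2 with a2 | a2 <;> rcases a3 with a3 | a3 <;> rcases a4 with a4 | a4 <;> linarith

lemma Nx.up_eq {f a : Cir} (hf : ∀ p ∈ S f, f.onUp p) (ha : ∀ p ∈ S a, a.onUp p) {p q : Fin 2 → ℝ} (h1 : Nx S f p q) (h2 : Nx S a p q) :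
    f.dfd (p 0) ∧ f.dfd (q 0) ∧ a.dfd (p 0) ∧ a.dfd (q 0) ∧ f.up (p 0) = a.up (p 0) ∧ f.up (q 0) = a.up (q 0) := by
  have a1 := hf p h1.1
  have a2 := hf q h1.2.1
  have a3 := ha p h2.1
  have a4 := ha q h2.2.1
  exact ⟨a1.1, a2.1, a3.1, a4.1, by rw [← a1.2, ← a3.2], by rw [← a2.2, ← a4.2]⟩

lemma Nx.height_inj {f a : Cir} (hf : ∀ p ∈ S f, f.onUp p) (ha : ∀ p ∈ S a, a.onUp p) {p q : Fin 2 → ℝ} (h1 : Nx S f p q) (h2 : Nx S a p q)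
    (h : f.up (md p q) = a.up (md p q)) : f = a := by
  obtain ⟨b1, b2, b3, b4, b5, b6⟩ := h1.up_eq hf ha h2
  have := md_lt h1.2.2.1
  exact eq_of_three this.1 this.2 b1 b2 b3 b4 b5 b6 h

lemma EdgeW.out {f a : Cir} (hf : ∀ p ∈ S f, f.onUp p) (ha : ∀ p ∈ S a, a.onUp p) {p q : Fin 2 → ℝ} (h : EdgeW M S f a p q)
    {t : ℝ} (ht : t < p 0 ∨ q 0 < t) (hat : a.dfd t) : f.dfd t ∧ a.up t < f.up t := by
  obtain ⟨b1, b2, b3, b4, b5, b6⟩ := h.1.up_eq hf ha h.2.1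
  have := md_lt h.1.2.2.1
  exact lens_out this.1 this.2 b1 b2 b3 b4 b5 b6 h.2.2.1 ht hat

lemma Nx.dfd_md {f : Cir} (hf : ∀ p ∈ S f, f.onUp p) {p q : Fin 2 → ℝ} (h : Nx S f p q) : f.dfd (md p q) := by
  have := md_lt h.2.2.1
  exact (f.concave (hf p h.1).1 (hf q h.2.1).1 this.1 this.2).1

lemma EdgeW.abv1 {f f' a : Cir} (hf : ∀ p ∈ S f, f.onUp p) (hf' : ∀ p ∈ S f', f'.onUp p) (ha : ∀ p ∈ S a, a.onUp p)
    (fM : f ∈ M) (fM' : f' ∈ M) {p q p' q' : Fin 2 → ℝ}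
    (h : EdgeW M S f a p q) (h' : EdgeW M S f' a p' q') (hne : f ≠ f') : abv (md p q) f' f := by
  rcases Nx_cases ha h.2.1 h'.2.1 with ⟨rfl, rfl⟩ | hc
  · exfalso
    rcases lt_trichotomy (f.up (md p q)) (f'.up (md p q)) with h1 | h1 | h1
    · exact h.2.2.2 f' fM' h'.1 ⟨h1, h'.2.2.1⟩
    · exact hne (h.1.height_inj hf hf' h'.1 h1)
    · exact h'.2.2.2 f fM h.1 ⟨h1, h.2.2.1⟩
  · obtain ⟨c1, c2⟩ := h'.out hf' ha hc (h.2.1.dfd_md ha)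
    exact ⟨c1, fun _ => h.2.2.1.trans c2⟩

lemma EdgeW.abv2 {f a b : Cir} (hf : ∀ p ∈ S f, f.onUp p) (ha : ∀ p ∈ S a, a.onUp p) (hb : ∀ p ∈ S b, b.onUp p)
    (aM : a ∈ M) (bM : b ∈ M) {p q p' q' : Fin 2 → ℝ}
    (h : EdgeW M S f a p q) (h' : EdgeW M S f b p' q') (hne : a ≠ b) : abv (md p q) a b := by
  rcases Nx_cases hf h.1 h'.1 with ⟨rfl, rfl⟩ | hc
  · exfalso
    rcases lt_trichotomy (a.up (md p q)) (b.up (md p q)) with h1 | h1 | h1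
    · exact h'.2.2.2 a aM h.2.1 ⟨h.2.2.1, h1⟩
    · exact hne (h.2.1.height_inj ha hb h'.2.1 h1)
    · exact h.2.2.2 b bM h'.2.1 ⟨h'.2.2.1, h1⟩
  · refine ⟨h.2.1.dfd_md ha, fun hbd => ?_⟩
    obtain ⟨c1, c2⟩ := h'.out hf hb hc hbd
    exact c2.trans h.2.2.1

lemma not_Alt {i j : Cir} {u v u' v' : ℝ} (h1 : abv u i j) (h2 : abv v i j) (h3 : abv u' j i) (h4 : abv v' j i) : ¬ Alt u v u' v' := by
  unfold Alt
  rintro (⟨a1, a2, a3⟩ | ⟨a1, a2, a3⟩ | ⟨a1, a2, a3⟩ | ⟨a1, a2, a3⟩ | ⟨a1, a2, a3⟩ | ⟨a1, a2, a3⟩ | ⟨a1, a2, a3⟩ | ⟨a1, a2, a3⟩)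
  · exact no_alt a1 a2 a3 h1 h3 h2 h4
  · exact no_alt a1 a2 a3 h1 h4 h2 h3
  · exact no_alt a1 a2 a3 h2 h3 h1 h4
  · exact no_alt a1 a2 a3 h2 h4 h1 h3
  · exact no_alt a1 a2 a3 h3 h1 h4 h2
  · exact no_alt a1 a2 a3 h4 h1 h3 h2
  · exact no_alt a1 a2 a3 h3 h2 h4 h1
  · exact no_alt a1 a2 a3 h4 h2 h3 h1

open Classical in
theorem bundle_bound (ε : ℝ) (hε : 0 < ε) : ∃ C : ℝ, 0 < C ∧ ∀ (M : Finset Cir) (S : Cir → Finset (Fin 2 → ℝ))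
    (_ : ∀ c ∈ M, ∀ p ∈ S c, c.onUp p) (W : Finset ((Fin 2 → ℝ) × (Fin 2 → ℝ))),
    ((∑ w ∈ W, (M.filter (fun c => Nx S c w.1 w.2)).card : ℕ) : ℝ) ≤ W.card + C * (M.card : ℝ)^(3/2+ε) := by
  obtain ⟨C, hC, H⟩ := lens_real ε hε
  refine ⟨C, hC, fun M S hS W => ?_⟩
  set E : M → M → Prop := fun f a => ∃ w : (Fin 2 → ℝ) × (Fin 2 → ℝ), EdgeW M S f.1 a.1 w.1 w.2 with hE
  set t : M → M → ℝ := fun f a => if h : E f a then md h.choose.1 h.choose.2 else 0 with ht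
  have hts : ∀ f a, E f a → ∃ p q, EdgeW M S f.1 a.1 p q ∧ t f a = md p q := by
    intro f a h
    refine ⟨h.choose.1, h.choose.2, h.choose_spec, ?_⟩
    simp only [ht, dif_pos h]
  have A1 : ∀ f f' x, f ≠ f' → E f x → E f' x → abv (t f x) f'.1 f.1 := by
    intro f f' x hne h1 h2
    obtain ⟨p, q, w1, e1⟩ := hts f x h1
    obtain ⟨p', q', w2, e2⟩ := hts f' x h2
    rw [e1]
    exact EdgeW.abv1 (hS _ f.2) (hS _ f'.2) (hS _ x.2) f.2 f'.2 w1 w2 (Subtype.coe_injective.ne hne)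
  have A2 : ∀ f x y, x ≠ y → E f x → E f y → abv (t f x) x.1 y.1 := by
    intro f x y hne h1 h2
    obtain ⟨p, q, w1, e1⟩ := hts f x h1
    obtain ⟨p', q', w2, e2⟩ := hts f y h2
    rw [e1]
    exact EdgeW.abv2 (hS _ f.2) (hS _ x.2) (hS _ y.2) x.2 y.2 w1 w2 (Subtype.coe_injective.ne hne)
  have key := H M E t ?_ ?_ ?_
  · rw [Fintype.card_coe] at key
    have hcard : (∑ w ∈ W, (M.filter (fun c => Nx S c w.1 w.2)).card) ≤ W.card + ∑ f, degI E f := by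
      -- pairs
      set Pr := (W ×ˢ M).filter (fun z => Nx S z.2 z.1.1 z.1.2) with hPr
      have h1 : (∑ w ∈ W, (M.filter (fun c => Nx S c w.1 w.2)).card) = Pr.card := by
        rw [hPr, card_filter, Finset.sum_product]
        exact Finset.sum_congr rfl fun w _ => by rw [card_filter]
      set top : ((Fin 2 → ℝ) × (Fin 2 → ℝ)) × Cir → Prop := fun z => ∀ c ∈ M, Nx S c z.1.1 z.1.2 →
        c.up (md z.1.1 z.1.2) ≤ z.2.up (md z.1.1 z.1.2) with htop
      rw [h1, ← card_filter_add_card_filter_not (s := Pr) top]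
      apply add_le_add
      · apply card_le_card_of_injOn (fun z => z.1)
        · intro z hz
          simp only [hPr, coe_filter, mem_product, mem_filter, Set.mem_ofPred_eq] at hz
          exact hz.1.1.1
        · intro z hz z' hz' e
          simp only [hPr, coe_filter, mem_product, mem_filter, Set.mem_ofPred_eq, htop] at hz hz'
          simp only at e
          obtain ⟨⟨⟨_, hM⟩, hN⟩, hT⟩ := hz
          obtain ⟨⟨⟨_, hM'⟩, hN'⟩, hT'⟩ := hz'
          rw [← e] at hN' hT'
          have l1 := hT _ hM' hN'
          have l2 := hT' _ hM hN
          exact Prod.ext e (hN.height_inj (hS _ hM) (hS _ hM') hN' (le_antisymm l2 l1))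
      · have hnext : ∀ z ∈ Pr.filter (fun z => ¬ top z), ∃ fa : M × M, fa.1.1 = z.2 ∧ EdgeW M S fa.1.1 fa.2.1 z.1.1 z.1.2 := by
          intro z hz
          simp only [hPr, mem_product, mem_filter, htop] at hz
          obtain ⟨⟨⟨_, hM⟩, hN⟩, hT⟩ := hz
          push Not at hT
          obtain ⟨c, cM, cN, hc⟩ := hT
          obtain ⟨a, ha, hmin⟩ := exists_min_image ((M.filter (fun c => Nx S c z.1.1 z.1.2)).filter
            (fun c => z.2.up (md z.1.1 z.1.2) < c.up (md z.1.1 z.1.2))) (fun c => c.up (md z.1.1 z.1.2))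
            ⟨c, by simp only [mem_filter]; exact ⟨⟨cM, cN⟩, hc⟩⟩
          simp only [mem_filter] at ha hmin
          refine ⟨(⟨z.2, hM⟩, ⟨a, ha.1.1⟩), rfl, hN, ha.1.2, ha.2, ?_⟩
          rintro c' cM' cN' ⟨u1, u2⟩
          have := hmin c' ⟨⟨cM', cN'⟩, u1⟩
          exact absurd u2 (not_lt.mpr this)
        rcases (Pr.filter (fun z => ¬ top z)).eq_empty_or_nonempty with h0 | ⟨z0, hz0⟩
        · rw [h0]; simp
        haveI : Nonempty (M × M) := ⟨(hnext z0 hz0).choose⟩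
        choose! g hg using hnext
        have h2 : ∑ f, degI E f = ((univ : Finset (M × M)).filter (fun z => E z.1 z.2)).card := by
          rw [card_filter, ← univ_product_univ, Finset.sum_product]
          exact Finset.sum_congr rfl fun w _ => by rw [degI, card_filter]
        rw [h2]
        apply card_le_card_of_injOn g
        · intro z hz
          have := hg z hz
          simp only [coe_filter, mem_univ, true_and, Set.mem_ofPred_eq]
          exact ⟨z.1, this.2⟩
        · intro z hz z' hz' e
          have k1 := hg z hz
          have k2 := hg z' hz'
          rw [← e] at k2
          refine Prod.ext ?_ (k1.1.symm.trans k2.1)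
          have f1 := hS _ (g z).1.2
          have f2 := hS _ (g z).2.2
          rcases Nx_cases f1 k1.2.1 k2.2.1 with hh | hc
          · exact Prod.ext hh.1 hh.2
          · exfalso
            have := (k2.2.out f1 f2 hc (k1.2.2.1.dfd_md f2)).2
            have := k1.2.2.2.1
            linarith
    have hcard' : ((∑ w ∈ W, (M.filter (fun c => Nx S c w.1 w.2)).card : ℕ) : ℝ) ≤ W.card + ∑ f, (degI E f : ℝ) := by
      exact_mod_cast hcard
    linarith
  · intro f f' x hne h1 h2 he
    have b1 := A1 f f' x hne h1 h2
    have b2 := A1 f' f x hne.symm h2 h1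
    rw [← he] at b2
    exact abv_asymm b1 b2
  · intro f x y hne h1 h2 he
    have b1 := A2 f x y hne h1 h2
    have b2 := A2 f y x hne.symm h2 h1
    rw [← he] at b2
    exact abv_asymm b1 b2
  · intro f f' x y hne hxy h1 h2 h3 h4
    have a1 := A1 f f' x hne h1 h2
    have a2 := A1 f f' y hne h3 h4
    have a3 := A1 f' f x hne.symm h2 h1
    have a4 := A1 f' f y hne.symm h4 h3
    have b1 := A2 f x y hxy h1 h3
    have b2 := A2 f' x y hxy h2 h4
    have b3 := A2 f y x hxy.symm h3 h1
    have b4 := A2 f' y x hxy.symm h4 h2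
    refine ⟨not_Alt a1 a2 a3 a4, not_Alt b1 b2 b3 b4, fun he => ?_, fun he => ?_⟩
    · rw [he] at a1; exact abv_asymm a1 a4
    · rw [he] at a3; exact abv_asymm a3 a2

end Cir
end Circ3Sec

section Circ4Sec
namespace Cir

/-- rational parametrization of a circle -/
def gam (c : Cir) (s : ℝ) : Fin 2 → ℝ := ![c.a + 2*c.r*s/(1+s^2), c.b + c.r*(1-s^2)/(1+s^2)]
/-- inverse parametrization -/
def par (c : Cir) (p : Fin 2 → ℝ) : ℝ := (p 0 - c.a)/(c.r + (p 1 - c.b))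

lemma onUp_q {c : Cir} {p : Fin 2 → ℝ} (h : c.onUp p) : (p 0 - c.a)^2 + (p 1 - c.b)^2 = c.r^2 ∧ c.b ≤ p 1 := by
  have := c.q_up h.1
  rw [← h.2] at this
  unfold q at this
  exact ⟨by linarith, h.2 ▸ c.b_le_up _⟩

lemma gam_par {c : Cir} {p : Fin 2 → ℝ} (h : c.onUp p) : c.gam (c.par p) = p := by
  obtain ⟨h1, h2⟩ := onUp_q h
  have hr := c.hr
  have hd : 0 < c.r + (p 1 - c.b) := by linarith
  have e : 1 + c.par p^2 = 2*c.r/(c.r + (p 1 - c.b)) := by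
    unfold par
    field_simp
    linear_combination h1
  have e0 : c.r + (p 1 - c.b) ≠ 0 := hd.ne'
  have er := hr.ne'
  funext i
  fin_cases i
  · show c.a + 2*c.r*(c.par p)/(1+(c.par p)^2) = p 0
    rw [e]; unfold par; field_simp; ring
  · show c.b + c.r*(1-(c.par p)^2)/(1+(c.par p)^2) = p 1
    have e2 : 1 - c.par p^2 = 2 - 2*c.r/(c.r + (p 1 - c.b)) := by linarith
    rw [e, e2]; field_simp; ring

lemma par_lt {c : Cir} {p q : Fin 2 → ℝ} (hp : c.onUp p) (hq : c.onUp q) (h : p 0 < q 0) : c.par p < c.par q := by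
  by_contra hn
  push Not at hn
  have hr := c.hr
  have ab : ∀ {p}, c.onUp p → (c.par p)^2 ≤ 1 := by
    intro p hp
    obtain ⟨h1, h2⟩ := onUp_q hp
    have hd : 0 < c.r + (p 1 - c.b) := by linarith
    unfold par
    rw [div_pow, div_le_one (by positivity)]
    nlinarith
  have a1 := ab hp
  have a2 := ab hq
  have b1 := congrFun (gam_par hp) 0
  have b2 := congrFun (gam_par hq) 0
  change c.a + 2*c.r*(c.par p)/(1+(c.par p)^2) = p 0 at b1
  change c.a + 2*c.r*(c.par q)/(1+(c.par q)^2) = q 0 at b2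
  rw [← b1, ← b2] at h
  clear ab b1 b2
  generalize c.par p = s at *
  generalize c.par q = t at *
  have : 2*c.r*t/(1+t^2) ≤ 2*c.r*s/(1+s^2) := by
    rw [div_le_div_iff₀ (by positivity) (by positivity)]
    have : 0 ≤ 2*c.r*((s-t)*(1-s*t)) := by
      apply mul_nonneg (by positivity) (mul_nonneg (by linarith) _)
      nlinarith [sq_nonneg (s-t)]
    nlinarith
  linarith

lemma gam_cont (c : Cir) : Continuous c.gam := by
  refine continuous_pi fun i => ?_
  have : ∀ s : ℝ, 1 + s^2 ≠ 0 := fun s => by positivity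
  fin_cases i
  · show Continuous (fun s => c.a + 2*c.r*s/(1+s^2))
    fun_prop (disch := assumption)
  · show Continuous (fun s => c.b + c.r*(1-s^2)/(1+s^2))
    fun_prop (disch := assumption)

lemma eval_aeval_X {d : ℕ} (s : ℝ) (Q : MvPolynomial (Fin d) ℝ) : 
    Polynomial.eval s (MvPolynomial.aeval (fun _ => Polynomial.X) Q) = MvPolynomial.eval (fun _ => s) Q := by
  induction Q using MvPolynomial.induction_on with
  | C a => simp
  | add p q hp hq => simp [hp, hq]
  | mul_X p n hp => simp [hp]

lemma circ_poly (c : Cir) {D : ℕ} (P : MvPolynomial (Fin 2) ℝ) (hP : P.totalDegree ≤ D) :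
    ∃ Q : Polynomial ℝ, Q.natDegree ≤ 2 * D ∧ ∀ s, Q.eval s = (1+s^2)^D * MvPolynomial.eval (c.gam s) P := by
  have d1 : (MvPolynomial.X 0^2 : MvPolynomial (Fin 1) ℝ).totalDegree ≤ 2 := by
    refine (MvPolynomial.totalDegree_pow _ _).trans ?_
    simp
  have d2 : (1 + MvPolynomial.X 0^2 : MvPolynomial (Fin 1) ℝ).totalDegree ≤ 2 :=
    (MvPolynomial.totalDegree_add _ _).trans (max_le (by simp) d1)
  have d3 : (1 - MvPolynomial.X 0^2 : MvPolynomial (Fin 1) ℝ).totalDegree ≤ 2 :=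
    (MvPolynomial.totalDegree_sub _ _).trans (max_le (by simp) d1)
  have dC : ∀ (z : ℝ) (F : MvPolynomial (Fin 1) ℝ), F.totalDegree ≤ 2 → (MvPolynomial.C z * F).totalDegree ≤ 2 := by
    intro z F hF
    refine (MvPolynomial.totalDegree_mul _ _).trans ?_
    simpa using hF
  have hn : ∀ i, ((![MvPolynomial.C c.a * (1 + MvPolynomial.X 0^2) + MvPolynomial.C (2*c.r) * MvPolynomial.X 0,
      MvPolynomial.C c.b * (1 + MvPolynomial.X 0^2) + MvPolynomial.C c.r * (1 - MvPolynomial.X 0 ^2)] : 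
        Fin 2 → MvPolynomial (Fin 1) ℝ) i).totalDegree ≤ 2 := by
    intro i
    fin_cases i
    · exact (MvPolynomial.totalDegree_add _ _).trans (max_le (dC _ _ d2) (dC _ _ (by simp)))
    · exact (MvPolynomial.totalDegree_add _ _).trans (max_le (dC _ _ d2) (dC _ _ d3))
  obtain ⟨Q, hQ, hQe⟩ := exists_rational_subst (d := 1) (δ := 2) P hP _ _ hn d2
  · refine ⟨MvPolynomial.aeval (fun _ => Polynomial.X) Q, ?_, ?_⟩
    · refine (MvPolynomial.aeval_natDegree_le Q hQ _ (n := 1) (fun _ => by simp)).trans (by simp)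
    · intro s
      have hs : 1 + s^2 ≠ 0 := by positivity
      rw [eval_aeval_X, hQe _ (by simpa using hs)]
      congr 1
      · simp
      · congr 1
        congr 1
        funext i
        fin_cases i
        · simp [gam]; field_simp
        · simp [gam]; field_simp

/-- number of consecutive pairs separated by zeros -/
lemma change_card (c : Cir) {D : ℕ} (P : MvPolynomial (Fin 2) ℝ) (hP : P.totalDegree ≤ D) (S : Cir → Finset (Fin 2 → ℝ))
    (hS : ∀ p ∈ S c, c.onUp p) (X : Finset (Fin 2 → ℝ)) (hX : ∀ p ∈ X, MvPolynomial.eval p P ≠ 0 ∧ ∃ q, Nx S c p q ∧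
      ∃ s, c.par p < s ∧ s < c.par q ∧ MvPolynomial.eval (c.gam s) P = 0) : X.card ≤ 2 * D := by
  classical
  obtain ⟨Q, hQ, hQe⟩ := c.circ_poly P hP
  rcases X.eq_empty_or_nonempty with h0 | ⟨p0, hp0⟩
  · simp [h0]
  have hQ0 : Q ≠ 0 := by
    intro h
    obtain ⟨h1, q, hq, -⟩ := hX p0 hp0
    have := hQe (c.par p0)
    rw [h, gam_par (hS _ hq.1)] at this
    simp only [Polynomial.eval_zero] at this
    rcases mul_eq_zero.mp this.symm with h2 | h2
    · have : (0:ℝ) < (1 + c.par p0^2)^D := by positivity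
      linarith
    · exact h1 h2
  choose! hnz q hq s hs1 hs2 hs3 using hX
  refine le_trans ?_ ((Q.card_roots').trans hQ)
  refine le_trans ?_ (Multiset.toFinset_card_le _)
  apply card_le_card_of_injOn s
  · intro p hp
    have : Q.IsRoot (s p) := by
      rw [Polynomial.IsRoot, hQe, hs3 p hp, mul_zero]
    simp [hQ0]
    exact this
  · intro p hp p' hp' e
    have n1 := hq p hp
    have n2 := hq p' hp'
    have o1 := hS _ n1.1
    have o2 := hS _ n2.1
    have o1' := hS _ n1.2.1
    have o2' := hS _ n2.2.1
    rcases lt_trichotomy (p 0) (p' 0) with h | h | h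
    · exfalso
      rcases n1.2.2.2 _ n2.1 with h3 | h3
      · linarith
      · have : c.par (q p) ≤ c.par p' := by
          rcases h3.lt_or_eq with h4 | h4
          · exact (par_lt o1' o2 h4).le
          · rw [pt_ext o1' o2 h4]
        have := hs1 p' hp'
        have := hs2 p hp
        linarith
    · exact pt_ext o1 o2 h
    · exfalso
      rcases n2.2.2.2 _ n1.1 with h3 | h3
      · linarith
      · have : c.par (q p') ≤ c.par p := by
          rcases h3.lt_or_eq with h4 | h4
          · exact (par_lt o2' o1 h4).le
          · rw [pt_ext o2' o1 h4]
        have := hs1 p hp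
        have := hs2 p' hp'
        linarith

/-- circle contained in the zero set -/
def inZ (c : Cir) (P : MvPolynomial (Fin 2) ℝ) : Prop := ∀ s, MvPolynomial.eval (c.gam s) P = 0

lemma zero_card (c : Cir) {D : ℕ} (P : MvPolynomial (Fin 2) ℝ) (hP : P.totalDegree ≤ D) (hc : ¬ c.inZ P)
    (X : Finset (Fin 2 → ℝ)) (hX : ∀ p ∈ X, c.onUp p ∧ MvPolynomial.eval p P = 0) : X.card ≤ 2 * D := by
  classical
  obtain ⟨Q, hQ, hQe⟩ := c.circ_poly P hP
  have hQ0 : Q ≠ 0 := by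
    intro h
    apply hc
    intro s
    have := hQe s
    rw [h] at this
    simp only [Polynomial.eval_zero] at this
    rcases mul_eq_zero.mp this.symm with h2 | h2
    · have : (0:ℝ) < (1 + s^2)^D := by positivity
      linarith
    · exact h2
  refine le_trans ?_ ((Q.card_roots').trans hQ)
  refine le_trans ?_ (Multiset.toFinset_card_le _)
  apply card_le_card_of_injOn c.par
  · intro p hp
    have : Q.IsRoot (c.par p) := by
      rw [Polynomial.IsRoot, hQe, gam_par (hX p hp).1, (hX p hp).2, mul_zero]
    simp [hQ0]
    exact this
  · intro p hp p' hp' e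
    rw [← gam_par (hX p hp).1, ← gam_par (hX p' hp').1, e]

/-- equation polynomial -/
def qp (c : Cir) : MvPolynomial (Fin 2) ℝ := (MvPolynomial.X 0 - MvPolynomial.C c.a)^2 +
  (MvPolynomial.X 1 - MvPolynomial.C c.b)^2 - MvPolynomial.C (c.r^2)

lemma eval_qp (c : Cir) (p : Fin 2 → ℝ) : MvPolynomial.eval p c.qp = (p 0 - c.a)^2 + (p 1 - c.b)^2 - c.r^2 := by
  simp [qp]

lemma exists_div (c : Cir) (P : MvPolynomial (Fin 2) ℝ) : ∃ (F : MvPolynomial (Fin 2) ℝ) (A B : Polynomial ℝ),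
    P = c.qp * F + Polynomial.aeval (MvPolynomial.X 0) A * MvPolynomial.X 1 + Polynomial.aeval (MvPolynomial.X 0) B := by
  induction P using MvPolynomial.induction_on with
  | C z => exact ⟨0, 0, Polynomial.C z, by simp [MvPolynomial.algebraMap_eq]⟩
  | add p q hp hq =>
    obtain ⟨F, A, B, h⟩ := hp
    obtain ⟨F', A', B', h'⟩ := hq
    refine ⟨F+F', A+A', B+B', ?_⟩
    rw [h, h']
    simp only [map_add]
    ring
  | mul_X p n hp =>
    obtain ⟨F, A, B, h⟩ := hp
    fin_cases n
    · refine ⟨F * MvPolynomial.X 0, A * Polynomial.X, B * Polynomial.X, ?_⟩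
      show p * MvPolynomial.X 0 = _
      rw [h]
      simp only [map_mul, Polynomial.aeval_X]
      ring
    · refine ⟨F * MvPolynomial.X 1 + Polynomial.aeval (MvPolynomial.X 0) A, A * Polynomial.C (2*c.b) + B,
        A * (Polynomial.C (c.r^2-c.b^2) - (Polynomial.X - Polynomial.C c.a)^2), ?_⟩
      show p * MvPolynomial.X 1 = _
      rw [h]
      simp only [map_mul, map_add, map_sub, map_pow, Polynomial.aeval_X, Polynomial.aeval_C, MvPolynomial.algebraMap_eq, qp]
      have : (MvPolynomial.C 2 : MvPolynomial (Fin 2) ℝ) = 2 := map_ofNat MvPolynomial.C 2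
      rw [this]
      ring

lemma eval_aeval0 (p : Fin 2 → ℝ) (A : Polynomial ℝ) :
    MvPolynomial.eval p (Polynomial.aeval (MvPolynomial.X 0) A) = A.eval (p 0) := by
  induction A using Polynomial.induction_on' with
  | add p q hp hq => simp [hp, hq]
  | monomial n a => simp [Polynomial.aeval_monomial, MvPolynomial.algebraMap_eq]

lemma dvd_of_inZ (c : Cir) (P : MvPolynomial (Fin 2) ℝ) (h : c.inZ P) : ∃ F, P = c.qp * F := by
  obtain ⟨F, A, B, e⟩ := c.exists_div P
  have hr := c.hr
  have hon : ∀ s, MvPolynomial.eval (c.gam s) c.qp = 0 := by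
    intro s
    rw [eval_qp]
    simp only [gam, Matrix.cons_val_zero, Matrix.cons_val_one]
    field_simp
    ring
  have h1 : ∀ s, A.eval (c.gam s 0) * c.gam s 1 + B.eval (c.gam s 0) = 0 := by
    intro s
    have := h s
    rw [e] at this
    simpa [hon s, eval_aeval0] using this
  have h2 : ∀ s ∈ Set.Ioo (0:ℝ) 1, A.eval (c.gam s 0) = 0 ∧ B.eval (c.gam s 0) = 0 := by
    rintro s ⟨hs0, hs1⟩
    have a1 := h1 s
    have a2 := h1 s⁻¹
    have e0 : c.gam s⁻¹ 0 = c.gam s 0 := by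
      simp only [gam, Matrix.cons_val_zero]; field_simp; ring
    have e1 : c.gam s 1 - c.gam s⁻¹ 1 = 2 * c.r*(1-s^2)/(1+s^2) := by
      simp only [gam, Matrix.cons_val_one, Matrix.cons_val_zero, Matrix.cons_val_fin_one]; field_simp; ring
    rw [e0] at a2
    have a3 : A.eval (c.gam s 0) * (2 * c.r*(1-s^2)/(1+s^2)) = 0 := by rw [← e1]; linarith
    have a4 : 0 < 2 * c.r*(1-s^2)/(1+s^2) := by
      have : 0 < 1 - s^2 := by nlinarith
      positivity
    have a5 : A.eval (c.gam s 0) = 0 := by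
      rcases mul_eq_zero.mp a3 with h | h
      · exact h
      · linarith
    rw [a5] at a1
    exact ⟨a5, by linarith⟩
  have hinf : Set.Infinite ((fun s => c.gam s 0) '' Set.Ioo (0:ℝ) 1) := by
    refine Set.Infinite.image ?_ (Set.Ioo_infinite one_pos)
    rintro s ⟨hs0, hs1⟩ t ⟨ht0, ht1⟩ e
    simp only [gam, Matrix.cons_val_zero] at e
    field_simp at e
    have h0 : 2 * c.r * ((s - t) * (1 - s*t)) = 0 := by linear_combination e
    have h5 : (s - t) * (1 - s*t) = 0 := by
      rcases mul_eq_zero.mp h0 with h | h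
      · linarith
      · exact h
    have : 0 < 1 - s*t := by nlinarith
    rcases mul_eq_zero.mp h5 with h | h <;> linarith
  have hA : A = 0 := Polynomial.eq_zero_of_infinite_isRoot A (hinf.mono (by rintro _ ⟨s, hs, rfl⟩; exact (h2 s hs).1))
  have hB : B = 0 := Polynomial.eq_zero_of_infinite_isRoot B (hinf.mono (by rintro _ ⟨s, hs, rfl⟩; exact (h2 s hs).2))
  exact ⟨F, by rw [e, hA, hB]; simp⟩

lemma eq_of_inZ (c c' : Cir) (h : c'.inZ c.qp) : c = c' := by
  have a1 := h 0
  have a2 := h 1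
  have a3 := h (-1)
  rw [eval_qp] at a1 a2 a3
  simp only [gam, Matrix.cons_val_zero, Matrix.cons_val_one] at a1 a2 a3
  norm_num at a1 a2 a3
  have hr := c.hr
  have hr' := c'.hr
  have ha : c.a = c'.a := by
    have : c'.r * (c'.a - c.a) = 0 := by nlinarith
    rcases mul_eq_zero.mp this with h | h <;> linarith
  rw [ha] at a1 a2 a3
  have hb : c.b = c'.b := by
    have : c'.r * (c'.b - c.b) = 0 := by nlinarith
    rcases mul_eq_zero.mp this with h | h <;> linarith
  rw [hb] at a1
  have hrr : c.r = c'.r := by nlinarith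
  exact Cir.ext ha hb hrr

lemma inZ_mul (c : Cir) (F G : MvPolynomial (Fin 2) ℝ) (h : c.inZ (F*G)) : c.inZ F ∨ c.inZ G := by
  obtain ⟨Q, -, hQe⟩ := c.circ_poly F le_rfl
  obtain ⟨Q', -, hQe'⟩ := c.circ_poly G le_rfl
  have : Q * Q' = 0 := by
    apply Polynomial.funext
    intro s
    have := h s
    rw [map_mul] at this
    rw [Polynomial.eval_mul, hQe, hQe', Polynomial.eval_zero]
    linear_combination ((1+s^2)^F.totalDegree * (1+s^2)^G.totalDegree) * this
  have pos : ∀ (s : ℝ) (n : ℕ), (1+s^2)^n ≠ 0 := fun s n => by positivity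
  rcases mul_eq_zero.mp this with h1 | h1
  · left
    intro s
    have := hQe s
    rw [h1] at this
    simpa [pos] using this.symm
  · right
    intro s
    have := hQe' s
    rw [h1] at this
    simpa [pos] using this.symm

lemma inZ_card (M : Finset Cir) : ∀ (P : MvPolynomial (Fin 2) ℝ), P ≠ 0 → (∀ c ∈ M, c.inZ P) → M.card ≤ P.totalDegree := by
  classical
  induction M using Finset.induction_on with
  | empty => intros; simp
  | insert c M hc ih =>
    intro P hP h
    obtain ⟨F, hF⟩ := c.dvd_of_inZ P (h c (mem_insert_self _ _))
    have hF0 : F ≠ 0 := by rintro rfl; simp at hF; exact hP hF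
    have hq0 : c.qp ≠ 0 := by intro h0; rw [h0] at hF; simp at hF; exact hP hF
    have h1 := ih F hF0 (by
      intro c' hc'
      have := h c' (mem_insert_of_mem hc')
      rw [hF] at this
      rcases inZ_mul _ _ _ this with h2 | h2
      · exfalso
        rw [eq_of_inZ _ _ h2] at hc
        exact hc hc'
      · exact h2)
    have h2 : 1 ≤ c.qp.totalDegree := by
      by_contra hn
      have h0 : c.qp.totalDegree = 0 := by omega
      rw [MvPolynomial.totalDegree_eq_zero_iff_eq_C] at h0
      have e1 := c.eval_qp ![c.a, c.b]
      have e2 := c.eval_qp ![c.a+c.r, c.b]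
      rw [h0] at e1 e2
      simp only [MvPolynomial.eval_C] at e1 e2
      rw [e2] at e1
      simp at e1
      exact c.hr.ne' e1
    rw [hF, MvPolynomial.totalDegree_mul_of_isDomain hq0 hF0, card_insert_of_notMem hc]
    omega

end Cir
end Circ4Sec

section Circ5Sec
/-- K_{2,3}-free bound -/
lemma kst2 {ι υ : Type*} (R : ι → υ → Prop) (X : Finset ι) (V : Finset υ)
    (h : ∀ u ∈ V, ∀ v ∈ V, u ≠ v → ∀ Y ⊆ X, (∀ x ∈ Y, R x u ∧ R x v) → Y.card ≤ 2) :
    Inc R X V ≤ X.card + 2 * V.card^2 := by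
  classical
  have e1 : Inc R X V = ∑ x ∈ X, (V.filter (fun u => R x u)).card := by
    unfold Inc
    simp only [card_filter]
    rw [sum_comm]
  have e2 : ∀ x ∈ X, (V.filter (fun u => R x u)).card ≤ 1 + (V.offDiag.filter (fun w => R x w.1 ∧ R x w.2)).card := by
    intro x _
    have : V.offDiag.filter (fun w => R x w.1 ∧ R x w.2) = (V.filter (fun u => R x u)).offDiag := by
      ext w
      simp only [mem_filter, mem_offDiag]
      tauto
    rw [this, offDiag_card]
    generalize (V.filter (fun u => R x u)).card = k
    rcases k with _ | _ | k
    · simp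
    · simp
    · have : (k+1+1) ≤ (k+1+1)*(k+1+1) - (k+1+1) := by
        rw [Nat.le_sub_iff_add_le (by nlinarith)]; nlinarith
      omega
  have e3 : ∑ x ∈ X, (V.offDiag.filter (fun w => R x w.1 ∧ R x w.2)).card
      = ∑ w ∈ V.offDiag, (X.filter (fun x => R x w.1 ∧ R x w.2)).card := by
    simp only [card_filter]
    rw [sum_comm]
  have e4 : ∑ w ∈ V.offDiag, (X.filter (fun x => R x w.1 ∧ R x w.2)).card ≤ ∑ w ∈ V.offDiag, 2 := by
    apply sum_le_sum
    intro w hw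
    rw [mem_offDiag] at hw
    exact h w.1 hw.1 w.2 hw.2.1 hw.2.2 _ (filter_subset _ _) (fun x hx => (mem_filter.mp hx).2)
  have e5 : V.offDiag.card ≤ V.card^2 := by rw [offDiag_card, sq]; omega
  calc Inc R X V = _ := e1
    _ ≤ ∑ x ∈ X, (1 + (V.offDiag.filter (fun w => R x w.1 ∧ R x w.2)).card) := sum_le_sum e2
    _ = X.card + ∑ w ∈ V.offDiag, (X.filter (fun x => R x w.1 ∧ R x w.2)).card := by
      rw [sum_add_distrib, e3]; simp
    _ ≤ X.card + V.offDiag.card * 2 := by rw [sum_const, smul_eq_mul] at e4; omega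
    _ ≤ _ := by nlinarith

namespace Cir

lemma up_two {u v : Cir} (huv : u ≠ v) (Y : Finset (Fin 2 → ℝ)) (h : ∀ x ∈ Y, u.onUp x ∧ v.onUp x) : Y.card ≤ 2 := by
  by_contra hn
  push Not at hn
  have key : ∀ x ∈ Y, ∀ y ∈ Y, ∀ z ∈ Y, x 0 < y 0 → y 0 < z 0 → False := by
    intro x hx y hy z hz h1 h2
    obtain ⟨ux, vx⟩ := h x hx
    obtain ⟨uy, vy⟩ := h y hy
    obtain ⟨uz, vz⟩ := h z hz
    exact huv (eq_of_three h1 h2 ux.1 uz.1 vx.1 vz.1 (by rw [← ux.2, ← vx.2]) (by rw [← uz.2, ← vz.2]) (by rw [← uy.2, ← vy.2]))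
  have ne : ∀ x ∈ Y, ∀ y ∈ Y, x ≠ y → x 0 ≠ y 0 := fun x hx y hy hxy e => hxy (pt_ext (h x hx).1 (h y hy).1 e)
  obtain ⟨x, hx, y, hy, z, hz, hxy, hxz, hyz⟩ := two_lt_card.mp hn
  have k1 := ne x hx y hy hxy
  have k2 := ne x hx z hz hxz
  have k3 := ne y hy z hz hyz
  rcases lt_or_gt_of_ne k1 with a | a <;> rcases lt_or_gt_of_ne k2 with b | b <;> rcases lt_or_gt_of_ne k3 with d | d
  · exact key x hx y hy z hz a d
  · exact key x hx z hz y hy b d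
  · linarith
  · exact key z hz x hx y hy b a
  · exact key y hy x hx z hz a b
  · linarith
  · exact key y hy z hz x hx d b
  · exact key z hz y hy x hx d a

/-- upper incidences -/
def upR (p : Fin 2 → ℝ) (c : Cir) : Prop := c.onUp p

lemma up_kst (P : Finset (Fin 2 → ℝ)) (M : Finset Cir) : Inc upR P M ≤ P.card + 2 * M.card^2 :=
  kst2 _ _ _ fun _ _ _ _ huv Y _ h => up_two huv Y h

lemma sign_ivt (c : Cir) (F : MvPolynomial (Fin 2) ℝ) {p q : Fin 2 → ℝ} (hp : c.onUp p) (hq : c.onUp q) (h : p 0 < q 0)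
    (h1 : MvPolynomial.eval p F ≠ 0) (h2 : MvPolynomial.eval q F ≠ 0)
    (h3 : SignType.sign (MvPolynomial.eval p F) ≠ SignType.sign (MvPolynomial.eval q F)) :
    ∃ s, c.par p < s ∧ s < c.par q ∧ MvPolynomial.eval (c.gam s) F = 0 := by
  have hc : Continuous fun s => MvPolynomial.eval (c.gam s) F := (MvPolynomial.continuous_eval F).comp c.gam_cont
  have hlt := par_lt hp hq h
  have ep : MvPolynomial.eval (c.gam (c.par p)) F = MvPolynomial.eval p F := by rw [gam_par hp]
  have eq : MvPolynomial.eval (c.gam (c.par q)) F = MvPolynomial.eval q F := by rw [gam_par hq]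
  rcases lt_or_gt_of_ne h1 with a | a <;> rcases lt_or_gt_of_ne h2 with b | b
  · rw [sign_neg a, sign_neg b] at h3; exact absurd rfl h3
  · obtain ⟨s, hs, e⟩ := intermediate_value_Ioo hlt.le hc.continuousOn (show (0:ℝ) ∈ Set.Ioo _ _ by
      simp only [ep, eq]; exact ⟨a, b⟩)
    exact ⟨s, hs.1, hs.2, e⟩
  · obtain ⟨s, hs, e⟩ := intermediate_value_Ioo' hlt.le hc.continuousOn (show (0:ℝ) ∈ Set.Ioo _ _ by
      simp only [ep, eq]; exact ⟨b, a⟩)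
    exact ⟨s, hs.1, hs.2, e⟩
  · rw [sign_pos a, sign_pos b] at h3; exact absurd rfl h3

/-- sign vector -/
def sv {T : ℕ} (F : Fin T → MvPolynomial (Fin 2) ℝ) (p : Fin 2 → ℝ) : Fin T → SignType :=
  fun t => SignType.sign (MvPolynomial.eval p (F t))

lemma nz_card {T : ℕ} (F : Fin T → MvPolynomial (Fin 2) ℝ) {D' : ℕ} (hdeg : (∏ t, F t).totalDegree ≤ D')
    (P : Finset (Fin 2 → ℝ)) (S : Cir → Finset (Fin 2 → ℝ)) (c : Cir)
    (hS : ∀ p ∈ S c, p ∈ P ∧ c.onUp p ∧ MvPolynomial.eval p (∏ t, F t) ≠ 0)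
    (W : Finset ((Fin 2 → ℝ) × (Fin 2 → ℝ)))
    (hW : ∀ p ∈ P, ∀ q ∈ P, MvPolynomial.eval p (∏ t, F t) ≠ 0 → sv F p = sv F q → (p, q) ∈ W)
    (k : ℕ) (hk : ∀ W' ⊆ W, (∀ w ∈ W', Nx S c w.1 w.2) → W'.card ≤ k) :
    (S c).card ≤ 1 + 2 * D' + k := by
  classical
  have on : ∀ p ∈ S c, c.onUp p := fun p hp => (hS p hp).2.1
  set A1 := (S c).filter (fun p => ∀ z ∈ S c, z 0 ≤ p 0)
  set A2 := (S c).filter (fun p => ∃ q, Nx S c p q ∧ sv F p ≠ sv F q)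
  set A3 := (S c).filter (fun p => ∃ q, Nx S c p q ∧ sv F p = sv F q)
  have hsub : S c ⊆ A1 ∪ A2 ∪ A3 := by
    intro p hp
    by_cases h1 : ∀ z ∈ S c, z 0 ≤ p 0
    · exact mem_union_left _ (mem_union_left _ (mem_filter.mpr ⟨hp, h1⟩))
    · push Not at h1
      obtain ⟨z, hz, hpz⟩ := h1
      obtain ⟨q, hq, hmin⟩ := exists_min_image ((S c).filter (fun z => p 0 < z 0)) (fun z => z 0) ⟨z, mem_filter.mpr ⟨hz, hpz⟩⟩
      rw [mem_filter] at hq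
      have hN : Nx S c p q := ⟨hp, hq.1, hq.2, fun z hz => by
        rcases le_or_gt (z 0) (p 0) with h | h
        · exact Or.inl h
        · exact Or.inr (hmin z (mem_filter.mpr ⟨hz, h⟩))⟩
      by_cases hs : sv F p = sv F q
      · exact mem_union_right _ (mem_filter.mpr ⟨hp, q, hN, hs⟩)
      · exact mem_union_left _ (mem_union_right _ (mem_filter.mpr ⟨hp, q, hN, hs⟩))
  have c1 : A1.card ≤ 1 := by
    rw [card_le_one]
    intro p hp q hq
    rw [mem_filter] at hp hq
    exact pt_ext (on p hp.1) (on q hq.1) (le_antisymm (hq.2 p hp.1) (hp.2 q hq.1))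
  have c2 : A2.card ≤ 2 * D' := by
    refine change_card c _ hdeg S on A2 ?_
    intro p hp
    rw [mem_filter] at hp
    obtain ⟨hp, q, hN, hs⟩ := hp
    refine ⟨(hS p hp).2.2, q, hN, ?_⟩
    obtain ⟨t, ht⟩ := Function.ne_iff.mp hs
    have n1 := (hS p hp).2.2
    have n2 := (hS q hN.2.1).2.2
    rw [map_prod, prod_ne_zero_iff] at n1 n2
    obtain ⟨s, a1, a2, a3⟩ := sign_ivt c (F t) (on p hp) (on q hN.2.1) hN.2.2.1 (n1 t (mem_univ _)) (n2 t (mem_univ _)) ht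
    exact ⟨s, a1, a2, by rw [map_prod]; exact prod_eq_zero (mem_univ t) a3⟩
  have c3 : A3.card ≤ k := by
    have : ∀ p, ∃ q, p ∈ A3 → Nx S c p q ∧ sv F p = sv F q := by
      intro p
      by_cases hp : p ∈ A3
      · obtain ⟨q, hq⟩ := (mem_filter.mp hp).2
        exact ⟨q, fun _ => hq⟩
      · exact ⟨0, fun h => absurd h hp⟩
    choose f hf using this
    rw [← card_image_of_injective A3 (f := fun p => (p, f p)) (fun a b h => (Prod.mk.inj h).1)]
    apply hk
    · intro w hw
      obtain ⟨p, hp, rfl⟩ := mem_image.mp hw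
      have hN := (hf p hp).1
      exact hW p (hS p hN.1).1 _ (hS _ hN.2.1).1 (hS p hN.1).2.2 (hf p hp).2
    · intro w hw
      obtain ⟨p, hp, rfl⟩ := mem_image.mp hw
      exact (hf p hp).1
  calc (S c).card ≤ (A1 ∪ A2 ∪ A3).card := card_le_card hsub
    _ ≤ A1.card + A2.card + A3.card := (card_union_le _ _).trans (Nat.add_le_add_right (card_union_le _ _) _)
    _ ≤ _ := by omega

lemma up_cell (ε : ℝ) (hε : 0 < ε) : ∃ C : ℝ, 0 < C ∧ ∀ (P : Finset (Fin 2 → ℝ)) (M : Finset Cir) (T : ℕ)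
    (F : Fin T → MvPolynomial (Fin 2) ℝ) (D' K : ℕ), (∀ t, F t ≠ 0) → (∏ t, F t).totalDegree ≤ D' →
    (∀ σ : Fin T → SignType, (∀ t, σ t ≠ 0) → (P.filter (fun p => sv F p = σ)).card * K ≤ P.card) → 0 < K →
    (Inc upR P M : ℝ) ≤ M.card * (1 + 4 * D') + P.card^2 / K + C * (M.card:ℝ)^(3/2+ε) + P.card + 2 * D'^2 := by
  classical
  obtain ⟨C, hC, hb⟩ := bundle_bound ε hε
  refine ⟨C, hC, fun P M T F D' K hF hdeg hcell hK => ?_⟩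
  set Q := ∏ t, F t with hQ
  have hQ0 : Q ≠ 0 := prod_ne_zero_iff.mpr fun t _ => hF t
  set S : Cir → Finset (Fin 2 → ℝ) := fun c => P.filter (fun p => c.onUp p ∧ MvPolynomial.eval p Q ≠ 0) with hS
  set W := (P ×ˢ P).filter (fun w => MvPolynomial.eval w.1 Q ≠ 0 ∧ sv F w.1 = sv F w.2) with hW
  have hWc : W.card * K ≤ P.card * P.card := by
    have : W.card ≤ ∑ p ∈ P.filter (fun p => MvPolynomial.eval p Q ≠ 0), (P.filter (fun q => sv F q = sv F p)).card := by
      rw [← card_sigma]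
      apply card_le_card_of_injOn (fun w => (⟨w.1, w.2⟩ : Σ _ : Fin 2 → ℝ, Fin 2 → ℝ))
      · intro w hw
        simp only [hW, coe_filter, mem_product, Set.mem_ofPred_eq] at hw
        simp only [coe_sigma, Set.mem_sigma_iff, mem_coe, mem_filter]
        exact ⟨⟨hw.1.1, hw.2.1⟩, hw.1.2, hw.2.2.symm⟩
      · intro w _ w' _ h
        simp only [Sigma.mk.injEq, heq_eq_eq] at h
        exact Prod.ext h.1 h.2
    calc W.card * K ≤ (∑ p ∈ P.filter (fun p => MvPolynomial.eval p Q ≠ 0), (P.filter (fun q => sv F q = sv F p)).card) * K :=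
          Nat.mul_le_mul_right _ this
      _ = ∑ p ∈ P.filter (fun p => MvPolynomial.eval p Q ≠ 0), (P.filter (fun q => sv F q = sv F p)).card * K := sum_mul _ _ _
      _ ≤ ∑ p ∈ P.filter (fun p => MvPolynomial.eval p Q ≠ 0), P.card := by
          apply sum_le_sum
          intro p hp
          apply hcell
          intro t
          have n1 := (mem_filter.mp hp).2
          rw [hQ, map_prod, prod_ne_zero_iff] at n1
          exact sign_ne_zero.mpr (n1 t (mem_univ _))
      _ ≤ P.card * P.card := by
          rw [sum_const, smul_eq_mul]
          exact Nat.mul_le_mul_right _ (card_filter_le _ _)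
  set k : Cir → ℕ := fun c => (W.filter (fun w => Nx S c w.1 w.2)).card with hk
  have h1 : ∀ c ∈ M, (S c).card ≤ 1 + 2*D' + k c := by
    intro c _
    refine nz_card F hdeg P S c (fun p hp => ?_) W ?_ _ ?_
    · exact mem_filter.mp hp
    · intro p hp q hq h1 h2
      exact mem_filter.mpr ⟨mem_product.mpr ⟨hp, hq⟩, h1, h2⟩
    · intro W' hW' h
      exact card_le_card fun w hw => mem_filter.mpr ⟨hW' hw, h w hw⟩
  have hb1 := hb M S (fun c _ p hp => (mem_filter.mp hp).2.1) W
  have hsw : ∑ c ∈ M, k c = ∑ w ∈ W, (M.filter (fun c => Nx S c w.1 w.2)).card := by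
    simp only [hk, card_filter]
    rw [sum_comm]
  have hsw' : ((∑ c ∈ M, k c : ℕ):ℝ) ≤ W.card + C*(M.card:ℝ)^(3/2+ε) := by
    rw [hsw]
    convert hb1 using 3
  -- zero part
  set Z := P.filter (fun p => MvPolynomial.eval p Q = 0) with hZ
  have h2 : ∀ c, (P.filter (fun p => c.onUp p)).card ≤ (S c).card + (Z.filter (fun p => c.onUp p)).card := by
    intro c
    refine (card_le_card ?_).trans (card_union_le _ _)
    intro p hp
    rw [mem_filter] at hp
    by_cases h : MvPolynomial.eval p Q = 0
    · exact mem_union_right _ (mem_filter.mpr ⟨mem_filter.mpr ⟨hp.1, h⟩, hp.2⟩)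
    · exact mem_union_left _ (mem_filter.mpr ⟨hp.1, hp.2, h⟩)
  have h3 : ∑ c ∈ M, (Z.filter (fun p => c.onUp p)).card ≤ M.card * (2*D') + (P.card + 2*D'^2) := by
    rw [← sum_filter_add_sum_filter_not M (fun c => ¬ c.inZ Q)]
    apply add_le_add
    · refine (sum_le_sum (fun c hc => ?_)).trans ((sum_const _).le.trans (Nat.mul_le_mul_right _ (card_filter_le M (fun c => ¬ c.inZ Q))))
      refine zero_card c Q hdeg (mem_filter.mp hc).2 _ fun p hp => ?_
      rw [mem_filter, mem_filter] at hp
      exact ⟨hp.2, hp.1.2⟩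
    · have a1 := up_kst Z (M.filter (fun c => ¬ ¬ c.inZ Q))
      have a2 := (inZ_card (M.filter (fun c => ¬ ¬ c.inZ Q)) Q hQ0 (fun c hc => not_not.mp (mem_filter.mp hc).2)).trans hdeg
      have a3 : Z.card ≤ P.card := card_filter_le _ _
      have a4 := Nat.pow_le_pow_left a2 2
      have a5 : Inc upR Z (M.filter (fun c => ¬ ¬ c.inZ Q)) = ∑ c ∈ M.filter (fun c => ¬ ¬ c.inZ Q), (Z.filter (fun p => c.onUp p)).card := by
        unfold Inc
        refine sum_congr rfl fun c _ => ?_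
        congr
      omega
  have h4 : Inc upR P M ≤ M.card * (1+2*D') + ∑ c ∈ M, k c + (M.card * (2*D') + (P.card + 2*D'^2)) := by
    calc Inc upR P M = ∑ c ∈ M, (P.filter (fun p => c.onUp p)).card := by
          unfold Inc
          refine sum_congr rfl fun c _ => ?_
          congr
      _ ≤ ∑ c ∈ M, ((1+2*D' + k c) + (Z.filter (fun p => c.onUp p)).card) :=
          sum_le_sum fun c hc => (h2 c).trans (Nat.add_le_add_right (h1 c hc) _)
      _ ≤ _ := by
          rw [sum_add_distrib, sum_add_distrib, sum_const, smul_eq_mul]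
          omega
  have h5 : (W.card : ℝ) ≤ P.card^2 / K := by
    rw [le_div_iff₀ (by exact_mod_cast hK), sq]
    exact_mod_cast hWc
  have h6 : (Inc upR P M : ℝ) ≤ M.card * (1+2*D') + ((∑ c ∈ M, k c : ℕ):ℝ) + (M.card * (2*D') + (P.card + 2*D'^2)) := by
    exact_mod_cast h4
  linarith

end Cir
end Circ5Sec

section Circ6Sec
namespace Cir

lemma up_arith {m n R D D' G C ε I : ℝ} (hm : 1 ≤ m) (hn : 1 ≤ n) (hε : 0 < ε) (hG : 1 ≤ G) (hC : 0 < C)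
    (hR : R^3 * m = n^2) (hR1 : 1 ≤ R) (hmn : m ≤ n^2) (hnm : n ≤ m^2) (hD0 : 1 ≤ D) (hD : R ≤ 2 * D) (hD'0 : 0 ≤ D') (hD' : D' ≤ G * n^ε * R)
    (hI : I ≤ m * (1 + 4 * D') + n^2 / D^2 + C * m^(3/2+ε) + n + 2 * D'^2) :
    I ≤ (8 * G^2 + 8 + C) * n^(2*ε) * ((m*n)^(2/3:ℝ) + m^(3/2:ℝ) + n + m) := by
  have hm0 : 0 < m := by linarith
  have hn0 : 0 < n := by linarith
  have hR0 : 0 < R := by linarith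
  -- m R = (mn)^{2/3}
  have e1 : m * R = (m*n)^(2/3:ℝ) := by
    have h : (m * R)^3 = ((m*n)^(2/3:ℝ))^3 := by
      rw [← Real.rpow_natCast ((m*n)^(2/3:ℝ)) 3, ← Real.rpow_mul (by positivity)]
      norm_num
      linear_combination m^2 * hR
    exact (pow_left_inj₀ (by positivity) (by positivity) (by norm_num)).mp h
  have e2 : n^2 / D^2 ≤ 4 * (m*n)^(2/3:ℝ) := by
    rw [← e1, div_le_iff₀ (by positivity), ← hR]
    have : R^2 ≤ (2*D)^2 := by gcongr
    have h2 : 0 < m * R := by positivity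
    nlinarith
  have e3 : R^2 ≤ n := by
    by_contra h
    push Not at h
    have h1 : n^3 < (R^2)^3 := by gcongr
    have h2 : (R^2)^3 * m^2 = n^4 := by linear_combination (R^3*m+n^2) * hR
    have h3 : n^3 * m^2 < n^4 := by rw [← h2]; gcongr
    have h4 : n^3 * n ≤ n^3 * m^2 := by gcongr
    linarith [show n^3 * n = n^4 by ring]
  have e4 : m^(3/2+ε) ≤ n^(2*ε) * m^(3/2:ℝ) := by
    rw [Real.rpow_add hm0, mul_comm]
    gcongr
    rw [Real.rpow_mul hn0.le, Real.rpow_two]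
    gcongr
  have hne : 1 ≤ n^ε := Real.one_le_rpow hn hε.le
  have hsq : n^(2*ε) = n^ε * n^ε := by rw [two_mul, Real.rpow_add hn0]
  rw [hsq] at e4 ⊢
  generalize n^ε = g at *
  have e5 : m * D' ≤ G * g * (m*n)^(2/3:ℝ) := by
    rw [← e1]
    calc m * D' ≤ m * (G * g * R) := by gcongr
      _ = _ := by ring
  have e6 : D'^2 ≤ G^2 * (g*g) * n := by
    calc D'^2 ≤ (G*g*R)^2 := by gcongr
      _ = G^2*(g*g) * R^2 := by ring
      _ ≤ _ := by gcongr
  have hX : 0 ≤ (m*n)^(2/3:ℝ) := by positivity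
  have hY : 0 ≤ m^(3/2:ℝ) := by positivity
  generalize (m*n)^(2/3:ℝ) = X at *
  generalize m^(3/2:ℝ) = Y at *
  have e7 : C * m^(3/2+ε) ≤ C * (g*g*Y) := by gcongr
  have gg : 1 ≤ g*g := one_le_mul_of_one_le_of_one_le hne hne
  have gg' : g ≤ g*g := le_mul_of_one_le_left (by linarith) hne
  have GG : G ≤ G^2 := by rw [sq]; exact le_mul_of_one_le_left (by linarith) hG
  have e8 : G * g * X ≤ G^2 * (g*g) * X := by gcongr
  have e9 : 4 * X ≤ 4 * (g*g) * X := by linarith [mul_le_mul_of_nonneg_right gg hX]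
  have e10 : m ≤ (g*g)*m := by linarith [mul_le_mul_of_nonneg_right gg hm0.le]
  have e11 : n ≤ (g*g)*n := by linarith [mul_le_mul_of_nonneg_right gg hn0.le]
  have p1 : 0 ≤ G^2 * (g*g) * X := by positivity
  have p2 : 0 ≤ G^2 * (g*g) * Y := by positivity
  have p3 : 0 ≤ G^2 * (g*g) * m := by positivity
  have p4 : 0 ≤ G^2 * (g*g) * n := by positivity
  have p5 : 0 ≤ (g*g) * Y := by positivity
  have p6 : 0 ≤ C*(g*g) * X := by positivity
  have p7 : 0 ≤ C*(g*g) * m := by positivity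
  have p8 : 0 ≤ C*(g*g) * n := by positivity
  have p9 : 0 ≤ (g*g) * X := by positivity
  have p10 : 0 ≤ (g*g) * m := by positivity
  have p11 : 0 ≤ (g*g) * n := by positivity
  calc I ≤ m + 4 * (m*D') + n^2/D^2 + C * m^(3/2+ε) + n + 2*D'^2 := by linarith
    _ ≤ (g*g)*m + 4 * (G^2 * (g*g) * X) + 4 * (g*g)*X + C * (g*g*Y) + (g*g)*n + 2 * (G^2*(g*g)*n) := by linarith
    _ ≤ _ := by
      have : (8 * G^2 + 8 + C) * (g*g) * (X + Y + n + m) = 8*(G^2 * (g*g) * X) + 8*(G^2 * (g*g) * Y) + 8*(G^2 * (g*g) * m) + 8*(G^2 * (g*g) * n)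
        + 8 * ((g*g)*X) + 8 * ((g*g)*Y) + 8 * ((g*g)*m) + 8*((g*g)*n) + C*(g*g)*X + C*(g*g*Y) + C*(g*g)*m + C*(g*g)*n := by ring
      rw [this]
      linarith

theorem up_bound (ε : ℝ) (hε : 0 < ε) : ∃ C : ℝ, 0 < C ∧ ∀ (P : Finset (Fin 2 → ℝ)) (M : Finset Cir), P.Nonempty → M.Nonempty →
    (Inc upR P M : ℝ) ≤ C * (P.card:ℝ)^ε * (((M.card:ℝ) * P.card)^(2/3:ℝ) + (M.card:ℝ)^(3/2:ℝ) + P.card + M.card) := by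
  classical
  obtain ⟨C, hC, hc⟩ := up_cell (ε/2) (by positivity)
  set G : ℝ := 704 * (1/((ε/2) * Real.log 2)) + 1 with hG
  have hl2 : 0 < Real.log 2 := Real.log_pos (by norm_num)
  have hG1 : 1 ≤ G := by rw [hG]; have : 0 < 704 * (1/((ε/2) * Real.log 2)) := by positivity
                         linarith
  refine ⟨8*G^2+8+C, by positivity, fun P M hP hM => ?_⟩
  have hn : (1:ℝ) ≤ P.card := by exact_mod_cast hP.card_pos
  have hm : (1:ℝ) ≤ M.card := by exact_mod_cast hM.card_pos
  have hne : (1:ℝ) ≤ (P.card:ℝ)^ε := Real.one_le_rpow hn hε.le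
  have hcoef : 1 ≤ (8*G^2+8+C) * (P.card:ℝ)^ε := by nlinarith
  have p1 : (0:ℝ) ≤ ((M.card:ℝ) * P.card)^(2/3:ℝ) := by positivity
  have p2 : (0:ℝ) ≤ (M.card:ℝ)^(3/2:ℝ) := by positivity
  have triv : Inc upR P M ≤ M.card * P.card := by
    unfold Inc
    exact (sum_le_sum fun c _ => card_filter_le _ _).trans (by rw [sum_const, smul_eq_mul])
  have trivR : (Inc upR P M:ℝ) ≤ M.card * P.card := by exact_mod_cast triv
  have kst : (Inc upR P M:ℝ) ≤ P.card + 2 * (M.card:ℝ)^2 := by exact_mod_cast up_kst P M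
  by_cases h1 : (P.card:ℝ) ≤ (M.card:ℝ)^2
  swap
  · push Not at h1
    have : 8 ≤ (8*G^2+8+C) * (P.card:ℝ)^ε := by nlinarith
    calc (Inc upR P M:ℝ) ≤ 8 * (0 + 0 + P.card + 0) := by linarith
      _ ≤ _ := by gcongr; linarith
  by_cases h2 : (M.card:ℝ) ≤ (P.card:ℝ)^2
  swap
  · push Not at h2
    have : (M.card:ℝ) * P.card ≤ (M.card:ℝ)^(3/2:ℝ) := by
      rw [show (3/2:ℝ) = 1 + 1/2 by norm_num, Real.rpow_add (by linarith), Real.rpow_one, ← Real.sqrt_eq_rpow]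
      gcongr
      exact Real.le_sqrt_of_sq_le h2.le
    calc (Inc upR P M:ℝ) ≤ 1 * (0 + (M.card:ℝ)^(3/2:ℝ) + 0 + 0) := by linarith
      _ ≤ _ := by gcongr <;> linarith
  -- main case
  set m : ℝ := (M.card : ℝ) with hmd
  set n : ℝ := (P.card : ℝ) with hnd
  obtain ⟨R, hRd⟩ : ∃ R, R = (n^2/m)^(1/3:ℝ) := ⟨_, rfl⟩
  have hq1 : 1 ≤ n^2/m := by rw [le_div_iff₀ (by linarith)]; linarith
  have hR1 : 1 ≤ R := by rw [hRd]; exact Real.one_le_rpow hq1 (by norm_num)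
  have hR3 : R^3 = n^2/m := by
    rw [hRd, ← Real.rpow_natCast, ← Real.rpow_mul (by linarith)]; norm_num
  have hR : R^3*m = n^2 := by rw [hR3]; field_simp
  have hRn : R ≤ n := by
    by_contra h
    push Not at h
    have : n^3 < R^3 := by gcongr
    have h3 : n^3 * 1 ≤ R^3 * m := by gcongr
    have h4 : n^2 * 1 ≤ n^2 * n := by gcongr
    nlinarith
  obtain ⟨k, hk1, hk2⟩ := exists_pow_between 2 le_rfl R hR1
  have hT : 31^(88*k) * ((2^k)^2)^2 ≤ 32^(88*k) := by
    have : 31^88 * 16 ≤ 32^88 := by norm_num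
    calc 31^(88*k) * ((2^k)^2)^2 = (31^88*16)^k := by
          rw [mul_pow, ← pow_mul, ← pow_mul, ← pow_mul, show 16 = 2^4 by norm_num, ← pow_mul]; ring_nf
      _ ≤ (32^88)^k := Nat.pow_le_pow_left this k
      _ = _ := by rw [← pow_mul]
  obtain ⟨a, ha0, hcell⟩ := partition_limit (d := 2) (D := 2^k) (T := 88*k) (by norm_num) (by positivity) (fun x : P => x.1) hT
  have hdeg : (∏ t, polyOf (a t)).totalDegree ≤ 88*k*(2*(4*2^k)) := by
    refine (MvPolynomial.totalDegree_finsetProd _ _).trans ?_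
    refine (sum_le_sum fun t _ => totalDegree_polyOf (a t)).trans ?_
    simp
  have hmain := hc P M (88*k) (fun t => polyOf (a t)) (88*k*(2*(4*2^k))) ((2^k)^2)
    (fun t h => ha0 t (coeff_polyOf _ h)) hdeg ?_ (by positivity)
  · have hkb : (k:ℝ) ≤ 1/((ε/2) * Real.log 2) * n^(ε/2) := by
      have h5 : (k:ℝ) * ((ε/2) * Real.log 2) ≤ n^(ε/2) := by
        have h6 : ((2:ℝ)^k)^(ε/2) ≤ n^(ε/2) := by
          gcongr
          push_cast at hk1
          linarith
        have h7 : ((2:ℝ)^k)^(ε/2) = Real.exp ((k:ℝ) * ((ε/2) * Real.log 2)) := by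
          rw [Real.rpow_def_of_pos (by positivity), Real.log_pow]; ring_nf
        rw [h7] at h6
        linarith [Real.add_one_le_exp ((k:ℝ) * ((ε/2) * Real.log 2))]
      rw [div_mul_eq_mul_div, one_mul, le_div_iff₀ (by positivity)]
      exact h5
    have := up_arith (D := 2^k) (D' := 88*k*(2*(4*2^k))) (G := G) (ε := ε/2) hm hn (by positivity) hG1 hC hR hR1 h2 h1
      (one_le_pow₀ (by norm_num)) (by push_cast at hk2; exact hk2) (by positivity) ?_ (by push_cast at hmain; exact hmain)
    · rw [show 2 * (ε/2) = ε by ring] at this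
      exact this
    · have hx : 0 ≤ n^(ε/2) := by positivity
      push_cast at hk1
      calc (88*k*(2*(4*2^k)) : ℝ) = 704 * k * 2^k := by ring
        _ ≤ 704 * (1/((ε/2) * Real.log 2) * n^(ε/2)) * R := by gcongr
        _ ≤ G * n^(ε/2) * R := by
          rw [hG, add_mul, ← mul_assoc 704]
          gcongr
          linarith
  · intro σ hσ
    have := hcell σ hσ
    rw [Fintype.card_coe] at this
    refine le_trans (Nat.mul_le_mul_right _ ?_) this
    have e : P.filter (fun p => sv (fun t => polyOf (a t)) p = σ) ⊆
        (univ.filter (fun x : P => ∀ t, SignType.sign (MvPolynomial.eval x.1 (polyOf (a t))) = σ t)).image Subtype.val := by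
      intro p hp
      rw [mem_filter] at hp
      rw [mem_image]
      exact ⟨⟨p, hp.1⟩, mem_filter.mpr ⟨mem_univ _, fun t => congrFun hp.2 t⟩, rfl⟩
    exact (card_le_card e).trans card_image_le

end Cir
end Circ6Sec

section Circ7Sec
lemma Inc_swap {ι υ : Type*} (R : ι → υ → Prop) (X : Finset ι) (V : Finset υ) :
    Inc R X V = Inc (fun v x => R x v) V X := by
  classical
  unfold Inc
  simp only [card_filter]
  rw [sum_comm]

namespace Cir

/-- reflection of points -/
def rp (p : Fin 2 → ℝ) : Fin 2 → ℝ := ![p 0, -p 1]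
/-- reflection of circles -/
def rc (c : Cir) : Cir := ⟨c.a, -c.b, c.r, c.hr⟩

lemma rp_inj : Function.Injective rp := by
  intro p q h
  have h0 := congrFun h 0
  have h1 := congrFun h 1
  simp [rp] at h0 h1
  funext i
  fin_cases i
  · exact h0
  · exact h1

lemma rc_inj : Function.Injective rc := by
  intro p q h
  have h0 := congrArg Cir.a h
  have h1 := congrArg Cir.b h
  have h2 := congrArg Cir.r h
  simp [rc] at h0 h1 h2
  exact Cir.ext h0 h1 h2

/-- point on circle -/
def onC (p : Fin 2 → ℝ) (c : Cir) : Prop := c.q (p 0) (p 1) = 0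

lemma onC_cases {p : Fin 2 → ℝ} {c : Cir} (h : onC p c) : upR p c ∨ upR (rp p) (rc c) := by
  rcases le_total c.b (p 1) with h1 | h1
  · left; exact c.eq_up h1 h
  · right
    have : (rc c).q (rp p 0) (rp p 1) = 0 := by
      unfold onC q at h
      simp only [q, rc, rp, Matrix.cons_val_zero, Matrix.cons_val_one]
      linarith
    exact (rc c).eq_up (by simp [rc, rp]; exact h1) this

theorem circ_bound (ε : ℝ) (hε : 0 < ε) : ∃ C : ℝ, 0 < C ∧ ∀ (P : Finset (Fin 2 → ℝ)) (M : Finset Cir), P.Nonempty → M.Nonempty →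
    (Inc onC P M : ℝ) ≤ C * (P.card:ℝ)^ε * (((M.card:ℝ) * P.card)^(2/3:ℝ) + (M.card:ℝ)^(3/2:ℝ) + P.card + M.card) := by
  classical
  obtain ⟨C, hC, h⟩ := up_bound ε hε
  refine ⟨2*C, by positivity, fun P M hP hM => ?_⟩
  have h1 := h P M hP hM
  have h2 := h (P.map ⟨rp, rp_inj⟩) (M.map ⟨rc, rc_inj⟩) (hP.map) (hM.map)
  rw [card_map, card_map, Inc_map] at h2
  have h3 : Inc onC P M ≤ Inc upR P M + Inc (fun x u => upR (rp x) (rc u)) P M := by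
    unfold Inc
    rw [← sum_add_distrib]
    refine sum_le_sum fun c _ => (card_le_card ?_).trans (card_union_le _ _)
    intro p hp
    rw [mem_filter] at hp
    rw [mem_union, mem_filter, mem_filter]
    rcases onC_cases hp.2 with h | h
    · exact Or.inl ⟨hp.1, h⟩
    · exact Or.inr ⟨hp.1, h⟩
  have h4 : (Inc onC P M:ℝ) ≤ Inc upR P M + Inc (fun x u => upR (rp x) (rc u)) P M := by exact_mod_cast h3
  change ((Inc (fun x u => upR (rp x) (rc u)) P M : ℕ) : ℝ) ≤ _ at h2
  linarith

end Cir

/-- generic pole -/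
lemma exists_pole {ι : Type*} (B : Finset ι) (h x y : ι → ℝ) (hh : ∀ i ∈ B, h i ≠ 0) :
    ∃ c s : ℝ, c^2+s^2 = 1 ∧ ∀ i ∈ B, c * x i + s * y i ≠ h i := by
  classical
  open Polynomial in
  set F : ι → ℝ[X] := fun i => C (h i + x i) * X^2 - C (2*y i) * X + C (h i - x i) with hF
  have hev : ∀ i t, (F i).eval t = (h i + x i) * t^2 - 2*y i*t + (h i - x i) := by
    intro i t; simp [hF]
  have hne : ∏ i ∈ B, F i ≠ 0 := by
    rw [prod_ne_zero_iff]
    intro i hi h0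
    have a1 := hev i 1
    have a2 := hev i (-1)
    rw [h0] at a1 a2
    simp at a1 a2
    exact hh i hi (by linarith)
  obtain ⟨t, ht⟩ : ∃ t, (∏ i ∈ B, F i).eval t ≠ 0 := by
    by_contra hn
    push Not at hn
    exact hne (Polynomial.funext fun t => by rw [hn t, Polynomial.eval_zero])
  rw [Polynomial.eval_prod, prod_ne_zero_iff] at ht
  have hp : (1+t^2) ≠ 0 := by positivity
  refine ⟨(1-t^2)/(1+t^2), 2*t/(1+t^2), by field_simp; ring, fun i hi e => ?_⟩
  apply ht i hi
  rw [hev]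
  field_simp at e
  linarith

section Stereo
variable (c s : ℝ)
/-- stereographic projection from (c,s,0) -/
def st (a : Fin 3 → ℝ) : Fin 2 → ℝ := ![(-s * a 0 + c * a 1)/(1 - (c * a 0 + s * a 1)), a 2/(1 - (c * a 0 + s * a 1))]

def nsq (n : Fin 3 → ℝ) : ℝ := n 0^2 + n 1^2 + n 2^2

lemma st_inj (hcs : c^2+s^2 = 1) {a b : Fin 3 → ℝ} (ha : nsq a = 1) (hb : nsq b = 1) (ha' : c * a 0 + s * a 1 ≠ 1)
    (hb' : c * b 0 + s * b 1 ≠ 1) (h : st c s a = st c s b) : a = b := by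
  have h0 := congrFun h 0
  have h1 := congrFun h 1
  simp only [st, Matrix.cons_val_zero, Matrix.cons_val_one] at h0 h1
  unfold nsq at ha hb
  obtain ⟨d, hd⟩ : ∃ d, d = 1 - (c * a 0 + s * a 1) := ⟨_, rfl⟩
  obtain ⟨e, he⟩ : ∃ e, e = 1 - (c * b 0 + s * b 1) := ⟨_, rfl⟩
  have hd0 : d ≠ 0 := by rw [hd]; intro h; apply ha'; linarith
  have he0 : e ≠ 0 := by rw [he]; intro h; apply hb'; linarith
  rw [← hd, ← he] at h0 h1
  have k1 : ((-s * a 0 + c * a 1)/d)^2 + (a 2/d)^2 = 2/d - 1 := by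
    field_simp
    rw [hd]
    linear_combination ha + (-(a 0)^2 - (a 1)^2) * (-hcs)
  have k2 : ((-s * b 0 + c * b 1)/e)^2 + (b 2/e)^2 = 2/e - 1 := by
    field_simp
    rw [he]
    linear_combination hb + (-(b 0)^2 - (b 1)^2) * (-hcs)
  rw [h0, h1, k2] at k1
  have hde : d = e := by
    have : 2/e = 2/d := by linarith
    field_simp at this
    exact this
  rw [hde] at h0 h1
  rw [div_left_inj' he0] at h0 h1
  have k3 : c * a 0 + s * a 1 = c * b 0 + s * b 1 := by linarith
  funext i
  fin_cases i
  · show a 0 = b 0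
    linear_combination c * k3 - s * h0 + (b 0 - a 0) * hcs
  · show a 1 = b 1
    linear_combination s * k3 + c * h0 + (b 1 - a 1) * hcs
  · exact h1

/-- denominator -/
def kk (n : Fin 3 → ℝ) : ℝ := c * n 0 + s * n 1 - nsq n/2

/-- circle of a point -/
def sc (n : Fin 3 → ℝ) : Cir :=
  if h : 0 < nsq n - (nsq n/2)^2 ∧ kk c s n ≠ 0 then
    ⟨-(-s * n 0 + c * n 1)/kk c s n, - n 2/kk c s n, √(nsq n - (nsq n/2)^2)/|kk c s n|,
      div_pos (Real.sqrt_pos.mpr h.1) (abs_pos.mpr h.2)⟩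
  else ⟨0,0,1,one_pos⟩

lemma sc_on (hcs : c^2+s^2 = 1) {n a : Fin 3 → ℝ} (h1 : 0 < nsq n - (nsq n/2)^2) (h2 : kk c s n ≠ 0) (ha : nsq a = 1)
    (ha' : c * a 0 + s * a 1 ≠ 1) (h : ud n a) : Cir.onC (st c s a) (sc c s n) := by
  have hp : n 0 * a 0 + n 1 * a 1 + n 2 * a 2 = nsq n/2 := by
    unfold ud at h
    rw [Fin.sum_univ_three] at h
    unfold nsq at *
    linarith
  unfold Cir.onC Cir.q
  rw [sc, dif_pos ⟨h1, h2⟩]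
  simp only [st, Matrix.cons_val_zero, Matrix.cons_val_one]
  rw [div_pow _ |_|, Real.sq_sqrt h1.le, sq_abs]
  have hd0 : 1 - (c * a 0 + s * a 1) ≠ 0 := by intro h; apply ha'; linarith
  obtain ⟨d, hd⟩ : ∃ d, d = 1 - (c * a 0 + s * a 1) := ⟨_, rfl⟩
  rw [← hd] at hd0 ⊢
  obtain ⟨k, hk⟩ : ∃ k, k = kk c s n := ⟨_, rfl⟩
  rw [← hk] at h2 ⊢
  have hk' : k = c * n 0 + s * n 1 - nsq n/2 := hk
  obtain ⟨a1, ha1⟩ : ∃ a1, a1 = -s * a 0 + c * a 1 := ⟨_, rfl⟩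
  obtain ⟨n1, hn1⟩ : ∃ n1, n1 = -s * n 0 + c * n 1 := ⟨_, rfl⟩
  obtain ⟨n3, hn3⟩ : ∃ n3, n3 = c * n 0 + s * n 1 := ⟨_, rfl⟩
  obtain ⟨a3, ha3⟩ : ∃ a3, a3 = c * a 0 + s * a 1 := ⟨_, rfl⟩
  have E1 : a1^2 + a 2^2 + a3^2 = 1 := by
    rw [ha1, ha3]; unfold nsq at ha; linear_combination ha + (a 0^2 + a 1^2) * hcs
  have E2 : n1^2 + n 2^2 + n3^2 = nsq n := by
    rw [hn1, hn3]; unfold nsq; linear_combination (n 0^2 + n 1^2) * hcs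
  have E3 : n1*a1 + n 2*a 2 + n3*a3 = nsq n/2 := by
    rw [hn1, hn3, ha1, ha3]; linear_combination hp + (n 0*a 0 + n 1*a 1) * hcs
  rw [← ha1, ← hn1]
  rw [← ha3] at hd
  rw [← hn3] at hk'
  generalize nsq n = q at *
  generalize n 2 = n2 at *
  generalize a 2 = a2 at *
  clear hk hn1 hn3 ha1 ha3 hp h ha ha' hcs h1
  have g : (a1/d - -n1/k)^2 + (a2/d - -n2/k)^2 - (q-(q/2)^2)/k^2
      = ((a1*k+n1*d)^2 + (a2*k+n2*d)^2 - (q-(q/2)^2)*d^2)/(d*k)^2 := by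
    field_simp
    ring
  rw [g]
  have : (a1*k+n1*d)^2 + (a2*k+n2*d)^2 - (q-(q/2)^2)*d^2 = 0 := by
    have hq : q = 2*(n3-k) := by linarith
    have ha3 : a3 = 1 - d := by linarith
    subst hq ha3
    linear_combination k^2 * E1 + d^2 * E2 + 2*k*d*E3
  rw [this, zero_div]

lemma sc_inj (hcs : c^2+s^2 = 1) {n m : Fin 3 → ℝ} (h1 : 0 < nsq n - (nsq n/2)^2) (h2 : kk c s n ≠ 0)
    (h1' : 0 < nsq m - (nsq m/2)^2) (h2' : kk c s m ≠ 0) (h : sc c s n = sc c s m) : n = m := by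
  rw [sc, sc, dif_pos ⟨h1, h2⟩, dif_pos ⟨h1', h2'⟩] at h
  rw [Cir.mk.injEq] at h
  obtain ⟨e1, e2, e3⟩ := h
  have hm0 : nsq m ≠ 0 := by intro h; rw [h] at h1'; norm_num at h1'
  have e3' : (nsq n - (nsq n/2)^2)/(kk c s n)^2 = (nsq m - (nsq m/2)^2)/(kk c s m)^2 := by
    have : (√(nsq n - (nsq n/2)^2)/|kk c s n|)^2 = (√(nsq m - (nsq m/2)^2)/|kk c s m|)^2 := by rw [e3]
    rwa [div_pow _ |_|, div_pow _ |_|, Real.sq_sqrt h1.le, Real.sq_sqrt h1'.le, sq_abs, sq_abs] at this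
  have hk : kk c s n = c * n 0 + s * n 1 - nsq n/2 := rfl
  have hk' : kk c s m = c * m 0 + s * m 1 - nsq m/2 := rfl
  have E2 : (-s * n 0 + c * n 1)^2 + n 2^2 + (c * n 0 + s * n 1)^2 = nsq n := by
    unfold nsq; linear_combination (n 0^2 + n 1^2) * hcs
  have E2' : (-s * m 0 + c * m 1)^2 + m 2^2 + (c * m 0 + s * m 1)^2 = nsq m := by
    unfold nsq; linear_combination (m 0^2 + m 1^2) * hcs
  have fin : -s * n 0 + c * n 1 = -s * m 0 + c * m 1 → n 2 = m 2 → c * n 0 + s * n 1 = c * m 0 + s * m 1 → n = m := by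
    intro k1 k2 k3
    funext i
    fin_cases i
    · show n 0 = m 0
      linear_combination c * k3 - s * k1 + (m 0 - n 0) * hcs
    · show n 1 = m 1
      linear_combination s * k3 + c * k1 + (m 1 - n 1) * hcs
    · exact k2
  generalize -s * n 0 + c * n 1 = n1 at *
  generalize -s * m 0 + c * m 1 = m1 at *
  generalize c * n 0 + s * n 1 = n3 at *
  generalize c * m 0 + s * m 1 = m3 at *
  generalize n 2 = n2 at *
  generalize m 2 = m2 at *
  generalize nsq n = q at *
  generalize nsq m = q' at *
  generalize kk c s n = k at *
  generalize kk c s m = k' at *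
  -- n = (k/k') m
  obtain ⟨l, hl⟩ : ∃ l, l = k/k' := ⟨_, rfl⟩
  have f1 : n1 = l * m1 := by rw [hl]; field_simp at e1 ⊢; linarith
  have f2 : n2 = l * m2 := by rw [hl]; field_simp at e2 ⊢; linarith
  have fk : k = l * k' := by rw [hl]; field_simp
  have hl0 : l ≠ 0 := by rw [hl]; exact div_ne_zero h2 h2'
  have f4 : q - (q/2)^2 = l^2 * (q' - (q'/2)^2) := by
    rw [hl]; field_simp at e3' ⊢; linarith
  -- n3 + q/2 = l (m3+q'/2)
  have f5 : (n3 - q/2)*(n3+q/2) = l^2 * ((m3-q'/2)*(m3+q'/2)) := by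
    have : (n3 - q/2)*(n3+q/2) = (q - (q/2)^2) - n1^2 - n2^2 := by linear_combination E2
    rw [this, f4, f1, f2]
    linear_combination (-l^2) * E2'
  have f6 : n3 + q/2 = l * (m3+q'/2) := by
    rw [← hk, ← hk', fk] at f5
    have : (l*k') * ((n3 + q/2) - l * (m3+q'/2)) = 0 := by linear_combination f5
    rcases mul_eq_zero.mp this with h | h
    · exact absurd h (mul_ne_zero hl0 h2')
    · linarith
  have f7 : n3 = l * m3 := by
    have : n3 - q/2 = l * (m3 - q'/2) := by rw [← hk, ← hk', fk]
    linarith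
  have f8 : q = l * q' := by rw [f7] at f6; linarith
  have f9 : q = l^2 * q' := by rw [← E2, ← E2', f1, f2, f7]; ring
  have f10 : l = 1 := by
    have : (l * q') * (l - 1) = 0 := by linear_combination f8 - f9
    rcases mul_eq_zero.mp this with h | h
    · exact absurd h (mul_ne_zero hl0 hm0)
    · linarith
  rw [f10, one_mul] at f1 f2 f7
  exact fin f1 f2 f7

end Stereo

lemma flat_one {n a b : Fin 3 → ℝ} (hn : n ≠ 0) (h0 : nsq n - (nsq n/2)^2 ≤ 0) (ha : nsq a = 1) (hb : nsq b = 1)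
    (h1 : ud n a) (h2 : ud n b) : a = b := by
  have hq : 0 < nsq n := by
    unfold nsq
    by_contra h
    apply hn
    funext i
    have : n 0 = 0 ∧ n 1 = 0 ∧ n 2 = 0 := by
      refine ⟨?_, ?_, ?_⟩ <;> nlinarith [sq_nonneg (n 0), sq_nonneg (n 1), sq_nonneg (n 2)]
    fin_cases i
    · exact this.1
    · exact this.2.1
    · exact this.2.2
  have key : ∀ a, nsq a = 1 → ud n a → ∀ i, n i = nsq n/2 * a i := by
    intro a ha h
    have hp : n 0 * a 0 + n 1 * a 1 + n 2 * a 2 = nsq n/2 := by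
      unfold ud at h
      rw [Fin.sum_univ_three] at h
      unfold nsq at *
      linarith
    have hs : (n 0 - nsq n/2 * a 0)^2 + (n 1 - nsq n/2 * a 1)^2 + (n 2 - nsq n/2 * a 2)^2 ≤ 0 := by
      have : (n 0 - nsq n/2 * a 0)^2 + (n 1 - nsq n/2 * a 1)^2 + (n 2 - nsq n/2 * a 2)^2
        = nsq n - 2 * (nsq n/2) * (n 0 * a 0 + n 1 * a 1 + n 2 * a 2) + (nsq n/2)^2 * nsq a := by
        unfold nsq; ring
      rw [this, ha, hp]
      linarith
    have z : ∀ x y w : ℝ, x^2+y^2+w^2 ≤ 0 → x = 0 ∧ y = 0 ∧ w = 0 := by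
      intro x y w h
      refine ⟨?_, ?_, ?_⟩ <;> nlinarith [sq_nonneg x, sq_nonneg y, sq_nonneg w]
    obtain ⟨z0, z1, z2⟩ := z _ _ _ hs
    intro i
    fin_cases i
    · exact sub_eq_zero.mp z0
    · exact sub_eq_zero.mp z1
    · exact sub_eq_zero.mp z2
  funext i
  have e1 := key a ha h1 i
  have e2 := key b hb h2 i
  have : nsq n/2 * (a i - b i) = 0 := by linarith
  rcases mul_eq_zero.mp this with h | h
  · linarith
  · linarith

theorem sphere_circ (ε : ℝ) (hε : 0 < ε) : ∃ C : ℝ, 0 < C ∧ ∀ (V A : Finset (Fin 3 → ℝ)), A.Nonempty → V.Nonempty →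
    (∀ a ∈ A, nsq a = 1) → (0 ∉ V) →
    (Inc ud V A : ℝ) ≤ C * (A.card:ℝ)^ε * (((V.card:ℝ) * A.card)^(2/3:ℝ) + (V.card:ℝ)^(3/2:ℝ) + A.card + V.card) := by
  classical
  obtain ⟨C, hC, hb⟩ := Cir.circ_bound ε hε
  refine ⟨C+1, by positivity, fun V A hA hV hA1 hV0 => ?_⟩
  have hnpos : ∀ n ∈ V, nsq n ≠ 0 := by
    intro n hn h
    have : n = 0 := by
      funext i
      unfold nsq at h
      have : n 0 = 0 ∧ n 1 = 0 ∧ n 2 = 0 := by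
        refine ⟨?_, ?_, ?_⟩ <;> nlinarith [sq_nonneg (n 0), sq_nonneg (n 1), sq_nonneg (n 2)]
      fin_cases i
      · exact this.1
      · exact this.2.1
      · exact this.2.2
    exact hV0 (this ▸ hn)
  obtain ⟨c, s, hcs, hp⟩ := exists_pole (A.disjSum V) (Sum.elim (fun _ => 1) (fun n => nsq n/2))
    (Sum.elim (fun a => a 0) (fun n => n 0)) (Sum.elim (fun a => a 1) (fun n => n 1)) (by
      intro i hi
      rcases mem_disjSum.mp hi with ⟨a, ha, rfl⟩ | ⟨n, hn, rfl⟩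
      · simp
      · have := hnpos n hn
        simp [this])
  have hpa : ∀ a ∈ A, c * a 0 + s * a 1 ≠ 1 := fun a ha => hp (Sum.inl a) (mem_disjSum.mpr (Or.inl ⟨a, ha, rfl⟩))
  have hpn : ∀ n ∈ V, kk c s n ≠ 0 := fun n hn h =>
    hp (Sum.inr n) (mem_disjSum.mpr (Or.inr ⟨n, hn, rfl⟩)) (sub_eq_zero.mp h)
  set V1 := V.filter (fun n => 0 < nsq n - (nsq n/2)^2) with hV1
  have hV1c : V1.card ≤ V.card := card_filter_le _ _
  set P := A.image (st c s) with hP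
  have hPc : P.card = A.card := card_image_of_injOn fun a ha b hb h =>
    st_inj c s hcs (hA1 a ha) (hA1 b hb) (hpa a ha) (hpa b hb) h
  set M := V1.image (sc c s) with hM
  have hinj : Set.InjOn (sc c s) V1 := by
    intro n hn m hm h
    have hn := mem_filter.mp hn
    have hm := mem_filter.mp hm
    exact sc_inj c s hcs hn.2 (hpn n hn.1) hm.2 (hpn m hm.1) h
  have hMc : M.card = V1.card := card_image_of_injOn hinj
  have e0 : Inc ud V A = ∑ n ∈ V, (A.filter (fun a => ud n a)).card := by
    rw [Inc_swap]
    unfold Inc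
    exact sum_congr rfl fun n _ => by congr
  have e1 : ∑ n ∈ V1, (A.filter (fun a => ud n a)).card ≤ Inc Cir.onC P M := by
    unfold Inc
    rw [hM, sum_image hinj]
    refine sum_le_sum fun n hn => ?_
    have hn := mem_filter.mp hn
    apply card_le_card_of_injOn (st c s)
    · intro a ha
      have ha := mem_filter.mp ha
      rw [mem_coe, mem_filter]
      exact ⟨mem_image_of_mem _ ha.1, sc_on c s hcs hn.2 (hpn n hn.1) (hA1 a ha.1) (hpa a ha.1) ha.2⟩
    · intro a ha b hb h
      have ha := (mem_filter.mp ha).1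
      have hb := (mem_filter.mp hb).1
      exact st_inj c s hcs (hA1 a ha) (hA1 b hb) (hpa a ha) (hpa b hb) h
  have e2 : ∑ n ∈ V.filter (fun n => ¬ 0 < nsq n - (nsq n/2)^2), (A.filter (fun a => ud n a)).card ≤ V.card := by
    refine le_trans (sum_le_sum (g := fun _ => 1) fun n hn => ?_) ?_
    · have hn := mem_filter.mp hn
      rw [card_le_one]
      intro a ha b hb
      have ha := mem_filter.mp ha
      have hb := mem_filter.mp hb
      exact flat_one (fun h => hV0 (h ▸ hn.1)) (not_lt.mp hn.2) (hA1 a ha.1) (hA1 b hb.1) ha.2 hb.2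
    · rw [sum_const, smul_eq_mul, mul_one]; exact card_filter_le _ _
  have e3 : Inc ud V A ≤ Inc Cir.onC P M + V.card := by
    rw [e0, ← sum_filter_add_sum_filter_not V (fun n => 0 < nsq n - (nsq n/2)^2)]
    exact add_le_add e1 e2
  have e3' : (Inc ud V A:ℝ) ≤ Inc Cir.onC P M + V.card := by exact_mod_cast e3
  have hn : (1:ℝ) ≤ A.card := by exact_mod_cast hA.card_pos
  have hne : (1:ℝ) ≤ (A.card:ℝ)^ε := Real.one_le_rpow hn hε.le
  have e4 : (Inc Cir.onC P M : ℝ) ≤ C * (A.card:ℝ)^ε * (((V.card:ℝ) * A.card)^(2/3:ℝ) + (V.card:ℝ)^(3/2:ℝ) + A.card + V.card) := by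
    rcases V1.eq_empty_or_nonempty with h | h
    · have : Inc Cir.onC P M = 0 := by rw [hM, h]; simp [Inc]
      rw [this, Nat.cast_zero]
      positivity
    · refine (hb P M (hA.image _) (h.image _)).trans ?_
      rw [hPc, hMc]
      have : (V1.card:ℝ) ≤ V.card := by exact_mod_cast hV1c
      gcongr
  have e5 : (V.card:ℝ) ≤ (A.card:ℝ)^ε * (((V.card:ℝ) * A.card)^(2/3:ℝ) + (V.card:ℝ)^(3/2:ℝ) + A.card + V.card) := by
    calc (V.card:ℝ) = 1 * (0 + 0 + 0 + V.card) := by ring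
      _ ≤ _ := by gcongr <;> positivity
  calc (Inc ud V A:ℝ) ≤ _ + _ := e3'
    _ ≤ _ + _ := add_le_add e4 e5
    _ = _ := by ring
end Circ7Sec

section BaseSec
lemma base_exp {x y z : ℝ} (hx : 0 ≤ x) (hxy : x ≤ 2*y) (hz : z = max 0 ((5*x-4*y)/11)) :
    0 ≤ z ∧ 3*z ≤ x ∧ z ≤ y ∧
    (let S := Real.exp (9/11*x+6/11*y) + Real.exp (2/3*(x+y)) + Real.exp y
     Real.exp (2*z+y) ≤ S ∧ Real.exp (2/3*(x+y)+z/3) ≤ S ∧ Real.exp (3/2*x-3/2*z) ≤ S ∧ Real.exp x ≤ S) := by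
  have p1 := Real.exp_pos (9/11*x+6/11*y)
  have p2 := Real.exp_pos (2/3*(x+y))
  have p3 := Real.exp_pos y
  rcases le_total ((5*x-4*y)/11) 0 with h | h
  · rw [max_eq_left h] at hz
    subst hz
    refine ⟨le_rfl, by linarith, by linarith, ?_, ?_, ?_, ?_⟩
    · have : Real.exp (2*0+y) ≤ Real.exp y := Real.exp_le_exp.mpr (by linarith)
      exact this.trans (by linarith)
    · have : Real.exp (2/3*(x+y)+0/3) ≤ Real.exp (2/3*(x+y)) := Real.exp_le_exp.mpr (by linarith)
      exact this.trans (by linarith)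
    · have : Real.exp (3/2*x-3/2*0) ≤ Real.exp (2/3*(x+y)) := Real.exp_le_exp.mpr (by linarith)
      linarith
    · have : Real.exp x ≤ Real.exp y := Real.exp_le_exp.mpr (by linarith)
      linarith
  · rw [max_eq_right h] at hz
    subst hz
    refine ⟨h, by linarith, by linarith, ?_, ?_, ?_, ?_⟩
    · have : Real.exp (2*((5*x-4*y)/11)+y) ≤ Real.exp (9/11*x+6/11*y) := Real.exp_le_exp.mpr (by linarith)
      linarith
    · have : Real.exp (2/3*(x+y)+((5*x-4*y)/11)/3) ≤ Real.exp (9/11*x+6/11*y) := Real.exp_le_exp.mpr (by linarith)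
      linarith
    · have : Real.exp (3/2*x-3/2*((5*x-4*y)/11)) ≤ Real.exp (9/11*x+6/11*y) := Real.exp_le_exp.mpr (by linarith)
      linarith
    · have : Real.exp x ≤ Real.exp (9/11*x+6/11*y) := Real.exp_le_exp.mpr (by linarith)
      linarith

lemma base_comb {x y z q Y B C C' h hq S T : ℝ} (hB : 1 ≤ B) (hC : 0 < C) (hC' : 0 < C') (hh : 1 ≤ h)
    (hz0 : 0 ≤ z) (hq0 : 0 ≤ hq) (hqh : hq ≤ h) (q0 : 0 < q) (hqR : q ≤ Real.exp z) (hY0 : 0 ≤ Y) (hY : Y ≤ B * Real.exp (x-3*z))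
    (s1 : Real.exp (2*z+y) ≤ S) (s2 : Real.exp (2/3*(x+y)+z/3) ≤ S) (s3 : Real.exp (3/2*x-3/2*z) ≤ S) (s4 : Real.exp x ≤ S)
    (hT : T ≤ C * hq * ((C'*h*Y^(2/3:ℝ)) * q^(7/3:ℝ) * (Real.exp y)^(2/3:ℝ) + (C'*h+1)*q^2*Real.exp y
      + (C'*h*(Y^(3/2:ℝ)+Y))*q^3 + Real.exp x)) :
    T ≤ C * (C'*(B+1+B^2+B)+2) * (h*h) * S := by
  have t1 : Y^(2/3:ℝ) * q^(7/3:ℝ) * (Real.exp y)^(2/3:ℝ) ≤ B * S := by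
    calc Y^(2/3:ℝ) * q^(7/3:ℝ) * (Real.exp y)^(2/3:ℝ) ≤ (B * Real.exp (x-3*z))^(2/3:ℝ) * (Real.exp z)^(7/3:ℝ) * (Real.exp y)^(2/3:ℝ) := by
          gcongr
      _ = B^(2/3:ℝ) * Real.exp (2/3*(x+y)+z/3) := by
          rw [Real.mul_rpow (by linarith) (Real.exp_pos _).le, ← Real.exp_mul, ← Real.exp_mul, ← Real.exp_mul, mul_assoc, mul_assoc, ← Real.exp_add, ← Real.exp_add]
          congr 2; ring
      _ ≤ B * S := by
          gcongr
          calc B^(2/3:ℝ) ≤ B^(1:ℝ) := Real.rpow_le_rpow_of_exponent_le hB (by norm_num)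
            _ = B := Real.rpow_one B
  have t2 : q^2 * Real.exp y ≤ S := by
    calc q^2 * Real.exp y ≤ (Real.exp z)^2 * Real.exp y := by gcongr
      _ = Real.exp (2*z+y) := by rw [← Real.exp_nat_mul, ← Real.exp_add]; norm_num
      _ ≤ S := s1
  have t3 : Y^(3/2:ℝ) * q^3 ≤ B^2 * S := by
    calc Y^(3/2:ℝ) * q^3 ≤ (B * Real.exp (x-3*z))^(3/2:ℝ) * (Real.exp z)^3 := by gcongr
      _ = B^(3/2:ℝ) * Real.exp (3/2*x-3/2*z) := by
          rw [Real.mul_rpow (by linarith) (Real.exp_pos _).le, ← Real.exp_mul, ← Real.exp_nat_mul, mul_assoc, ← Real.exp_add]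
          congr 2; push_cast; ring
      _ ≤ B^2 * S := by
          gcongr
          calc B^(3/2:ℝ) ≤ B^(2:ℝ) := Real.rpow_le_rpow_of_exponent_le hB (by norm_num)
            _ = B^2 := Real.rpow_two B
  have t4 : Y * q^3 ≤ B * S := by
    calc Y * q^3 ≤ (B * Real.exp (x-3*z)) * (Real.exp z)^3 := by gcongr
      _ = B * Real.exp x := by
          rw [← Real.exp_nat_mul, mul_assoc, ← Real.exp_add]
          congr 2; push_cast; ring
      _ ≤ B * S := by gcongr
  have hS : 0 < S := lt_of_lt_of_le (Real.exp_pos _) s4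
  have hhS : S ≤ h * S := le_mul_of_one_le_left hS.le hh
  have inner : (C'*h*Y^(2/3:ℝ)) * q^(7/3:ℝ) * (Real.exp y)^(2/3:ℝ) + (C'*h+1)*q^2*Real.exp y
      + (C'*h*(Y^(3/2:ℝ)+Y))*q^3 + Real.exp x ≤ h * ((C'*(B+1+B^2+B)+2) * S) := by
    have hp : 0 < C' * h := by positivity
    have u1 := mul_le_mul_of_nonneg_left t1 hp.le
    have u2 := mul_le_mul_of_nonneg_left t2 hp.le
    have u3 := mul_le_mul_of_nonneg_left t3 hp.le
    have u4 := mul_le_mul_of_nonneg_left t4 hp.le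
    linarith
  calc T ≤ _ := hT
    _ ≤ C * h * (h * ((C'*(B+1+B^2+B)+2) * S)) := by
        refine mul_le_mul (by gcongr) inner ?_ (by positivity)
        positivity
    _ = _ := by ring

theorem base_inc (ε : ℝ) (hε : 0 < ε) : ∃ C : ℝ, 0 < C ∧ ∀ (V A : Finset (Fin 3 → ℝ)), A.Nonempty → V.Nonempty →
    (∀ a ∈ A, nsq a = 1) → (0 ∉ V) → V.card ≤ A.card^2 →
    (Inc ud V A : ℝ) ≤ C * (A.card:ℝ)^ε * ((V.card:ℝ)^(9/11:ℝ) * (A.card:ℝ)^(6/11:ℝ) + ((V.card:ℝ) * A.card)^(2/3:ℝ) + A.card) := by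
  obtain ⟨C', hC', hcirc⟩ := sphere_circ (ε/2) (by positivity)
  obtain ⟨D, hD, C, hC, hit⟩ := sphere_iter (ε/2) (by positivity)
  set B : ℝ := 2 * (D:ℝ)^3 with hB
  have hD1 : (1:ℝ) ≤ D := by exact_mod_cast (by omega : 1 ≤ D)
  have hB1 : 1 ≤ B := by rw [hB]; have := one_le_pow₀ hD1 (n := 3); linarith
  refine ⟨C * (C'*(B+1+B^2+B)+2), by positivity, fun V A hA hV hA1 hV0 hVA => ?_⟩
  have hm : (1:ℝ) ≤ V.card := by exact_mod_cast hV.card_pos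
  have hn : (1:ℝ) ≤ A.card := by exact_mod_cast hA.card_pos
  have hmn : (V.card:ℝ) ≤ (A.card:ℝ)^2 := by exact_mod_cast hVA
  obtain ⟨x, hx⟩ : ∃ x, x = Real.log V.card := ⟨_, rfl⟩
  obtain ⟨y, hy⟩ : ∃ y, y = Real.log A.card := ⟨_, rfl⟩
  have ex : Real.exp x = V.card := by rw [hx, Real.exp_log (by linarith)]
  have ey : Real.exp y = A.card := by rw [hy, Real.exp_log (by linarith)]
  have hx0 : 0 ≤ x := by rw [hx]; exact Real.log_nonneg hm
  have hy0 : 0 ≤ y := by rw [hy]; exact Real.log_nonneg hn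
  have hxy : x ≤ 2*y := by
    rw [hx, hy]
    have := Real.log_le_log (by linarith) hmn
    rwa [Real.log_pow, Nat.cast_ofNat] at this
  obtain ⟨z, hz⟩ : ∃ z, z = max 0 ((5*x-4*y)/11) := ⟨_, rfl⟩
  obtain ⟨hz0, hzx, hzy, s1, s2, s3, s4⟩ := base_exp hx0 hxy hz
  obtain ⟨j, hj1, hj2⟩ := exists_pow_between D hD (Real.exp z) (Real.one_le_exp hz0)
  have hq0 : (0:ℝ) < (D:ℝ)^j := by positivity
  set Y := ⌈(V.card:ℝ)/((D:ℝ)^j)^3⌉₊ with hYd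
  have hYc : V.card ≤ Y * D^(3*j) := by
    have : (V.card:ℝ)/((D:ℝ)^j)^3 ≤ Y := Nat.le_ceil _
    rw [div_le_iff₀ (by positivity), ← pow_mul, mul_comm j 3] at this
    exact_mod_cast this
  have hYu : (Y:ℝ) ≤ B * Real.exp (x-3*z) := by
    have h1 : (Y:ℝ) < (V.card:ℝ)/((D:ℝ)^j)^3 + 1 := Nat.ceil_lt_add_one (by positivity)
    have h2 : (1:ℝ) ≤ Real.exp (x-3*z) := Real.one_le_exp (by linarith)
    have h3 : (V.card:ℝ)/((D:ℝ)^j)^3 ≤ (D:ℝ)^3 * Real.exp (x-3*z) := by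
      rw [div_le_iff₀ (by positivity)]
      calc (V.card:ℝ) = (Real.exp z)^3 * Real.exp (x-3*z) := by
            rw [← ex, ← Real.exp_nat_mul, ← Real.exp_add]; congr 1; push_cast; ring
        _ ≤ (D * (D:ℝ)^j)^3 * Real.exp (x-3*z) := by gcongr
        _ = _ := by ring
    have h4 : (1:ℝ) ≤ (D:ℝ)^3 * Real.exp (x-3*z) := one_le_mul_of_one_le_of_one_le (one_le_pow₀ hD1) h2
    rw [hB]
    linarith
  obtain ⟨h, hh⟩ : ∃ h, h = (A.card:ℝ)^(ε/2) := ⟨_, rfl⟩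
  have hh1 : 1 ≤ h := by rw [hh]; exact Real.one_le_rpow hn (by positivity)
  have hqh : ((D:ℝ)^j)^(ε/2) ≤ h := by
    rw [hh]
    gcongr
    rw [← ey]
    exact hj1.trans (Real.exp_le_exp.mpr hzy)
  have hY0 : (0:ℝ) ≤ Y := Nat.cast_nonneg _
  have key := hit V A Y j hYc (C'*h*(Y:ℝ)^(2/3:ℝ)) (C'*h) (C'*h*((Y:ℝ)^(3/2:ℝ)+Y)) (by positivity) (by positivity) (by positivity) (by
    intro P0 hP0 U0 hU0 hc
    rcases P0.eq_empty_or_nonempty with h0 | h0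
    · have : Inc ud P0 U0 = 0 := by subst h0; simp [Inc]
      rw [this, Nat.cast_zero]; positivity
    rcases U0.eq_empty_or_nonempty with h1 | h1
    · have : Inc ud P0 U0 = 0 := by subst h1; simp [Inc]
      rw [this, Nat.cast_zero]; positivity
    have := hcirc P0 U0 h1 h0 (fun a ha => hA1 a (hU0 ha)) (fun h => hV0 (hP0 h))
    have hc' : (P0.card:ℝ) ≤ Y := by exact_mod_cast hc
    have hu : (U0.card:ℝ) ≤ A.card := by exact_mod_cast card_le_card hU0
    calc (Inc ud P0 U0:ℝ) ≤ _ := this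
      _ ≤ C' * h * (((Y:ℝ) * U0.card)^(2/3:ℝ) + (Y:ℝ)^(3/2:ℝ) + U0.card + Y) := by
          rw [hh]; gcongr
      _ = _ := by rw [Real.mul_rpow hY0 (by positivity)]; ring)
  rw [← ex, ← ey] at key
  have fin := base_comb hB1 hC hC' hh1 hz0 (by positivity) hqh hq0 hj1 hY0 hYu s1 s2 s3 s4 key
  have e1 : h * h = (A.card:ℝ)^ε := by
    rw [hh, ← Real.rpow_add (by linarith)]; congr 1; ring
  have e2 : Real.exp (9/11*x+6/11*y) + Real.exp (2/3*(x+y)) + Real.exp y = ((V.card:ℝ)^(9/11:ℝ) * (A.card:ℝ)^(6/11:ℝ) + ((V.card:ℝ) * A.card)^(2/3:ℝ) + A.card) := by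
    rw [← ex, ← ey, ← Real.exp_mul, ← Real.exp_mul, ← Real.exp_add, ← Real.exp_add, ← Real.exp_mul]
    congr 3 <;> ring_nf
  rw [e1, e2] at fin
  exact fin

lemma base_arith {k m n g : ℝ} (hk : 1 ≤ k) (hm : 1 ≤ m) (hn : 1 ≤ n) (hg : 1 ≤ g) (h1 : k * m ≤ n^2) (h2 : k ≤ n)
    (h3 : k * m ≤ g * (m^(9/11:ℝ) * n^(6/11:ℝ) + (m*n)^(2/3:ℝ) + n)) : k^2 * m ≤ 9 * g^2 * n^(20/9:ℝ) := by
  obtain ⟨x, rfl⟩ : ∃ x, m = Real.exp x := ⟨Real.log m, (Real.exp_log (by linarith)).symm⟩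
  obtain ⟨y, rfl⟩ : ∃ y, n = Real.exp y := ⟨Real.log n, (Real.exp_log (by linarith)).symm⟩
  obtain ⟨w, rfl⟩ : ∃ w, k = Real.exp w := ⟨Real.log k, (Real.exp_log (by linarith)).symm⟩
  obtain ⟨v, hv⟩ : ∃ v, 3 * g = Real.exp v := ⟨Real.log (3*g), (Real.exp_log (by linarith)).symm⟩
  have hg9 : 9 * g^2 = Real.exp (2*v) := by
    rw [two_mul, Real.exp_add, ← hv]; ring
  have hv0 : 0 ≤ v := by rw [← Real.one_le_exp_iff, ← hv]; linarith
  have hy0 : 0 ≤ y := by rwa [← Real.one_le_exp_iff]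
  have a1 : w + x ≤ 2*y := by
    rw [← Real.exp_add, ← Real.exp_nat_mul, Real.exp_le_exp] at h1; exact_mod_cast h1
  have a2 : w ≤ y := Real.exp_le_exp.mp h2
  rw [hg9, ← Real.exp_nat_mul, ← Real.exp_add, ← Real.exp_mul, ← Real.exp_add, Real.exp_le_exp]
  rw [← Real.exp_add, ← Real.exp_mul, ← Real.exp_mul, ← Real.exp_add, ← Real.exp_add, ← Real.exp_mul] at h3
  push_cast
  obtain ⟨M1, hM1⟩ : ∃ M1, M1 = max (x*(9/11) + y*(6/11)) (max ((x+y)*(2/3)) y) := ⟨_, rfl⟩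
  have b1 : Real.exp (x*(9/11) + y*(6/11)) ≤ Real.exp M1 := Real.exp_le_exp.mpr (by rw [hM1]; exact le_max_left _ _)
  have b2 : Real.exp ((x+y)*(2/3)) ≤ Real.exp M1 := Real.exp_le_exp.mpr (by rw [hM1]; exact (le_max_left _ _).trans (le_max_right _ _))
  have b3 : Real.exp y ≤ Real.exp M1 := Real.exp_le_exp.mpr (by rw [hM1]; exact (le_max_right _ _).trans (le_max_right _ _))
  have b4 : w + x ≤ v + M1 := by
    rw [← Real.exp_le_exp, Real.exp_add v, ← hv]
    nlinarith
  rcases max_cases (x*(9/11) + y*(6/11)) (max ((x+y)*(2/3)) y) with ⟨h, _⟩ | ⟨h, _⟩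
  · rw [hM1, h] at b4
    linarith
  · rcases max_cases ((x+y)*(2/3)) y with ⟨h', _⟩ | ⟨h', _⟩
    · rw [hM1, h, h'] at b4
      linarith
    · rw [hM1, h, h'] at b4
      linarith
end BaseSec

section Final1Sec
/-- number of representations of `n` as a sum of `s` elements of `A` -/
def cnt (A : Finset (Fin 3 → ℝ)) (s : ℕ) (n : Fin 3 → ℝ) : ℕ :=
  ((Fintype.piFinset (fun _ : Fin s => A)).filter (fun f => ∑ i, f i = n)).card

/-- the `s`-fold sumset -/
def Sup (A : Finset (Fin 3 → ℝ)) (s : ℕ) : Finset (Fin 3 → ℝ) :=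
  (Fintype.piFinset (fun _ : Fin s => A)).image (fun f => ∑ i, f i)

/-- the energy as a sum of squares -/
def En (A : Finset (Fin 3 → ℝ)) (s : ℕ) : ℕ := ∑ n ∈ Sup A s, cnt A s n ^ 2

lemma cnt_pos {A : Finset (Fin 3 → ℝ)} {s : ℕ} {n : Fin 3 → ℝ} : 0 < cnt A s n ↔ n ∈ Sup A s := by
  unfold cnt Sup
  rw [card_pos]
  constructor
  · rintro ⟨f, hf⟩
    rw [mem_filter] at hf
    exact mem_image.mpr ⟨f, hf.1, hf.2⟩
  · intro h
    obtain ⟨f, hf, h⟩ := mem_image.mp h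
    exact ⟨f, mem_filter.mpr ⟨hf, h⟩⟩

lemma cnt_sum (A : Finset (Fin 3 → ℝ)) (s : ℕ) : ∑ n ∈ Sup A s, cnt A s n = A.card ^ s := by
  unfold cnt Sup
  rw [← card_eq_sum_card_image, Fintype.card_piFinset]
  simp

lemma cnt_succ (A : Finset (Fin 3 → ℝ)) (s : ℕ) (n : Fin 3 → ℝ) :
    cnt A (s+1) n = ∑ a ∈ A, cnt A s (n - a) := by
  unfold cnt
  rw [← card_sigma]
  symm
  refine card_bij' (fun x _ => Fin.cons x.1 x.2) (fun f _ => ⟨f 0, Fin.tail f⟩) ?_ ?_ ?_ ?_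
  · rintro ⟨a, f⟩ h
    rw [mem_sigma, mem_filter, Fintype.mem_piFinset] at h
    rw [mem_filter, Fintype.mem_piFinset]
    refine ⟨?_, ?_⟩
    · intro i
      refine Fin.cases ?_ ?_ i
      · simpa using h.1
      · intro j; simpa using h.2.1 j
    · rw [Fin.sum_univ_succ]
      simp only [Fin.cons_zero, Fin.cons_succ]
      rw [h.2.2]; simp
  · intro f h
    rw [mem_filter, Fintype.mem_piFinset] at h
    rw [mem_sigma, mem_filter, Fintype.mem_piFinset]
    refine ⟨h.1 0, fun i => h.1 _, ?_⟩
    rw [← h.2, Fin.sum_univ_succ]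
    simp [Fin.tail]
  · rintro ⟨a, f⟩ h
    simp
  · intro f h
    simp

lemma cnt_zero (A : Finset (Fin 3 → ℝ)) (n : Fin 3 → ℝ) : cnt A 0 n = if n = 0 then 1 else 0 := by
  unfold cnt
  by_cases h : n = 0
  · subst h; simp
  · rw [if_neg h, card_eq_zero, filter_eq_empty_iff]
    intro f _ h'
    apply h; rw [← h']; simp

lemma cnt_one (A : Finset (Fin 3 → ℝ)) (n : Fin 3 → ℝ) : cnt A 1 n = if n ∈ A then 1 else 0 := by
  rw [cnt_succ]
  simp only [cnt_zero, sub_eq_zero]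
  simp

lemma cnt_le (A : Finset (Fin 3 → ℝ)) (s : ℕ) : ∀ n, cnt A (s+1) n ≤ A.card ^ s := by
  induction s with
  | zero => intro n; rw [cnt_one]; split_ifs <;> simp
  | succ s ih =>
    intro n
    rw [cnt_succ]
    calc _ ≤ ∑ a ∈ A, A.card ^ s := sum_le_sum fun a _ => ih _
      _ = _ := by rw [sum_const, smul_eq_mul, pow_succ']

lemma cnt_le' (A : Finset (Fin 3 → ℝ)) (s : ℕ) (n) : cnt A s n ≤ A.card ^ s := by
  unfold cnt
  refine (card_filter_le _ _).trans ?_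
  rw [Fintype.card_piFinset]; simp

/-- dyadic level -/
def Lev (A : Finset (Fin 3 → ℝ)) (s i : ℕ) : Finset (Fin 3 → ℝ) :=
  (Sup A s).filter (fun n => Nat.log 2 (cnt A s n) = i)

/-- number of levels -/
def NL (A : Finset (Fin 3 → ℝ)) (s : ℕ) : ℕ := Nat.log 2 (A.card ^ s) + 1

lemma sum_lev {M : Type*} [AddCommMonoid M] (A : Finset (Fin 3 → ℝ)) (s : ℕ) (F : (Fin 3 → ℝ) → M) :
    ∑ n ∈ Sup A s, F n = ∑ i ∈ range (NL A s), ∑ n ∈ Lev A s i, F n := by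
  unfold Lev
  rw [sum_fiberwise_of_maps_to]
  intro n _
  rw [mem_range, NL]
  exact Nat.lt_succ_of_le (Nat.log_mono_right (cnt_le' A s n))

lemma lev_le {A : Finset (Fin 3 → ℝ)} {s i : ℕ} {n} (h : n ∈ Lev A s i) : 2^i ≤ cnt A s n := by
  unfold Lev at h
  rw [mem_filter] at h
  rw [← h.2]
  exact Nat.pow_log_le_self 2 (cnt_pos.mpr h.1).ne'

lemma lev_lt {A : Finset (Fin 3 → ℝ)} {s i : ℕ} {n} (h : n ∈ Lev A s i) : cnt A s n ≤ 2 * 2^i := by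
  unfold Lev at h
  rw [mem_filter] at h
  rw [← h.2, ← pow_succ']
  exact (Nat.lt_pow_succ_log_self (by norm_num) _).le

lemma lev_sub {A : Finset (Fin 3 → ℝ)} {s i : ℕ} : Lev A s i ⊆ Sup A s := filter_subset _ _

lemma lev_mass (A : Finset (Fin 3 → ℝ)) (s i : ℕ) : 2^i * (Lev A s i).card ≤ A.card ^ s := by
  rw [← cnt_sum, mul_comm, ← smul_eq_mul, ← sum_const]
  calc _ ≤ ∑ n ∈ Lev A s i, cnt A s n := sum_le_sum fun n hn => lev_le hn
    _ ≤ _ := sum_le_sum_of_subset lev_sub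

lemma lev_energy (A : Finset (Fin 3 → ℝ)) (s i : ℕ) : (2^i)^2 * (Lev A s i).card ≤ En A s := by
  unfold En
  rw [mul_comm, ← smul_eq_mul, ← sum_const]
  calc _ ≤ ∑ n ∈ Lev A s i, cnt A s n ^ 2 := sum_le_sum fun n hn => Nat.pow_le_pow_left (lev_le hn) 2
    _ ≤ _ := sum_le_sum_of_subset lev_sub

lemma NL_bound (s : ℕ) (ε : ℝ) (hε : 0 < ε) : ∃ C : ℝ, 0 < C ∧ ∀ A : Finset (Fin 3 → ℝ), A.Nonempty →
    (NL A s : ℝ) ≤ C * (A.card:ℝ)^ε := by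
  have h2 : 0 < Real.log 2 := Real.log_pos (by norm_num)
  refine ⟨s / (ε * Real.log 2) + 1, by positivity, ?_⟩
  intro A hA
  have hN : (1:ℝ) ≤ A.card := by exact_mod_cast hA.card_pos
  have h1 : 1 ≤ (A.card:ℝ)^ε := Real.one_le_rpow hN hε.le
  have hl : (Nat.log 2 (A.card ^ s) : ℝ) * Real.log 2 ≤ s * Real.log A.card := by
    have : 2 ^ Nat.log 2 (A.card ^ s) ≤ A.card ^ s := Nat.pow_log_le_self 2 (pow_pos hA.card_pos s).ne'
    have h3 : ((2:ℝ) ^ Nat.log 2 (A.card ^ s)) ≤ (A.card:ℝ) ^ s := by exact_mod_cast this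
    have := Real.log_le_log (by positivity) h3
    rwa [Real.log_pow, Real.log_pow] at this
  have hlog := Real.log_le_rpow_div (show (0:ℝ) ≤ A.card by positivity) hε
  have : (Nat.log 2 (A.card ^ s) : ℝ) ≤ s / (ε * Real.log 2) * (A.card:ℝ)^ε := by
    rw [div_mul_eq_mul_div, le_div_iff₀ (by positivity)]
    calc (Nat.log 2 (A.card ^ s) : ℝ) * (ε * Real.log 2) = ε * ((Nat.log 2 (A.card ^ s) : ℝ) * Real.log 2) := by ring
      _ ≤ ε * (s * ((A.card:ℝ)^ε / ε)) := by
        exact mul_le_mul_of_nonneg_left (hl.trans (mul_le_mul_of_nonneg_left hlog (by positivity))) hε.le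
      _ = _ := by field_simp
  unfold NL
  push_cast
  linarith

lemma base_mass (A V : Finset (Fin 3 → ℝ)) (hA : ∀ a ∈ A, nsq a = 1) : ∑ n ∈ V, cnt A 2 n ≤ Inc ud V A := by
  classical
  simp only [cnt_succ A 1, cnt_one]
  rw [sum_comm]
  unfold Inc
  refine sum_le_sum fun a ha => ?_
  rw [← card_filter]
  refine card_le_card fun n hn => ?_
  rw [mem_filter] at hn ⊢
  refine ⟨hn.1, ?_⟩
  have := hA _ hn.2
  unfold ud
  unfold nsq at this
  rw [Fin.sum_univ_three]
  simpa using this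

theorem base_energy (ε : ℝ) (hε : 0 < ε) : ∃ C : ℝ, 0 < C ∧ ∀ A : Finset (Fin 3 → ℝ), A.Nonempty →
    (∀ a ∈ A, nsq a = 1) → (En A 2 : ℝ) ≤ C * (A.card:ℝ)^(20/9 + ε) := by
  obtain ⟨C1, hC1, hL⟩ := NL_bound 2 (ε/3) (by positivity)
  obtain ⟨C0, hC0, hI⟩ := base_inc (ε/3) (by positivity)
  refine ⟨C1 * (36 * (C0+1)^2 + 1), by positivity, ?_⟩
  intro A hA hA1
  have hL := hL A hA
  have hN : (1:ℝ) ≤ A.card := by exact_mod_cast hA.card_pos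
  have hNe : 1 ≤ (A.card:ℝ)^(ε/3) := Real.one_le_rpow hN (by positivity)
  set g : ℝ := (C0+1) * (A.card:ℝ)^(ε/3) with hg
  have hg1 : 1 ≤ g := by
    rw [hg]; nlinarith
  have key : ∀ i, (∑ n ∈ Lev A 2 i, (cnt A 2 n : ℝ)^2) ≤ (36 * (C0+1)^2 + 1) * (A.card:ℝ)^(20/9+2*(ε/3)) := by
    intro i
    have hgg : g^2 * (A.card:ℝ)^(20/9:ℝ) = (C0+1)^2 * (A.card:ℝ)^(20/9+2*(ε/3)) := by
      rw [hg, mul_pow, Real.rpow_add (by linarith), two_mul (ε/3), Real.rpow_add (by linarith)]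
      ring
    have hz : ((cnt A 2 0 : ℝ))^2 ≤ (A.card:ℝ)^(20/9+2*(ε/3)) := by
      have h1 : (cnt A 2 0 : ℝ) ≤ A.card := by
        have := cnt_le A 1 0
        rw [pow_one] at this
        exact_mod_cast this
      calc ((cnt A 2 0 : ℝ))^2 ≤ (A.card:ℝ)^2 := by gcongr
        _ = (A.card:ℝ)^(2:ℝ) := by norm_num
        _ ≤ _ := Real.rpow_le_rpow_of_exponent_le hN (by linarith)
    have hsub : (∑ n ∈ Lev A 2 i, (cnt A 2 n : ℝ)^2) ≤ (∑ n ∈ (Lev A 2 i).erase 0, (cnt A 2 n : ℝ)^2) + (cnt A 2 0 : ℝ)^2 := by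
      by_cases h : (0 : Fin 3 → ℝ) ∈ Lev A 2 i
      · rw [sum_erase_add _ _ h]
      · rw [erase_eq_of_notMem h]; linarith [sq_nonneg (cnt A 2 0 : ℝ)]
    set V := (Lev A 2 i).erase 0 with hV
    have hVsub : V ⊆ Lev A 2 i := erase_subset _ _
    have hmain : (∑ n ∈ V, (cnt A 2 n : ℝ)^2) ≤ 36 * (C0+1)^2 * (A.card:ℝ)^(20/9+2*(ε/3)) := by
      rcases V.eq_empty_or_nonempty with h0 | hVn
      · rw [h0, sum_empty]; positivity
      have hkm : 2^i * V.card ≤ A.card^2 := (Nat.mul_le_mul_left _ (card_le_card hVsub)).trans (lev_mass A 2 i)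
      have hVc : V.card ≤ A.card^2 := le_trans (Nat.le_mul_of_pos_left _ (by positivity)) hkm
      have hinc := hI V A hA hVn hA1 (notMem_erase _ _) hVc
      have hlow : 2^i * V.card ≤ Inc ud V A := by
        refine le_trans ?_ (base_mass A V hA1)
        rw [mul_comm, ← smul_eq_mul, ← sum_const]
        exact sum_le_sum fun n hn => lev_le (hVsub hn)
      have hkn : 2^i ≤ A.card := by
        obtain ⟨v, hv⟩ := hVn
        have := (lev_le (hVsub hv)).trans (cnt_le A 1 v)
        rwa [pow_one] at this
      have har := base_arith (k := (2:ℝ)^i) (m := V.card) (n := A.card) (g := g) (one_le_pow₀ (by norm_num))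
        (by exact_mod_cast hVn.card_pos) hN hg1 (by exact_mod_cast hkm) (by exact_mod_cast hkn) (by
          have h1 : ((2:ℝ)^i * V.card) ≤ Inc ud V A := by exact_mod_cast hlow
          refine h1.trans (hinc.trans ?_)
          rw [hg]
          gcongr
          linarith)
      have hup : (∑ n ∈ V, (cnt A 2 n : ℝ)^2) ≤ 4 * (((2:ℝ)^i)^2 * V.card) := by
        calc (∑ n ∈ V, (cnt A 2 n : ℝ)^2) ≤ ∑ n ∈ V, (2 * (2:ℝ)^i)^2 := by
              refine sum_le_sum fun n hn => ?_
              have : (cnt A 2 n : ℝ) ≤ 2 * (2:ℝ)^i := by exact_mod_cast lev_lt (hVsub hn)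
              gcongr
          _ = _ := by rw [sum_const, nsmul_eq_mul]; ring
      calc _ ≤ _ := hup
        _ ≤ 4 * (9 * g^2 * (A.card:ℝ)^(20/9:ℝ)) := by gcongr
        _ = 36 * (g^2 * (A.card:ℝ)^(20/9:ℝ)) := by ring
        _ = _ := by rw [hgg]; ring
    linarith
  have hE : (En A 2 : ℝ) = ∑ i ∈ range (NL A 2), ∑ n ∈ Lev A 2 i, (cnt A 2 n : ℝ)^2 := by
    rw [← sum_lev]; unfold En; push_cast; rfl
  rw [hE]
  calc _ ≤ ∑ i ∈ range (NL A 2), (36 * (C0+1)^2 + 1) * (A.card:ℝ)^(20/9+2*(ε/3)) := sum_le_sum fun i _ => key i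
    _ = NL A 2 * ((36 * (C0+1)^2 + 1) * (A.card:ℝ)^(20/9+2*(ε/3))) := by rw [sum_const, card_range, nsmul_eq_mul]
    _ ≤ (C1 * (A.card:ℝ)^(ε/3)) * ((36 * (C0+1)^2 + 1) * (A.card:ℝ)^(20/9+2*(ε/3))) := by gcongr
    _ = C1 * (36 * (C0+1)^2 + 1) * ((A.card:ℝ)^(ε/3) * (A.card:ℝ)^(20/9+2*(ε/3))) := by ring
    _ = _ := by
      rw [← Real.rpow_add (by linarith)]
      congr 2; ring
end Final1Sec

section Final2Sec
lemma step_ub (A : Finset (Fin 3 → ℝ)) (s : ℕ) (hA : ∀ a ∈ A, nsq a = 1) :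
    En A (s+1) ≤ ∑ i ∈ range (NL A (s+1)), ∑ j ∈ range (NL A s),
      4 * (2^i * 2^j) * Inc ud (Lev A (s+1) i) (Lev A s j) := by
  classical
  have h1 : ∀ n, cnt A (s+1) n ≤ ∑ u ∈ Sup A s, if ud n u then cnt A s u else 0 := by
    intro n
    rw [cnt_succ, ← sum_filter]
    have e : ∑ a ∈ A, cnt A s (n-a) = ∑ u ∈ A.image (fun a => n - a), cnt A s u := by
      rw [sum_image]
      intro a _ b _ h
      simpa using h
    rw [e, ← sum_filter_add_sum_filter_not _ (fun u => u ∈ Sup A s)]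
    have z : ∑ u ∈ (A.image (fun a => n - a)).filter (fun u => ¬ u ∈ Sup A s), cnt A s u = 0 := by
      refine sum_eq_zero fun u hu => ?_
      rw [mem_filter] at hu
      by_contra h
      exact hu.2 (cnt_pos.mp (Nat.pos_of_ne_zero h))
    rw [z, add_zero]
    refine sum_le_sum_of_subset fun u hu => ?_
    rw [mem_filter, mem_image] at hu
    obtain ⟨⟨a, ha, rfl⟩, hu⟩ := hu
    rw [mem_filter]
    refine ⟨hu, ?_⟩
    have := hA a ha
    unfold nsq at this
    unfold ud
    rw [Fin.sum_univ_three]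
    simpa using this
  have h2 : En A (s+1) ≤ ∑ n ∈ Sup A (s+1), ∑ u ∈ Sup A s, if ud n u then cnt A (s+1) n * cnt A s u else 0 := by
    unfold En
    refine sum_le_sum fun n _ => ?_
    rw [sq]
    refine (Nat.mul_le_mul_left _ (h1 n)).trans ?_
    rw [mul_sum]
    refine sum_le_sum fun u _ => ?_
    split_ifs <;> simp
  refine h2.trans ?_
  rw [sum_lev]
  refine sum_le_sum fun i _ => ?_
  simp only [sum_lev A s]
  rw [sum_comm]
  refine sum_le_sum fun j _ => ?_
  rw [sum_comm]
  unfold Inc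
  rw [mul_sum]
  refine sum_le_sum fun u hu => ?_
  rw [← sum_filter]
  calc _ ≤ ∑ n ∈ (Lev A (s+1) i).filter (fun n => ud n u), 4 * (2^i*2^j) := by
        refine sum_le_sum fun n hn => ?_
        have a1 := lev_lt (mem_filter.mp hn).1
        have a2 := lev_lt hu
        calc _ ≤ _ := Nat.mul_le_mul a1 a2
          _ = _ := by ring
    _ = _ := by rw [sum_const, smul_eq_mul, mul_comm]

lemma split_pow {p m q k : ℝ} (hp : 0 < p) (hm : 0 < m) (hq : 0 < q) (hk : 0 < k) :
    p * q * (m*k)^(3/4:ℝ) = (p^2*m)^(1/4:ℝ) * (p*m)^(1/2:ℝ) * ((q^2*k)^(1/4:ℝ) * (q*k)^(1/2:ℝ)) := by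
  obtain ⟨a, rfl⟩ : ∃ x, p = Real.exp x := ⟨Real.log p, (Real.exp_log hp).symm⟩
  obtain ⟨b, rfl⟩ : ∃ x, m = Real.exp x := ⟨Real.log m, (Real.exp_log hm).symm⟩
  obtain ⟨c, rfl⟩ : ∃ x, q = Real.exp x := ⟨Real.log q, (Real.exp_log hq).symm⟩
  obtain ⟨d, rfl⟩ : ∃ x, k = Real.exp x := ⟨Real.log k, (Real.exp_log hk).symm⟩
  simp only [← Real.exp_nat_mul, ← Real.exp_add, ← Real.exp_mul]
  congr 1; push_cast; ring

/-- single pair of levels -/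
lemma pair_bound {p q m k E F n C ε I : ℝ} {s : ℕ} (hp : 0 < p) (hq : 0 < q) (hm : 0 < m) (hk : 0 < k) (hn : 1 ≤ n)
    (hC : 0 < C) (hε : 0 < ε)
    (h1 : p^2*m ≤ E) (h2 : p*m ≤ n^(s+2)) (h3 : q^2*k ≤ F) (h4 : q*k ≤ n^(s+1)) (h5 : q ≤ n^s) (h6 : p ≤ n^(s+1))
    (hmn : m ≤ n^(s+2))
    (hI : I ≤ C * m^ε * ((m*k)^(3/4:ℝ) + m + k)) :
    4 * (p * q) * I ≤ 4 * C * (n^(s+2))^ε * (E^(1/4:ℝ) * F^(1/4:ℝ) * n^((s:ℝ)+3/2) + 2 * n^(2*s+2)) := by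
  have hn0 : 0 < n := by linarith
  have hE : 0 < E := lt_of_lt_of_le (by positivity) h1
  have hF : 0 < F := lt_of_lt_of_le (by positivity) h3
  have t1 : p * q * (m*k)^(3/4:ℝ) ≤ E^(1/4:ℝ) * F^(1/4:ℝ) * n^((s:ℝ)+3/2) := by
    rw [split_pow hp hm hq hk]
    have e : n^((s:ℝ)+3/2) = (n^(s+2))^(1/2:ℝ) * (n^(s+1))^(1/2:ℝ) := by
      rw [← Real.rpow_natCast, ← Real.rpow_natCast, ← Real.rpow_mul hn0.le, ← Real.rpow_mul hn0.le, ← Real.rpow_add hn0]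
      congr 1; push_cast; ring
    rw [e]
    calc _ ≤ E^(1/4:ℝ) * (n^(s+2))^(1/2:ℝ) * (F^(1/4:ℝ) * (n^(s+1))^(1/2:ℝ)) := by gcongr
      _ = _ := by ring
  have t2 : p * q * m ≤ n^(2*s+2) := by
    calc p * q * m = (p*m)*q := by ring
      _ ≤ n^(s+2) * n^s := by gcongr
      _ = _ := by ring
  have t3 : p * q * k ≤ n^(2*s+2) := by
    calc p * q * k = p*(q*k) := by ring
      _ ≤ n^(s+1) * n^(s+1) := by gcongr
      _ = _ := by ring
  calc 4 * (p * q) * I ≤ 4 * (p*q) * (C * m^ε * ((m*k)^(3/4:ℝ) + m + k)) := by gcongr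
    _ = 4 * C * m^ε * (p * q * (m*k)^(3/4:ℝ) + p*q*m + p*q*k) := by ring
    _ ≤ 4 * C * (n^(s+2))^ε * (E^(1/4:ℝ) * F^(1/4:ℝ) * n^((s:ℝ)+3/2) + 2 * n^(2*s+2)) := by
      have : m^ε ≤ (n^(s+2))^ε := Real.rpow_le_rpow hm.le hmn hε.le
      have t4 : p * q * (m*k)^(3/4:ℝ) + p*q*m + p*q*k ≤ E^(1/4:ℝ) * F^(1/4:ℝ) * n^((s:ℝ)+3/2) + 2 * n^(2*s+2) := by linarith
      exact mul_le_mul (mul_le_mul_of_nonneg_left this (by positivity)) t4 (by positivity) (by positivity)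

/-- solving the recursive inequality; `w` is the exponent -/
lemma solve_rec {E F n G C w η : ℝ} {s : ℕ} (hn : 1 ≤ n) (hE : 0 < E) (hF : 0 < F) (hG : 1 ≤ G) (hC : 1 ≤ C) (hη : 0 < η) (hw : 0 ≤ w)
    (h : E ≤ G * n^η * (E^(1/4:ℝ) * F^(1/4:ℝ) * n^((s:ℝ)+3/2) + 2 * n^(2*s+2)))
    (hFn : F ≤ C * n^(2*(s:ℝ) + w + η)) :
    E ≤ (4 * G * C)^2 * n^(2*(s:ℝ)+2+w/3+2*η) := by
  have hn0 : 0 < n := by linarith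
  obtain ⟨x, rfl⟩ : ∃ x, E = Real.exp x := ⟨Real.log E, (Real.exp_log hE).symm⟩
  obtain ⟨y, rfl⟩ : ∃ y, F = Real.exp y := ⟨Real.log F, (Real.exp_log hF).symm⟩
  obtain ⟨z, rfl⟩ : ∃ z, n = Real.exp z := ⟨Real.log n, (Real.exp_log hn0).symm⟩
  obtain ⟨a, rfl⟩ : ∃ y, G = Real.exp y := ⟨Real.log G, (Real.exp_log (by linarith)).symm⟩
  obtain ⟨b, rfl⟩ : ∃ y, C = Real.exp y := ⟨Real.log C, (Real.exp_log (by linarith)).symm⟩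
  obtain ⟨c, hc⟩ : ∃ y, 4 = Real.exp y := ⟨Real.log 4, (Real.exp_log (by norm_num)).symm⟩
  have ha := Real.one_le_exp_iff.mp hG
  have hb := Real.one_le_exp_iff.mp hC
  have hz := Real.one_le_exp_iff.mp hn
  have hc0 : 0 ≤ c := Real.one_le_exp_iff.mp (by linarith)
  rw [hc]
  have hs : (0:ℝ) ≤ s := Nat.cast_nonneg s
  simp only [← Real.exp_nat_mul, ← Real.exp_add, ← Real.exp_mul] at h hFn ⊢
  rw [Real.exp_le_exp] at hFn ⊢
  have hzη : 0 ≤ z * η := mul_nonneg hz hη.le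
  have hzw : 0 ≤ z * w := mul_nonneg hz hw
  push_cast at h ⊢
  rcases le_total (Real.exp (x*(1/4) + y*(1/4) + z*(s+3/2))) (Real.exp ((2*s+2)*z)) with h' | h'
  · have h3 : Real.exp x ≤ Real.exp (c + (a + z*η + (2*s+2)*z)) := by
      refine h.trans ?_
      rw [Real.exp_add c, Real.exp_add (a+z*η), ← hc]
      have := Real.exp_pos (a+z*η)
      nlinarith
    rw [Real.exp_le_exp] at h3
    nlinarith
  · have h3 : Real.exp x ≤ Real.exp (c + (a + z*η + (x*(1/4) + y*(1/4) + z*(s+3/2)))) := by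
      refine h.trans ?_
      rw [Real.exp_add c, Real.exp_add (a+z*η), ← hc]
      have := Real.exp_pos (a+z*η)
      nlinarith [Real.exp_pos (x*(1/4) + y*(1/4) + z*(s+3/2))]
    rw [Real.exp_le_exp] at h3
    nlinarith

lemma En_pos {A : Finset (Fin 3 → ℝ)} (hA : A.Nonempty) (s : ℕ) : 0 < En A s := by
  obtain ⟨a, ha⟩ := hA
  have : ∑ i : Fin s, a ∈ Sup A s := mem_image.mpr ⟨fun _ => a, by simpa using fun _ => ha, rfl⟩
  exact sum_pos' (fun _ _ => Nat.zero_le _) ⟨_, this, pow_pos (cnt_pos.mpr this) 2⟩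

theorem step_energy (s : ℕ) (w : ℝ) (hw : 0 ≤ w)
    (ih : ∀ ε : ℝ, 0 < ε → ∃ C : ℝ, 0 < C ∧ ∀ A : Finset (Fin 3 → ℝ), A.Nonempty →
      (∀ a ∈ A, nsq a = 1) → (En A (s+1) : ℝ) ≤ C * (A.card:ℝ)^(2*(s:ℝ) + w + ε))
    (ε : ℝ) (hε : 0 < ε) : ∃ C : ℝ, 0 < C ∧ ∀ A : Finset (Fin 3 → ℝ), A.Nonempty →
      (∀ a ∈ A, nsq a = 1) → (En A (s+2) : ℝ) ≤ C * (A.card:ℝ)^(2*(s:ℝ) + 2 + w/3 + ε) := by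
  obtain ⟨C, hC, hF⟩ := ih (ε/2) (by positivity)
  obtain ⟨L1, hL1, hL1b⟩ := NL_bound (s+2) (ε/6) (by positivity)
  obtain ⟨L2, hL2, hL2b⟩ := NL_bound (s+1) (ε/6) (by positivity)
  have hs2 : (0:ℝ) < (s:ℝ)+2 := by positivity
  obtain ⟨B, hB, hinc⟩ := sphere_B (ε/6/((s:ℝ)+2)) (by positivity)
  refine ⟨(4 * (L1*L2*(4*B)+1) * (C+1))^2, by positivity, ?_⟩
  intro A hA hA1
  have hN : (1:ℝ) ≤ A.card := by exact_mod_cast hA.card_pos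
  have hF := hF A hA hA1
  have hL1b := hL1b A hA
  have hL2b := hL2b A hA
  have hE0 : (0:ℝ) < En A (s+2) := by exact_mod_cast En_pos hA (s+2)
  have hF0 : (0:ℝ) < En A (s+1) := by exact_mod_cast En_pos hA (s+1)
  set n : ℝ := (A.card:ℝ) with hn
  have hn0 : 0 < n := by linarith
  obtain ⟨W, hW⟩ : ∃ W : ℝ, W = (En A (s+2):ℝ)^(1/4:ℝ) * (En A (s+1):ℝ)^(1/4:ℝ) * n^((s:ℝ)+3/2) + 2 * n^(2*s+2) := ⟨_, rfl⟩
  have hW0 : 0 ≤ W := by rw [hW]; positivity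
  have hub := step_ub A (s+1) hA1
  have hub' : (En A (s+2) : ℝ) ≤ ∑ i ∈ range (NL A (s+2)), ∑ j ∈ range (NL A (s+1)),
      4 * ((2:ℝ)^i * 2^j) * (Inc ud (Lev A (s+2) i) (Lev A (s+1) j) : ℝ) := by exact_mod_cast hub
  have hpair : ∀ i j, 4 * ((2:ℝ)^i * 2^j) * (Inc ud (Lev A (s+2) i) (Lev A (s+1) j) : ℝ) ≤ 4 * B * n^(ε/6) * W := by
    intro i j
    have hnn : (n^(s+2))^(ε/6/((s:ℝ)+2)) = n^(ε/6) := by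
      rw [← Real.rpow_natCast, ← Real.rpow_mul hn0.le]
      congr 1; push_cast; field_simp
    rcases (Lev A (s+2) i).eq_empty_or_nonempty with h0 | hP
    · rw [h0]; simp [Inc]; positivity
    rcases (Lev A (s+1) j).eq_empty_or_nonempty with h0 | hU
    · rw [h0]; simp [Inc]; positivity
    have hI := hinc _ _ hP hU
    rw [← hnn, hW]
    have hmass := lev_mass A (s+2) i
    refine pair_bound (p := 2^i) (q := 2^j) (m := (Lev A (s+2) i).card) (k := (Lev A (s+1) j).card) (by positivity) (by positivity)
      (by exact_mod_cast hP.card_pos) (by exact_mod_cast hU.card_pos) hN hB (by positivity) ?_ ?_ ?_ ?_ ?_ ?_ ?_ hI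
    · exact_mod_cast lev_energy A (s+2) i
    · rw [hn]; exact_mod_cast hmass
    · exact_mod_cast lev_energy A (s+1) j
    · rw [hn]; exact_mod_cast lev_mass A (s+1) j
    · obtain ⟨u, hu⟩ := hU
      rw [hn]; exact_mod_cast (lev_le hu).trans (cnt_le A s u)
    · obtain ⟨u, hu⟩ := hP
      rw [hn]; exact_mod_cast (lev_le hu).trans (cnt_le A (s+1) u)
    · rw [hn]; exact_mod_cast (Nat.le_mul_of_pos_left _ (by positivity)).trans hmass
  have hE : (En A (s+2) : ℝ) ≤ (L1*L2*(4*B)+1) * n^(ε/2) * W := by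
    calc (En A (s+2) : ℝ) ≤ _ := hub'
      _ ≤ ∑ i ∈ range (NL A (s+2)), ∑ j ∈ range (NL A (s+1)), 4 * B * n^(ε/6) * W :=
        sum_le_sum fun i _ => sum_le_sum fun j _ => hpair i j
      _ = NL A (s+2) * (NL A (s+1) * (4 * B * n^(ε/6) * W)) := by
        simp only [sum_const, card_range, nsmul_eq_mul]
      _ ≤ (L1 * n^(ε/6)) * ((L2 * n^(ε/6)) * (4 * B * n^(ε/6) * W)) := by gcongr
      _ = (L1*L2*(4*B)) * (n^(ε/6) * n^(ε/6) * n^(ε/6)) * W := by ring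
      _ = (L1*L2*(4*B)) * n^(ε/2) * W := by
        rw [← Real.rpow_add hn0, ← Real.rpow_add hn0]; congr 3; ring
      _ ≤ _ := by
        gcongr; linarith
  rw [hW] at hE
  have := solve_rec (C := C+1) hN hE0 hF0 (by nlinarith [mul_pos (mul_pos hL1 hL2) hB]) (by linarith) (by positivity : 0 < ε/2) hw hE
    (hF.trans (by gcongr; linarith))
  convert this using 3
  ring

theorem energy_bound (s : ℕ) : ∀ ε : ℝ, 0 < ε → ∃ C : ℝ, 0 < C ∧ ∀ A : Finset (Fin 3 → ℝ), A.Nonempty →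
      (∀ a ∈ A, nsq a = 1) → (En A (s+2) : ℝ) ≤ C * (A.card:ℝ)^(2*((s+1:ℕ):ℝ) + 2*(3:ℝ)^(-((s:ℝ)+2)) + ε) := by
  induction s with
  | zero =>
    intro ε hε
    obtain ⟨C, hC, h⟩ := base_energy ε hε
    refine ⟨C, hC, fun A hA hA1 => ?_⟩
    convert h A hA hA1 using 3
    have : (3:ℝ)^(-(((0:ℕ):ℝ)+2)) = 1/9 := by
      rw [Real.rpow_neg (by norm_num)]; norm_num
    rw [this]; norm_num
  | succ s ih =>
    intro ε hε
    obtain ⟨C, hC, h⟩ := step_energy (s+1) (2*(3:ℝ)^(-((s:ℝ)+2))) (by positivity) ih ε hε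
    refine ⟨C, hC, fun A hA hA1 => ?_⟩
    convert h A hA hA1 using 3
    have : (3:ℝ)^(-(((s+1:ℕ):ℝ)+2)) = (3:ℝ)^(-((s:ℝ)+2)) / 3 := by
      rw [show -(((s+1:ℕ):ℝ)+2) = -((s:ℝ)+2) - 1 by push_cast; ring, Real.rpow_sub (by norm_num), Real.rpow_one]
    rw [this]; push_cast; ring
end Final2Sec

section Final3Sec
lemma En_eq (A : Finset (Fin 3 → ℝ)) (s : ℕ) :
    En A s = ((Fintype.piFinset (fun _ : Fin s => A) ×ˢ Fintype.piFinset (fun _ : Fin s => A)).filter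
      (fun p => ∑ i, p.1 i = ∑ i, p.2 i)).card := by
  rw [card_eq_sum_card_fiberwise (f := fun p => ∑ i, p.1 i) (t := Sup A s)]
  · unfold En
    refine sum_congr rfl fun n _ => ?_
    unfold cnt
    rw [sq, ← card_product]
    congr 1
    ext ⟨f, g⟩
    simp only [mem_filter, mem_product]
    constructor
    · rintro ⟨⟨h1, h2⟩, h3, h4⟩
      exact ⟨⟨⟨h1, h3⟩, by rw [h2, h4]⟩, h2⟩
    · rintro ⟨⟨⟨h1, h3⟩, h4⟩, h2⟩
      exact ⟨⟨h1, h2⟩, h3, by rw [← h4, h2]⟩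
  · intro p hp
    have hp := mem_filter.mp (mem_coe.mp hp)
    exact mem_coe.mpr (mem_image.mpr ⟨p.1, (mem_product.mp hp.1).1, rfl⟩)

lemma addEnergy_le (A A' : Finset (Fin 3 → ℝ)) (s : ℕ) (c : ℝ) (hc : c ≠ 0) (h : ∀ a ∈ A, c • a ∈ A') :
    addEnergy s (A : Set (Fin 3 → ℝ)) ≤ En A' s := by
  rw [En_eq, ← Nat.card_eq_finsetCard]
  unfold _root_.addEnergy
  refine Nat.card_le_card_of_injective (fun p => ⟨(fun i => c • p.1.1 i, fun i => c • p.1.2 i), ?_⟩) ?_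
  · rw [mem_filter, mem_product, Fintype.mem_piFinset, Fintype.mem_piFinset]
    refine ⟨⟨fun i => h _ (p.2.1 i), fun i => h _ (p.2.2.1 i)⟩, ?_⟩
    simp only
    rw [← smul_sum, ← smul_sum, p.2.2.2]
  · rintro ⟨⟨f, g⟩, hp⟩ ⟨⟨f', g'⟩, hp'⟩ he
    simp only [Subtype.mk.injEq, Prod.mk.injEq] at he ⊢
    exact ⟨funext fun i => smul_right_injective _ hc (congrFun he.1 i),
      funext fun i => smul_right_injective _ hc (congrFun he.2 i)⟩
end Final3Sec

theorem statement_4 (s : ℕ) (hs : 2 ≤ s) (ε : ℝ) (hε : 0 < ε) :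
    ∃ C : ℝ, 0 < C ∧
      ∀ lam : ℝ, 0 < lam → ∀ A : Set (Fin 3 → ℝ), A.Finite → A.Nonempty → A ⊆ realSphere 3 lam →
        (addEnergy s A : ℝ) ≤
          C * (A.ncard : ℝ) ^ (2 * (s : ℝ) - 2 + 2 * (3 : ℝ) ^ (-(s : ℝ)) + ε) := by
  obtain ⟨t, rfl⟩ := Nat.exists_eq_add_of_le' hs
  obtain ⟨C, hC, h⟩ := energy_bound t ε hε
  refine ⟨C, hC, ?_⟩
  intro lam hlam A hfin hne hsub
  lift A to Finset (Fin 3 → ℝ) using hfin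
  have hsq : 0 < Real.sqrt lam := Real.sqrt_pos.mpr hlam
  have hc : (Real.sqrt lam)⁻¹ ≠ 0 := (inv_pos.mpr hsq).ne'
  have hinj : Function.Injective (fun a : Fin 3 → ℝ => (Real.sqrt lam)⁻¹ • a) := smul_right_injective _ hc
  have hA : A.Nonempty := by simpa using hne
  have hcard : (A.image (fun a => (Real.sqrt lam)⁻¹ • a)).card = A.card := card_image_of_injective _ hinj
  have h1 := h (A.image (fun a => (Real.sqrt lam)⁻¹ • a)) (hA.image _) (by
    intro b hb
    obtain ⟨a, ha, rfl⟩ := mem_image.mp hb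
    have : ∑ i, a i ^ 2 = lam := hsub ha
    rw [Fin.sum_univ_three] at this
    unfold nsq
    simp only [Pi.smul_apply, smul_eq_mul, mul_pow, inv_pow, Real.sq_sqrt hlam.le]
    rw [← mul_add, ← mul_add, this]
    field_simp)
  have h2 : (addEnergy (t+2) (A : Set (Fin 3 → ℝ)) : ℝ) ≤ En (A.image (fun a => (Real.sqrt lam)⁻¹ • a)) (t+2) := by
    exact_mod_cast addEnergy_le A _ (t+2) _ hc (fun a ha => mem_image_of_mem _ ha)
  refine h2.trans (h1.trans (le_of_eq ?_))
  rw [hcard, Set.ncard_coe_finset]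
  congr 2
  push_cast; ring_nf
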